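/- For every δ ∈ (0,1) there exist a threshold q₀ and constants c₁, c₂, c₃ ≥ 1 such that the following holds for every prime power q ≥ q₀ and all integers d, k, ℓ with ℓ a perfect square, ℓ ≥ exp((1/δ)^{c₂}), k ≥ ℓ^{c₁} and d > k. Let X = B(2d,S_k,q) and let Σ be any nonempty finite set. Suppose F assigns to every ℓ-element face A of X a function F[A] : A → Σ, and suppose Pr[ F[s₁](x) = F[s₂](x) for all x ∈ s₁ ∩ s₂ ] ≥ δ, where the probability is over the (ℓ,√ℓ)-agreement test: sample a uniformly random maximal face T of X, then a uniformly random √ℓ-element subset s of T, then independent uniformly random ℓ-element subsets s₁ and s₂ of T with s ⊆ s₁ and s ⊆ s₂. Then there exists a function f from the vertices of X to Σ such that Pr_{A∼μ_ℓ}[ |{x ∈ A : F[A](x) ≠ f(x)}| ≤ δ·ℓ ] ≥ δ^{c₃}, where μ_ℓ samples a uniformly random maximal face T of X and then a uniformly random ℓ-element subset A of T. -/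

import Mathlib

open Finset
open scoped Classical

noncomputable instance (F : Type) [Field F] [Fintype F] (n : ℕ) :
    Fintype (Submodule F (Fin n → F)) :=
  Fintype.ofInjective (fun W => (W : Set (Fin n → F)))
    fun _ _ h => SetLike.coe_injective h

/-- A face of the projected flags complex `B(n,S,q)`: a finite chain of subspaces of `F^n`
whose dimensions all lie in `S`. -/
def IsFlagFace (F : Type) [Field F] [Fintype F] (n : ℕ) (S : Finset ℕ)
    (s : Finset (Submodule F (Fin n → F))) : Prop :=
  IsChain (· ≤ ·) (s : Set (Submodule F (Fin n → F))) ∧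
    ∀ W ∈ s, Module.finrank F W ∈ S

/-- A maximal face of `B(n,S,q)`: a chain containing one subspace of each dimension in `S`. -/
def IsMaxFlagFace (F : Type) [Field F] [Fintype F] (n : ℕ) (S : Finset ℕ)
    (T : Finset (Submodule F (Fin n → F))) : Prop :=
  IsFlagFace F n S T ∧ ∀ i ∈ S, ∃ W ∈ T, Module.finrank F W = i

/-- The maximal faces of `B(n,S,q)`. -/
noncomputable def maxFlagFaces (F : Type) [Field F] [Fintype F] (n : ℕ) (S : Finset ℕ) :
    Finset (Finset (Submodule F (Fin n → F))) :=
  Finset.univ.filter fun T => IsMaxFlagFace F n S T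

/-- The acceptance probability of the `(ℓ, ℓ₀)`-agreement test on `B(n,S,q)` for the
ensemble `G`: sample a uniform maximal face `T`, a uniform `ℓ₀`-element subset `s ⊆ T`,
then independent uniform `ℓ`-element subsets `s₁, s₂ ⊆ T` containing `s`, and accept if
`G s₁` and `G s₂` agree on `s₁ ∩ s₂`. -/
noncomputable def agreeProb (F : Type) [Field F] [Fintype F] (n : ℕ) (S : Finset ℕ)
    (ℓ₀ ℓ : ℕ) (A : Type)
    (G : Finset (Submodule F (Fin n → F)) → Submodule F (Fin n → F) → A) : ℝ :=
  (∑ T ∈ maxFlagFaces F n S,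
      (∑ s ∈ T.powersetCard ℓ₀,
          (∑ s₁ ∈ (T.powersetCard ℓ).filter (fun s₁ => s ⊆ s₁),
              ∑ s₂ ∈ (T.powersetCard ℓ).filter (fun s₂ => s ⊆ s₂),
                if ∀ x ∈ s₁ ∩ s₂, G s₁ x = G s₂ x then (1 : ℝ) else 0) /
            ((((T.powersetCard ℓ).filter (fun s₁ => s ⊆ s₁)).card : ℝ) ^ 2)) /
        ((T.powersetCard ℓ₀).card : ℝ)) /
    ((maxFlagFaces F n S).card : ℝ)

/-- The probability, over a uniform maximal face `T` and a uniform `ℓ`-element subset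
`A ⊆ T` (the distribution `μ_ℓ`), that the local function `G A` differs from the global
function `f` on at most `δ·ℓ` points of `A`. -/
noncomputable def closeProb (F : Type) [Field F] [Fintype F] (n : ℕ) (S : Finset ℕ)
    (ℓ : ℕ) (δ : ℝ) (A : Type)
    (G : Finset (Submodule F (Fin n → F)) → Submodule F (Fin n → F) → A)
    (f : Submodule F (Fin n → F) → A) : ℝ :=
  (∑ T ∈ maxFlagFaces F n S,
      (∑ B ∈ T.powersetCard ℓ,
          if ((B.filter (fun x => G B x ≠ f x)).card : ℝ) ≤ δ * (ℓ : ℝ)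
          then (1 : ℝ) else 0) / ((T.powersetCard ℓ).card : ℝ)) /
    ((maxFlagFaces F n S).card : ℝ)


set_option linter.all false

/-- uniform average of `f` over `s` -/
noncomputable def av {α : Type*} (s : Finset α) (f : α → ℝ) : ℝ := (∑ x ∈ s, f x) / (s.card : ℝ)

/-- real-valued indicator -/
noncomputable def ind (p : Prop) : ℝ := if p then 1 else 0

section avbasic
variable {α β : Type*} {s : Finset α} {t : Finset β} {f g : α → ℝ}

theorem av_congr (h : ∀ x ∈ s, f x = g x) : av s f = av s g := by
  unfold av; rw [Finset.sum_congr rfl h]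

theorem av_mono (h : ∀ x ∈ s, f x ≤ g x) : av s f ≤ av s g := by
  unfold av; exact div_le_div_of_nonneg_right (Finset.sum_le_sum h) (Nat.cast_nonneg _)

theorem av_nonneg (h : ∀ x ∈ s, 0 ≤ f x) : 0 ≤ av s f := by
  unfold av; exact div_nonneg (Finset.sum_nonneg h) (Nat.cast_nonneg _)

theorem av_add (s : Finset α) (f g : α → ℝ) : av s (fun x => f x + g x) = av s f + av s g := by
  unfold av; rw [Finset.sum_add_distrib, add_div]

theorem av_sub (s : Finset α) (f g : α → ℝ) : av s (fun x => f x - g x) = av s f - av s g := by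
  unfold av; rw [Finset.sum_sub_distrib, sub_div]

theorem av_mul (s : Finset α) (c : ℝ) (f : α → ℝ) : av s (fun x => c * f x) = c * av s f := by
  unfold av; rw [← Finset.mul_sum, mul_div_assoc]

theorem av_mul' (s : Finset α) (c : ℝ) (f : α → ℝ) : av s (fun x => f x * c) = av s f * c := by
  unfold av; rw [← Finset.sum_mul]; ring

theorem av_div (s : Finset α) (c : ℝ) (f : α → ℝ) : av s (fun x => f x / c) = av s f / c := by
  simp only [div_eq_mul_inv, av_mul']

theorem av_const (hs : s.Nonempty) (c : ℝ) : av s (fun _ => c) = c := by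
  unfold av
  have : (s.card : ℝ) ≠ 0 := by exact_mod_cast hs.card_pos.ne'
  simp [this]

theorem av_zero (s : Finset α) : av s (fun _ => (0:ℝ)) = 0 := by simp [av]

theorem av_sum {γ : Type*} (s : Finset α) (r : Finset γ) (f : α → γ → ℝ) :
    av s (fun x => ∑ y ∈ r, f x y) = ∑ y ∈ r, av s (fun x => f x y) := by
  unfold av; rw [Finset.sum_comm, Finset.sum_div]

theorem av_comm (s : Finset α) (t : Finset β) (f : α → β → ℝ) :
    av s (fun x => av t (f x)) = av t (fun y => av s (fun x => f x y)) := by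
  unfold av
  simp only [← Finset.sum_div]
  rw [Finset.sum_comm, div_right_comm]

theorem av_le_const (hs : s.Nonempty) {c : ℝ} (h : ∀ x ∈ s, f x ≤ c) : av s f ≤ c := by
  rw [← av_const hs c]; exact av_mono h

theorem av_le_const' {c : ℝ} (hc : 0 ≤ c) (h : ∀ x ∈ s, f x ≤ c) : av s f ≤ c := by
  rcases s.eq_empty_or_nonempty with rfl | hs
  · simpa [av] using hc
  · exact av_le_const hs h

theorem const_le_av (hs : s.Nonempty) {c : ℝ} (h : ∀ x ∈ s, c ≤ f x) : c ≤ av s f := by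
  rw [← av_const hs c]; exact av_mono h

theorem exists_le_av (hs : s.Nonempty) (f : α → ℝ) : ∃ x ∈ s, f x ≤ av s f := by
  by_contra! h
  have := Finset.sum_lt_sum_of_nonempty hs h
  have h2 : av s f * s.card = ∑ x ∈ s, f x := by
    unfold av; rw [div_mul_cancel₀]; exact_mod_cast hs.card_pos.ne'
  simp only [Finset.sum_const, nsmul_eq_mul] at this
  linarith

theorem exists_ge_av (hs : s.Nonempty) (f : α → ℝ) : ∃ x ∈ s, av s f ≤ f x := by
  obtain ⟨x, hx, h⟩ := exists_le_av hs (fun x => - f x)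
  refine ⟨x, hx, ?_⟩
  have : av s (fun x => - f x) = - av s f := by
    have := av_mul s (-1) f
    simpa using this
  linarith

theorem av_sq_le (s : Finset α) (f : α → ℝ) : (av s f)^2 ≤ av s (fun x => (f x)^2) := by
  rcases s.eq_empty_or_nonempty with rfl | hs
  · simp [av]
  have h : 0 ≤ av s (fun x => (f x - av s f)^2) := av_nonneg fun x _ => sq_nonneg _
  have e : ∀ x, (f x - av s f)^2 = (f x)^2 + ((-2 * av s f) * f x + (av s f)^2) := by intro x; ring
  simp only [e] at h
  rw [av_add, av_add, av_mul, av_const hs] at h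
  nlinarith

theorem av_fubini (R : α → Finset β) (R' : β → Finset α) (c c' : ℕ)
    (hR : ∀ a b, (a ∈ s ∧ b ∈ R a) ↔ (b ∈ t ∧ a ∈ R' b))
    (hc : ∀ a ∈ s, (R a).card = c) (hc' : ∀ b ∈ t, (R' b).card = c') (f : α → β → ℝ) :
    av s (fun a => av (R a) (f a)) = av t (fun b => av (R' b) (fun a => f a b)) := by
  have key : ∀ f : α → β → ℝ, ∑ a ∈ s, ∑ b ∈ R a, f a b = ∑ b ∈ t, ∑ a ∈ R' b, f a b := by
    intro f
    exact Finset.sum_comm' (by intro a b; rw [hR, and_comm])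
  have e1 : av s (fun a => av (R a) (f a)) = (∑ a ∈ s, ∑ b ∈ R a, f a b) / (s.card * c) := by
    have : ∀ a ∈ s, av (R a) (f a) = (∑ b ∈ R a, f a b) / c := fun a ha => by rw [av, hc a ha]
    rw [av_congr this, av, ← Finset.sum_div, div_div, mul_comm (c : ℝ)]
  have e2 : av t (fun b => av (R' b) (fun a => f a b)) =
      (∑ b ∈ t, ∑ a ∈ R' b, f a b) / (t.card * c') := by
    have : ∀ b ∈ t, av (R' b) (fun a => f a b) = (∑ a ∈ R' b, f a b) / c' :=
      fun a ha => by rw [av, hc' a ha]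
    rw [av_congr this, av, ← Finset.sum_div, div_div, mul_comm (c' : ℝ)]
  have h1 := key (fun _ _ => 1)
  simp only [Finset.sum_const, nsmul_eq_mul, mul_one] at h1
  rw [Finset.sum_congr rfl (fun a ha => by rw [hc a ha]),
    Finset.sum_congr (s₁ := t) rfl (fun a ha => by rw [hc' a ha])] at h1
  simp only [Finset.sum_const, nsmul_eq_mul] at h1
  rw [e1, e2, key, h1]

theorem av_bij {e : α → β} (h1 : ∀ a ∈ s, e a ∈ t) (h2 : Set.InjOn e s)
    (h3 : ∀ b ∈ t, ∃ a ∈ s, e a = b) (f : β → ℝ) : av s (fun a => f (e a)) = av t f := by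
  have hb : Set.BijOn e s t := ⟨fun a ha => h1 a ha, h2, fun b hb => by
    obtain ⟨a, ha, rfl⟩ := h3 b hb; exact ⟨a, ha, rfl⟩⟩
  unfold av
  rw [Finset.sum_nbij e (s := s) (t := t) (g := f) h1 h2 hb.surjOn (fun _ _ => rfl),
    Finset.card_nbij e (s := s) (t := t) h1 h2 hb.surjOn]

theorem ind_nonneg (p : Prop) : 0 ≤ ind p := by unfold ind; split_ifs <;> norm_num
theorem ind_le_one (p : Prop) : ind p ≤ 1 := by unfold ind; split_ifs <;> norm_num
theorem ind_true {p : Prop} (h : p) : ind p = 1 := by simp [ind, h]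
theorem ind_false {p : Prop} (h : ¬ p) : ind p = 0 := by simp [ind, h]
theorem ind_mono {p q : Prop} (h : p → q) : ind p ≤ ind q := by
  unfold ind; split_ifs <;> norm_num; tauto
theorem ind_congr {p q : Prop} (h : p ↔ q) : ind p = ind q := by
  unfold ind; simp [h]
theorem ind_or {p q r : Prop} (h : p → q ∨ r) : ind p ≤ ind q + ind r := by
  unfold ind; split_ifs <;> norm_num; tauto
theorem ind_not (p : Prop) : ind (¬ p) = 1 - ind p := by
  unfold ind; split_ifs <;> simp_all
theorem ind_and (p q : Prop) : ind (p ∧ q) = ind p * ind q := by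
  unfold ind; split_ifs <;> simp_all
theorem ind_sq (p : Prop) : ind p ^ 2 = ind p := by
  unfold ind; split_ifs <;> simp
/-- Markov -/
theorem ind_le_div {x c : ℝ} (hc : 0 < c) (hx : 0 ≤ x) : ind (c ≤ x) ≤ x / c := by
  unfold ind; split_ifs with h
  · rwa [le_div_iff₀ hc, one_mul]
  · exact div_nonneg hx hc.le
theorem ind_le_div_sq {x c : ℝ} (hc : 0 < c) : ind (c ≤ |x|) ≤ x^2 / c^2 := by
  unfold ind; split_ifs with h
  · rw [le_div_iff₀ (by positivity), one_mul, ← sq_abs x]; exact pow_le_pow_left₀ hc.le h 2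
  · positivity
theorem av_ind_le_one (s : Finset α) (p : α → Prop) : av s (fun x => ind (p x)) ≤ 1 :=
  av_le_const' zero_le_one fun _ _ => ind_le_one _
end avbasic

section gr
variable {F : Type} [Field F] [Fintype F] {n : ℕ}

abbrev Sb (F : Type) [Field F] (n : ℕ) := Submodule F (Fin n → F)

noncomputable abbrev dm (x : Sb F n) : ℕ := Module.finrank F x

noncomputable def Gr (w v : Sb F n) (i : ℕ) : Finset (Sb F n) :=
  univ.filter fun x => w ≤ x ∧ x ≤ v ∧ dm x = i

theorem mem_Gr {w v x : Sb F n} {i : ℕ} : x ∈ Gr w v i ↔ w ≤ x ∧ x ≤ v ∧ dm x = i := by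
  simp [Gr]

theorem dm_mono {x y : Sb F n} (h : x ≤ y) : dm x ≤ dm y := Submodule.finrank_mono h

theorem eq_of_le_dm {x y : Sb F n} (h : x ≤ y) (h2 : dm y ≤ dm x) : x = y :=
  Submodule.eq_of_le_of_finrank_le h h2

theorem dm_sup_inf (x y : Sb F n) : dm (x ⊔ y) + dm (x ⊓ y) = dm x + dm y :=
  Submodule.finrank_sup_add_finrank_inf_eq x y

theorem dm_top : dm (⊤ : Sb F n) = n := by simp [dm]
theorem dm_bot : dm (⊥ : Sb F n) = 0 := by simp [dm]
theorem dm_le (x : Sb F n) : dm x ≤ n := by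
  have := dm_mono (le_top : x ≤ ⊤); rwa [dm_top] at this

theorem exists_of_dm {w v : Sb F n} (h : w ≤ v) {i : ℕ} (h1 : dm w ≤ i) (h2 : i ≤ dm v) :
    ∃ x, w ≤ x ∧ x ≤ v ∧ dm x = i := by
  induction i, h1 using Nat.le_induction with
  | base => exact ⟨w, le_rfl, h, rfl⟩
  | succ i hi ih =>
    obtain ⟨x, hx1, hx2, hx3⟩ := ih (by omega)
    have hlt : x < v := lt_of_le_of_ne hx2 (by rintro rfl; omega)
    obtain ⟨z, hz, hzx⟩ := SetLike.exists_of_lt hlt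
    refine ⟨x ⊔ Submodule.span F {z}, hx1.trans le_sup_left,
      sup_le hx2 (by simpa [Submodule.span_singleton_le_iff_mem] using hz), ?_⟩
    have e := dm_sup_inf x (Submodule.span F {z})
    have hz0 : z ≠ 0 := by rintro rfl; exact hzx x.zero_mem
    have e1 : dm (Submodule.span F {z}) = 1 := finrank_span_singleton hz0
    have e2 : x ⊓ Submodule.span F {z} = ⊥ := by
      have := (Submodule.disjoint_span_singleton' hz0 (s := x)).2 hzx
      exact this.eq_bot
    rw [e2, dm_bot, e1] at e; omega

theorem Gr_nonempty {w v : Sb F n} (h : w ≤ v) {i : ℕ} (h1 : dm w ≤ i) (h2 : i ≤ dm v) :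
    (Gr w v i).Nonempty := by
  obtain ⟨x, h⟩ := exists_of_dm h h1 h2
  exact ⟨x, mem_Gr.2 h⟩

/-- order automorphisms preserving dimension -/
theorem exists_iso {w x x' v : Sb F n} (h1 : w ≤ x) (h2 : x ≤ v) (h1' : w ≤ x') (h2' : x' ≤ v)
    (hd : dm x = dm x') :
    ∃ g : Sb F n ≃o Sb F n, (∀ y, dm (g y) = dm y) ∧ g x = x' ∧ (∀ y ≤ w, g y = y) ∧
      (∀ y, v ≤ y → g y = y) := by
  obtain ⟨k, hk⟩ := Submodule.exists_isCompl w
  obtain ⟨e, he⟩ := Submodule.exists_isCompl v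
  set m := k ⊓ v with hm
  have hwm : w ⊔ m = v := by
    rw [hm, ← sup_inf_assoc_of_le k (h1.trans h2), hk.sup_eq_top, top_inf_eq]
  have hdm : Disjoint m w := (hk.disjoint.symm.mono_left inf_le_left)
  have hC : IsCompl m (w ⊔ e) := by
    constructor
    · apply Disjoint.disjoint_sup_right_of_disjoint_sup_left hdm
      rw [sup_comm, hwm]; exact he.disjoint
    · rw [codisjoint_iff, ← sup_assoc, sup_comm m, hwm]; exact he.sup_eq_top
  have hx : ∀ y, w ≤ y → y ≤ v → w ⊔ (m ⊓ y) = y := by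
    intro y hy1 hy2
    rw [← sup_inf_assoc_of_le m hy1, hwm, inf_eq_right.2 hy2]
  have hdim : ∀ y, w ≤ y → y ≤ v → dm (m ⊓ y) + dm w = dm y := by
    intro y hy1 hy2
    have e1 := dm_sup_inf w (m ⊓ y)
    rw [hx y hy1 hy2] at e1
    have : w ⊓ (m ⊓ y) = ⊥ := (hdm.symm.mono_right inf_le_left).eq_bot
    rw [this, dm_bot] at e1; omega
  have hd1 : ∀ y : Sb F n, Module.finrank F (Submodule.comap m.subtype y) = dm (m ⊓ y) := by
    intro y
    have : m ⊓ y = Submodule.map m.subtype (Submodule.comap m.subtype y) := by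
      rw [Submodule.map_comap_subtype]
    rw [dm, this, Submodule.finrank_map_subtype_eq]
  have hd2 : Module.finrank F (Submodule.comap m.subtype x) =
      Module.finrank F (Submodule.comap m.subtype x') := by
    rw [hd1, hd1]; have := hdim x h1 h2; have := hdim x' h1' h2'; omega
  haveI : ∀ y : Submodule F m, Module.Free F y := fun y => Module.Free.of_divisionRing F y
  obtain ⟨φ⟩ : Nonempty ((Submodule.comap m.subtype x) ≃ₗ[F] (Submodule.comap m.subtype x')) :=
    FiniteDimensional.nonempty_linearEquiv_of_finrank_eq hd2
  obtain ⟨gm, hgm⟩ := Submodule.exists_linearEquiv_restrict_eq φ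
  let E := Submodule.prodEquivOfIsCompl m (w ⊔ e) hC
  let g : (Fin n → F) ≃ₗ[F] (Fin n → F) :=
    E.symm ≪≫ₗ (LinearEquiv.prodCongr gm (LinearEquiv.refl F _)) ≪≫ₗ E
  have hgE : ∀ a b, g (E (a, b)) = (gm a : Fin n → F) + b := by
    intro a b
    simp [g, E]
  have hEa : ∀ a b, E (a, b) = (a : Fin n → F) + b := by intro a b; simp [E]
  have gP : ∀ z ∈ w ⊔ e, g z = z := by
    intro z hz
    have := hgE 0 ⟨z, hz⟩
    rw [hEa] at this; simpa using this
  have gM : ∀ (z) (hz : z ∈ m), g z = gm ⟨z, hz⟩ := by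
    intro z hz
    have := hgE ⟨z, hz⟩ 0
    rw [hEa] at this; simpa using this
  have gdm : ∀ y : Sb F n, dm (Submodule.map (g : (Fin n → F) →ₗ[F] (Fin n → F)) y) = dm y := by
    intro y; exact LinearEquiv.finrank_map_eq g y
  refine ⟨Submodule.orderIsoMapComap g, gdm, ?_, ?_, ?_⟩
  · show Submodule.map (g : (Fin n → F) →ₗ[F] (Fin n → F)) x = x'
    apply eq_of_le_dm
    · conv_lhs => rw [← hx x h1 h2]
      rw [Submodule.map_sup]
      apply sup_le
      · rintro _ ⟨z, hz, rfl⟩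
        have : g z = z := gP z (Submodule.mem_sup_left hz)
        show g z ∈ x'
        rw [this]; exact h1' hz
      · rintro _ ⟨z, ⟨hz, hz2⟩, rfl⟩
        show g z ∈ x'
        rw [gM z hz]
        have := hgm ⟨⟨z, hz⟩, hz2⟩
        rw [← this]
        exact (φ ⟨⟨z, hz⟩, hz2⟩).2
    · rw [gdm, hd]
  · intro y hy
    show Submodule.map (g : (Fin n → F) →ₗ[F] (Fin n → F)) y = y
    apply eq_of_le_dm
    · rintro _ ⟨z, hz, rfl⟩
      show g z ∈ y
      rw [gP z (Submodule.mem_sup_left (hy hz))]; exact hz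
    · rw [gdm]
  · intro y hy
    show Submodule.map (g : (Fin n → F) →ₗ[F] (Fin n → F)) y = y
    apply eq_of_le_dm
    · rintro _ ⟨z, hz, rfl⟩
      show g z ∈ y
      obtain ⟨⟨a, b⟩, rfl⟩ := E.surjective z
      rw [hgE]
      rw [hEa] at hz
      have ha : (a : Fin n → F) ∈ y := hy (inf_le_right (a := k) a.2)
      have hb : (b : Fin n → F) ∈ y := by
        have := y.sub_mem hz ha; simpa using this
      exact y.add_mem (hy (inf_le_right (a := k) (gm a).2)) hb
    · rw [gdm]

theorem card_Gr_iso (g : Sb F n ≃o Sb F n) (hg : ∀ y, dm (g y) = dm y) (w v : Sb F n) (i : ℕ) :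
    (Gr (g w) (g v) i).card = (Gr w v i).card := by
  symm
  apply Finset.card_bij (fun x _ => g x)
  · intro x hx; rw [mem_Gr] at *; simp [hx, hg]
  · intro a _ b _ h; exact g.injective h
  · intro b hb
    refine ⟨g.symm b, ?_, by simp⟩
    rw [mem_Gr] at *
    refine ⟨?_, ?_, ?_⟩
    · rw [← g.le_iff_le]; simpa using hb.1
    · rw [← g.le_iff_le]; simpa using hb.2.1
    · rw [← hg]; simpa using hb.2.2

theorem card_Gr_eq {w v w' v' : Sb F n} (h : w ≤ v) (h' : w' ≤ v') (hw : dm w = dm w')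
    (hv : dm v = dm v') (i : ℕ) : (Gr w v i).card = (Gr w' v' i).card := by
  obtain ⟨g, hg, hgv, -, -⟩ := exists_iso (bot_le : ⊥ ≤ v) le_top (bot_le : ⊥ ≤ v') le_top hv
  have h1 := card_Gr_iso g hg w v i
  rw [hgv] at h1
  have h2 : g w ≤ v' := by rw [← hgv]; exact g.le_iff_le.2 h
  obtain ⟨g2, hg2, hgw, -, hgv2⟩ := exists_iso (bot_le : ⊥ ≤ g w) h2 bot_le h' (by rw [hg, hw])
  have h3 := card_Gr_iso g2 hg2 (g w) v' i
  rw [hgv2 v' le_rfl, hgw] at h3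
  omega

theorem swap_Gr {w v : Sb F n} (i j : ℕ) (f : Sb F n → Sb F n → ℝ) :
    av (Gr w v j) (fun y => av (Gr w y i) (fun x => f x y)) =
    av (Gr w v i) (fun x => av (Gr x v j) (fun y => f x y)) := by
  by_cases hY : (Gr w v j).Nonempty
  · by_cases hX : (Gr w v i).Nonempty
    · obtain ⟨y0, hy0⟩ := hY
      obtain ⟨x0, hx0⟩ := hX
      refine av_fubini (fun y => Gr w y i) (fun x => Gr x v j) (Gr w y0 i).card (Gr x0 v j).card
        ?_ ?_ ?_ (fun y x => f x y)
      · intro a b; simp only [mem_Gr]; constructor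
        · rintro ⟨⟨h1, h2, h3⟩, h4, h5, h6⟩; exact ⟨⟨h4, h5.trans h2, h6⟩, h5, h2, h3⟩
        · rintro ⟨⟨h1, h2, h3⟩, h4, h5, h6⟩; exact ⟨⟨h1.trans h4, h5, h6⟩, h1, h4, h3⟩
      · intro a ha; rw [mem_Gr] at *
        exact card_Gr_eq ha.1 hy0.1 rfl (ha.2.2.trans hy0.2.2.symm) i
      · intro a ha; rw [mem_Gr] at *
        exact card_Gr_eq ha.2.1 hx0.2.1 (ha.2.2.trans hx0.2.2.symm) rfl j
    · rw [Finset.not_nonempty_iff_eq_empty] at hX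
      have : ∀ y ∈ Gr w v j, av (Gr w y i) (fun x => f x y) = 0 := by
        intro y hy
        have : Gr w y i = ∅ := by
          rw [Finset.eq_empty_iff_forall_notMem] at *
          intro x hx; apply hX x; rw [mem_Gr] at *; exact ⟨hx.1, hx.2.1.trans hy.2.1, hx.2.2⟩
        simp [this, av]
      rw [av_congr this, hX]; simp [av]
  · rw [Finset.not_nonempty_iff_eq_empty] at hY
    have : ∀ x ∈ Gr w v i, av (Gr x v j) (fun y => f x y) = 0 := by
      intro y hy
      have : Gr y v j = ∅ := by
        rw [Finset.eq_empty_iff_forall_notMem] at *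
        intro x hx; apply hY x; rw [mem_Gr] at *; exact ⟨hy.1.trans hx.1, hx.2.1, hx.2.2⟩
      simp [this, av]
    rw [av_congr this, hY]; simp [av]
end gr


theorem av_mul_sq_le {α : Type*} (s : Finset α) (f g : α → ℝ) :
    (av s (fun x => f x * g x))^2 ≤ av s (fun x => f x ^ 2) * av s (fun x => g x ^ 2) := by
  unfold av
  rw [div_pow, div_mul_div_comm, ← sq]
  exact div_le_div_of_nonneg_right (Finset.sum_mul_sq_le_sq_mul_sq s f g) (by positivity)

section gr
variable {F : Type} [Field F] [Fintype F] {n : ℕ}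

theorem Gr_tower {w v : Sb F n} {i j : ℕ} (hij : i ≤ j) (hj : j ≤ dm v) (f : Sb F n → ℝ) :
    av (Gr w v j) (fun y => av (Gr w y i) f) = av (Gr w v i) f := by
  rw [swap_Gr i j (fun x _ => f x)]
  refine av_congr fun x hx => ?_
  rw [mem_Gr] at hx
  exact av_const (Gr_nonempty hx.2.1 (by omega) hj) _

theorem Gr_tower' {w v : Sb F n} {i j : ℕ} (hij : i ≤ j) (hi : dm w ≤ i) (f : Sb F n → ℝ) :
    av (Gr w v i) (fun x => av (Gr x v j) f) = av (Gr w v j) f := by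
  rw [← swap_Gr i j (fun _ y => f y)]
  refine av_congr fun x hx => ?_
  rw [mem_Gr] at hx
  exact av_const (Gr_nonempty hx.1 hi (by omega)) _

theorem card_swap {w v : Sb F n} {i j : ℕ} {x0 y0 : Sb F n} (hx0 : x0 ∈ Gr w v i)
    (hy0 : y0 ∈ Gr w v j) :
    (Gr w v j).card * (Gr w y0 i).card = (Gr w v i).card * (Gr x0 v j).card := by
  have h := Finset.sum_comm' (s := Gr w v j) (t := fun y => Gr w y i) (t' := Gr w v i)
    (s' := fun x => Gr x v j) (f := fun _ _ => 1) (by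
      intro a b; simp only [mem_Gr]; constructor
      · rintro ⟨⟨h1, h2, h3⟩, h4, h5, h6⟩; exact ⟨⟨h5, h2, h3⟩, h4, h5.trans h2, h6⟩
      · rintro ⟨⟨h4, h5, h6⟩, h1, h2, h3⟩; exact ⟨⟨h1.trans h4, h5, h6⟩, h1, h4, h3⟩)
  simp only [Finset.sum_const, smul_eq_mul, mul_one] at h
  have k1 : ∀ y ∈ Gr w v j, (Gr w y i).card = (Gr w y0 i).card := fun y hy => by
    rw [mem_Gr] at *
    exact card_Gr_eq hy.1 hy0.1 rfl (hy.2.2.trans hy0.2.2.symm) i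
  have k2 : ∀ x ∈ Gr w v i, (Gr x v j).card = (Gr x0 v j).card := fun y hy => by
    rw [mem_Gr] at *
    exact card_Gr_eq hy.2.1 hx0.2.1 (hy.2.2.trans hx0.2.2.symm) rfl j
  rw [Finset.sum_congr rfl k1, Finset.sum_congr rfl k2] at h
  simpa using h

/-- number of one-step extensions of `w` inside `v` -/
theorem card_atoms {w v : Sb F n} (h : w ≤ v) :
    (Gr w v (dm w + 1)).card * (Fintype.card F - 1) = (Fintype.card F) ^ (dm v - dm w) - 1 := by
  set q := Fintype.card F with hq
  have hq1 : 1 < q := Fintype.one_lt_card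
  have hc : ∀ x : Sb F n, (univ.filter (fun z => z ∈ x)).card = q ^ dm x := by
    intro x
    rw [hq, ← Module.card_eq_pow_finrank (K := F) (V := x), Fintype.card_subtype]
  have hsub : ∀ x : Sb F n, w ≤ x →
      (univ.filter (fun z => z ∈ x ∧ z ∉ w)).card = q ^ dm x - q ^ dm w := by
    intro x hx
    rw [← hc, ← hc, ← Finset.card_sdiff_of_subset]
    · congr 1; ext z; simp
    · intro z; simp; exact fun hz => hx hz
  have key : (univ.filter (fun z => z ∈ v ∧ z ∉ w)) =
      (Gr w v (dm w + 1)).biUnion (fun x => univ.filter (fun z => z ∈ x ∧ z ∉ w)) := by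
    ext z
    simp only [mem_filter, mem_univ, true_and, mem_biUnion, mem_Gr]
    constructor
    · rintro ⟨hz, hzw⟩
      refine ⟨w ⊔ Submodule.span F {z}, ⟨le_sup_left,
        sup_le h (by simpa [Submodule.span_singleton_le_iff_mem] using hz), ?_⟩, ?_, hzw⟩
      · have e := dm_sup_inf w (Submodule.span F {z})
        have hz0 : z ≠ 0 := by rintro rfl; exact hzw w.zero_mem
        have e1 : dm (Submodule.span F {z}) = 1 := finrank_span_singleton hz0
        have e2 : w ⊓ Submodule.span F {z} = ⊥ := by
          have := (Submodule.disjoint_span_singleton' hz0 (s := w)).2 hzw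
          exact this.eq_bot
        rw [e2, dm_bot, e1] at e; omega
      · exact Submodule.mem_sup_right (Submodule.mem_span_singleton_self z)
    · rintro ⟨x, ⟨h1, h2, h3⟩, h4, h5⟩; exact ⟨h2 h4, h5⟩
  have hcard := congrArg Finset.card key
  rw [hsub v h, Finset.card_biUnion] at hcard
  · have k1 : ∀ x ∈ Gr w v (dm w + 1), (univ.filter (fun z => z ∈ x ∧ z ∉ w)).card =
        q ^ (dm w + 1) - q ^ dm w := by
      intro x hx; rw [mem_Gr] at hx; rw [hsub x hx.1, hx.2.2]
    rw [Finset.sum_congr rfl k1, Finset.sum_const, smul_eq_mul] at hcard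
    have e1 : q ^ (dm w + 1) - q ^ dm w = q ^ dm w * (q - 1) := by
      rw [Nat.mul_sub, pow_succ, mul_one]
    have e2 : q ^ dm v - q ^ dm w = q ^ dm w * (q ^ (dm v - dm w) - 1) := by
      rw [Nat.mul_sub, ← pow_add, mul_one]; congr 2; have := dm_mono h; omega
    rw [e1, e2] at hcard
    have : 0 < q ^ dm w := by positivity
    apply Nat.eq_of_mul_eq_mul_left this
    rw [hcard]; ring
  · intro x hx y hy hxy
    show Disjoint _ _
    rw [Finset.disjoint_left]
    intro z hz1 hz2
    simp only [mem_filter, mem_univ, true_and] at hz1 hz2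
    apply hxy
    rw [Finset.mem_coe, mem_Gr] at hx hy
    have hz : ¬ (x ⊓ y ≤ w) := fun h => hz1.2 (h ⟨hz1.1, hz2.1⟩)
    have h1 : w < x ⊓ y := lt_of_le_of_ne (le_inf hx.1 hy.1) (fun h => hz h.ge)
    have h2 := Submodule.finrank_lt_finrank_of_lt h1
    have e1 : x ⊓ y = x := eq_of_le_dm inf_le_left (by simp only [dm] at *; omega)
    have e2 : x ⊓ y = y := eq_of_le_dm inf_le_right (by simp only [dm] at *; omega)
    rw [← e1, e2]

theorem card_atoms_pos_ge {w v : Sb F n} (h : w ≤ v) {r : ℕ} (hr : dm v = dm w + r + 1) :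
    (Fintype.card F)^r ≤ (Gr w v (dm w + 1)).card := by
  have h1 := card_atoms h
  have hq1 : 1 < Fintype.card F := Fintype.one_lt_card
  set q := Fintype.card F
  rw [hr, show dm w + r + 1 - dm w = r + 1 by omega] at h1
  have : q ^ r * (q - 1) ≤ q ^ (r+1) - 1 := by
    rw [Nat.mul_sub, pow_succ, mul_one]
    have : 0 < q^r := by positivity
    omega
  rw [← h1] at this
  exact Nat.le_of_mul_le_mul_right this (by omega)

/-- hyperplanes of `v` over `w` are as many as atoms -/
theorem card_hyper {w : Sb F n} (r : ℕ) : ∀ v : Sb F n, w ≤ v → dm v = dm w + r + 1 →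
    (Gr w v (dm w + r)).card = (Gr w v (dm w + 1)).card := by
  intro v hwv hr
  induction r generalizing v w with
  | zero =>
    have e1 : Gr w v (dm w + 0) = {w} := by
      ext x; rw [mem_Gr, mem_singleton]; constructor
      · rintro ⟨h1, h2, h3⟩; exact (eq_of_le_dm h1 (by omega)).symm
      · rintro rfl; exact ⟨le_rfl, hwv, rfl⟩
    have e2 : Gr w v (dm w + 1) = {v} := by
      ext x; rw [mem_Gr, mem_singleton]; constructor
      · rintro ⟨h1, h2, h3⟩; exact (eq_of_le_dm h2 (by omega))
      · rintro rfl; exact ⟨hwv, le_rfl, by omega⟩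
    rw [e1, e2]; simp
  | succ r ih =>
    obtain ⟨y0, hy0⟩ := Gr_nonempty hwv (i := dm w + (r+1)) (by omega) (by omega)
    obtain ⟨x0, hx0⟩ := Gr_nonempty hwv (i := dm w + 1) (by omega) (by omega)
    have h1 := card_swap hx0 hy0
    rw [mem_Gr] at hx0 hy0
    have h2 := ih (w := x0) v hx0.2.1 (by omega)
    have h3 : (Gr w y0 (dm w + 1)).card = (Gr x0 v (dm x0 + 1)).card := by
      have a1 := card_atoms hy0.1
      have a2 := card_atoms hx0.2.1
      have hq1 : 1 < Fintype.card F := Fintype.one_lt_card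
      have : dm y0 - dm w = dm v - dm x0 := by omega
      rw [this, ← a2] at a1
      exact Nat.eq_of_mul_eq_mul_right (by omega) a1
    rw [show dm x0 + r = dm w + (r+1) by omega] at h2
    rw [h3, h2] at h1
    have hpos : 0 < (Gr x0 v (dm x0 + 1)).card :=
      (Gr_nonempty hx0.2.1 (by omega) (by omega)).card_pos
    exact Nat.eq_of_mul_eq_mul_right hpos h1

theorem adj_count {w v : Sb F n} {a : ℕ} {x x' : Sb F n} (hx : x ∈ Gr w v (a+1))
    (hx' : x' ∈ Gr w v (a+1)) (hne : x ≠ x') :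
    ((Gr w v (a+2)).filter (fun y => x ≤ y ∧ x' ≤ y)).card =
    ((Gr w v a).filter (fun z => z ≤ x ∧ z ≤ x')).card := by
  rw [mem_Gr] at hx hx'
  have hd := dm_sup_inf x x'
  have h1 : dm (x ⊓ x') ≤ a := by
    by_contra hcon
    have e1 : x ⊓ x' = x := eq_of_le_dm inf_le_left (by omega)
    have e2 : x ⊓ x' = x' := eq_of_le_dm inf_le_right (by omega)
    exact hne (e1.symm.trans e2)
  by_cases hc : dm (x ⊓ x') = a
  · have e1 : (Gr w v (a+2)).filter (fun y => x ≤ y ∧ x' ≤ y) = {x ⊔ x'} := by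
      ext y; simp only [mem_filter, mem_Gr, mem_singleton]; constructor
      · rintro ⟨⟨_, _, h⟩, h1, h2⟩; exact (eq_of_le_dm (sup_le h1 h2) (by omega)).symm
      · rintro rfl; exact ⟨⟨hx.1.trans le_sup_left, sup_le hx.2.1 hx'.2.1, by omega⟩,
          le_sup_left, le_sup_right⟩
    have e2 : (Gr w v a).filter (fun z => z ≤ x ∧ z ≤ x') = {x ⊓ x'} := by
      ext y; simp only [mem_filter, mem_Gr, mem_singleton]; constructor
      · rintro ⟨⟨_, _, h⟩, h1, h2⟩; exact (eq_of_le_dm (le_inf h1 h2) (by omega))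
      · rintro rfl; exact ⟨⟨le_inf hx.1 hx'.1, inf_le_left.trans hx.2.1, by omega⟩,
          inf_le_left, inf_le_right⟩
    rw [e1, e2]; simp
  · have e1 : (Gr w v (a+2)).filter (fun y => x ≤ y ∧ x' ≤ y) = ∅ := by
      ext y; simp only [mem_filter, mem_Gr, notMem_empty, iff_false]
      rintro ⟨⟨_, _, h⟩, h1, h2⟩
      have := dm_mono (sup_le h1 h2); omega
    have e2 : (Gr w v a).filter (fun z => z ≤ x ∧ z ≤ x') = ∅ := by
      ext y; simp only [mem_filter, mem_Gr, notMem_empty, iff_false]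
      rintro ⟨⟨_, _, h⟩, h1, h2⟩
      have := dm_mono (le_inf h1 h2); omega
    rw [e1, e2]

/-- sum of squares of local sums -/
theorem sum_sq_expand {α β : Type*} (X : Finset α) (Y : Finset β) (r : α → β → Prop) (f : α → ℝ) :
    ∑ y ∈ Y, (∑ x ∈ X.filter (fun x => r x y), f x)^2 =
    ∑ x ∈ X, ∑ x' ∈ X, f x * f x' * ((Y.filter (fun y => r x y ∧ r x' y)).card : ℝ) := by
  have : ∀ y ∈ Y, (∑ x ∈ X.filter (fun x => r x y), f x)^2 =
      ∑ x ∈ X, ∑ x' ∈ X, f x * f x' * (if r x y ∧ r x' y then 1 else 0) := by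
    intro y _
    rw [sq, Finset.sum_filter, Finset.sum_mul_sum]
    refine Finset.sum_congr rfl fun x _ => Finset.sum_congr rfl fun x' _ => ?_
    by_cases h1 : r x y <;> by_cases h2 : r x' y <;> simp [h1, h2]
  rw [Finset.sum_congr rfl this, Finset.sum_comm]
  refine Finset.sum_congr rfl fun x _ => ?_
  rw [Finset.sum_comm]
  refine Finset.sum_congr rfl fun x' _ => ?_
  rw [← Finset.mul_sum]; simp

theorem sum_identity {w v : Sb F n} {a : ℕ} {x0 : Sb F n} (hx0 : x0 ∈ Gr w v (a+1))
    (f : Sb F n → ℝ) :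
    ∑ y ∈ Gr w v (a+2), (∑ x ∈ Gr w y (a+1), f x)^2 =
    ∑ z ∈ Gr w v a, (∑ x ∈ Gr z v (a+1), f x)^2 +
      (((Gr x0 v (a+2)).card : ℝ) - (Gr w x0 a).card) * ∑ x ∈ Gr w v (a+1), f x ^ 2 := by
  have e1 : ∀ y ∈ Gr w v (a+2), Gr w y (a+1) = (Gr w v (a+1)).filter (fun x => x ≤ y) := by
    intro y hy; rw [mem_Gr] at hy; ext x; simp only [mem_Gr, mem_filter]
    constructor
    · rintro ⟨h1, h2, h3⟩; exact ⟨⟨h1, h2.trans hy.2.1, h3⟩, h2⟩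
    · rintro ⟨⟨h1, h2, h3⟩, h4⟩; exact ⟨h1, h4, h3⟩
  have e2 : ∀ y ∈ Gr w v a, Gr y v (a+1) = (Gr w v (a+1)).filter (fun x => y ≤ x) := by
    intro y hy; rw [mem_Gr] at hy; ext x; simp only [mem_Gr, mem_filter]
    constructor
    · rintro ⟨h1, h2, h3⟩; exact ⟨⟨hy.1.trans h1, h2, h3⟩, h1⟩
    · rintro ⟨⟨h1, h2, h3⟩, h4⟩; exact ⟨h4, h2, h3⟩
  rw [Finset.sum_congr rfl (fun y hy => by rw [e1 y hy]),
    Finset.sum_congr (s₁ := Gr w v a) rfl (fun y hy => by rw [e2 y hy]),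
    sum_sq_expand _ _ (fun x y => x ≤ y), sum_sq_expand _ _ (fun x y => y ≤ x), Finset.mul_sum,
    ← Finset.sum_add_distrib]
  refine Finset.sum_congr rfl fun x hx => ?_
  rw [← sub_eq_iff_eq_add', ← Finset.sum_sub_distrib]
  rw [Finset.sum_eq_single x]
  · have hx2 := hx
    rw [mem_Gr] at hx hx0
    have c1 : (Gr w v (a+2)).filter (fun y => x ≤ y ∧ x ≤ y) = Gr x v (a+2) := by
      ext y; simp only [mem_Gr, mem_filter]; constructor
      · rintro ⟨⟨h1, h2, h3⟩, h4, _⟩; exact ⟨h4, h2, h3⟩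
      · rintro ⟨h1, h2, h3⟩; exact ⟨⟨hx.1.trans h1, h2, h3⟩, h1, h1⟩
    have c2 : (Gr w v a).filter (fun y => y ≤ x ∧ y ≤ x) = Gr w x a := by
      ext y; simp only [mem_Gr, mem_filter]; constructor
      · rintro ⟨⟨h1, h2, h3⟩, h4, _⟩; exact ⟨h1, h4, h3⟩
      · rintro ⟨h1, h2, h3⟩; exact ⟨⟨h1, h2.trans hx.2.1, h3⟩, h2, h2⟩
    rw [c1, c2, card_Gr_eq hx.2.1 hx0.2.1 (hx.2.2.trans hx0.2.2.symm) rfl,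
      card_Gr_eq hx.1 hx0.1 rfl (hx.2.2.trans hx0.2.2.symm)]
    ring
  · intro x' hx' hne
    rw [adj_count hx hx' hne.symm, sub_self]
  · intro h; exact absurd hx h

theorem up_le_down {w v : Sb F n} {a : ℕ} (hwv : w ≤ v) (ha : dm w ≤ a) (hv : a + 2 ≤ dm v)
    (f : Sb F n → ℝ) :
    av (Gr w v (a+2)) (fun y => (av (Gr w y (a+1)) f)^2) ≤
    av (Gr w v a) (fun z => (av (Gr z v (a+1)) f)^2) +
      av (Gr w v (a+1)) (fun x => f x ^ 2) / (Fintype.card F : ℝ)^(a + 1 - dm w) := by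
  obtain ⟨x0, hx0⟩ := Gr_nonempty hwv (i := a + 1) (by omega) (by omega)
  obtain ⟨y0, hy0⟩ := Gr_nonempty hwv (i := a + 2) (by omega) (by omega)
  obtain ⟨z0, hz0⟩ := Gr_nonempty hwv (i := a) (by omega) (by omega)
  have hI := sum_identity hx0 f
  have hI1 := sum_identity hx0 (fun _ => 1)
  have s1 := card_swap hx0 hy0
  have s2 := card_swap hz0 hx0
  set DD := av (Gr w v a) (fun z => (av (Gr z v (a+1)) f)^2) with hDD
  set N := av (Gr w v (a+1)) (fun x => f x ^ 2) with hN
  have hDN : DD ≤ N := by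
    rw [hN, ← Gr_tower' (i := a) (j := a+1) (by omega) ha]
    exact av_mono fun z _ => av_sq_le _ _
  have hx0' := mem_Gr.1 hx0
  have hy0' := mem_Gr.1 hy0
  have hz0' := mem_Gr.1 hz0
  have pos : ∀ s : Finset (Sb F n), s.Nonempty → (0:ℝ) < s.card := fun s hs => by
    exact_mod_cast hs.card_pos
  have pX := pos _ ⟨x0, hx0⟩
  have pY := pos _ ⟨y0, hy0⟩
  have pZ := pos _ ⟨z0, hz0⟩
  have pm := pos (Gr w y0 (a+1)) (Gr_nonempty hy0'.1 (by omega) (by omega))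
  have pu := pos (Gr x0 v (a+2)) (Gr_nonempty hx0'.2.1 (by omega) (by omega))
  have pl := pos (Gr w x0 a) (Gr_nonempty hx0'.1 (by omega) (by omega))
  have pmz := pos (Gr z0 v (a+1)) (Gr_nonempty hz0'.2.1 (by omega) (by omega))
  have hmq : (Fintype.card F : ℝ)^(a + 1 - dm w) ≤ (Gr w y0 (a+1)).card := by
    have h1 := card_hyper (a + 1 - dm w) y0 hy0'.1 (by omega)
    have h2 := card_atoms_pos_ge (r := a + 1 - dm w) hy0'.1 (by omega)
    rw [← h1, show dm w + (a + 1 - dm w) = a + 1 by omega] at h2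
    exact_mod_cast h2
  have hUU : ∀ f : Sb F n → ℝ, ∑ y ∈ Gr w v (a+2), (∑ x ∈ Gr w y (a+1), f x)^2 =
      (Gr w v (a+2)).card * ((Gr w y0 (a+1)).card : ℝ)^2 *
        av (Gr w v (a+2)) (fun y => (av (Gr w y (a+1)) f)^2) := by
    intro f
    have : ∀ y ∈ Gr w v (a+2), (av (Gr w y (a+1)) f)^2 = (∑ x ∈ Gr w y (a+1), f x)^2 /
        ((Gr w y0 (a+1)).card : ℝ)^2 := by
      intro y hy; rw [mem_Gr] at hy
      rw [av, div_pow, card_Gr_eq hy.1 hy0'.1 rfl (hy.2.2.trans hy0'.2.2.symm)]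
    rw [av_congr this, av, ← Finset.sum_div]
    field_simp
  have hDDs : ∀ f : Sb F n → ℝ, ∑ y ∈ Gr w v a, (∑ x ∈ Gr y v (a+1), f x)^2 =
      (Gr w v a).card * ((Gr z0 v (a+1)).card : ℝ)^2 *
        av (Gr w v a) (fun y => (av (Gr y v (a+1)) f)^2) := by
    intro f
    have : ∀ y ∈ Gr w v a, (av (Gr y v (a+1)) f)^2 = (∑ x ∈ Gr y v (a+1), f x)^2 /
        ((Gr z0 v (a+1)).card : ℝ)^2 := by
      intro y hy; rw [mem_Gr] at hy
      rw [av, div_pow, card_Gr_eq hy.2.1 hz0'.2.1 (hy.2.2.trans hz0'.2.2.symm) rfl]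
    rw [av_congr this, av, ← Finset.sum_div]
    field_simp
  have hNs : ∑ x ∈ Gr w v (a+1), f x ^ 2 = (Gr w v (a+1)).card * N := by
    rw [hN, av]; field_simp
  rw [hUU, hDDs, hNs] at hI
  rw [hUU, hDDs] at hI1
  have one1 : av (Gr w v (a+2)) (fun y => (av (Gr w y (a+1)) (fun _ => (1:ℝ)))^2) = 1 := by
    rw [av_congr (g := fun _ => 1), av_const ⟨y0, hy0⟩]
    intro y hy; rw [mem_Gr] at hy
    rw [av_const (Gr_nonempty hy.1 (by omega) (by omega))]; norm_num
  have one2 : av (Gr w v a) (fun y => (av (Gr y v (a+1)) (fun _ => (1:ℝ)))^2) = 1 := by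
    rw [av_congr (g := fun _ => 1), av_const ⟨z0, hz0⟩]
    intro y hy; rw [mem_Gr] at hy
    rw [av_const (Gr_nonempty hy.2.1 (by omega) (by omega))]; norm_num
  rw [one1, one2] at hI1
  simp only [one_pow, Finset.sum_const, nsmul_eq_mul, mul_one] at hI1
  have s1' : ((Gr w v (a+2)).card : ℝ) * (Gr w y0 (a+1)).card =
    (Gr w v (a+1)).card * (Gr x0 v (a+2)).card := by exact_mod_cast s1
  have s2' : ((Gr w v (a+1)).card : ℝ) * (Gr w x0 a).card =
    (Gr w v a).card * (Gr z0 v (a+1)).card := by exact_mod_cast s2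
  set UU := av (Gr w v (a+2)) (fun y => (av (Gr w y (a+1)) f)^2) with hUUd
  rw [← hDD] at hI
  generalize hYc : ((Gr w v (a+2)).card : ℝ) = Y at *
  generalize hXc : ((Gr w v (a+1)).card : ℝ) = X at *
  generalize hZc : ((Gr w v a).card : ℝ) = Z at *
  generalize ((Gr w y0 (a+1)).card : ℝ) = m at *
  generalize ((Gr x0 v (a+2)).card : ℝ) = u at *
  generalize ((Gr w x0 a).card : ℝ) = l at *
  generalize ((Gr z0 v (a+1)).card : ℝ) = k at *
  have hqp : (0:ℝ) < (Fintype.card F : ℝ)^(a + 1 - dm w) := by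
    have : 0 < Fintype.card F := Fintype.card_pos
    positivity
  have i1 : u * m * UU = l * k * DD + (u - l) * N := by
    have : X * (u * m * UU) = X * (l * k * DD + (u - l) * N) := by
      calc X * (u * m * UU) = Y * m^2 * UU := by linear_combination (-m * UU) * s1'
        _ = Z * k^2 * DD + (u - l) * (X * N) := hI
        _ = X * (l * k * DD + (u - l) * N) := by linear_combination (-k * DD) * s2'
    exact mul_left_cancel₀ pX.ne' this
  have i2 : u * m = l * k + (u - l) := by
    have : X * (u * m) = X * (l * k + (u - l)) := by
      calc X * (u * m) = Y * m^2 := by linear_combination (-m) * s1'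
        _ = Z * k^2 + (u - l) * X := hI1
        _ = X * (l * k + (u - l)) := by linear_combination (-k) * s2'
    exact mul_left_cancel₀ pX.ne' this
  have hDD0 : 0 ≤ DD := av_nonneg fun _ _ => sq_nonneg _
  have hN0 : 0 ≤ N := hDD0.trans hDN
  have i3 : UU ≤ DD + N / m := by
    have : u * m * UU ≤ u * m * (DD + N / m) := by
      have : u * m * (DD + N / m) = u * m * DD + u * N := by field_simp
      rw [this, i1, i2]
      nlinarith [mul_nonneg pl.le (sub_nonneg.2 hDN), mul_nonneg pu.le hDD0, mul_nonneg pl.le hDD0]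
    exact le_of_mul_le_mul_left this (by positivity)
  refine i3.trans ?_
  have := div_le_div_of_nonneg_left hN0 hqp hmq
  linarith

/-- adjointness: a bound for up averaging gives a bound for down averaging -/
theorem down_of_up {w v : Sb F n} {i j : ℕ} (hij : i ≤ j) (hi : dm w ≤ i) (hj : j ≤ dm v) {μ : ℝ}
    (hμ : 0 ≤ μ)
    (H : ∀ g : Sb F n → ℝ, av (Gr w v i) g = 0 →
      av (Gr w v j) (fun y => (av (Gr w y i) g)^2) ≤ μ * av (Gr w v i) (fun x => g x ^ 2))
    (f : Sb F n → ℝ) (hf : av (Gr w v j) f = 0) :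
    av (Gr w v i) (fun x => (av (Gr x v j) f)^2) ≤ μ * av (Gr w v j) (fun y => f y ^ 2) := by
  set g : Sb F n → ℝ := fun x => av (Gr x v j) f with hg
  have hg0 : av (Gr w v i) g = 0 := by rw [hg, Gr_tower' hij hi, hf]
  have h1 := H g hg0
  have e : av (Gr w v i) (fun x => g x ^ 2) = av (Gr w v j) (fun y => f y * av (Gr w y i) g) := by
    have : ∀ x, g x ^ 2 = av (Gr x v j) (fun y => f y * g x) := by
      intro x; rw [av_mul']; rw [sq]
    simp only [this]
    rw [← swap_Gr i j (fun x y => f y * g x)]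
    exact av_congr fun y _ => av_mul _ _ _
  have h2 := av_mul_sq_le (Gr w v j) f (fun y => av (Gr w y i) g)
  rw [← e] at h2
  set D := av (Gr w v i) (fun x => g x ^ 2)
  have hD : 0 ≤ D := av_nonneg fun _ _ => sq_nonneg _
  have hN : 0 ≤ av (Gr w v j) (fun y => f y ^ 2) := av_nonneg fun _ _ => sq_nonneg _
  rcases hD.eq_or_lt with h0 | h0
  · rw [← h0]; positivity
  · have : D * D ≤ (μ * av (Gr w v j) (fun y => f y ^ 2)) * D := by nlinarith
    exact le_of_mul_le_mul_right this h0

theorem spectral_one {w v : Sb F n} (hwv : w ≤ v) (r : ℕ) (hv : dm w + r + 1 ≤ dm v)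
    (f : Sb F n → ℝ) (hf : av (Gr w v (dm w + r)) f = 0) :
    av (Gr w v (dm w + r + 1)) (fun y => (av (Gr w y (dm w + r)) f)^2) ≤
    (2 / (Fintype.card F : ℝ) * (1 - 1 / (Fintype.card F : ℝ)^r)) *
      av (Gr w v (dm w + r)) (fun x => f x ^ 2) := by
  have hq : (2:ℝ) ≤ Fintype.card F := by
    have : 1 < Fintype.card F := Fintype.one_lt_card
    exact_mod_cast this
  generalize hqq : (Fintype.card F : ℝ) = q at *
  have hq1 : 1 ≤ q := by linarith
  induction r generalizing f with
  | zero =>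
    have e1 : ∀ u, w ≤ u → Gr w u (dm w + 0) = {w} := by
      intro u hu
      ext x; rw [mem_Gr, mem_singleton]; constructor
      · rintro ⟨h1, h2, h3⟩; exact (eq_of_le_dm h1 (by omega)).symm
      · rintro rfl; exact ⟨le_rfl, hu, rfl⟩
    rw [e1 v hwv] at hf ⊢
    have hf0 : f w = 0 := by simpa [av] using hf
    rw [av_congr (g := fun _ => 0)]
    · rw [av_zero]; simp
    · intro y hy; rw [mem_Gr] at hy; rw [e1 y hy.1]; simp [av, hf0]
  | succ r ih =>
    have hμ : 0 ≤ 2 / q * (1 - 1 / q^r) := by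
      have : 1 / q^r ≤ 1 := by rw [div_le_one (by positivity)]; exact one_le_pow₀ hq1
      have : 0 ≤ 1 - 1 / q^r := by linarith
      positivity
    have h1 := down_of_up (w := w) (v := v) (i := dm w + r) (j := dm w + r + 1) (by omega) (by omega) (by omega)
      hμ (fun g hg => ih (by omega) g hg) f hf
    have h2 := up_le_down (a := dm w + r) hwv (by omega) (by omega) f
    rw [hqq, show dm w + r + 1 - dm w = r + 1 by omega] at h2
    have hN : 0 ≤ av (Gr w v (dm w + r + 1)) (fun y => f y ^ 2) := av_nonneg fun _ _ => sq_nonneg _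
    refine h2.trans ?_
    refine (add_le_add_left h1 _).trans ?_
    rw [div_eq_mul_one_div (av _ _) (q^(r+1)), mul_comm _ (1 / q^(r+1)), ← add_mul]
    apply mul_le_mul_of_nonneg_right _ hN
    have : 2 / q * (1 - 1 / q ^ (r + 1)) - (2 / q * (1 - 1 / q ^ r) + 1 / q ^ (r + 1)) =
      (1/q^(r+1)) * (1 - 2/q) := by
      rw [pow_succ]; field_simp; ring
    have h3 : 0 ≤ 1 - 2/q := by
      rw [sub_nonneg, div_le_one (by positivity)]; exact hq
    have h4 : 0 ≤ (1/q^(r+1)) * (1 - 2/q) := by positivity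
    linarith

theorem spectral_up {w v : Sb F n} (hwv : w ≤ v) {i : ℕ} (hi : dm w ≤ i) (g : ℕ) (hv : i + g ≤ dm v)
    (f : Sb F n → ℝ) (hf : av (Gr w v i) f = 0) :
    av (Gr w v (i + g)) (fun y => (av (Gr w y i) f)^2) ≤
    (2 / (Fintype.card F : ℝ))^g * av (Gr w v i) (fun x => f x ^ 2) := by
  have hq : (2:ℝ) ≤ Fintype.card F := by
    have : 1 < Fintype.card F := Fintype.one_lt_card
    exact_mod_cast this
  induction g with
  | zero =>
    rw [pow_zero, one_mul]
    apply le_of_eq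
    refine av_congr fun y hy => ?_
    rw [mem_Gr] at hy
    have : Gr w y (i) = {y} := by
      ext x; rw [mem_Gr, mem_singleton]; constructor
      · rintro ⟨h1, h2, h3⟩; exact (eq_of_le_dm h2 (by omega))
      · rintro rfl; exact ⟨hy.1, le_rfl, by omega⟩
    rw [this]; simp [av]
  | succ g ih =>
    have h1 := ih (by omega)
    set h : Sb F n → ℝ := fun y => av (Gr w y i) f with hh
    have h0 : av (Gr w v (i + g)) h = 0 := by rw [hh, Gr_tower (by omega) (by omega), hf]
    obtain ⟨r, hr⟩ := Nat.exists_eq_add_of_le (show dm w ≤ i + g by omega)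
    have h2 := spectral_one hwv r (by omega) h (by rw [← hr]; exact h0)
    rw [← hr] at h2
    have e : av (Gr w v (i + (g+1))) (fun y => (av (Gr w y i) f)^2) =
        av (Gr w v (i + g + 1)) (fun y => (av (Gr w y (i+g)) h)^2) := by
      refine av_congr fun y hy => ?_
      rw [mem_Gr] at hy
      rw [hh, Gr_tower (by omega) (by omega)]
    rw [e]
    refine h2.trans ?_
    have hN : 0 ≤ av (Gr w v (i+g)) (fun y => h y ^ 2) := av_nonneg fun _ _ => sq_nonneg _
    generalize (Fintype.card F : ℝ) = q at *
    have hle : 2 / q * (1 - 1 / q ^ r) ≤ 2 / q := by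
      have : 0 ≤ 2 / q * (1 / q^r) := by positivity
      linarith
    calc _ ≤ 2 / q * av (Gr w v (i+g)) (fun y => h y ^ 2) := mul_le_mul_of_nonneg_right hle hN
      _ ≤ 2 / q * _ := mul_le_mul_of_nonneg_left h1 (by positivity)
      _ = _ := by rw [pow_succ]; ring

theorem spectral_down {w v : Sb F n} (hwv : w ≤ v) {i : ℕ} (hi : dm w ≤ i) (g : ℕ) (hv : i + g ≤ dm v)
    (f : Sb F n → ℝ) (hf : av (Gr w v (i+g)) f = 0) :
    av (Gr w v i) (fun x => (av (Gr x v (i+g)) f)^2) ≤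
    (2 / (Fintype.card F : ℝ))^g * av (Gr w v (i+g)) (fun x => f x ^ 2) :=
  down_of_up (by omega) hi hv (by positivity) (fun h h0 => spectral_up hwv hi g hv h h0) f hf
end gr


theorem av_ind_eq_sum {α Γ : Type*} (s t : Finset α) (κ : α → Γ) (hts : t ⊆ s) :
    av t (fun y => av t (fun y' => ind (κ y ≠ κ y'))) =
    ind t.Nonempty - ∑ c ∈ s.image κ, (av t (fun y => ind (κ y = c)))^2 := by
  rcases t.eq_empty_or_nonempty with rfl | ht
  · simp [av, ind]
  have h1 : ∀ y ∈ t, av t (fun y' => ind (κ y ≠ κ y')) =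
      1 - ∑ c ∈ s.image κ, ind (κ y = c) * av t (fun y' => ind (κ y' = c)) := by
    intro y hy
    have e : ∀ y', ind (κ y ≠ κ y') = 1 - ind (κ y' = κ y) := by
      intro y'; rw [ind_not]; congr 1; exact ind_congr eq_comm
    simp only [e]
    rw [av_sub, av_const ht]
    congr 1
    rw [Finset.sum_eq_single (κ y)]
    · rw [ind_true rfl, one_mul]
    · intro c _ hc; rw [ind_false (fun h => hc h.symm), zero_mul]
    · intro h; exact absurd (Finset.mem_image_of_mem κ (hts hy)) h
  rw [av_congr h1, av_sub, av_const ht, av_sum, ind_true ht]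
  congr 1
  refine Finset.sum_congr rfl fun c _ => ?_
  rw [av_mul', sq]

/-- abstract collision lemma -/
theorem collision {α β Γ : Type*} (X : Finset β) (Y : Finset α) (R : β → Finset α) (κ : α → Γ)
    (hX : X.Nonempty) (hY : Y.Nonempty) (hR : ∀ x ∈ X, (R x).Nonempty) (hRY : ∀ x ∈ X, R x ⊆ Y)
    (ht : ∀ f : α → ℝ, av X (fun x => av (R x) f) = av Y f)
    (hs : ∀ f : α → ℝ, av Y f = 0 → av X (fun x => (av (R x) f)^2) ≤ (1/2) * av Y (fun y => f y ^2)) :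
    ∃ c : Γ, av Y (fun y => ind (κ y ≠ c)) ≤
      2 * av X (fun x => av (R x) (fun y => av (R x) (fun y' => ind (κ y ≠ κ y')))) := by
  have h1 : av X (fun x => av (R x) (fun y => av (R x) (fun y' => ind (κ y ≠ κ y')))) =
      1 - ∑ c ∈ Y.image κ, av X (fun x => (av (R x) (fun y => ind (κ y = c)))^2) := by
    rw [← av_sum, ← av_const hX (1:ℝ), ← av_sub]
    refine av_congr fun x hx => ?_
    rw [av_ind_eq_sum Y (R x) κ (hRY x hx), ind_true (hR x hx)]
  have h2 := av_ind_eq_sum Y Y κ subset_rfl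
  rw [ind_true hY] at h2
  have hsum : ∑ c ∈ Y.image κ, av Y (fun y => ind (κ y = c)) = 1 := by
    rw [← av_sum]
    rw [av_congr (g := fun _ => 1), av_const hY]
    intro y hy
    rw [Finset.sum_eq_single (κ y)]
    · rw [ind_true rfl]
    · intro c _ hc; rw [ind_false (fun h => hc h.symm)]
    · intro h; exact absurd (Finset.mem_image_of_mem κ hy) h
  have h3 : ∀ c ∈ Y.image κ, av X (fun x => (av (R x) (fun y => ind (κ y = c)))^2) ≤
      (1/2) * av Y (fun y => ind (κ y = c)) + (1/2) * (av Y (fun y => ind (κ y = c)))^2 := by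
    intro c _
    set m := av Y (fun y => ind (κ y = c)) with hm
    have h0 : av Y (fun y => ind (κ y = c) - m) = 0 := by rw [av_sub, av_const hY, ← hm, sub_self]
    have := hs _ h0
    have e1 : av X (fun x => (av (R x) (fun y => ind (κ y = c) - m))^2) =
        av X (fun x => (av (R x) (fun y => ind (κ y = c)))^2) - m^2 := by
      have : ∀ x ∈ X, (av (R x) (fun y => ind (κ y = c) - m))^2 =
          (av (R x) (fun y => ind (κ y = c)))^2 + ((-2 * m) * av (R x) (fun y => ind (κ y = c)) + m^2) := by
        intro x hx; rw [av_sub, av_const (hR x hx)]; ring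
      rw [av_congr this, av_add, av_add, av_mul, ht, av_const hX, ← hm]; ring
    have e2 : av Y (fun y => (ind (κ y = c) - m)^2) = m - m^2 := by
      have : ∀ y ∈ Y, (ind (κ y = c) - m)^2 = ind (κ y = c) + ((-2 * m) * ind (κ y = c) + m^2) := by
        intro y _; have := ind_sq (κ y = c); linear_combination this
      rw [av_congr this, av_add, av_add, av_mul, av_const hY, ← hm]; ring
    rw [e1, e2] at this
    linarith
  have h4 := Finset.sum_le_sum h3
  rw [Finset.sum_add_distrib, ← Finset.mul_sum, ← Finset.mul_sum, hsum] at h4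
  obtain ⟨y', hy', hle⟩ := exists_le_av hY (fun y' => av Y (fun y => ind (κ y ≠ κ y')))
  refine ⟨κ y', hle.trans ?_⟩
  rw [av_comm, h2, h1]
  linarith

section gr
variable {F : Type} [Field F] [Fintype F] {n : ℕ} {Γ : Type*}

theorem lam_pow_le {q : ℝ} (hq : 4 ≤ q) {i j : ℕ} (hij : i < j) : (2/q)^(j-i) ≤ 1/2 := by
  have h1 : 2/q ≤ 1/2 := by rw [div_le_div_iff₀ (by linarith) (by norm_num)]; linarith
  have h0 : 0 ≤ 2/q := by positivity
  calc (2/q)^(j-i) ≤ (2/q)^1 := pow_le_pow_of_le_one h0 (by linarith) (by omega)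
    _ ≤ 1/2 := by simpa using h1

theorem coll_up (hq : (4:ℝ) ≤ Fintype.card F) {w v : Sb F n} (hwv : w ≤ v) {i j : ℕ} (hi : dm w ≤ i)
    (hij : i < j) (hj : j ≤ dm v) (κ : Sb F n → Γ) :
    ∃ c : Γ, av (Gr w v j) (fun y => ind (κ y ≠ c)) ≤
      2 * av (Gr w v i) (fun x => av (Gr x v j) (fun y => av (Gr x v j) (fun y' => ind (κ y ≠ κ y')))) := by
  apply collision
  · exact Gr_nonempty hwv hi (by omega)
  · exact Gr_nonempty hwv (by omega) hj
  · intro x hx; rw [mem_Gr] at hx; exact Gr_nonempty hx.2.1 (by omega) hj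
  · intro x hx y hy; rw [mem_Gr] at *; exact ⟨hx.1.trans hy.1, hy.2⟩
  · intro f; exact Gr_tower' hij.le hi f
  · intro f hf
    have := spectral_down hwv hi (j - i) (by omega) f (by rwa [Nat.add_sub_of_le hij.le])
    rw [Nat.add_sub_of_le hij.le] at this
    exact this.trans (mul_le_mul_of_nonneg_right (lam_pow_le hq hij) (av_nonneg fun _ _ => sq_nonneg _))

theorem coll_down (hq : (4:ℝ) ≤ Fintype.card F) {w v : Sb F n} (hwv : w ≤ v) {i j : ℕ} (hi : dm w ≤ i)
    (hij : i < j) (hj : j ≤ dm v) (κ : Sb F n → Γ) :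
    ∃ c : Γ, av (Gr w v i) (fun y => ind (κ y ≠ c)) ≤
      2 * av (Gr w v j) (fun x => av (Gr w x i) (fun y => av (Gr w x i) (fun y' => ind (κ y ≠ κ y')))) := by
  apply collision
  · exact Gr_nonempty hwv (by omega) hj
  · exact Gr_nonempty hwv hi (by omega)
  · intro x hx; rw [mem_Gr] at hx; exact Gr_nonempty hx.1 (by omega) (by omega)
  · intro x hx y hy; rw [mem_Gr] at *; exact ⟨hy.1, hy.2.1.trans hx.2.1, hy.2.2⟩
  · intro f; exact Gr_tower hij.le hj f
  · intro f hf
    have := spectral_up hwv hi (j - i) (by omega) f hf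
    rw [Nat.add_sub_of_le hij.le] at this
    exact this.trans (mul_le_mul_of_nonneg_right (lam_pow_le hq hij) (av_nonneg fun _ _ => sq_nonneg _))

theorem sampling (hq : (4:ℝ) ≤ Fintype.card F) {w v : Sb F n} (hwv : w ≤ v) {i j : ℕ} (hi : dm w ≤ i)
    (hij : i < j) (hj : j ≤ dm v) (f : Sb F n → ℝ) (h0 : ∀ x, 0 ≤ f x) (h1 : ∀ x, f x ≤ 1) {c : ℝ}
    (hc : 0 < c) :
    av (Gr w v i) (fun x => ind (c ≤ av (Gr x v j) f)) ≤
      4 * (2 / Fintype.card F) * av (Gr w v j) f / c^2 + ind (c / 2 ≤ av (Gr w v j) f) := by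
  set m := av (Gr w v j) f with hm
  have hm0 : 0 ≤ m := av_nonneg fun _ _ => h0 _
  by_cases hcm : c / 2 ≤ m
  · rw [ind_true hcm]
    have := av_ind_le_one (Gr w v i) (fun x => c ≤ av (Gr x v j) f)
    have : 0 ≤ 4 * (2 / Fintype.card F) * m / c^2 := by positivity
    linarith
  rw [ind_false hcm, add_zero]
  push Not at hcm
  have hY : (Gr w v j).Nonempty := Gr_nonempty hwv (by omega) hj
  have hz : av (Gr w v j) (fun x => f x - m) = 0 := by rw [av_sub, av_const hY, ← hm, sub_self]
  have hs := spectral_down hwv hi (j - i) (by omega) (fun x => f x - m)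
    (by rwa [Nat.add_sub_of_le hij.le])
  rw [Nat.add_sub_of_le hij.le] at hs
  have e2 : av (Gr w v j) (fun y => (f y - m)^2) ≤ m := by
    have : ∀ y ∈ Gr w v j, (f y - m)^2 ≤ f y + ((-2 * m) * f y + m^2) := by
      intro y _; nlinarith [h0 y, h1 y]
    refine (av_mono this).trans ?_
    rw [av_add, av_add, av_mul, av_const hY, ← hm]; nlinarith
  have e3 : (2 / (Fintype.card F : ℝ))^(j-i) ≤ 2 / Fintype.card F := by
    have hle : 2 / (Fintype.card F : ℝ) ≤ 1 := by rw [div_le_one (by linarith)]; linarith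
    calc _ ≤ (2 / (Fintype.card F : ℝ))^1 := pow_le_pow_of_le_one (by positivity) hle (by omega)
      _ = _ := pow_one _
  have e4 : av (Gr w v i) (fun x => (av (Gr x v j) (fun y => f y - m))^2) ≤ 2 / Fintype.card F * m :=
    hs.trans (mul_le_mul e3 e2 (av_nonneg fun _ _ => sq_nonneg _) (by positivity))
  calc _ ≤ av (Gr w v i) (fun x => (av (Gr x v j) (fun y => f y - m))^2 / (c/2)^2) := by
        refine av_mono fun x hx => ?_
        rw [mem_Gr] at hx
        rw [av_sub, av_const (Gr_nonempty hx.2.1 (by omega) hj)]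
        refine (ind_mono ?_).trans (ind_le_div_sq (c := c/2) (by positivity))
        intro h; rw [le_abs]; left; linarith
    _ = av (Gr w v i) (fun x => (av (Gr x v j) (fun y => f y - m))^2) / (c/2)^2 := av_div _ _ _
    _ ≤ (2 / Fintype.card F * m) / (c/2)^2 := div_le_div_of_nonneg_right e4 (by positivity)
    _ = _ := by field_simp; ring

theorem card_atoms_ge_two (hq : (4:ℝ) ≤ Fintype.card F) {w x : Sb F n} (h : w ≤ x) (hd : dm w + 2 ≤ dm x) :
    2 ≤ (Gr w x (dm w + 1)).card := by
  have h1 := card_atoms_pos_ge h (r := dm x - dm w - 1) (by omega)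
  have h2 : 4 ≤ Fintype.card F := by exact_mod_cast hq
  have : Fintype.card F ^ 1 ≤ Fintype.card F ^ (dm x - dm w - 1) := Nat.pow_le_pow_right (by omega) (by omega)
  rw [pow_one] at this
  omega

/-- pair law: pairs of distinct atoms -/
theorem pair_law (hq : (4:ℝ) ≤ Fintype.card F) {w : Sb F n} {a : ℕ} (ha : a = dm w + 1) :
    ∃ κ : ℕ → ℝ, (∀ i, a + 1 ≤ i → i ≤ n → 0 < κ i) ∧
     (∀ i j, a + 1 ≤ i → i ≤ n → a + 1 ≤ j → j ≤ n → κ i ≤ 2 * κ j) ∧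
     ∀ i, a + 1 ≤ i → i ≤ n → ∀ ψ : Sb F n → Sb F n → Sb F n → ℝ,
      av (Gr w ⊤ i) (fun x => av (Gr w x a) (fun u => av (Gr w x a) (fun u' =>
        ind (u ≠ u') * ψ u u' x))) =
      κ i * av (Gr w ⊤ (a+1)) (fun s => ∑ u ∈ Gr w s a, ∑ u' ∈ Gr w s a,
        ind (u ≠ u') * av (Gr s ⊤ i) (fun x => ψ u u' x)) := by
  subst ha
  have hex : ∀ i, ∃ x : Sb F n, (dm w + 1 + 1 ≤ i → i ≤ n → x ∈ Gr w ⊤ i) := by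
    intro i
    by_cases h : dm w + 1 + 1 ≤ i ∧ i ≤ n
    · obtain ⟨x, hx⟩ := Gr_nonempty (le_top : w ≤ ⊤) (i := i) (by omega) (by rw [dm_top]; exact h.2)
      exact ⟨x, fun _ _ => hx⟩
    · exact ⟨⊥, fun h1 h2 => absurd ⟨h1, h2⟩ h⟩
  choose X hX using hex
  have key : ∀ x : Sb F n, w ≤ x → ∀ ψ : Sb F n → Sb F n → ℝ,
      ∑ u ∈ Gr w x (dm w + 1), ∑ u' ∈ Gr w x (dm w + 1), ind (u ≠ u') * ψ u u' =
      ∑ s ∈ Gr w x (dm w + 1 + 1), ∑ u ∈ Gr w s (dm w + 1), ∑ u' ∈ Gr w s (dm w + 1),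
        ind (u ≠ u') * ψ u u' := by
    intro x hwx ψ
    have e : ∀ s ∈ Gr w x (dm w + 1 + 1), ∑ u ∈ Gr w s (dm w + 1), ∑ u' ∈ Gr w s (dm w + 1),
        ind (u ≠ u') * ψ u u' = ∑ u ∈ Gr w x (dm w + 1), ∑ u' ∈ Gr w x (dm w + 1),
          (if u ≤ s ∧ u' ≤ s then ind (u ≠ u') * ψ u u' else 0) := by
      intro s hs
      rw [mem_Gr] at hs
      have e1 : Gr w s (dm w + 1) = (Gr w x (dm w + 1)).filter (fun u => u ≤ s) := by
        ext u; simp only [mem_Gr, mem_filter]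
        constructor
        · rintro ⟨h1, h2, h3⟩; exact ⟨⟨h1, h2.trans hs.2.1, h3⟩, h2⟩
        · rintro ⟨⟨h1, h2, h3⟩, h4⟩; exact ⟨h1, h4, h3⟩
      rw [e1, Finset.sum_filter]
      refine Finset.sum_congr rfl fun u _ => ?_
      by_cases hu : u ≤ s
      · simp only [hu, if_true, true_and]; rw [Finset.sum_filter]
      · simp [hu]
    rw [Finset.sum_congr (s₁ := Gr w x (dm w + 1 + 1)) rfl e, Finset.sum_comm (s := Gr w x (dm w + 1 + 1))]
    refine Finset.sum_congr rfl fun u hu => ?_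
    rw [Finset.sum_comm (s := Gr w x (dm w + 1 + 1))]
    refine Finset.sum_congr rfl fun u' hu' => ?_
    by_cases hne : u = u'
    · simp [ind, hne]
    rw [mem_Gr] at hu hu'
    have hd := dm_sup_inf u u'
    have hinf : dm (u ⊓ u') = dm w := by
      have h1 := dm_mono (le_inf hu.1 hu'.1)
      by_contra hcon
      have e1 : u ⊓ u' = u := eq_of_le_dm inf_le_left (by omega)
      have e2 : u ⊓ u' = u' := eq_of_le_dm inf_le_right (by omega)
      exact hne (e1.symm.trans e2)
    rw [Finset.sum_eq_single (u ⊔ u')]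
    · simp
    · intro s hs hsne
      rw [if_neg]
      rintro ⟨h1, h2⟩
      rw [mem_Gr] at hs
      exact hsne (eq_of_le_dm (sup_le h1 h2) (by omega)).symm
    · intro h; exfalso; apply h; rw [mem_Gr]
      exact ⟨hu.1.trans le_sup_left, sup_le hu.2.1 hu'.2.1, by omega⟩
  let h : ℕ → ℝ := fun i => ((Gr w (X i) (dm w + 1)).card : ℝ)
  let c : ℕ → ℝ := fun i => ((Gr w (X i) (dm w + 1 + 1)).card : ℝ)
  have hh2 : ∀ i, dm w + 1 + 1 ≤ i → i ≤ n → 2 ≤ h i := by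
    intro i h1 h2
    have := mem_Gr.1 (hX i h1 h2)
    have := card_atoms_ge_two hq this.1 (by omega)
    show (2:ℝ) ≤ ((Gr w (X i) (dm w + 1)).card : ℝ)
    exact_mod_cast this
  have hc0 : ∀ i, dm w + 1 + 1 ≤ i → i ≤ n → 0 < c i := by
    intro i h1 h2
    have := mem_Gr.1 (hX i h1 h2)
    have := (Gr_nonempty this.1 (i := dm w + 1 + 1) (by omega) (by omega)).card_pos
    show (0:ℝ) < ((Gr w (X i) (dm w + 1 + 1)).card : ℝ)
    exact_mod_cast this
  have hrel : ∀ i, dm w + 1 + 1 ≤ i → i ≤ n →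
      h i * (h i - 1) = c i * (h (dm w + 2) * (h (dm w + 2) - 1)) := by
    intro i h1 h2
    have offd : ∀ s : Finset (Sb F n), ∑ u ∈ s, ∑ u' ∈ s, ind (u ≠ u') * 1 =
        (s.card : ℝ) * (s.card - 1) := by
      intro s
      have : ∀ u ∈ s, ∑ u' ∈ s, ind (u ≠ u') * 1 = (s.card : ℝ) - 1 := by
        intro u hu
        have : ∀ u' ∈ s, ind (u ≠ u') * 1 = 1 - (if u' = u then 1 else 0) := by
          intro u' _
          by_cases h : u = u'
          · simp [ind, h]
          · rw [if_neg (fun e => h e.symm), ind_true h]; ring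
        rw [Finset.sum_congr rfl this, Finset.sum_sub_distrib]
        simp [hu]
      rw [Finset.sum_congr rfl this]; simp [Finset.sum_const, nsmul_eq_mul]; ring
    have hk := key (X i) (mem_Gr.1 (hX i h1 h2)).1 (fun _ _ => 1)
    simp only [offd] at hk
    have h3 := mem_Gr.1 (hX (dm w + 2) (by omega) (by omega))
    have : ∀ s ∈ Gr w (X i) (dm w + 1 + 1), ((Gr w s (dm w + 1)).card : ℝ) *
        ((Gr w s (dm w + 1)).card - 1) = h (dm w + 2) * (h (dm w + 2) - 1) := by
      intro s hs
      rw [mem_Gr] at hs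
      have : (Gr w s (dm w + 1)).card = (Gr w (X (dm w + 2)) (dm w + 1)).card :=
        card_Gr_eq hs.1 h3.1 rfl (by omega) _
      show _ = ((Gr w (X (dm w + 2)) (dm w + 1)).card : ℝ) * (((Gr w (X (dm w + 2)) (dm w + 1)).card : ℝ) - 1)
      rw [this]
    rw [Finset.sum_congr rfl this] at hk
    simpa using hk
  refine ⟨fun i => c i / (h i)^2, ?_, ?_, ?_⟩
  · intro i h1 h2
    have := hh2 i h1 h2; have := hc0 i h1 h2
    positivity
  · intro i j h1 h2 h3 h4
    have := hh2 i h1 h2; have := hh2 j h3 h4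
    have r1 := hrel i h1 h2; have r2 := hrel j h3 h4
    have h5 : 2 ≤ h (dm w + 2) := hh2 _ (by omega) (by omega)
    generalize hM : h (dm w + 2) * (h (dm w + 2) - 1) = M at r1 r2
    have hM0 : 0 < M := by rw [← hM]; nlinarith
    have e1 : c i = h i * (h i - 1) / M := by rw [r1]; field_simp
    have e2 : c j = h j * (h j - 1) / M := by rw [r2]; field_simp
    show c i / (h i)^2 ≤ 2 * (c j / (h j)^2)
    rw [e1, e2]
    have a1 : h i * (h i - 1) / M / (h i)^2 = (1 - 1 / h i) / M := by field_simp
    have a2 : h j * (h j - 1) / M / (h j)^2 = (1 - 1 / h j) / M := by field_simp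
    rw [a1, a2, ← mul_div_assoc]
    apply div_le_div_of_nonneg_right _ hM0.le
    have b1 : 0 ≤ 1 / h i := one_div_nonneg.2 (by linarith [hh2 i h1 h2])
    have b2 : 1 / h j ≤ 1 / 2 := one_div_le_one_div_of_le (by norm_num) (hh2 j h3 h4)
    linarith
  · intro i h1 h2 ψ
    have hXi := mem_Gr.1 (hX i h1 h2)
    have e1 : ∀ x ∈ Gr w ⊤ i, av (Gr w x (dm w + 1)) (fun u => av (Gr w x (dm w + 1)) (fun u' =>
        ind (u ≠ u') * ψ u u' x)) = (c i / (h i)^2) * av (Gr w x (dm w + 1 + 1)) (fun s =>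
          ∑ u ∈ Gr w s (dm w + 1), ∑ u' ∈ Gr w s (dm w + 1), ind (u ≠ u') * ψ u u' x) := by
      intro x hx
      rw [mem_Gr] at hx
      have k1 : ((Gr w x (dm w + 1)).card : ℝ) = h i := by
        have : (Gr w x (dm w + 1)).card = (Gr w (X i) (dm w + 1)).card :=
          card_Gr_eq hx.1 hXi.1 rfl (by omega) _
        show _ = ((Gr w (X i) (dm w + 1)).card : ℝ)
        rw [this]
      have k2 : ((Gr w x (dm w + 1 + 1)).card : ℝ) = c i := by
        have : (Gr w x (dm w + 1 + 1)).card = (Gr w (X i) (dm w + 1 + 1)).card :=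
          card_Gr_eq hx.1 hXi.1 rfl (by omega) _
        show _ = ((Gr w (X i) (dm w + 1 + 1)).card : ℝ)
        rw [this]
      have hk := key x hx.1 (fun u u' => ψ u u' x)
      unfold av
      rw [k1, k2, ← hk, ← Finset.sum_div]
      have := hh2 i h1 h2; have := hc0 i h1 h2
      field_simp
    rw [av_congr e1, av_mul]
    congr 1
    rw [swap_Gr (dm w + 1 + 1) i (fun s x => ∑ u ∈ Gr w s (dm w + 1), ∑ u' ∈ Gr w s (dm w + 1),
      ind (u ≠ u') * ψ u u' x)]
    refine av_congr fun s _ => ?_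
    rw [av_sum]
    refine Finset.sum_congr rfl fun u _ => ?_
    rw [av_sum]
    refine Finset.sum_congr rfl fun u' _ => ?_
    rw [av_mul]

/-- comparison of a uniform atom with an atom of a random `x ⊇ v'` -/
theorem atom_compare (hq : (4:ℝ) ≤ Fintype.card F) {w v' : Sb F n} {b : ℕ} (hwv : w ≤ v')
    (hw : dm w + 1 ≤ dm v') (hb : dm v' < b) (hbn : b ≤ n) (f : Sb F n → ℝ) (hf : ∀ u, 0 ≤ f u) :
    av (Gr w ⊤ (dm w + 1)) f ≤ 2 * av (Gr v' ⊤ b) (fun x => av (Gr w x (dm w + 1)) f) := by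
  set a := dm w + 1 with ha
  obtain ⟨x0, hx0⟩ := Gr_nonempty (le_top : v' ≤ ⊤) (i := b) (by omega) (by rw [dm_top]; exact hbn)
  have hx0' := mem_Gr.1 hx0
  set hb' : ℝ := ((Gr w x0 a).card : ℝ) with hhb
  set N : ℝ := ((Gr v' ⊤ b).card : ℝ) with hN
  have hNpos : 0 < N := by
    have := Finset.card_pos.2 ⟨x0, hx0⟩
    rw [hN]; exact_mod_cast this
  have hbpos : 0 < hb' := by
    have := (Gr_nonempty (hwv.trans hx0'.1) (i := a) (by omega) (by omega)).card_pos
    rw [hhb]; exact_mod_cast this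
  -- expansion
  let d : Sb F n → ℝ := fun u => ((Gr (v' ⊔ u) ⊤ b).card : ℝ)
  have hexp : ∀ g : Sb F n → ℝ, av (Gr v' ⊤ b) (fun x => av (Gr w x a) g) =
      (∑ u ∈ Gr w ⊤ a, d u * g u) / (N * hb') := by
    intro g
    have : ∀ x ∈ Gr v' ⊤ b, av (Gr w x a) g = (∑ u ∈ Gr w x a, g u) / hb' := by
      intro x hx; rw [mem_Gr] at hx
      rw [av, card_Gr_eq (hwv.trans hx.1) (hwv.trans hx0'.1) rfl (by omega)]
    rw [av_congr this, av_div, av, div_div]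
    congr 1
    have h1 : ∑ x ∈ Gr v' ⊤ b, ∑ u ∈ Gr w x a, g u = ∑ u ∈ Gr w ⊤ a, ∑ x ∈ Gr (v' ⊔ u) ⊤ b, g u := by
      apply Finset.sum_comm'
      intro x u; simp only [mem_Gr, le_top, true_and, sup_le_iff]
      constructor
      · rintro ⟨⟨h1, h2⟩, h3, h4, h5⟩; exact ⟨⟨⟨h1, h4⟩, h2⟩, h3, h5⟩
      · rintro ⟨⟨⟨h1, h4⟩, h2⟩, h3, h5⟩; exact ⟨⟨h1, h2⟩, h3, h4, h5⟩
    rw [h1]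
    refine Finset.sum_congr rfl fun u _ => ?_
    simp [d]
  -- atoms inside v'
  set hn : ℝ := ((Gr w ⊤ a).card : ℝ) with hhn
  set hv : ℝ := ((Gr w v' a).card : ℝ) with hhv
  have hdin : ∀ u ∈ Gr w ⊤ a, u ≤ v' → d u = N := by
    intro u _ hu; simp only [d, sup_eq_left.2 hu]; rfl
  have hone := hexp (fun _ => 1)
  have hone' : av (Gr v' ⊤ b) (fun x => av (Gr w x a) (fun _ => (1:ℝ))) = 1 := by
    rw [av_congr (g := fun _ => 1), av_const ⟨x0, hx0⟩]
    intro x hx; rw [mem_Gr] at hx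
    exact av_const (Gr_nonempty (hwv.trans hx.1) (by omega) (by omega)) _
  rw [hone'] at hone
  simp only [mul_one] at hone
  have hsumd : ∑ u ∈ Gr w ⊤ a, d u = N * hb' := by
    field_simp at hone; linarith
  have hvb : 2 * hv ≤ hb' := by
    have a1 := card_atoms hwv
    have a2 := card_atoms (hwv.trans hx0'.1)
    set q := Fintype.card F
    have hq4 : 4 ≤ q := by exact_mod_cast hq
    have : 2 * (q ^ (dm v' - dm w) - 1) ≤ q ^ (dm x0 - dm w) - 1 := by
      have : q ^ (dm v' - dm w) * q ≤ q ^ (dm x0 - dm w) := by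
        rw [← pow_succ]; exact Nat.pow_le_pow_right (by omega) (by omega)
      have h1 : 1 ≤ q ^ (dm v' - dm w) := Nat.one_le_pow _ _ (by omega)
      have : q ^ (dm v' - dm w) * 4 ≤ q ^ (dm v' - dm w) * q := Nat.mul_le_mul_left _ hq4
      omega
    rw [← a1, ← a2, ← mul_assoc] at this
    have := Nat.le_of_mul_le_mul_right this (by omega)
    rw [hhv, hhb]; exact_mod_cast this
  have hbn' : hb' ≤ hn := by
    rw [hhb, hhn]
    have : (Gr w x0 a).card ≤ (Gr w ⊤ a).card := by
      apply Finset.card_le_card; intro u hu; rw [mem_Gr] at *; exact ⟨hu.1, le_top, hu.2.2⟩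
    exact_mod_cast this
  -- main pointwise bound: d u ≥ N hb' / (2 hn)
  have hnpos : 0 < hn := lt_of_lt_of_le hbpos hbn'
  have hpt : ∀ u ∈ Gr w ⊤ a, N * hb' / (2 * hn) ≤ d u := by
    intro u hu
    by_cases hin : u ≤ v'
    · rw [hdin u hu hin, div_le_iff₀ (by positivity)]
      nlinarith
    · have hu' := mem_Gr.1 hu
      have hdimsup : ∀ u ∈ Gr w ⊤ a, ¬ u ≤ v' → dm (v' ⊔ u) = dm v' + 1 := by
        intro u hu hin
        rw [mem_Gr] at hu
        have h1 := dm_sup_inf v' u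
        have h2 : dm w ≤ dm (v' ⊓ u) := dm_mono (le_inf hwv hu.1)
        have h3 : dm (v' ⊓ u) ≠ dm u := by
          intro h
          have : v' ⊓ u = u := eq_of_le_dm inf_le_right (by omega)
          exact hin (inf_eq_right.1 this)
        have h4 : dm (v' ⊓ u) ≤ dm u := dm_mono inf_le_right
        omega
      have hconst : ∀ u2 ∈ (Gr w ⊤ a).filter (fun u => ¬ u ≤ v'), d u2 = d u := by
        intro u2 hu2
        rw [mem_filter] at hu2
        simp only [d]
        rw [card_Gr_eq (le_top : v' ⊔ u2 ≤ ⊤) (le_top : v' ⊔ u ≤ ⊤)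
          (by rw [hdimsup u2 hu2.1 hu2.2, hdimsup u hu hin]) rfl]
      have hsplit := Finset.sum_filter_add_sum_filter_not (Gr w ⊤ a) (fun u => u ≤ v') d
      have hfil : (Gr w ⊤ a).filter (fun u => u ≤ v') = Gr w v' a := by
        ext u; simp only [mem_Gr, mem_filter, le_top, true_and]; tauto
      have s1 : ∑ u ∈ (Gr w ⊤ a).filter (fun u => u ≤ v'), d u = hv * N := by
        rw [Finset.sum_congr rfl (g := fun _ => N)]
        · rw [hfil]; simp [hhv]
        · intro u hu; rw [mem_filter] at hu; exact hdin u hu.1 hu.2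
      have hcardle : (((Gr w ⊤ a).filter (fun u => ¬ u ≤ v')).card : ℝ) ≤ hn := by
        rw [hhn]; exact_mod_cast Finset.card_filter_le _ _
      rw [s1, hsumd, Finset.sum_congr rfl hconst] at hsplit
      simp only [Finset.sum_const, nsmul_eq_mul] at hsplit
      have hd0 : 0 ≤ d u := Nat.cast_nonneg _
      rw [div_le_iff₀ (by positivity)]
      nlinarith [mul_le_mul_of_nonneg_right hcardle hd0]
  rw [hexp f]
  unfold av
  rw [← hhn, div_le_iff₀ hnpos, ← mul_div_assoc, div_mul_eq_mul_div, le_div_iff₀ (by positivity)]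
  rw [Finset.sum_mul, Finset.mul_sum, Finset.sum_mul]
  refine Finset.sum_le_sum fun u hu => ?_
  have := hpt u hu
  rw [div_le_iff₀ (by positivity)] at this
  nlinarith [hf u, mul_le_mul_of_nonneg_right this (hf u)]
end gr


theorem av_pair_add {α : Type*} {s : Finset α} (hs : s.Nonempty) (f : α → ℝ) :
    av s (fun x => av s (fun y => f x + f y)) = 2 * av s f := by
  have e : ∀ x ∈ s, av s (fun y => f x + f y) = f x + av s f := by
    intro x _; rw [av_add, av_const hs]
  rw [av_congr e, av_add, av_const hs]; ring

section cocycle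
variable {F : Type} [Field F] [Fintype F] {n : ℕ} {Γ : Type*} [Group Γ]

/-- failure indicator of the local factorization -/
noncomputable def bd (A B : Sb F n → Sb F n → Sb F n → Γ) (Φ : Sb F n → Sb F n → Γ)
    (u v v' x : Sb F n) : ℝ := ind (A u v v' * B v v' x ≠ Φ u x)

noncomputable def bt (A B : Sb F n → Sb F n → Sb F n → Γ) (Φ : Sb F n → Sb F n → Γ) (ν' b : ℕ)
    (u v : Sb F n) : ℝ :=
  av (Gr v ⊤ ν') (fun v' => av (Gr v' ⊤ b) (fun x => bd A B Φ u v v' x))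

noncomputable def pp (A B : Sb F n → Sb F n → Sb F n → Γ) (Φ : Sb F n → Sb F n → Γ) (ω ν ν' b : ℕ)
    (w : Sb F n) : ℝ :=
  av (Gr w ⊤ ω) (fun u => av (Gr u ⊤ ν) (fun v => bt A B Φ ν' b u v))

variable (A B : Sb F n → Sb F n → Sb F n → Γ) (Φ : Sb F n → Sb F n → Γ)

theorem bd_nonneg (u v v' x : Sb F n) : 0 ≤ bd A B Φ u v v' x := ind_nonneg _
theorem bd_le_one (u v v' x : Sb F n) : bd A B Φ u v v' x ≤ 1 := ind_le_one _
theorem bt_nonneg (ν' b : ℕ) (u v : Sb F n) : 0 ≤ bt A B Φ ν' b u v :=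
  av_nonneg fun _ _ => av_nonneg fun _ _ => bd_nonneg _ _ _ _ _ _ _
theorem bt_le_one (ν' b : ℕ) (u v : Sb F n) : bt A B Φ ν' b u v ≤ 1 :=
  av_le_const' zero_le_one fun _ _ => av_le_const' zero_le_one fun _ _ => bd_le_one _ _ _ _ _ _ _
theorem pp_nonneg (ω ν ν' b : ℕ) (w : Sb F n) : 0 ≤ pp A B Φ ω ν ν' b w :=
  av_nonneg fun _ _ => av_nonneg fun _ _ => bt_nonneg _ _ _ _ _ _ _
theorem pp_le_one (ω ν ν' b : ℕ) (w : Sb F n) : pp A B Φ ω ν ν' b w ≤ 1 :=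
  av_le_const' zero_le_one fun _ _ => av_le_const' zero_le_one fun _ _ => bt_le_one _ _ _ _ _ _ _

theorem gam_exists (hq : (4:ℝ) ≤ Fintype.card F) {ν ν' b : ℕ} (hν : ν ≤ ν') (hb : ν' < b) (hbn : b ≤ n)
    (s u0 u : Sb F n) (hs : dm s ≤ ν) :
    ∃ c : Γ, av (Gr s ⊤ b) (fun x => ind (Φ u0 x ≠ c * Φ u x)) ≤
      4 * av (Gr s ⊤ ν) (fun v => bt A B Φ ν' b u0 v + bt A B Φ ν' b u v) := by
  obtain ⟨c, hc⟩ := coll_up hq (le_top : s ≤ ⊤) (i := ν') (j := b) (by omega) hb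
    (by rw [dm_top]; exact hbn) (fun x => Φ u0 x * (Φ u x)⁻¹)
  refine ⟨c, ?_⟩
  have e1 : av (Gr s ⊤ b) (fun x => ind (Φ u0 x ≠ c * Φ u x)) =
      av (Gr s ⊤ b) (fun x => ind (Φ u0 x * (Φ u x)⁻¹ ≠ c)) :=
    av_congr fun x _ => ind_congr (not_congr (by rw [mul_inv_eq_iff_eq_mul]))
  rw [e1]
  refine hc.trans ?_
  set G : Sb F n → Sb F n → Sb F n → ℝ := fun v v' x => bd A B Φ u0 v v' x + bd A B Φ u v v' x with hG
  have key : av (Gr s ⊤ ν') (fun v' => av (Gr v' ⊤ b) (fun x => av (Gr v' ⊤ b) (fun x' =>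
      ind (Φ u0 x * (Φ u x)⁻¹ ≠ Φ u0 x' * (Φ u x')⁻¹)))) ≤
      av (Gr s ⊤ ν') (fun v' => av (Gr s v' ν) (fun v => 2 * av (Gr v' ⊤ b) (fun x => G v v' x))) := by
    refine av_mono fun v' hv' => ?_
    rw [mem_Gr] at hv'
    have hne : (Gr v' ⊤ b).Nonempty := Gr_nonempty le_top (by omega) (by rw [dm_top]; omega)
    refine const_le_av (Gr_nonempty hv'.1 hs (by omega)) fun v _ => ?_
    have : 2 * av (Gr v' ⊤ b) (fun x => G v v' x) =
        av (Gr v' ⊤ b) (fun x => av (Gr v' ⊤ b) (fun x' => G v v' x + G v v' x')) := by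
      exact (av_pair_add hne (G v v')).symm
    rw [this]
    refine av_mono fun x _ => av_mono fun x' _ => ?_
    by_cases h : bd A B Φ u0 v v' x = 0 ∧ bd A B Φ u v v' x = 0 ∧ bd A B Φ u0 v v' x' = 0 ∧ bd A B Φ u v v' x' = 0
    · obtain ⟨h1, h2, h3, h4⟩ := h
      have z : ∀ {p : Prop}, ind (¬ p) = 0 → p := by
        intro p h; by_contra hp; rw [ind_true hp] at h; norm_num at h
      have h1 := z h1; have h2 := z h2; have h3 := z h3; have h4 := z h4
      rw [ind_false]
      · exact add_nonneg (add_nonneg (bd_nonneg _ _ _ _ _ _ _) (bd_nonneg _ _ _ _ _ _ _))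
          (add_nonneg (bd_nonneg _ _ _ _ _ _ _) (bd_nonneg _ _ _ _ _ _ _))
      · rw [not_not, ← h1, ← h2, ← h3, ← h4]; group
    · have o : ∀ {p : Prop}, ind p ≠ 0 → ind p = 1 := by
        intro p h; by_cases hp : p
        · exact ind_true hp
        · exact absurd (ind_false hp) h
      refine (ind_le_one _).trans ?_
      have p1 := bd_nonneg A B Φ u0 v v' x; have p2 := bd_nonneg A B Φ u v v' x
      have p3 := bd_nonneg A B Φ u0 v v' x'; have p4 := bd_nonneg A B Φ u v v' x'
      simp only [hG]
      by_cases h1 : bd A B Φ u0 v v' x = 0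
      · by_cases h2 : bd A B Φ u v v' x = 0
        · by_cases h3 : bd A B Φ u0 v v' x' = 0
          · have h4 : bd A B Φ u v v' x' ≠ 0 := fun h4 => h ⟨h1, h2, h3, h4⟩
            have : bd A B Φ u v v' x' = 1 := o h4
            linarith
          · have : bd A B Φ u0 v v' x' = 1 := o h3
            linarith
        · have : bd A B Φ u v v' x = 1 := o h2
          linarith
      · have : bd A B Φ u0 v v' x = 1 := o h1
        linarith
  rw [swap_Gr ν ν' (fun v v' => 2 * av (Gr v' ⊤ b) (fun x => G v v' x))] at key
  have e2 : av (Gr s ⊤ ν) (fun v => av (Gr v ⊤ ν') (fun v' => 2 * av (Gr v' ⊤ b) (fun x => G v v' x))) =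
      2 * av (Gr s ⊤ ν) (fun v => bt A B Φ ν' b u0 v + bt A B Φ ν' b u v) := by
    rw [← av_mul]
    refine av_congr fun v _ => ?_
    rw [av_mul]; congr 1
    rw [bt, bt, ← av_add]
    refine av_congr fun v' _ => ?_
    rw [← av_add]
  linarith

/-- step (α) -/
theorem lower_alpha (hq : (4:ℝ) ≤ Fintype.card F) {ω ν ν' b : ℕ} (hων : ω < ν) (hν : ν ≤ ν') (hb : ν' < b)
    (hbn : b ≤ n) (w : Sb F n) (hw : ω = dm w + 1) :
    ∃ γ : Sb F n → Sb F n → Γ,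
      av (Gr w ⊤ b) (fun x => av (Gr w x ω) (fun u0 => av (Gr w x ω) (fun u =>
        ind (Φ u0 x ≠ γ u0 u * Φ u x)))) ≤ 16 * pp A B Φ ω ν ν' b w := by
  have hex : ∀ u0 u : Sb F n, ∃ c : Γ, (u0 = u → c = 1) ∧ (u0 ≠ u → dm (u0 ⊔ u) ≤ ν →
      av (Gr (u0 ⊔ u) ⊤ b) (fun x => ind (Φ u0 x ≠ c * Φ u x)) ≤
      4 * av (Gr (u0 ⊔ u) ⊤ ν) (fun v => bt A B Φ ν' b u0 v + bt A B Φ ν' b u v)) := by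
    intro u0 u
    by_cases h : u0 = u
    · exact ⟨1, fun _ => rfl, fun h' => absurd h h'⟩
    · by_cases hd : dm (u0 ⊔ u) ≤ ν
      · obtain ⟨c, hc⟩ := gam_exists A B Φ hq hν hb hbn (u0 ⊔ u) u0 u hd
        exact ⟨c, fun h' => absurd h' h, fun _ _ => hc⟩
      · exact ⟨1, fun _ => rfl, fun _ h' => absurd h' hd⟩
  choose γ hγ1 hγ2 using hex
  refine ⟨γ, ?_⟩
  obtain ⟨κ, κpos, κle, hκ⟩ := pair_law hq hw
  have e1 : av (Gr w ⊤ b) (fun x => av (Gr w x ω) (fun u0 => av (Gr w x ω) (fun u =>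
        ind (Φ u0 x ≠ γ u0 u * Φ u x)))) = av (Gr w ⊤ b) (fun x => av (Gr w x ω) (fun u0 => av (Gr w x ω) (fun u =>
        ind (u0 ≠ u) * ind (Φ u0 x ≠ γ u0 u * Φ u x)))) := by
    refine av_congr fun x _ => av_congr fun u0 _ => av_congr fun u _ => ?_
    by_cases h : u0 = u
    · rw [ind_false (p := u0 ≠ u) (by simpa using h), zero_mul, ind_false]
      rw [not_not, hγ1 _ _ h, one_mul, h]
    · rw [ind_true (p := u0 ≠ u) h, one_mul]
  rw [e1, hκ b (by omega) hbn]
  have hBt : ∀ u0 u v, 0 ≤ bt A B Φ ν' b u0 v + bt A B Φ ν' b u v := fun u0 u v =>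
    add_nonneg (bt_nonneg _ _ _ _ _ _ _) (bt_nonneg _ _ _ _ _ _ _)
  have e2 : av (Gr w ⊤ (ω+1)) (fun s => ∑ u ∈ Gr w s ω, ∑ u' ∈ Gr w s ω,
        ind (u ≠ u') * av (Gr s ⊤ b) (fun x => ind (Φ u x ≠ γ u u' * Φ u' x))) ≤
      4 * av (Gr w ⊤ (ω+1)) (fun s => ∑ u ∈ Gr w s ω, ∑ u' ∈ Gr w s ω,
        ind (u ≠ u') * av (Gr s ⊤ ν) (fun v => bt A B Φ ν' b u v + bt A B Φ ν' b u' v)) := by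
    rw [← av_mul]
    refine av_mono fun s hs => ?_
    rw [mem_Gr] at hs
    rw [Finset.mul_sum]
    refine Finset.sum_le_sum fun u hu => ?_
    rw [Finset.mul_sum]
    refine Finset.sum_le_sum fun u' hu' => ?_
    by_cases h : u = u'
    · rw [ind_false (p := u ≠ u') (by simpa using h)]; simp
    · rw [ind_true (p := u ≠ u') h, one_mul, one_mul]
      rw [mem_Gr] at hu hu'
      have hsup : u ⊔ u' = s := by
        refine eq_of_le_dm (sup_le hu.2.1 hu'.2.1) ?_
        have h1 := dm_mono (le_sup_left : u ≤ u ⊔ u')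
        by_contra hcon
        have e1 : u = u ⊔ u' := eq_of_le_dm le_sup_left (by omega)
        have e2 : u' = u ⊔ u' := eq_of_le_dm le_sup_right (by omega)
        exact h (e1.trans e2.symm)
      have := hγ2 u u' h (by rw [hsup]; omega)
      rwa [hsup] at this
  have e3 : κ ν * av (Gr w ⊤ (ω+1)) (fun s => ∑ u ∈ Gr w s ω, ∑ u' ∈ Gr w s ω,
        ind (u ≠ u') * av (Gr s ⊤ ν) (fun v => bt A B Φ ν' b u v + bt A B Φ ν' b u' v)) ≤
      2 * pp A B Φ ω ν ν' b w := by
    rw [← hκ ν (by omega) (by omega) (fun u u' v => bt A B Φ ν' b u v + bt A B Φ ν' b u' v)]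
    have : 2 * pp A B Φ ω ν ν' b w = av (Gr w ⊤ ν) (fun v => 2 * av (Gr w v ω) (fun u => bt A B Φ ν' b u v)) := by
      rw [av_mul, swap_Gr ω ν (fun u v => bt A B Φ ν' b u v)]; rfl
    rw [this]
    refine av_mono fun v hv => ?_
    rw [mem_Gr] at hv
    have hne : (Gr w v ω).Nonempty := Gr_nonempty hv.1 (by omega) (by omega)
    have : 2 * av (Gr w v ω) (fun u => bt A B Φ ν' b u v) = av (Gr w v ω) (fun u => av (Gr w v ω) (fun u' =>
        bt A B Φ ν' b u v + bt A B Φ ν' b u' v)) := by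
      exact (av_pair_add hne (fun u => bt A B Φ ν' b u v)).symm
    rw [this]
    refine av_mono fun u _ => av_mono fun u' _ => ?_
    have := ind_le_one (u ≠ u')
    nlinarith [hBt u u' v]
  have k1 := κle b ν (by omega) hbn (by omega) (by omega)
  have k2 := κpos b (by omega) hbn
  set Q := av (Gr w ⊤ (ω+1)) (fun s => ∑ u ∈ Gr w s ω, ∑ u' ∈ Gr w s ω,
        ind (u ≠ u') * av (Gr s ⊤ ν) (fun v => bt A B Φ ν' b u v + bt A B Φ ν' b u' v)) with hQ
  have hQ0 : 0 ≤ Q := av_nonneg fun s _ => Finset.sum_nonneg fun u _ => Finset.sum_nonneg fun u' _ =>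
    mul_nonneg (ind_nonneg _) (av_nonneg fun v _ => hBt _ _ _)
  calc _ ≤ κ b * (4 * Q) := mul_le_mul_of_nonneg_left e2 k2.le
    _ ≤ (2 * κ ν) * (4 * Q) := mul_le_mul_of_nonneg_right k1 (by linarith)
    _ ≤ _ := by nlinarith

theorem pp_alt {ω ν ν' b : ℕ} (w : Sb F n) :
    av (Gr w ⊤ ν') (fun v' => av (Gr w v' ν) (fun v => av (Gr w v ω) (fun u => av (Gr v' ⊤ b) (fun x =>
      bd A B Φ u v v' x)))) = pp A B Φ ω ν ν' b w := by
  rw [swap_Gr ν ν' (fun v v' => av (Gr w v ω) (fun u => av (Gr v' ⊤ b) (fun x => bd A B Φ u v v' x)))]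
  rw [pp, ← swap_Gr ω ν (fun u v => bt A B Φ ν' b u v)]
  refine av_congr fun v _ => ?_
  rw [av_comm]; rfl

theorem lower (hq : (4:ℝ) ≤ Fintype.card F) {ω ν ν' b : ℕ} (hων : ω < ν) (hν : ν ≤ ν') (hb : ν' < b)
    (hbn : b ≤ n) (w : Sb F n) (hw : ω = dm w + 1) :
    ∃ (γ H : Sb F n → Γ),
      av (Gr w ⊤ b) (fun x => av (Gr w x ω) (fun u => ind (γ u * Φ u x ≠ H x))) ≤
        144 * pp A B Φ ω ν ν' b w := by
  obtain ⟨γ, hγ⟩ := lower_alpha A B Φ hq hων hν hb hbn w hw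
  set p := pp A B Φ ω ν ν' b w with hp
  set W : Sb F n → Sb F n → Sb F n → Sb F n → ℝ := fun u0 u u' x =>
    ind (γ u0 u * Φ u x ≠ γ u0 u' * Φ u' x) with hW
  set Z : Sb F n → Sb F n → ℝ := fun u0 v' => av (Gr w v' ν) (fun v => av (Gr v' ⊤ b) (fun x =>
    av (Gr w v ω) (fun u => av (Gr w v ω) (fun u' => W u0 u u' x)))) with hZ
  have hZ0 : ∀ u0 v', 0 ≤ Z u0 v' := fun u0 v' => av_nonneg fun _ _ => av_nonneg fun _ _ =>
    av_nonneg fun _ _ => av_nonneg fun _ _ => ind_nonneg _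
  set α : Sb F n → Sb F n → Sb F n → ℝ := fun u0 u x => ind (Φ u0 x ≠ γ u0 u * Φ u x) with hα
  have hpt : ∀ v' ∈ Gr w ⊤ ν', ∀ xs ∈ Gr v' ⊤ b, ∀ u0 ∈ Gr w xs ω, Z u0 v' ≤
      2 * av (Gr w v' ω) (fun u => α u0 u xs) +
      2 * av (Gr w v' ν) (fun v => av (Gr w v ω) (fun u => bd A B Φ u v v' xs)) +
      2 * av (Gr w v' ν) (fun v => av (Gr w v ω) (fun u => av (Gr v' ⊤ b) (fun x => bd A B Φ u v v' x))) := by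
    intro v' hv' xs hxs u0 hu0
    rw [mem_Gr] at hv' hxs
    rw [← Gr_tower (i := ω) (j := ν) (w := w) (v := v') hων.le (by omega), ← mul_add, ← av_add, ← mul_add,
      ← av_add, ← av_mul]
    refine av_mono fun v hv => ?_
    rw [mem_Gr] at hv
    rw [← av_add, ← av_add, ← av_pair_add (Gr_nonempty hv.1 (by omega) (by omega))]
    rw [av_comm]
    refine av_mono fun u _ => ?_
    rw [av_comm]
    refine av_mono fun u' _ => ?_
    have hne : (Gr v' ⊤ b).Nonempty := Gr_nonempty le_top (by omega) (by rw [dm_top]; omega)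
    have : α u0 u xs + bd A B Φ u v v' xs + av (Gr v' ⊤ b) (fun x => bd A B Φ u v v' x) +
        (α u0 u' xs + bd A B Φ u' v v' xs + av (Gr v' ⊤ b) (fun x => bd A B Φ u' v v' x)) =
        av (Gr v' ⊤ b) (fun x => (α u0 u xs + bd A B Φ u v v' xs + (α u0 u' xs + bd A B Φ u' v v' xs)) +
          (bd A B Φ u v v' x + bd A B Φ u' v v' x)) := by
      rw [av_add _ (fun _ => α u0 u xs + bd A B Φ u v v' xs + (α u0 u' xs + bd A B Φ u' v v' xs)), av_const hne, av_add]; ring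
    rw [this]
    refine av_mono fun x _ => ?_
    by_cases h1 : Φ u0 xs ≠ γ u0 u * Φ u xs
    · have : α u0 u xs = 1 := ind_true h1
      have := bd_nonneg A B Φ u v v' xs; have := bd_nonneg A B Φ u' v v' xs
      have := bd_nonneg A B Φ u v v' x; have := bd_nonneg A B Φ u' v v' x
      have : 0 ≤ α u0 u' xs := ind_nonneg _
      have : W u0 u u' x ≤ 1 := ind_le_one _
      linarith
    by_cases h2 : Φ u0 xs ≠ γ u0 u' * Φ u' xs
    · have : α u0 u' xs = 1 := ind_true h2
      have := bd_nonneg A B Φ u v v' xs; have := bd_nonneg A B Φ u' v v' xs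
      have := bd_nonneg A B Φ u v v' x; have := bd_nonneg A B Φ u' v v' x
      have : 0 ≤ α u0 u xs := ind_nonneg _
      have : W u0 u u' x ≤ 1 := ind_le_one _
      linarith
    have a1 : 0 ≤ α u0 u xs := ind_nonneg _
    have a2 : 0 ≤ α u0 u' xs := ind_nonneg _
    have a3 : W u0 u u' x ≤ 1 := ind_le_one _
    have b1 := bd_nonneg A B Φ u v v' xs; have b2 := bd_nonneg A B Φ u' v v' xs
    have b3 := bd_nonneg A B Φ u v v' x; have b4 := bd_nonneg A B Φ u' v v' x
    by_cases h3 : A u v v' * B v v' xs ≠ Φ u xs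
    · have : bd A B Φ u v v' xs = 1 := ind_true h3
      linarith
    by_cases h4 : A u' v v' * B v v' xs ≠ Φ u' xs
    · have : bd A B Φ u' v v' xs = 1 := ind_true h4
      linarith
    by_cases h5 : A u v v' * B v v' x ≠ Φ u x
    · have : bd A B Φ u v v' x = 1 := ind_true h5
      linarith
    by_cases h6 : A u' v v' * B v v' x ≠ Φ u' x
    · have : bd A B Φ u' v v' x = 1 := ind_true h6
      linarith
    have : W u0 u u' x = 0 := by
      apply ind_false
      rw [not_not] at h1 h2 h3 h4 h5 h6 ⊢
      rw [h1, ← h3, ← h4, ← mul_assoc, ← mul_assoc] at h2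
      have := mul_right_cancel h2
      rw [← h5, ← h6, ← mul_assoc, ← mul_assoc, this]
    linarith
  have h36 : av (Gr w ⊤ ν') (fun v' => av (Gr v' ⊤ b) (fun xs => av (Gr w xs ω) (fun u0 => Z u0 v'))) ≤ 36 * p := by
    have e1 : av (Gr w ⊤ ν') (fun v' => av (Gr v' ⊤ b) (fun xs => av (Gr w xs ω) (fun u0 => Z u0 v'))) ≤
      av (Gr w ⊤ ν') (fun v' => av (Gr v' ⊤ b) (fun xs => 
        2 * av (Gr w xs ω) (fun u0 => av (Gr w v' ω) (fun u => α u0 u xs)) +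
      2 * av (Gr w v' ν) (fun v => av (Gr w v ω) (fun u => bd A B Φ u v v' xs)) +
      2 * av (Gr w v' ν) (fun v => av (Gr w v ω) (fun u => av (Gr v' ⊤ b) (fun x => bd A B Φ u v v' x))))) := by
      refine av_mono fun v' hv' => av_mono fun xs hxs => ?_
      refine (av_mono (hpt v' hv' xs hxs)).trans (le_of_eq ?_)
      rw [mem_Gr] at hv' hxs
      have hne : (Gr w xs ω).Nonempty := Gr_nonempty (hv'.1.trans hxs.1) (by omega) (by omega)
      rw [av_add, av_add, av_const hne, av_const hne, av_mul]
    refine e1.trans ?_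
    have e2 : ∀ v' ∈ Gr w ⊤ ν', av (Gr v' ⊤ b) (fun xs => 
        2 * av (Gr w xs ω) (fun u0 => av (Gr w v' ω) (fun u => α u0 u xs)) +
      2 * av (Gr w v' ν) (fun v => av (Gr w v ω) (fun u => bd A B Φ u v v' xs)) +
      2 * av (Gr w v' ν) (fun v => av (Gr w v ω) (fun u => av (Gr v' ⊤ b) (fun x => bd A B Φ u v v' x)))) = 
      2 * av (Gr v' ⊤ b) (fun xs => av (Gr w xs ω) (fun u0 => av (Gr w v' ω) (fun u => α u0 u xs))) +
      4 * av (Gr w v' ν) (fun v => av (Gr w v ω) (fun u => av (Gr v' ⊤ b) (fun x => bd A B Φ u v v' x))) := by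
      intro v' hv'
      rw [mem_Gr] at hv'
      have hne : (Gr v' ⊤ b).Nonempty := Gr_nonempty le_top (by omega) (by rw [dm_top]; omega)
      rw [av_add, av_add, av_const hne, av_mul, av_mul]
      have : av (Gr v' ⊤ b) (fun xs => av (Gr w v' ν) (fun v => av (Gr w v ω) (fun u => bd A B Φ u v v' xs))) =
        av (Gr w v' ν) (fun v => av (Gr w v ω) (fun u => av (Gr v' ⊤ b) (fun x => bd A B Φ u v v' x))) := by
        rw [av_comm]
        refine av_congr fun v _ => ?_
        rw [av_comm]
      rw [this]; ring
    rw [av_congr e2, av_add, av_mul, av_mul, pp_alt, ← hp]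
    rw [← swap_Gr ν' b (fun v' xs => av (Gr w xs ω) (fun u0 => av (Gr w v' ω) (fun u => α u0 u xs)))]
    have e3 : ∀ xs ∈ Gr w ⊤ b, av (Gr w xs ν') (fun v' => av (Gr w xs ω) (fun u0 => av (Gr w v' ω) (fun u => α u0 u xs))) =
        av (Gr w xs ω) (fun u0 => av (Gr w xs ω) (fun u => α u0 u xs)) := by
      intro xs hxs
      rw [mem_Gr] at hxs
      rw [av_comm]
      refine av_congr fun u0 _ => ?_
      exact Gr_tower (by omega) (by omega) _
    rw [av_congr e3]
    linarith
  have h72 : av (Gr w ⊤ ω) (fun u0 => av (Gr w ⊤ ν') (fun v' => Z u0 v')) ≤ 72 * p := by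
    rw [av_comm]
    have : av (Gr w ⊤ ν') (fun v' => av (Gr w ⊤ ω) (fun u0 => Z u0 v')) ≤
        2 * av (Gr w ⊤ ν') (fun v' => av (Gr v' ⊤ b) (fun xs => av (Gr w xs ω) (fun u0 => Z u0 v'))) := by
      rw [← av_mul]
      refine av_mono fun v' hv' => ?_
      rw [mem_Gr] at hv'
      have := atom_compare hq hv'.1 (by omega) (b := b) (by omega) hbn (fun u0 => Z u0 v') (fun u0 => hZ0 u0 v')
      rwa [← hw] at this
    linarith
  obtain ⟨u0, hu0, hle⟩ := exists_le_av (Gr_nonempty (le_top : w ≤ ⊤) (i := ω) (by omega) (by rw [dm_top]; omega))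
    (fun u0 => av (Gr w ⊤ ν') (fun v' => Z u0 v'))
  have hle2 := hle.trans h72
  have e4 : av (Gr w ⊤ ν') (fun v' => Z u0 v') = av (Gr w ⊤ b) (fun x => av (Gr w x ν) (fun v =>
      av (Gr w v ω) (fun u => av (Gr w v ω) (fun u' => W u0 u u' x)))) := by
    have : ∀ v' ∈ Gr w ⊤ ν', Z u0 v' = av (Gr v' ⊤ b) (fun x => av (Gr w v' ν) (fun v =>
      av (Gr w v ω) (fun u => av (Gr w v ω) (fun u' => W u0 u u' x)))) := by
      intro v' _; simp only [hZ]; rw [av_comm]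
    rw [av_congr this, ← swap_Gr ν' b (fun v' x => av (Gr w v' ν) (fun v =>
      av (Gr w v ω) (fun u => av (Gr w v ω) (fun u' => W u0 u u' x))))]
    refine av_congr fun x hx => ?_
    rw [mem_Gr] at hx
    exact Gr_tower hν (by omega) _
  rw [e4] at hle2
  have hH : ∀ x, ∃ c : Γ, x ∈ Gr w ⊤ b → av (Gr w x ω) (fun u => ind (γ u0 u * Φ u x ≠ c)) ≤
      2 * av (Gr w x ν) (fun v => av (Gr w v ω) (fun u => av (Gr w v ω) (fun u' => W u0 u u' x))) := by
    intro x
    by_cases hx : x ∈ Gr w ⊤ b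
    · have hx' := mem_Gr.1 hx
      obtain ⟨c, hc⟩ := coll_down hq hx'.1 (i := ω) (j := ν) (by omega) hων (by omega) (fun u => γ u0 u * Φ u x)
      exact ⟨c, fun _ => hc⟩
    · exact ⟨1, fun h => absurd h hx⟩
  choose H hH using hH
  refine ⟨γ u0, H, (av_mono hH).trans ?_⟩
  rw [av_mul]; linarith
end cocycle


/-- choose the best option -/
theorem exists_best {α Γ : Type*} [Inhabited Γ] (s : Finset α) (c : α → Γ) (f : Γ → ℝ) :
    ∃ g : Γ, s.Nonempty → f g ≤ av s (fun a => f (c a)) := by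
  by_cases hs : s.Nonempty
  · obtain ⟨a, _, h⟩ := exists_le_av hs (fun a => f (c a))
    exact ⟨c a, fun _ => h⟩
  · exact ⟨default, fun h => absurd h hs⟩

section cocycle
variable {F : Type} [Field F] [Fintype F] {n : ℕ} {Γ : Type*} [Group Γ]

def Cf : ℕ → ℝ
  | 0 => 0
  | (j+1) => 144 + 145 * Cf j

theorem Cf_nonneg : ∀ j, 0 ≤ Cf j
  | 0 => le_rfl
  | (j+1) => by have := Cf_nonneg j; simp only [Cf]; linarith

/-- error of a frame -/
noncomputable def fe (Φ : Sb F n → Sb F n → Γ) (ω b : ℕ) (w : Sb F n) (γ H : Sb F n → Γ) : ℝ :=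
  av (Gr w ⊤ b) (fun x => av (Gr w x ω) (fun u => ind (γ u * Φ u x ≠ H x)))

theorem fe_nonneg (Φ : Sb F n → Sb F n → Γ) (ω b : ℕ) (w : Sb F n) (γ H : Sb F n → Γ) :
    0 ≤ fe Φ ω b w γ H := av_nonneg fun _ _ => av_nonneg fun _ _ => ind_nonneg _

theorem pp_tower (A B : Sb F n → Sb F n → Sb F n → Γ) (Φ : Sb F n → Sb F n → Γ) {ω' ω ν ν' b : ℕ} {w : Sb F n}
    (h1 : ω' ≤ ω) (h2 : dm w ≤ ω') :
    av (Gr w ⊤ ω') (fun z => pp A B Φ ω ν ν' b z) = pp A B Φ ω ν ν' b w :=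
  Gr_tower' h1 h2 _

theorem chain_tower {ω ν ν' b : ℕ} {z : Sb F n} (h1 : ω ≤ ν) (h2 : ν ≤ ν') (h3 : ν' ≤ b) (hz : dm z ≤ ω)
    (g : Sb F n → Sb F n → ℝ) :
    av (Gr z ⊤ ν) (fun v => av (Gr v ⊤ ν') (fun v' => av (Gr v' ⊤ b) (fun x => av (Gr z v ω) (fun u => g u x)))) =
    av (Gr z ⊤ b) (fun x => av (Gr z x ω) (fun u => g u x)) := by
  have e : ∀ v ∈ Gr z ⊤ ν, av (Gr v ⊤ ν') (fun v' => av (Gr v' ⊤ b) (fun x => av (Gr z v ω) (fun u => g u x))) =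
      av (Gr z v ω) (fun u => av (Gr v ⊤ b) (fun x => g u x)) := by
    intro v hv
    rw [mem_Gr] at hv
    rw [Gr_tower' h3 (by omega), av_comm]
  rw [av_congr e, swap_Gr ω ν (fun u v => av (Gr v ⊤ b) (fun x => g u x))]
  rw [swap_Gr ω b (fun u x => g u x)]
  refine av_congr fun u hu => ?_
  rw [mem_Gr] at hu
  exact Gr_tower' (by omega) (by omega) _

variable (B : Sb F n → Sb F n → Sb F n → Γ)

/-- lowering the structure by one dimension -/
theorem lower_struct (hq : (4:ℝ) ≤ Fintype.card F) {ω ν ν' b : ℕ} (hων : ω + 1 < ν) (hν : ν ≤ ν') (hb : ν' < b)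
    (hbn : b ≤ n) (A : Sb F n → Sb F n → Sb F n → Γ) (Φ : Sb F n → Sb F n → Γ) :
    ∃ (A1 : Sb F n → Sb F n → Sb F n → Γ) (γ H : Sb F n → Sb F n → Γ),
      (∀ z, dm z = ω → fe Φ (ω+1) b z (γ z) (H z) ≤ 144 * pp A B Φ (ω+1) ν ν' b z) ∧
      ∀ y, dm y ≤ ω → pp A1 B H ω ν ν' b y ≤ 145 * pp A B Φ (ω+1) ν ν' b y := by
  have hex : ∀ z : Sb F n, ∃ γH : (Sb F n → Γ) × (Sb F n → Γ), dm z = ω →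
      fe Φ (ω+1) b z γH.1 γH.2 ≤ 144 * pp A B Φ (ω+1) ν ν' b z := by
    intro z
    by_cases hz : dm z = ω
    · obtain ⟨γ, H, h⟩ := lower A B Φ hq hων hν hb hbn z (by omega)
      exact ⟨(γ, H), fun _ => h⟩
    · exact ⟨(fun _ => 1, fun _ => 1), fun h => absurd h hz⟩
  choose γH hγH using hex
  have : Inhabited Γ := ⟨1⟩
  choose A1 hA1 using fun z v v' : Sb F n => exists_best (Gr z v (ω+1)) (fun u => (γH z).1 u * A u v v')
    (fun c : Γ => av (Gr v' ⊤ b) (fun x => ind (c * B v v' x ≠ (γH z).2 x)))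
  refine ⟨A1, fun z => (γH z).1, fun z => (γH z).2, hγH, ?_⟩
  intro y hy
  have hz1 : ∀ z ∈ Gr y ⊤ ω, av (Gr z ⊤ ν) (fun v => bt A1 B (fun z => (γH z).2) ν' b z v) ≤
      145 * pp A B Φ (ω+1) ν ν' b z := by
    intro z hz
    rw [mem_Gr] at hz
    have h1 : av (Gr z ⊤ ν) (fun v => bt A1 B (fun z => (γH z).2) ν' b z v) ≤
        av (Gr z ⊤ ν) (fun v => av (Gr v ⊤ ν') (fun v' => av (Gr v' ⊤ b) (fun x => av (Gr z v (ω+1)) (fun u =>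
          ind ((γH z).1 u * Φ u x ≠ (γH z).2 x))) +
          av (Gr z v (ω+1)) (fun u => av (Gr v' ⊤ b) (fun x => bd A B Φ u v v' x)))) := by
      refine av_mono fun v hv => av_mono fun v' hv' => ?_
      rw [mem_Gr] at hv hv'
      refine (hA1 z v v' (Gr_nonempty hv.1 (by omega) (by omega))).trans ?_
      rw [av_comm (Gr v' ⊤ b), ← av_add]
      refine av_mono fun u _ => ?_
      rw [← av_add]
      refine av_mono fun x _ => ?_
      refine ind_or fun h => ?_
      by_contra hcon
      push Not at hcon
      apply h
      rw [mul_assoc, hcon.2, hcon.1]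
    refine h1.trans ?_
    have e : ∀ v ∈ Gr z ⊤ ν, av (Gr v ⊤ ν') (fun v' => av (Gr v' ⊤ b) (fun x => av (Gr z v (ω+1)) (fun u =>
          ind ((γH z).1 u * Φ u x ≠ (γH z).2 x))) +
          av (Gr z v (ω+1)) (fun u => av (Gr v' ⊤ b) (fun x => bd A B Φ u v v' x))) =
        av (Gr v ⊤ ν') (fun v' => av (Gr v' ⊤ b) (fun x => av (Gr z v (ω+1)) (fun u =>
          ind ((γH z).1 u * Φ u x ≠ (γH z).2 x)))) + av (Gr z v (ω+1)) (fun u => bt A B Φ ν' b u v) := by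
      intro v _
      rw [av_add]; congr 1
      rw [av_comm]; rfl
    rw [av_congr e, av_add, chain_tower (by omega) hν hb.le (by omega) (fun u x => ind ((γH z).1 u * Φ u x ≠ (γH z).2 x)),
      swap_Gr (ω+1) ν (fun u v => bt A B Φ ν' b u v)]
    have h2 := hγH z hz.2.2
    have h3 : av (Gr z ⊤ (ω+1)) (fun u => av (Gr u ⊤ ν) (fun v => bt A B Φ ν' b u v)) = pp A B Φ (ω+1) ν ν' b z := rfl
    rw [h3]
    unfold fe at h2
    linarith
  calc pp A1 B (fun z => (γH z).2) ω ν ν' b y ≤ av (Gr y ⊤ ω) (fun z => 145 * pp A B Φ (ω+1) ν ν' b z) := av_mono hz1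
    _ = _ := by rw [av_mul, pp_tower A B Φ (by omega) hy]

theorem frame (hq : (4:ℝ) ≤ Fintype.card F) {ν ν' b : ℕ} (hν : ν ≤ ν') (hb : ν' < b) (hbn : b ≤ n) :
    ∀ (j : ℕ) (ω : ℕ) (hων : ω < ν) (A : Sb F n → Sb F n → Sb F n → Γ) (Φ : Sb F n → Sb F n → Γ) (w : Sb F n),
      dm w + j = ω → ∃ γ H : Sb F n → Γ, fe Φ ω b w γ H ≤ Cf j * pp A B Φ ω ν ν' b w := by
  intro j
  induction j with
  | zero =>
    intro ω hων A Φ w hw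
    refine ⟨fun _ => 1, fun x => Φ w x, ?_⟩
    simp only [Cf, zero_mul]
    refine av_le_const' le_rfl fun x hx => av_le_const' le_rfl fun u hu => ?_
    rw [mem_Gr] at hu
    have : w = u := eq_of_le_dm hu.1 (by omega)
    rw [ind_false]; rw [not_not, ← this, one_mul]
  | succ j ih =>
    intro ω hων A Φ w hw
    obtain ⟨ω, rfl⟩ : ∃ ω', ω = ω' + 1 := ⟨ω - 1, by omega⟩
    obtain ⟨A1, γ, H, h1, h2⟩ := lower_struct B hq hων hν hb hbn A Φ
    obtain ⟨γ1, H1, h3⟩ := ih ω (by omega) A1 H w (by omega)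
    have : Inhabited Γ := ⟨1⟩
    choose g hg using fun u : Sb F n => exists_best (Gr w u ω) (fun z => γ1 z * γ z u)
      (fun c : Γ => av (Gr u ⊤ b) (fun x => ind (c * Φ u x ≠ H1 x)))
    refine ⟨g, H1, ?_⟩
    unfold fe
    rw [swap_Gr (ω+1) b (fun u x => ind (g u * Φ u x ≠ H1 x))]
    have e1 : av (Gr w ⊤ (ω+1)) (fun u => av (Gr u ⊤ b) (fun x => ind (g u * Φ u x ≠ H1 x))) ≤
        av (Gr w ⊤ (ω+1)) (fun u => av (Gr w u ω) (fun z => av (Gr u ⊤ b) (fun x => ind (γ z u * Φ u x ≠ H z x)))) +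
        av (Gr w ⊤ (ω+1)) (fun u => av (Gr u ⊤ b) (fun x => av (Gr w u ω) (fun z => ind (γ1 z * H z x ≠ H1 x)))) := by
      rw [← av_add]
      refine av_mono fun u hu => ?_
      rw [mem_Gr] at hu
      refine (hg u (Gr_nonempty hu.1 (by omega) (by omega))).trans ?_
      rw [av_comm (Gr u ⊤ b), ← av_add]
      refine av_mono fun z _ => ?_
      rw [← av_add]
      refine av_mono fun x _ => ?_
      refine ind_or fun h => ?_
      by_contra hcon
      push Not at hcon
      apply h
      rw [mul_assoc, hcon.1, hcon.2]
    refine e1.trans ?_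
    have e2 : av (Gr w ⊤ (ω+1)) (fun u => av (Gr w u ω) (fun z => av (Gr u ⊤ b) (fun x => ind (γ z u * Φ u x ≠ H z x)))) ≤
        144 * pp A B Φ (ω+1) ν ν' b w := by
      rw [swap_Gr ω (ω+1) (fun z u => av (Gr u ⊤ b) (fun x => ind (γ z u * Φ u x ≠ H z x)))]
      rw [← pp_tower A B Φ (ω' := ω) (by omega) (by omega), ← av_mul]
      refine av_mono fun z hz => ?_
      rw [mem_Gr] at hz
      rw [← swap_Gr (ω+1) b (fun u x => ind (γ z u * Φ u x ≠ H z x))]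
      exact h1 z hz.2.2
    have e3 : av (Gr w ⊤ (ω+1)) (fun u => av (Gr u ⊤ b) (fun x => av (Gr w u ω) (fun z => ind (γ1 z * H z x ≠ H1 x)))) ≤
        Cf j * (145 * pp A B Φ (ω+1) ν ν' b w) := by
      rw [← swap_Gr (ω+1) b (fun u x => av (Gr w u ω) (fun z => ind (γ1 z * H z x ≠ H1 x)))]
      refine le_trans (le_of_eq ?_) (h3.trans (mul_le_mul_of_nonneg_left (h2 w (by omega)) (Cf_nonneg j)))
      refine av_congr fun x hx => ?_
      rw [mem_Gr] at hx
      exact Gr_tower (by omega) (by omega) _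
    simp only [Cf]
    linarith
end cocycle


section cocycle
variable {F : Type} [Field F] [Fintype F] {n : ℕ} {Γ : Type*} [Group Γ]

theorem Cf_mono {i j : ℕ} (h : i ≤ j) : Cf i ≤ Cf j := by
  have hs : ∀ j, Cf j ≤ Cf (j+1) := by
    intro j; have := Cf_nonneg j; simp only [Cf]; linarith
  exact monotone_nat_of_le_succ hs h

theorem Cf_three : Cf 3 = 3048624 := by simp [Cf]; norm_num

theorem Gr_self {u v : Sb F n} (h : u ≤ v) : Gr u v (dm u) = {u} := by
  ext x; rw [mem_Gr, mem_singleton]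
  constructor
  · rintro ⟨h1, _, h3⟩; exact (eq_of_le_dm h1 h3.le).symm
  · rintro rfl; exact ⟨le_rfl, h, rfl⟩

theorem av_singleton {α : Type*} (a : α) (f : α → ℝ) : av {a} f = f a := by simp [av]

theorem bt_self (A B : Sb F n → Sb F n → Sb F n → Γ) (Φ : Sb F n → Sb F n → Γ) {ω b : ℕ} {w u : Sb F n}
    (hu : dm u = ω) :
    bt A B Φ ω b w u = av (Gr u ⊤ b) (fun x => ind (A w u u * B u u x ≠ Φ w x)) := by
  subst hu
  rw [bt, Gr_self le_top, av_singleton]; rfl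

theorem main_cocycle (hq : (10:ℝ)^21 ≤ Fintype.card F) : ∀ (ω ν ν' b : ℕ) (hων : ω < ν) (hν : ν ≤ ν')
    (hb : ν' < b) (hbn : b ≤ n) (A B : Sb F n → Sb F n → Sb F n → Γ) (Φ : Sb F n → Sb F n → Γ),
    ∃ h h' : Sb F n → Γ, fe Φ ω b ⊥ h h' ≤ (200 * Cf 3) * pp A B Φ ω ν ν' b ⊥ := by
  have hq4 : (4:ℝ) ≤ Fintype.card F := le_trans (by norm_num) hq
  intro ω
  induction ω using Nat.strong_induction_on with
  | _ ω ih =>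
  intro ν ν' b hων hν hb hbn A B Φ
  set p := pp A B Φ ω ν ν' b ⊥ with hp
  have hp0 : 0 ≤ p := pp_nonneg _ _ _ _ _ _ _ _
  set C := Cf 3 with hC
  have hCv : C = 3048624 := Cf_three
  by_cases hω : ω ≤ 3
  · obtain ⟨γ, H, h⟩ := frame B hq4 hν hb hbn ω ω hων A Φ ⊥ (by rw [dm_bot]; omega)
    refine ⟨γ, H, h.trans ?_⟩
    have : Cf ω ≤ C := Cf_mono hω
    rw [← hp]
    nlinarith [Cf_nonneg ω]
  by_cases hKp : 1 ≤ (200 * C) * p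
  · refine ⟨fun _ => 1, fun _ => 1, le_trans ?_ hKp⟩
    exact av_le_const' zero_le_one fun _ _ => av_le_const' zero_le_one fun _ _ => ind_le_one _
  push Not at hω hKp
  obtain ⟨o, rfl⟩ : ∃ o, ω = o + 3 := ⟨ω - 3, by omega⟩
  -- frames
  have hfr : ∀ w : Sb F n, ∃ γH : (Sb F n → Γ) × (Sb F n → Γ), o ≤ dm w → dm w ≤ o + 3 →
      fe Φ (o+3) b w γH.1 γH.2 ≤ C * pp A B Φ (o+3) ν ν' b w := by
    intro w
    by_cases h : o ≤ dm w ∧ dm w ≤ o + 3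
    · obtain ⟨γ, H, h'⟩ := frame B hq4 hν hb hbn (o + 3 - dm w) (o+3) hων A Φ w (by omega)
      refine ⟨(γ, H), fun _ _ => h'.trans ?_⟩
      exact mul_le_mul_of_nonneg_right (Cf_mono (by omega)) (pp_nonneg _ _ _ _ _ _ _ _)
    · exact ⟨(fun _ => 1, fun _ => 1), fun h1 h2 => absurd ⟨h1, h2⟩ h⟩
  choose γH hγH using hfr
  set γ : Sb F n → Sb F n → Γ := fun w => (γH w).1 with hγ
  set H : Sb F n → Sb F n → Γ := fun w => (γH w).2 with hH
  set e : Sb F n → ℝ := fun w => fe Φ (o+3) b w (γ w) (H w) with he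
  have he0 : ∀ w, 0 ≤ e w := fun w => fe_nonneg _ _ _ _ _ _
  have hepp : ∀ w, o ≤ dm w → dm w ≤ o + 3 → e w ≤ C * pp A B Φ (o+3) ν ν' b w := hγH
  set A' : Sb F n → Sb F n → Sb F n → Γ := fun w u _ => γ w u with hA'
  set B' : Sb F n → Sb F n → Sb F n → Γ := fun u _ x => Φ u x with hB'
  set ew : Sb F n → Sb F n → ℝ := fun w w' => av (Gr w' ⊤ (o+3)) (fun u => bt A' B' H (o+3) b w u) with hew
  have ew0 : ∀ w w', 0 ≤ ew w w' := fun _ _ => av_nonneg fun _ _ => bt_nonneg _ _ _ _ _ _ _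
  have ew_self : ∀ w, ew w w = e w := by
    intro w
    simp only [hew, he, fe]
    rw [swap_Gr (o+3) b (fun u x => ind (γ w u * Φ u x ≠ H w x))]
    refine av_congr fun u hu => ?_
    rw [mem_Gr] at hu
    rw [bt_self A' B' H hu.2.2]
  have ew_tower : ∀ w m, dm w ≤ m → m ≤ o + 3 → av (Gr w ⊤ m) (fun w' => ew w w') = e w := by
    intro w m h1 h2
    rw [← ew_self w]
    exact Gr_tower' h2 h1 _
  have he_av : ∀ m, o ≤ m → m ≤ o + 3 → av (Gr ⊥ ⊤ m) e ≤ C * p := by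
    intro m h1 h2
    rw [hp, ← pp_tower A B Φ (ω' := m) h2 (by rw [dm_bot]; omega), ← av_mul]
    refine av_mono fun w hw => ?_
    rw [mem_Gr] at hw
    exact hepp w (by omega) (by omega)
  -- L
  have hLex : ∀ w w' : Sb F n, ∃ c : Γ, dm w' ≤ o + 3 →
      av (Gr w' ⊤ b) (fun x => ind (H w x ≠ c * H w' x)) ≤ 4 * (ew w w' + e w') := by
    intro w w'
    by_cases h : dm w' ≤ o + 3
    · obtain ⟨c, hc⟩ := gam_exists A' B' H hq4 (ν := o+3) (ν' := o+3) le_rfl (by omega) hbn w' w w' h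
      refine ⟨c, fun _ => hc.trans (le_of_eq ?_)⟩
      rw [av_add, ← ew_self w']
    · exact ⟨1, fun h' => absurd h' h⟩
  choose L hL using hLex
  set η : Sb F n → Sb F n → ℝ := fun w w' => av (Gr w' ⊤ b) (fun x => ind (H w x ≠ L w w' * H w' x)) with hη
  have hη0 : ∀ w w', 0 ≤ η w w' := fun _ _ => av_nonneg fun _ _ => ind_nonneg _
  -- averages
  have hbot : ∀ m : ℕ, dm (⊥ : Sb F n) ≤ m := fun m => by rw [dm_bot]; omega
  have hη_av : ∀ i j, o ≤ i → i ≤ j → j ≤ o + 3 → av (Gr ⊥ ⊤ i) (fun w => av (Gr w ⊤ j) (fun w' => η w w')) ≤ 8 * C * p := by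
    intro i j h1 h2 h3
    have : av (Gr ⊥ ⊤ i) (fun w => av (Gr w ⊤ j) (fun w' => η w w')) ≤
        av (Gr ⊥ ⊤ i) (fun w => av (Gr w ⊤ j) (fun w' => 4 * (ew w w' + e w'))) := by
      refine av_mono fun w hw => av_mono fun w' hw' => ?_
      rw [mem_Gr] at hw'
      exact hL w w' (by omega)
    refine this.trans ?_
    have : ∀ w ∈ Gr (⊥ : Sb F n) ⊤ i, av (Gr w ⊤ j) (fun w' => 4 * (ew w w' + e w')) = 4 * (e w + av (Gr w ⊤ j) e) := by
      intro w hw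
      rw [mem_Gr] at hw
      rw [av_mul, av_add, ew_tower w j (by omega) h3]
    rw [av_congr this, av_mul, av_add, Gr_tower' h2 (hbot _)]
    have := he_av i h1 (by omega); have := he_av j (by omega) h3
    linarith
  set lam : ℝ := 2 / Fintype.card F with hlam
  have hlam0 : 0 ≤ lam := by positivity
  have hS : ∀ m c, o ≤ m → m < o + 3 → 1/96 ≤ c → av (Gr ⊥ ⊤ m) (fun w => ind (c ≤ e w)) ≤ 36864 * lam * C^2 * p := by
    intro m c h1 h2 hc
    have h3 : av (Gr ⊥ ⊤ m) (fun w => ind (c ≤ e w)) ≤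
        av (Gr ⊥ ⊤ m) (fun w => ind (1/96/C ≤ pp A B Φ (o+3) ν ν' b w)) := by
      refine av_mono fun w hw => ind_mono fun h => ?_
      rw [mem_Gr] at hw
      have := hepp w (by omega) (by omega)
      rw [div_le_iff₀ (by rw [hCv]; norm_num)]
      linarith
    refine h3.trans ?_
    have h4 := sampling hq4 (le_top : (⊥ : Sb F n) ≤ ⊤) (hbot m) h2 (by rw [dm_top]; omega)
      (fun u => av (Gr u ⊤ ν) (fun v => bt A B Φ ν' b u v))
      (fun u => av_nonneg fun _ _ => bt_nonneg _ _ _ _ _ _ _)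
      (fun u => av_le_const' zero_le_one fun _ _ => bt_le_one _ _ _ _ _ _ _) (c := 1/96/C)
      (by rw [hCv]; norm_num)
    refine h4.trans ?_
    have : av (Gr ⊥ ⊤ (o+3)) (fun u => av (Gr u ⊤ ν) (fun v => bt A B Φ ν' b u v)) = p := rfl
    rw [this, ind_false, add_zero]
    · refine le_of_eq ?_
      have : C ≠ 0 := by rw [hCv]; norm_num
      rw [← hlam]; field_simp
      ring
    · rw [not_le]
      rw [hCv] at hKp ⊢
      norm_num at hKp ⊢
      linarith
  have hX : ∀ i j, o ≤ i → i ≤ j → j < o + 3 → av (Gr ⊥ ⊤ i) (fun w => av (Gr w ⊤ j) (fun w' => ind (1/48 ≤ ew w w'))) ≤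
      9216 * lam * C * p + 36864 * lam * C^2 * p := by
    intro i j h1 h2 h3
    have : av (Gr ⊥ ⊤ i) (fun w => av (Gr w ⊤ j) (fun w' => ind (1/48 ≤ ew w w'))) ≤
        av (Gr ⊥ ⊤ i) (fun w => 9216 * lam * e w + ind (1/96 ≤ e w)) := by
      refine av_mono fun w hw => ?_
      rw [mem_Gr] at hw
      have h4 := sampling hq4 (le_top : w ≤ ⊤) (i := j) (j := o+3) (by omega) h3 (by rw [dm_top]; omega)
        (fun u => bt A' B' H (o+3) b w u) (fun u => bt_nonneg _ _ _ _ _ _ _) (fun u => bt_le_one _ _ _ _ _ _ _)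
        (c := 1/48) (by norm_num)
      refine h4.trans (le_of_eq ?_)
      have : av (Gr w ⊤ (o+3)) (fun u => bt A' B' H (o+3) b w u) = e w := ew_self w
      rw [this]
      have : (1/48/2 : ℝ) = 1/96 := by norm_num
      rw [this]; ring
    refine this.trans ?_
    rw [av_add, av_mul]
    have h5 := he_av i h1 (by omega)
    have h6 := hS i (1/96) h1 (by omega) le_rfl
    have := mul_le_mul_of_nonneg_left h5 (show 0 ≤ 9216 * lam by positivity)
    linarith
  have hSt : ∀ i j, o ≤ i → i ≤ j → j < o + 3 → av (Gr ⊥ ⊤ i) (fun w => av (Gr w ⊤ j) (fun w' => ind (1/48 ≤ e w'))) ≤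
      36864 * lam * C^2 * p := by
    intro i j h1 h2 h3
    rw [Gr_tower' h2 (hbot _)]
    exact hS j _ (by omega) h3 (by norm_num)
  have hηI : ∀ i j, o ≤ i → i ≤ j → j < o + 3 → av (Gr ⊥ ⊤ i) (fun w => av (Gr w ⊤ j) (fun w' => ind (1/6 ≤ η w w'))) ≤
      9216 * lam * C * p + 73728 * lam * C^2 * p := by
    intro i j h1 h2 h3
    have : av (Gr ⊥ ⊤ i) (fun w => av (Gr w ⊤ j) (fun w' => ind (1/6 ≤ η w w'))) ≤
        av (Gr ⊥ ⊤ i) (fun w => av (Gr w ⊤ j) (fun w' => ind (1/48 ≤ ew w w') + ind (1/48 ≤ e w'))) := by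
      refine av_mono fun w _ => av_mono fun w' hw' => ind_or fun h => ?_
      rw [mem_Gr] at hw'
      by_contra hcon
      push Not at hcon
      have h5 : η w w' ≤ 4 * (ew w w' + e w') := hL w w' (by omega)
      linarith
    have e5 : ∀ w ∈ Gr (⊥ : Sb F n) ⊤ i, av (Gr w ⊤ j) (fun w' => ind (1/48 ≤ ew w w') + ind (1/48 ≤ e w')) =
      av (Gr w ⊤ j) (fun w' => ind (1/48 ≤ ew w w')) + av (Gr w ⊤ j) (fun w' => ind (1/48 ≤ e w')) := fun w _ => av_add _ _ _
    rw [av_congr e5, av_add] at this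
    have := hX i j h1 h2 h3; have := hSt i j h1 h2 h3
    linarith
  -- new structure
  set At : Sb F n → Sb F n → Sb F n → Γ := fun w1 w2 _ => L w1 w2 with hAt
  set Bt : Sb F n → Sb F n → Sb F n → Γ := fun w2 _ w3 => L w2 w3 with hBt
  set pt := pp At Bt L o (o+1) (o+1) (o+2) ⊥ with hpt
  have hpt_le : pt ≤ p / 8 := by
    have e1 : pt = av (Gr ⊥ ⊤ o) (fun w1 => av (Gr w1 ⊤ (o+1)) (fun w2 => av (Gr w2 ⊤ (o+2)) (fun w3 =>
        ind (L w1 w2 * L w2 w3 ≠ L w1 w3)))) := by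
      refine av_congr fun w1 _ => av_congr fun w2 hw2 => ?_
      rw [mem_Gr] at hw2
      rw [bt_self At Bt L hw2.2.2]
    set fw : Sb F n → Sb F n → Sb F n → ℝ := fun w1 w2 w3 => av (Gr w3 ⊤ b) (fun x => ind (H w1 x ≠ L w1 w2 * H w2 x)) with hfw
    have e2 : pt ≤ av (Gr ⊥ ⊤ o) (fun w1 => av (Gr w1 ⊤ (o+1)) (fun w2 => av (Gr w2 ⊤ (o+2)) (fun w3 =>
        ind (1/3 ≤ fw w1 w2 w3)) + av (Gr w2 ⊤ (o+2)) (fun w3 => ind (1/6 ≤ η w2 w3)) +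
        av (Gr w2 ⊤ (o+2)) (fun w3 => ind (1/6 ≤ η w1 w3)))) := by
      rw [e1]
      refine av_mono fun w1 _ => av_mono fun w2 _ => ?_
      rw [← av_add, ← av_add]
      refine av_mono fun w3 hw3 => ?_
      rw [mem_Gr] at hw3
      rw [add_assoc]
      refine (ind_or (q := 1/3 ≤ fw w1 w2 w3) (r := 1/6 ≤ η w2 w3 ∨ 1/6 ≤ η w1 w3) fun h => ?_).trans
        (add_le_add le_rfl (ind_or fun h => h))
      by_contra hcon
      push Not at hcon
      obtain ⟨c1, c2, c3⟩ := hcon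
      have hne : (Gr w3 ⊤ b).Nonempty := Gr_nonempty le_top (by omega) (by rw [dm_top]; omega)
      have : (1:ℝ) ≤ fw w1 w2 w3 + (η w2 w3 + η w1 w3) := by
        simp only [hfw, hη]
        rw [← av_add, ← av_add]
        refine const_le_av hne fun x _ => ?_
        by_cases d1 : H w1 x = L w1 w2 * H w2 x
        · by_cases d2 : H w2 x = L w2 w3 * H w3 x
          · have d3 : H w1 x ≠ L w1 w3 * H w3 x := by
              intro d3; apply h
              rw [d1, d2, ← mul_assoc] at d3
              exact mul_right_cancel d3
            rw [ind_true d3]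
            have := ind_nonneg (H w1 x ≠ L w1 w2 * H w2 x); have := ind_nonneg (H w2 x ≠ L w2 w3 * H w3 x)
            linarith
          · rw [ind_true (p := H w2 x ≠ _) d2]
            have := ind_nonneg (H w1 x ≠ L w1 w2 * H w2 x); have := ind_nonneg (H w1 x ≠ L w1 w3 * H w3 x)
            linarith
        · rw [ind_true (p := H w1 x ≠ L w1 w2 * H w2 x) d1]
          have := ind_nonneg (H w2 x ≠ L w2 w3 * H w3 x); have := ind_nonneg (H w1 x ≠ L w1 w3 * H w3 x)
          linarith
      linarith
    have e3 : av (Gr ⊥ ⊤ o) (fun w1 => av (Gr w1 ⊤ (o+1)) (fun w2 => av (Gr w2 ⊤ (o+2)) (fun w3 =>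
        ind (1/3 ≤ fw w1 w2 w3)))) ≤ 288 * lam * C * p + (9216 * lam * C * p + 73728 * lam * C^2 * p) := by
      have : av (Gr ⊥ ⊤ o) (fun w1 => av (Gr w1 ⊤ (o+1)) (fun w2 => av (Gr w2 ⊤ (o+2)) (fun w3 =>
        ind (1/3 ≤ fw w1 w2 w3)))) ≤ av (Gr ⊥ ⊤ o) (fun w1 => 36 * lam * av (Gr w1 ⊤ (o+1)) (fun w2 => η w1 w2) +
          av (Gr w1 ⊤ (o+1)) (fun w2 => ind (1/6 ≤ η w1 w2))) := by
        refine av_mono fun w1 _ => ?_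
        rw [← av_mul, ← av_add]
        refine av_mono fun w2 hw2 => ?_
        rw [mem_Gr] at hw2
        have h4 := sampling hq4 (le_top : w2 ≤ ⊤) (i := o+2) (j := b) (by omega) (by omega) (by rw [dm_top]; omega)
          (fun x => ind (H w1 x ≠ L w1 w2 * H w2 x)) (fun u => ind_nonneg _) (fun u => ind_le_one _)
          (c := 1/3) (by norm_num)
        refine h4.trans (le_of_eq ?_)
        have : (1/3/2 : ℝ) = 1/6 := by norm_num
        rw [this]; simp only [hη, hlam]; ring
      refine this.trans ?_
      rw [av_add, av_mul]
      have h5 := hη_av o (o+1) le_rfl (by omega) (by omega)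
      have h6 := hηI o (o+1) le_rfl (by omega) (by omega)
      have := mul_le_mul_of_nonneg_left h5 (show 0 ≤ 36 * lam by positivity)
      linarith
    have e4 : av (Gr ⊥ ⊤ o) (fun w1 => av (Gr w1 ⊤ (o+1)) (fun w2 => av (Gr w2 ⊤ (o+2)) (fun w3 => ind (1/6 ≤ η w2 w3)))) ≤
        9216 * lam * C * p + 73728 * lam * C^2 * p := by
      rw [Gr_tower' (by omega) (hbot _)]
      exact hηI (o+1) (o+2) (by omega) (by omega) (by omega)
    have e5 : av (Gr ⊥ ⊤ o) (fun w1 => av (Gr w1 ⊤ (o+1)) (fun w2 => av (Gr w2 ⊤ (o+2)) (fun w3 => ind (1/6 ≤ η w1 w3)))) ≤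
        9216 * lam * C * p + 73728 * lam * C^2 * p := by
      refine le_trans (le_of_eq ?_) (hηI o (o+2) (by omega) (by omega) (by omega))
      refine av_congr fun w1 hw1 => ?_
      rw [mem_Gr] at hw1
      exact Gr_tower' (by omega) (by omega) _
    have e6 : ∀ w1 ∈ Gr (⊥ : Sb F n) ⊤ o, av (Gr w1 ⊤ (o+1)) (fun w2 => av (Gr w2 ⊤ (o+2)) (fun w3 =>
        ind (1/3 ≤ fw w1 w2 w3)) + av (Gr w2 ⊤ (o+2)) (fun w3 => ind (1/6 ≤ η w2 w3)) +
        av (Gr w2 ⊤ (o+2)) (fun w3 => ind (1/6 ≤ η w1 w3))) = av (Gr w1 ⊤ (o+1)) (fun w2 => av (Gr w2 ⊤ (o+2)) (fun w3 =>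
        ind (1/3 ≤ fw w1 w2 w3))) + av (Gr w1 ⊤ (o+1)) (fun w2 => av (Gr w2 ⊤ (o+2)) (fun w3 => ind (1/6 ≤ η w2 w3))) +
        av (Gr w1 ⊤ (o+1)) (fun w2 => av (Gr w2 ⊤ (o+2)) (fun w3 => ind (1/6 ≤ η w1 w3))) := by
      intro w1 _; rw [av_add, av_add]
    rw [av_congr e6, av_add, av_add] at e2
    have hl : lam * (300000 * C^2) ≤ 1/8 := by
      rw [hlam, hCv, div_mul_eq_mul_div, div_le_iff₀ (by linarith)]
      refine le_trans ?_ (mul_le_mul_of_nonneg_left hq (by norm_num))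
      norm_num
    have hl2 : 288 * lam * C * p + 3 * (9216 * lam * C * p + 73728 * lam * C^2 * p) ≤ lam * (300000 * C^2) * p := by
      have hlp : 0 ≤ lam * p := mul_nonneg hlam0 hp0
      rw [hCv]; nlinarith
    have := mul_le_mul_of_nonneg_right hl hp0
    linarith
  obtain ⟨ht, ht', hht⟩ := ih o (by omega) (o+1) (o+1) (o+2) (by omega) le_rfl (by omega) (by omega) At Bt L
  rw [← hpt] at hht
  -- k'
  have hkex : ∀ x : Sb F n, ∃ c : Γ, dm x = b → av (Gr ⊥ x (o+2)) (fun z => ind (ht' z * H z x ≠ c)) ≤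
      4 * av (Gr ⊥ x o) (fun w => av (Gr w x (o+2)) (fun z => ind (ht w * L w z ≠ ht' z) + ind (H w x ≠ L w z * H z x))) := by
    intro x
    by_cases hx : dm x = b
    · obtain ⟨c, hc⟩ := coll_up hq4 (bot_le : (⊥ : Sb F n) ≤ x) (i := o) (j := o+2) (by rw [dm_bot]; omega) (by omega) (by omega)
        (fun z => ht' z * H z x)
      refine ⟨c, fun _ => hc.trans ?_⟩
      have e4 : ∀ r : ℝ, 4 * r = 2 * (2 * r) := fun r => by ring
      rw [e4]
      refine mul_le_mul_of_nonneg_left ?_ (by norm_num)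
      rw [← av_mul]
      refine av_mono fun w hw => ?_
      rw [mem_Gr] at hw
      rw [← av_pair_add (Gr_nonempty hw.2.1 (by omega) (by omega))]
      refine av_mono fun z _ => av_mono fun z' _ => ?_
      refine (ind_or (q := ht w * L w z ≠ ht' z ∨ H w x ≠ L w z * H z x)
        (r := ht w * L w z' ≠ ht' z' ∨ H w x ≠ L w z' * H z' x) fun h => ?_).trans
        (add_le_add (ind_or fun h => h) (ind_or fun h => h))
      by_contra hcon
      push Not at hcon
      obtain ⟨⟨d1, d2⟩, d3, d4⟩ := hcon
      apply h
      rw [← d1, ← d3, mul_assoc, mul_assoc, ← d2, ← d4]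
    · exact ⟨1, fun h => absurd h hx⟩
  choose k' hk' using hkex
  have hk'av : av (Gr ⊥ ⊤ b) (fun x => av (Gr ⊥ x (o+2)) (fun z => ind (ht' z * H z x ≠ k' x))) ≤
      4 * ((200 * C) * pt) + 32 * C * p := by
    have h1 : av (Gr ⊥ ⊤ b) (fun x => av (Gr ⊥ x (o+2)) (fun z => ind (ht' z * H z x ≠ k' x))) ≤
        av (Gr ⊥ ⊤ b) (fun x => 4 * (av (Gr ⊥ x o) (fun w => av (Gr w x (o+2)) (fun z => ind (ht w * L w z ≠ ht' z))) +
          av (Gr ⊥ x o) (fun w => av (Gr w x (o+2)) (fun z => ind (H w x ≠ L w z * H z x))))) := by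
      refine av_mono fun x hx => ?_
      rw [mem_Gr] at hx
      refine (hk' x hx.2.2).trans (le_of_eq ?_)
      rw [← av_add]; congr 1
      refine av_congr fun w _ => ?_
      rw [av_add]
    refine h1.trans ?_
    rw [av_mul, av_add]
    have h2 : av (Gr ⊥ ⊤ b) (fun x => av (Gr ⊥ x o) (fun w => av (Gr w x (o+2)) (fun z => ind (ht w * L w z ≠ ht' z)))) =
        fe L o (o+2) ⊥ ht ht' := by
      rw [fe, ← Gr_tower (i := o+2) (j := b) (by omega) (by rw [dm_top]; omega)]
      refine av_congr fun x _ => ?_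
      rw [swap_Gr o (o+2) (fun w z => ind (ht w * L w z ≠ ht' z))]
    have h3 : av (Gr ⊥ ⊤ b) (fun x => av (Gr ⊥ x o) (fun w => av (Gr w x (o+2)) (fun z => ind (H w x ≠ L w z * H z x)))) =
        av (Gr ⊥ ⊤ o) (fun w => av (Gr w ⊤ (o+2)) (fun z => η w z)) := by
      rw [swap_Gr o b (fun w x => av (Gr w x (o+2)) (fun z => ind (H w x ≠ L w z * H z x)))]
      refine av_congr fun w _ => ?_
      rw [swap_Gr (o+2) b (fun z x => ind (H w x ≠ L w z * H z x))]
    rw [h2, h3]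
    have := hη_av o (o+2) le_rfl (by omega) (by omega)
    linarith
  have : Inhabited Γ := ⟨1⟩
  choose k hk using fun u : Sb F n => exists_best (Gr ⊥ u (o+2)) (fun z => ht' z * γ z u)
    (fun c : Γ => av (Gr u ⊤ b) (fun x => ind (c * Φ u x ≠ k' x)))
  refine ⟨k, k', ?_⟩
  unfold fe
  rw [swap_Gr (o+3) b (fun u x => ind (k u * Φ u x ≠ k' x))]
  have f1 : av (Gr ⊥ ⊤ (o+3)) (fun u => av (Gr u ⊤ b) (fun x => ind (k u * Φ u x ≠ k' x))) ≤
      av (Gr ⊥ ⊤ (o+3)) (fun u => av (Gr ⊥ u (o+2)) (fun z => av (Gr u ⊤ b) (fun x => ind (γ z u * Φ u x ≠ H z x)))) +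
      av (Gr ⊥ ⊤ (o+3)) (fun u => av (Gr u ⊤ b) (fun x => av (Gr ⊥ u (o+2)) (fun z => ind (ht' z * H z x ≠ k' x)))) := by
    rw [← av_add]
    refine av_mono fun u hu => ?_
    rw [mem_Gr] at hu
    refine (hk u (Gr_nonempty bot_le (by rw [dm_bot]; omega) (by omega))).trans ?_
    rw [av_comm (Gr u ⊤ b), ← av_add]
    refine av_mono fun z _ => ?_
    rw [← av_add]
    refine av_mono fun x _ => ?_
    refine ind_or fun h => ?_
    by_contra hcon
    push Not at hcon
    apply h
    rw [mul_assoc, hcon.1, hcon.2]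
  have f2 : av (Gr ⊥ ⊤ (o+3)) (fun u => av (Gr ⊥ u (o+2)) (fun z => av (Gr u ⊤ b) (fun x => ind (γ z u * Φ u x ≠ H z x)))) ≤
      C * p := by
    rw [swap_Gr (o+2) (o+3) (fun z u => av (Gr u ⊤ b) (fun x => ind (γ z u * Φ u x ≠ H z x)))]
    refine le_trans (le_of_eq ?_) (he_av (o+2) (by omega) (by omega))
    refine av_congr fun z _ => ?_
    rw [← swap_Gr (o+3) b (fun u x => ind (γ z u * Φ u x ≠ H z x))]
    rfl
  have f3 : av (Gr ⊥ ⊤ (o+3)) (fun u => av (Gr u ⊤ b) (fun x => av (Gr ⊥ u (o+2)) (fun z => ind (ht' z * H z x ≠ k' x)))) =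
      av (Gr ⊥ ⊤ b) (fun x => av (Gr ⊥ x (o+2)) (fun z => ind (ht' z * H z x ≠ k' x))) := by
    rw [← swap_Gr (o+3) b (fun u x => av (Gr ⊥ u (o+2)) (fun z => ind (ht' z * H z x ≠ k' x)))]
    refine av_congr fun x hx => ?_
    rw [mem_Gr] at hx
    exact Gr_tower (by omega) (by omega) _
  rw [f3] at f1
  have hCp : 0 ≤ C * p := mul_nonneg (by rw [hCv]; norm_num) hp0
  have : (200 * C) * pt ≤ (200 * C) * (p/8) := mul_le_mul_of_nonneg_left hpt_le (by rw [hCv]; norm_num)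
  linarith
end cocycle


section coords
variable {Ω ι P : Type*} [Fintype Ω] [Fintype ι] [DecidableEq ι]

noncomputable def cl (X : Ω → ι → P) (J : Finset ι) (T : Ω) : Finset Ω :=
  univ.filter fun T' => ∀ j ∈ J, X T' j = X T j
noncomputable def cE (X : Ω → ι → P) (J : Finset ι) (f : Ω → ℝ) (T : Ω) : ℝ := av (cl X J T) f
noncomputable def EE (f : Ω → ℝ) : ℝ := av univ f
def Ms (X : Ω → ι → P) (J : Finset ι) {β : Type*} (f : Ω → β) : Prop :=
  ∀ T T', (∀ j ∈ J, X T j = X T' j) → f T = f T'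

variable {X : Ω → ι → P} {J K : Finset ι} {f g m : Ω → ℝ}

theorem mem_cl {T T' : Ω} : T' ∈ cl X J T ↔ ∀ j ∈ J, X T' j = X T j := by simp [cl]
theorem self_mem_cl (T : Ω) : T ∈ cl X J T := mem_cl.2 fun _ _ => rfl
theorem cl_ne (T : Ω) : (cl X J T).Nonempty := ⟨T, self_mem_cl T⟩
theorem cl_symm {T T' : Ω} : T' ∈ cl X J T ↔ T ∈ cl X J T' := by
  simp only [mem_cl]; exact ⟨fun h j hj => (h j hj).symm, fun h j hj => (h j hj).symm⟩
theorem cl_eq {T T' : Ω} (h : ∀ j ∈ J, X T j = X T' j) : cl X J T = cl X J T' := by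
  ext S; simp only [mem_cl]
  exact ⟨fun h' j hj => (h' j hj).trans (h j hj), fun h' j hj => (h' j hj).trans (h j hj).symm⟩
theorem cE_ms (f : Ω → ℝ) : Ms X J (cE X J f) := fun T T' h => by rw [cE, cE, cl_eq h]
theorem Ms.mono {β : Type*} {f : Ω → β} (h : Ms X J f) (hJ : J ⊆ K) : Ms X K f := fun T T' h' => h T T' fun j hj => h' j (hJ hj)
theorem cE_of_ms (h : Ms X J f) (T : Ω) : cE X J f T = f T := by
  rw [cE, av_congr (g := fun _ => f T) (fun S hS => h S T (mem_cl.1 hS)), av_const (cl_ne T)]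
theorem cE_mul (h : Ms X J m) (f : Ω → ℝ) (T : Ω) : cE X J (fun T => f T * m T) T = cE X J f T * m T := by
  rw [cE, av_congr (g := fun S => f S * m T) (fun S hS => by rw [h S T (mem_cl.1 hS)]), av_mul', cE]
theorem EE_cE (f : Ω → ℝ) : EE (cE X J f) = EE f := by
  have key : ∑ T, cE X J f T = ∑ T, f T := by
    have : ∀ T, cE X J f T = ∑ S, if S ∈ cl X J T then f S / (cl X J T).card else 0 := by
      intro T
      rw [cE, av, Finset.sum_div, Finset.sum_ite_mem, Finset.univ_inter]
    rw [Finset.sum_congr rfl fun T _ => this T, Finset.sum_comm]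
    refine Finset.sum_congr rfl fun S _ => ?_
    have h2 : ∀ T, (if S ∈ cl X J T then f S / (cl X J T).card else 0) = if T ∈ cl X J S then f S / (cl X J S).card else 0 := by
      intro T
      by_cases h : S ∈ cl X J T
      · rw [if_pos h, if_pos (cl_symm.1 h), cl_eq (mem_cl.1 h)]
      · rw [if_neg h, if_neg (fun h' => h (cl_symm.1 h'))]
    rw [Finset.sum_congr rfl fun T _ => h2 T, Finset.sum_ite_mem, Finset.univ_inter, Finset.sum_const, nsmul_eq_mul]
    have : ((cl X J S).card : ℝ) ≠ 0 := by exact_mod_cast (cl_ne S).card_pos.ne'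
    field_simp
  unfold EE av; rw [key]
theorem EE_cE_mul (h : Ms X J m) (f : Ω → ℝ) : EE (fun T => cE X J f T * m T) = EE (fun T => f T * m T) := by
  rw [← EE_cE (X := X) (J := J) (fun T => f T * m T)]
  exact congrArg EE (funext fun T => (cE_mul h f T).symm)
theorem cE_eq_EE (f : Ω → ℝ) (T : Ω) : cE X J f T = EE (fun S => f S * ind (S ∈ cl X J T)) * ((Fintype.card Ω : ℝ) / (cl X J T).card) := by
  haveI : Nonempty Ω := ⟨T⟩
  have h0 : (Fintype.card Ω : ℝ) ≠ 0 := by exact_mod_cast Fintype.card_ne_zero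
  have : ∑ S, f S * ind (S ∈ cl X J T) = ∑ S ∈ cl X J T, f S := by
    simp only [ind, mul_ite, mul_one, mul_zero]
    rw [Finset.sum_ite_mem, Finset.univ_inter]
  rw [EE, cE, av, av, this, card_univ]
  field_simp
theorem cE_cE (hJ : J ⊆ K) (f : Ω → ℝ) (T : Ω) : cE X J (cE X K f) T = cE X J f T := by
  rw [cE_eq_EE, cE_eq_EE, EE_cE_mul]
  intro S S' h
  apply ind_congr
  simp only [mem_cl]
  exact ⟨fun h' j hj => (h j (hJ hj)).symm.trans (h' j hj), fun h' j hj => (h j (hJ hj)).trans (h' j hj)⟩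

theorem EE_sub (f g : Ω → ℝ) : EE (fun T => f T - g T) = EE f - EE g := av_sub _ _ _
theorem EE_add (f g : Ω → ℝ) : EE (fun T => f T + g T) = EE f + EE g := av_add _ _ _
theorem EE_mul (c : ℝ) (f : Ω → ℝ) : EE (fun T => c * f T) = c * EE f := av_mul _ _ _
theorem EE_sum {γ : Type*} (s : Finset γ) (f : Ω → γ → ℝ) : EE (fun T => ∑ i ∈ s, f T i) = ∑ i ∈ s, EE (fun T => f T i) := av_sum _ _ _
theorem EE_mono (h : ∀ T, f T ≤ g T) : EE f ≤ EE g := av_mono fun T _ => h T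
theorem EE_nonneg (h : ∀ T, 0 ≤ f T) : 0 ≤ EE f := av_nonneg fun T _ => h T
theorem EE_av {γ : Type*} (s : Finset γ) (f : Ω → γ → ℝ) : EE (fun T => av s (f T)) = av s (fun i => EE (fun T => f T i)) :=
  av_comm _ _ _
theorem EE_congr (h : ∀ T, f T = g T) : EE f = EE g := av_congr fun T _ => h T
theorem cE_sub (f g : Ω → ℝ) (T : Ω) : cE X J (fun T => f T - g T) T = cE X J f T - cE X J g T := av_sub _ _ _
theorem cE_av {γ : Type*} (s : Finset γ) (f : γ → Ω → ℝ) (T : Ω) : cE X J (fun T => av s (fun i => f i T)) T = av s (fun i => cE X J (f i) T) :=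
  av_comm _ _ _
theorem cE_sum {γ : Type*} (s : Finset γ) (f : γ → Ω → ℝ) (T : Ω) : cE X J (fun T => ∑ i ∈ s, (f i T)) T = ∑ i ∈ s, cE X J (f i) T :=
  av_sum _ _ _
theorem cE_sq_le (f : Ω → ℝ) (T : Ω) : cE X J f T ^ 2 ≤ cE X J (fun T => f T ^ 2) T := av_sq_le _ _
theorem cE_mono (h : ∀ T, f T ≤ g T) (T : Ω) : cE X J f T ≤ cE X J g T := av_mono fun T _ => h T
theorem cE_nonneg (h : ∀ T, 0 ≤ f T) (T : Ω) : 0 ≤ cE X J f T := av_nonneg fun T _ => h T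
theorem cE_const (c : ℝ) (T : Ω) : cE X J (fun _ => c) T = c := av_const (cl_ne T) c

/-- correlation decay hypothesis -/
structure Hyp (X : Ω → ι → P) (lam : ι → ι → ℝ) : Prop where
  pos : ∀ i j, 0 < lam i j
  symm : ∀ i j, lam i j = lam j i
  diag : ∀ i, 1 ≤ lam i i
  sum : ∀ i, ∑ j, lam i j ≤ 3
  decay : ∀ (J : Finset ι) (i j : ι) (f : Ω → ℝ), i ∉ J → j ∉ J → i ≠ j → Ms X (insert i J) f →
    (∀ T, cE X J f T = 0) → EE (fun T => cE X (insert j J) f T ^ 2) ≤ lam i j ^ 2 * EE (fun T => f T ^ 2)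

variable {lam : ι → ι → ℝ}

theorem core_lemma (H : Hyp X lam) (U : Finset ι) (m : ι → Ω → ℝ) (hU : ∀ i ∈ U, i ∉ J)
    (h1 : ∀ i, Ms X (insert i J) (m i)) (h2 : ∀ i T, cE X J (m i) T = 0) :
    EE (fun T => (∑ i ∈ U, m i T)^2) ≤ 3 * ∑ i ∈ U, EE (fun T => m i T ^ 2) := by
  have pair : ∀ i ∈ U, ∀ j ∈ U, EE (fun T => m i T * m j T) ≤
      lam i j * ((EE (fun T => m i T ^ 2) + EE (fun T => m j T ^ 2)) / 2) := by
    intro i hi j hj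
    have n1 : 0 ≤ EE (fun T => m i T ^ 2) := EE_nonneg fun T => sq_nonneg _
    by_cases hij : i = j
    · subst hij
      have : EE (fun T => m i T * m i T) = EE (fun T => m i T ^ 2) := EE_congr fun T => by ring
      rw [this]
      have := H.diag i
      nlinarith
    · have hd := H.decay J i j (m i) (hU i hi) (hU j hj) hij (h1 i) (h2 i)
      have hp := H.pos i j
      rw [← EE_cE_mul (h1 j) (m i)]
      have : EE (fun T => cE X (insert j J) (m i) T * m j T) ≤
          EE (fun T => (1 / (2 * lam i j)) * cE X (insert j J) (m i) T ^ 2 + (lam i j / 2) * m j T ^ 2) := by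
        refine EE_mono fun T => ?_
        set a := cE X (insert j J) (m i) T
        set b := m j T
        have : 0 ≤ (1 / (2 * lam i j)) * (a - lam i j * b)^2 := by positivity
        have e : (1 / (2 * lam i j)) * (a - lam i j * b)^2 = (1 / (2 * lam i j)) * a^2 + (lam i j / 2) * b^2 - a * b := by
          field_simp; ring
        linarith
      refine this.trans ?_
      rw [EE_add, EE_mul, EE_mul]
      have : (1 / (2 * lam i j)) * EE (fun T => cE X (insert j J) (m i) T ^ 2) ≤
          (1 / (2 * lam i j)) * (lam i j ^ 2 * EE (fun T => m i T ^ 2)) := mul_le_mul_of_nonneg_left hd (by positivity)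
      have e : (1 / (2 * lam i j)) * (lam i j ^ 2 * EE (fun T => m i T ^ 2)) = lam i j / 2 * EE (fun T => m i T ^ 2) := by
        field_simp
      linarith
  have e1 : EE (fun T => (∑ i ∈ U, m i T)^2) = ∑ i ∈ U, ∑ j ∈ U, EE (fun T => m i T * m j T) := by
    have : ∀ T, (∑ i ∈ U, m i T)^2 = ∑ i ∈ U, ∑ j ∈ U, m i T * m j T := fun T => by
      rw [sq, Finset.sum_mul_sum]
    rw [EE_congr this, EE_sum]
    exact Finset.sum_congr rfl fun i _ => EE_sum _ _
  rw [e1]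
  have e2 : ∑ i ∈ U, ∑ j ∈ U, EE (fun T => m i T * m j T) ≤
      ∑ i ∈ U, ∑ j ∈ U, lam i j * ((EE (fun T => m i T ^ 2) + EE (fun T => m j T ^ 2)) / 2) :=
    Finset.sum_le_sum fun i hi => Finset.sum_le_sum fun j hj => pair i hi j hj
  have e3 : ∑ i ∈ U, ∑ j ∈ U, lam i j * ((EE (fun T => m i T ^ 2) + EE (fun T => m j T ^ 2)) / 2) =
      ∑ i ∈ U, ∑ j ∈ U, lam i j * EE (fun T => m i T ^ 2) := by
    have a1 : ∑ i ∈ U, ∑ j ∈ U, lam i j * EE (fun T => m j T ^ 2) = ∑ i ∈ U, ∑ j ∈ U, lam i j * EE (fun T => m i T ^ 2) := by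
      rw [Finset.sum_comm]
      exact Finset.sum_congr rfl fun i _ => Finset.sum_congr rfl fun j _ => by rw [H.symm]
    have a2 : ∀ i j, lam i j * ((EE (fun T => m i T ^ 2) + EE (fun T => m j T ^ 2)) / 2) =
      (1/2) * (lam i j * EE (fun T => m i T ^ 2)) + (1/2) * (lam i j * EE (fun T => m j T ^ 2)) := fun i j => by ring
    simp only [a2, Finset.sum_add_distrib, ← Finset.mul_sum]
    rw [a1]; ring
  refine e2.trans (e3.le.trans ?_)
  rw [Finset.mul_sum]
  refine Finset.sum_le_sum fun i hi => ?_
  rw [← Finset.sum_mul]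
  refine mul_le_mul_of_nonneg_right ?_ (EE_nonneg fun T => sq_nonneg _)
  exact (Finset.sum_le_sum_of_subset_of_nonneg (Finset.subset_univ _) fun j _ _ => (H.pos i j).le).trans (H.sum i)

theorem cE_sub_cE (hJ : J ⊆ K) (f : Ω → ℝ) (T : Ω) : cE X J (fun T => cE X K f T - cE X J f T) T = 0 := by
  rw [cE_sub, cE_cE hJ, cE_cE (subset_refl _), sub_self]

theorem influence (H : Hyp X lam) (J : Finset ι) (D : Ω → ℝ) :
    ∑ i ∈ Jᶜ, EE (fun T => (cE X (insert i J) D T - cE X J D T)^2) ≤ 3 * EE (fun T => D T ^ 2) := by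
  set m : ι → Ω → ℝ := fun i T => cE X (insert i J) D T - cE X J D T with hm
  have ms : ∀ i, Ms X (insert i J) (m i) := fun i T T' h => by
    rw [hm]; simp only
    rw [cE_ms D T T' h, cE_ms D T T' fun j hj => h j (mem_insert_of_mem hj)]
  have m0 : ∀ i T, cE X J (m i) T = 0 := fun i T => cE_sub_cE (subset_insert _ _) D T
  have hc := core_lemma H Jᶜ m (fun i hi => by simpa using hi) ms m0
  have e1 : ∀ i, EE (fun T => m i T ^ 2) = EE (fun T => D T * m i T) := by
    intro i
    have a1 : EE (fun T => m i T ^ 2) = EE (fun T => cE X (insert i J) D T * m i T - m i T * cE X J D T) :=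
      EE_congr fun T => by simp only [hm]; ring
    rw [a1, EE_sub, EE_cE_mul (ms i), ← EE_cE_mul (cE_ms D) (m i)]
    have : EE (fun T => cE X J (m i) T * cE X J D T) = 0 := by
      rw [EE_congr (g := fun _ => 0) fun T => by rw [m0, zero_mul]]; exact av_zero _
    rw [this, sub_zero]
  have e2 : ∑ i ∈ Jᶜ, EE (fun T => m i T ^ 2) = EE (fun T => D T * ∑ i ∈ Jᶜ, m i T) := by
    rw [Finset.sum_congr rfl fun i _ => e1 i, ← EE_sum]
    exact EE_congr fun T => by rw [Finset.mul_sum]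
  have e3 : EE (fun T => D T * ∑ i ∈ Jᶜ, m i T) ≤ EE (fun T => (3/2) * D T ^ 2 + (1/6) * (∑ i ∈ Jᶜ, m i T)^2) :=
    EE_mono fun T => by nlinarith [sq_nonneg (3 * D T - ∑ i ∈ Jᶜ, m i T)]
  rw [EE_add, EE_mul, EE_mul] at e3
  linarith
end coords


section sp
variable {ι : Type*} [Fintype ι] [DecidableEq ι]

noncomputable def Sp (J : Finset ι) (s : ℕ) : Finset (Finset ι) := univ.filter fun I => J ⊆ I ∧ I.card = s

theorem mem_Sp {J I : Finset ι} {s : ℕ} : I ∈ Sp J s ↔ J ⊆ I ∧ I.card = s := by simp [Sp]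

theorem card_Sp {J : Finset ι} {s : ℕ} (h : J.card ≤ s) :
    (Sp J s).card = (Fintype.card ι - J.card).choose (s - J.card) := by
  rw [← Finset.card_compl, ← Finset.card_powersetCard]
  refine Finset.card_nbij' (fun I => I \ J) (fun I => I ∪ J) ?_ ?_ ?_ ?_
  · intro I hI
    have := mem_Sp.1 hI
    rw [Finset.mem_coe, Finset.mem_powersetCard]
    refine ⟨fun x hx => by simp at hx ⊢; exact hx.2, ?_⟩
    rw [Finset.card_sdiff_of_subset this.1, this.2]
  · intro I hI
    rw [Finset.mem_coe, Finset.mem_powersetCard] at hI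
    rw [Finset.mem_coe, mem_Sp]
    refine ⟨Finset.subset_union_right, ?_⟩
    rw [Finset.card_union_of_disjoint, hI.2]; · omega
    rw [Finset.disjoint_left]; intro x hx; simpa using hI.1 hx
  · intro I hI
    have := mem_Sp.1 hI
    exact Finset.sdiff_union_of_subset this.1
  · intro I hI
    rw [Finset.mem_coe, Finset.mem_powersetCard] at hI
    simp only
    rw [Finset.union_sdiff_cancel_right]
    rw [Finset.disjoint_left]; intro x hx; simpa using hI.1 hx

theorem Sp_ne {J : Finset ι} {s : ℕ} (h : J.card ≤ s) (hs : s ≤ Fintype.card ι) : (Sp J s).Nonempty := by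
  rw [← Finset.card_pos, card_Sp h]
  exact Nat.choose_pos (by omega)

theorem Sp_self (J : Finset ι) : Sp J J.card = {J} := by
  ext I; rw [mem_Sp, mem_singleton]
  constructor
  · rintro ⟨h1, h2⟩; exact (Finset.eq_of_subset_of_card_le h1 h2.le).symm
  · rintro rfl; exact ⟨subset_rfl, rfl⟩

theorem av_Sp_in {J : Finset ι} {s : ℕ} (h : J.card < s) (φ : Finset ι → ι → ℝ) :
    av (Sp J s) (fun I => av (I \ J) (φ I)) = av Jᶜ (fun i => av (Sp (insert i J) s) (fun I => φ I i)) := by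
  refine av_fubini (fun I => I \ J) (fun i => Sp (insert i J) s) (s - J.card)
    ((Fintype.card ι - (J.card+1)).choose (s - (J.card+1))) ?_ ?_ ?_ φ
  · intro I i
    simp only [mem_Sp, mem_sdiff, mem_compl, Finset.insert_subset_iff]; tauto
  · intro I hI
    rw [mem_Sp] at hI
    rw [Finset.card_sdiff_of_subset hI.1, hI.2]
  · intro i hi
    have : (insert i J).card = J.card + 1 := Finset.card_insert_of_notMem (by simpa using hi)
    rw [card_Sp (by omega), this]

theorem av_Sp_in' {J : Finset ι} {s : ℕ} (h : J.card < s) (φ : Finset ι → ℝ) :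
    av Jᶜ (fun i => av (Sp (insert i J) s) φ) = av (Sp J s) φ := by
  rw [← av_Sp_in h (fun I _ => φ I)]
  refine av_congr fun I hI => ?_
  rw [mem_Sp] at hI
  apply av_const
  rw [← Finset.card_pos, Finset.card_sdiff_of_subset hI.1]; omega

theorem av_Sp_chain {J : Finset ι} {s : ℕ} (h : J.card ≤ s) (φ : Finset ι → ℝ) :
    av (Sp J s) (fun I => av Iᶜ (fun i => φ (insert i I))) = av (Sp J (s+1)) φ := by
  have e1 : ∀ I ∈ Sp J s, av Iᶜ (fun i => φ (insert i I)) = av ((Sp J (s+1)).filter (fun I' => I ⊆ I')) φ := by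
    intro I hI
    rw [mem_Sp] at hI
    refine av_bij (e := fun i => insert i I) ?_ ?_ ?_ φ
    · intro i hi
      rw [mem_filter, mem_Sp]
      refine ⟨⟨hI.1.trans (subset_insert _ _), ?_⟩, subset_insert _ _⟩
      rw [Finset.card_insert_of_notMem (by simpa using hi), hI.2]
    · intro i hi j hj hij
      simp only at hij
      have : i ∈ insert j I := hij ▸ mem_insert_self i I
      rw [mem_insert] at this
      rcases this with h | h
      · exact h
      · simp at hi; exact absurd h hi
    · intro I' hI'
      rw [mem_filter, mem_Sp] at hI'
      obtain ⟨i, hi⟩ : ∃ i, i ∈ I' \ I := by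
        apply Finset.card_pos.1
        rw [Finset.card_sdiff_of_subset hI'.2]; omega
      rw [mem_sdiff] at hi
      refine ⟨i, by simpa using hi.2, ?_⟩
      apply Finset.eq_of_subset_of_card_le
      · rw [Finset.insert_subset_iff]; exact ⟨hi.1, hI'.2⟩
      · rw [Finset.card_insert_of_notMem hi.2]; omega
  rw [av_congr e1]
  have e2 := av_fubini (s := Sp J s) (t := Sp J (s+1)) (fun I => (Sp J (s+1)).filter (fun I' => I ⊆ I'))
    (fun I' => (Sp J s).filter (fun I => I ⊆ I')) (Fintype.card ι - s) (s + 1 - J.card) ?_ ?_ ?_ (fun _ I' => φ I')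
  · rw [e2]
    refine av_congr fun I' hI' => ?_
    rw [mem_Sp] at hI'
    apply av_const
    obtain ⟨I, h1, h2, h3⟩ := Finset.exists_subsuperset_card_eq hI'.1 h (by omega)
    exact ⟨I, by rw [mem_filter, mem_Sp]; exact ⟨⟨h1, h3⟩, h2⟩⟩
  · intro I I'; simp only [mem_filter]; tauto
  · intro I hI
    rw [mem_Sp] at hI
    rw [show (Sp J (s+1)).filter (fun I' => I ⊆ I') = Sp I (s+1) from ?_, card_Sp (by omega), hI.2]
    · simp
    · ext I'; simp only [mem_filter, mem_Sp]
      exact ⟨fun h => ⟨h.2, h.1.2⟩, fun h => ⟨⟨hI.1.trans h.1, h.2⟩, h.1⟩⟩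
  · intro I' hI'
    rw [mem_Sp] at hI'
    have : (I' \ J).card = s + 1 - J.card := by rw [Finset.card_sdiff_of_subset hI'.1, hI'.2]
    rw [← this]
    symm
    refine Finset.card_nbij (fun i => I'.erase i) ?_ ?_ ?_
    · intro i hi
      simp only [coe_sdiff, Set.mem_diff, mem_coe] at hi
      rw [mem_coe, mem_filter, mem_Sp]
      refine ⟨⟨?_, ?_⟩, erase_subset _ _⟩
      · intro x hx; rw [mem_erase]; exact ⟨by rintro rfl; exact hi.2 hx, hI'.1 hx⟩
      · rw [card_erase_of_mem hi.1]; omega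
    · intro i hi j hj hij
      simp only [coe_sdiff, Set.mem_diff, mem_coe] at hi hj
      by_contra hne
      simp only at hij
      have : i ∈ I'.erase j := mem_erase.2 ⟨hne, hi.1⟩
      rw [← hij] at this; simp at this
    · intro I hI
      rw [mem_coe, mem_filter, mem_Sp] at hI
      obtain ⟨i, hi⟩ : ∃ i, i ∈ I' \ I := by
        apply Finset.card_pos.1
        rw [Finset.card_sdiff_of_subset hI.2]; omega
      rw [mem_sdiff] at hi
      refine ⟨i, ?_, ?_⟩
      · simp only [coe_sdiff, Set.mem_diff, mem_coe]; exact ⟨hi.1, fun h => hi.2 (hI.1.1 h)⟩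
      · symm; apply Finset.eq_of_subset_of_card_le
        · intro x hx; rw [mem_erase]; exact ⟨by rintro rfl; exact hi.2 hx, hI.2 hx⟩
        · rw [card_erase_of_mem hi.1]; omega

theorem av_Sp_out {J : Finset ι} {s : ℕ} (h : J.card ≤ s) (hs : s < Fintype.card ι) (φ : ι → ℝ) :
    av (Sp J s) (fun I => av Iᶜ φ) = av Jᶜ φ := by
  have e2 := av_fubini (s := Sp J s) (t := Jᶜ) (fun I => Iᶜ) (fun i => (Sp J s).filter (fun I => i ∉ I)) (Fintype.card ι - s)
    ((Fintype.card ι - J.card).choose (s - J.card) - if J.card = s then 0 else (Fintype.card ι - (J.card+1)).choose (s - (J.card+1))) ?_ ?_ ?_ (fun _ i => φ i)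
  · rw [e2]
    refine av_congr fun i hi => ?_
    apply av_const
    have h1 : J ⊆ univ.erase i := fun x hx => by
      rw [mem_erase]; exact ⟨by rintro rfl; simp at hi; exact hi hx, mem_univ _⟩
    obtain ⟨I, h1, h2, h3⟩ := Finset.exists_subsuperset_card_eq h1 h (by rw [card_erase_of_mem (mem_univ _), card_univ]; omega)
    exact ⟨I, by rw [mem_filter, mem_Sp]; exact ⟨⟨h1, h3⟩, fun hi => by simpa using h2 hi⟩⟩
  · intro I i; simp only [mem_filter, mem_Sp, mem_compl]
    exact ⟨fun h => ⟨fun h' => h.2 (h.1.1 h'), h.1, h.2⟩, fun h => ⟨h.2.1, h.2.2⟩⟩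
  · intro I hI; rw [mem_Sp] at hI; rw [card_compl, hI.2]
  · intro i hi
    have hi' : i ∉ J := by simpa using hi
    have e : (Sp J s).filter (fun I => i ∉ I) = Sp J s \ Sp (insert i J) s := by
      ext I; simp only [mem_filter, mem_sdiff, mem_Sp, Finset.insert_subset_iff]; tauto
    have hsub : Sp (insert i J) s ⊆ Sp J s := fun I hI => by
      rw [mem_Sp, Finset.insert_subset_iff] at hI; rw [mem_Sp]; exact ⟨hI.1.2, hI.2⟩
    rw [e, card_sdiff_of_subset hsub, card_Sp h]
    congr 1
    have hc : (insert i J).card = J.card + 1 := Finset.card_insert_of_notMem hi'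
    split_ifs with hJ
    · rw [card_eq_zero]
      ext I; simp only [mem_Sp, notMem_empty, iff_false]
      rintro ⟨h1, h2⟩
      have := card_le_card h1
      omega
    · rw [card_Sp (by omega), hc]

/-- sampling without replacement -/
theorem sample_wo {J : Finset ι} (μ : ι → ℝ) (h0 : av Jᶜ μ = 0) (k : ℕ) (hk : J.card + k ≤ Fintype.card ι) :
    av (Sp J (J.card + k)) (fun I => (∑ i ∈ I \ J, μ i)^2) ≤ k * av Jᶜ (fun i => μ i ^ 2) := by
  have hsum : ∑ i ∈ Jᶜ, μ i = 0 := by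
    rcases Jᶜ.eq_empty_or_nonempty with h | h
    · rw [h]; simp
    · have : (Jᶜ.card : ℝ) ≠ 0 := by exact_mod_cast h.card_pos.ne'
      rw [av, div_eq_zero_iff] at h0; tauto
  induction k with
  | zero => rw [add_zero, Sp_self, av_singleton]; simp
  | succ k ih =>
    have ih := ih (by omega)
    rw [← add_assoc, ← av_Sp_chain (by omega)]
    have : ∀ I ∈ Sp J (J.card + k), av Iᶜ (fun i => (∑ j ∈ insert i I \ J, μ j)^2) ≤
        (∑ i ∈ I \ J, μ i)^2 + av Iᶜ (fun i => μ i ^ 2) := by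
      intro I hI
      rw [mem_Sp] at hI
      have hne : (Iᶜ).Nonempty := by rw [← Finset.card_pos, card_compl]; omega
      have e : ∀ i ∈ Iᶜ, (∑ j ∈ insert i I \ J, μ j)^2 = ((∑ i ∈ I \ J, μ i)^2 + (2 * ∑ i ∈ I \ J, μ i) * μ i) + μ i ^ 2 := by
        intro i hi
        have hi' : i ∉ I := by simpa using hi
        have : insert i I \ J = insert i (I \ J) := by
          rw [Finset.insert_sdiff_of_notMem _ (fun h => hi' (hI.1 h))]
        rw [this, sum_insert (by simp [hi'])]; ring
      rw [av_congr e, av_add, av_add, av_const hne, av_mul]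
      have e2 : ∑ i ∈ Iᶜ, μ i = - ∑ i ∈ I \ J, μ i := by
        have : Jᶜ = Iᶜ ∪ (I \ J) := by
          ext x; simp only [mem_compl, mem_union, mem_sdiff]
          by_cases hx : x ∈ J
          · simp [hx, hI.1 hx]
          · simp [hx]; tauto
        rw [this, sum_union] at hsum
        · linarith
        · rw [disjoint_left]; intro x hx; simp at hx ⊢; intro h; exact absurd h hx
      have e3 : av Iᶜ μ = - (∑ i ∈ I \ J, μ i) / (Iᶜ.card : ℝ) := by rw [av, e2]
      rw [e3]
      have : (2 * ∑ i ∈ I \ J, μ i) * (- (∑ i ∈ I \ J, μ i) / (Iᶜ.card : ℝ)) = - (2 * (∑ i ∈ I \ J, μ i)^2 / (Iᶜ.card : ℝ)) := by ring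
      rw [this]
      have : 0 ≤ 2 * (∑ i ∈ I \ J, μ i)^2 / (Iᶜ.card : ℝ) := by positivity
      linarith
    refine (av_mono this).trans ?_
    rw [av_add, av_Sp_out (by omega) (by omega)]
    push_cast
    linarith
end sp

section lemV
variable {Ω ι P : Type*} [Fintype Ω] [Fintype ι] [DecidableEq ι] {X : Ω → ι → P} {J K : Finset ι} {lam : ι → ι → ℝ}

noncomputable def Fm (X : Ω → ι → P) (ℓ : ℕ) (f : Finset ι → Ω → ℝ) (K : Finset ι) (T : Ω) : ℝ :=
  av (Sp K ℓ) (fun I => cE X K (f I) T)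

theorem Fm_ms (ℓ : ℕ) (f : Finset ι → Ω → ℝ) (K : Finset ι) : Ms X K (Fm X ℓ f K) := fun T T' h => by
  unfold Fm; exact av_congr fun I _ => cE_ms _ T T' h

theorem cE_Fm (ℓ : ℕ) (f : Finset ι → Ω → ℝ) (h : J ⊆ K) (T : Ω) :
    cE X J (Fm X ℓ f K) T = av (Sp K ℓ) (fun I => cE X J (f I) T) := by
  unfold Fm
  rw [cE_av]
  exact av_congr fun I _ => cE_cE h _ _

theorem Fm_avg {ℓ : ℕ} (f : Finset ι → Ω → ℝ) (hJ : J.card < ℓ) (T : Ω) :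
    av Jᶜ (fun i => cE X J (Fm X ℓ f (insert i J)) T) = Fm X ℓ f J T := by
  rw [av_congr fun i _ => cE_Fm ℓ f (subset_insert i J) T, av_Sp_in' hJ]; rfl

theorem EE_Fm_mul {ℓ : ℕ} (f : Finset ι → Ω → ℝ) {m : Ω → ℝ} (hm : Ms X K m) :
    EE (fun T => Fm X ℓ f K T * m T) = av (Sp K ℓ) (fun I => EE (fun T => f I T * m T)) := by
  unfold Fm
  rw [EE_congr (g := fun T => av (Sp K ℓ) (fun I => cE X K (f I) T * m T)) fun T => by rw [av_mul'], EE_av]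
  exact av_congr fun I _ => EE_cE_mul hm _

theorem EE_zero : EE (fun _ : Ω => (0:ℝ)) = 0 := av_zero _

theorem Fm_pythag {ℓ : ℕ} (f : Finset ι → Ω → ℝ) (hJ : J.card < ℓ) (hℓ : ℓ ≤ Fintype.card ι) :
    av Jᶜ (fun i => EE (fun T => (Fm X ℓ f (insert i J) T - Fm X ℓ f J T)^2)) =
    av Jᶜ (fun i => EE (fun T => Fm X ℓ f (insert i J) T ^ 2)) - EE (fun T => Fm X ℓ f J T ^ 2) := by
  have hne : (Jᶜ).Nonempty := by rw [← Finset.card_pos, card_compl]; omega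
  have e : ∀ i, EE (fun T => (Fm X ℓ f (insert i J) T - Fm X ℓ f J T)^2) =
      (EE (fun T => Fm X ℓ f (insert i J) T ^ 2) + EE (fun T => Fm X ℓ f J T ^ 2)) -
        2 * EE (fun T => cE X J (Fm X ℓ f (insert i J)) T * Fm X ℓ f J T) := by
    intro i
    rw [EE_cE_mul (Fm_ms ℓ f J), ← EE_mul, ← EE_add, ← EE_sub]
    exact EE_congr fun T => by ring
  rw [av_congr fun i _ => e i, av_sub, av_add, av_const hne, av_mul]
  have : EE (fun T => av Jᶜ (fun i => cE X J (Fm X ℓ f (insert i J)) T * Fm X ℓ f J T)) = EE (fun T => Fm X ℓ f J T ^ 2) :=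
    EE_congr fun T => by rw [av_mul', Fm_avg f hJ]; ring
  rw [EE_av] at this
  rw [this]; ring

theorem lemmaV (H : Hyp X lam) {ℓ : ℕ} (f : Finset ι → Ω → ℝ) (hJ : J.card < ℓ) (hℓ : ℓ ≤ Fintype.card ι) :
    av Jᶜ (fun i => EE (fun T => (Fm X ℓ f (insert i J) T - Fm X ℓ f J T)^2)) ≤
      (3 / ((ℓ - J.card : ℕ) : ℝ)) * av (Sp J ℓ) (fun I => EE (fun T => f I T ^ 2)) := by
  set k := ℓ - J.card with hk
  have hk0 : (0:ℝ) < k := by exact_mod_cast (by omega : 0 < k)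
  set w : ι → Ω → ℝ := fun i T => Fm X ℓ f (insert i J) T - Fm X ℓ f J T with hw
  set c : ι → Ω → ℝ := fun i T => cE X J (Fm X ℓ f (insert i J)) T with hc
  set μ : ι → Ω → ℝ := fun i T => c i T - Fm X ℓ f J T with hμ
  set n : ι → Ω → ℝ := fun i T => Fm X ℓ f (insert i J) T - c i T with hn
  have hcms : ∀ i, Ms X J (c i) := fun i => cE_ms _
  have hμms : ∀ i, Ms X J (μ i) := fun i T T' h => by
    simp only [hμ]; rw [hcms i T T' h, Fm_ms ℓ f J T T' h]
  have hnms : ∀ i, Ms X (insert i J) (n i) := fun i T T' h => by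
    simp only [hn]
    rw [(hcms i).mono (subset_insert i J) T T' h, Fm_ms ℓ f _ T T' h]
  have hwms : ∀ i, Ms X (insert i J) (w i) := fun i T T' h => by
    simp only [hw]
    rw [(Fm_ms ℓ f J).mono (subset_insert i J) T T' h, Fm_ms ℓ f _ T T' h]
  have hn0 : ∀ i T, cE X J (n i) T = 0 := fun i T => by
    simp only [hn]; rw [cE_sub, cE_of_ms (hcms i), sub_self]
  have hne : (Jᶜ).Nonempty := by rw [← Finset.card_pos, card_compl]; omega
  have hμ0 : ∀ T, av Jᶜ (fun i => μ i T) = 0 := fun T => by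
    simp only [hμ]
    rw [av_sub, av_const hne, Fm_avg f hJ, sub_self]
  have hwn : ∀ i T, w i T = n i T + μ i T := fun i T => by simp only [hw, hn, hμ]; ring
  have orth : ∀ i (m : Ω → ℝ), Ms X J m → EE (fun T => n i T * m T) = 0 := fun i m hm => by
    rw [← EE_cE_mul hm, EE_congr (g := fun _ => 0) fun T => by rw [hn0, zero_mul], EE_zero]
  set A := av (Sp J ℓ) (fun I => EE (fun T => f I T ^ 2)) with hA
  set Y := av Jᶜ (fun i => EE (fun T => w i T ^ 2)) with hY
  -- duality
  have d1 : Y = av (Sp J ℓ) (fun I => EE (fun T => f I T * av (I \ J) (fun i => w i T))) := by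
    have a1 : ∀ i, EE (fun T => w i T ^ 2) = av (Sp (insert i J) ℓ) (fun I => EE (fun T => f I T * w i T)) -
        EE (fun T => μ i T * Fm X ℓ f J T) := by
      intro i
      rw [← EE_Fm_mul f (hwms i)]
      have : EE (fun T => μ i T * Fm X ℓ f J T) = EE (fun T => Fm X ℓ f J T * w i T) := by
        have h1 := orth i _ (Fm_ms ℓ f J)
        have h2 : EE (fun T => Fm X ℓ f J T * w i T) = EE (fun T => n i T * Fm X ℓ f J T) + EE (fun T => μ i T * Fm X ℓ f J T) := by
          rw [← EE_add]; exact EE_congr fun T => by rw [hwn]; ring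
        rw [h2, h1, zero_add]
      rw [this, ← EE_sub]
      exact EE_congr fun T => by simp only [hw]; ring
    rw [hY, av_congr fun i _ => a1 i, av_sub, ← EE_av]
    have : EE (fun T => av Jᶜ (fun i => μ i T * Fm X ℓ f J T)) = 0 := by
      rw [EE_congr (g := fun _ => 0) fun T => by rw [av_mul', hμ0, zero_mul], EE_zero]
    rw [this, sub_zero, ← av_Sp_in hJ (fun I i => EE (fun T => f I T * w i T))]
    refine av_congr fun I _ => ?_
    rw [← EE_av]
    exact EE_congr fun T => by rw [av_mul]
  -- second moment
  have d2 : av (Sp J ℓ) (fun I => EE (fun T => (av (I \ J) (fun i => w i T))^2)) ≤ (3 / k) * Y := by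
    have b1 : ∀ I ∈ Sp J ℓ, EE (fun T => (av (I \ J) (fun i => w i T))^2) =
        (1/(k:ℝ)^2) * (EE (fun T => (∑ i ∈ I \ J, n i T)^2) + EE (fun T => (∑ i ∈ I \ J, μ i T)^2)) := by
      intro I hI
      rw [mem_Sp] at hI
      have hcard : (I \ J).card = k := by rw [card_sdiff_of_subset hI.1, hI.2]
      have c1 : EE (fun T => (∑ i ∈ I \ J, n i T) * (∑ i ∈ I \ J, μ i T)) = 0 := by
        rw [EE_congr (g := fun T => ∑ i ∈ I \ J, n i T * (∑ i ∈ I \ J, μ i T)) fun T => by rw [sum_mul], EE_sum]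
        refine sum_eq_zero fun i _ => orth i _ fun T T' h => ?_
        exact sum_congr rfl fun j _ => hμms j T T' h
      have c2 : EE (fun T => (av (I \ J) (fun i => w i T))^2) = (1/(k:ℝ)^2) * (EE (fun T => (∑ i ∈ I \ J, n i T)^2) + EE (fun T => (∑ i ∈ I \ J, μ i T)^2) +
          2 * EE (fun T => (∑ i ∈ I \ J, n i T) * (∑ i ∈ I \ J, μ i T))) := by
        rw [← EE_mul, ← EE_add, ← EE_add, ← EE_mul]
        refine EE_congr fun T => ?_
        rw [av, hcard, sum_congr rfl fun i _ => hwn i T, sum_add_distrib]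
        field_simp; ring
      rw [c2, c1]; ring
    rw [av_congr b1, av_mul, av_add]
    have b2 : av (Sp J ℓ) (fun I => EE (fun T => (∑ i ∈ I \ J, n i T)^2)) ≤ 3 * k * av Jᶜ (fun i => EE (fun T => n i T ^ 2)) := by
      have : ∀ I ∈ Sp J ℓ, EE (fun T => (∑ i ∈ I \ J, n i T)^2) ≤ (3 * k) * av (I \ J) (fun i => EE (fun T => n i T ^ 2)) := by
        intro I hI
        rw [mem_Sp] at hI
        have hcard : (I \ J).card = k := by rw [card_sdiff_of_subset hI.1, hI.2]
        refine (core_lemma H (I \ J) n (fun i hi => (mem_sdiff.1 hi).2) hnms hn0).trans (le_of_eq ?_)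
        rw [av, hcard]; field_simp
      refine (av_mono this).trans (le_of_eq ?_)
      rw [av_mul, av_Sp_in hJ (fun I i => EE (fun T => n i T ^ 2))]
      congr 1
      refine av_congr fun i hi => av_const (Sp_ne ?_ hℓ) _
      rw [Finset.card_insert_of_notMem (by simpa using hi)]; omega
    have b3 : av (Sp J ℓ) (fun I => EE (fun T => (∑ i ∈ I \ J, μ i T)^2)) ≤ k * av Jᶜ (fun i => EE (fun T => μ i T ^ 2)) := by
      rw [← EE_av, ← EE_av, ← EE_mul]
      refine EE_mono fun T => ?_
      have := sample_wo (fun i => μ i T) (hμ0 T) k (by omega)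
      rwa [show J.card + k = ℓ by omega] at this
    have b4 : Y = av Jᶜ (fun i => EE (fun T => n i T ^ 2)) + av Jᶜ (fun i => EE (fun T => μ i T ^ 2)) := by
      rw [hY, ← av_add]
      refine av_congr fun i _ => ?_
      have : EE (fun T => w i T ^ 2) = EE (fun T => n i T ^ 2) + EE (fun T => μ i T ^ 2) + 2 * EE (fun T => n i T * μ i T) := by
        rw [← EE_mul, ← EE_add, ← EE_add]
        exact EE_congr fun T => by rw [hwn]; ring
      rw [this, orth i _ (hμms i)]; ring
    have b5 : 0 ≤ av Jᶜ (fun i => EE (fun T => μ i T ^ 2)) := av_nonneg fun i _ => EE_nonneg fun T => sq_nonneg _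
    have e1 : (3 / (k:ℝ)) * Y = (1/(k:ℝ)^2) * (3 * k * Y) := by field_simp
    rw [e1]
    refine mul_le_mul_of_nonneg_left ?_ (by positivity)
    rw [b4]
    have := mul_nonneg hk0.le b5
    linarith
  have d3 : Y ≤ (3 / (2 * k)) * A + (k / 6) * ((3 / k) * Y) := by
    have : Y ≤ av (Sp J ℓ) (fun I => (3 / (2 * (k:ℝ))) * EE (fun T => f I T ^ 2) + (k / 6) * EE (fun T => (av (I \ J) (fun i => w i T))^2)) := by
      rw [d1]
      refine av_mono fun I _ => ?_
      rw [← EE_mul, ← EE_mul, ← EE_add]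
      refine EE_mono fun T => ?_
      set a := f I T
      set b := av (I \ J) (fun i => w i T)
      have h : 0 ≤ (k:ℝ) / 6 * (b - 3 / k * a)^2 := by positivity
      have e : (k:ℝ) / 6 * (b - 3 / k * a)^2 = 3 / (2 * k) * a^2 + k / 6 * b^2 - a * b := by
        field_simp; ring
      linarith
    refine this.trans ?_
    rw [av_add, av_mul, av_mul]
    have := mul_le_mul_of_nonneg_left d2 (by positivity : (0:ℝ) ≤ k / 6)
    linarith
  have e : (k:ℝ) / 6 * ((3 / k) * Y) = Y / 2 := by field_simp; ring
  have e' : (3:ℝ) / (2 * k) * A = (3 / k) * A / 2 := by field_simp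
  rw [e, e'] at d3
  linarith

theorem test_lemma (H : Hyp X lam) {ℓ : ℕ} (f : Finset ι → Ω → ℝ) (hf : ∀ I, Ms X I (f I)) (hJ : J.card ≤ ℓ) (hℓ : ℓ < Fintype.card ι) :
    EE (fun T => (av (Sp J ℓ) (fun I => f I T))^2) ≤ EE (fun T => Fm X ℓ f J T ^ 2) +
      (3 * ℓ / (Fintype.card ι - ℓ : ℝ)) * av (Sp J ℓ) (fun I => EE (fun T => f I T ^ 2)) := by
  set G : Ω → ℝ := fun T => av (Sp J ℓ) (fun I => f I T) with hG
  have hGF : ∀ T, cE X J G T = Fm X ℓ f J T := fun T => cE_av _ _ _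
  set D : Ω → ℝ := fun T => G T - cE X J G T with hD
  have hNl : (0:ℝ) < (Fintype.card ι : ℝ) - ℓ := by
    rw [sub_pos]; exact_mod_cast hℓ
  have hD0 : ∀ T, cE X J D T = 0 := fun T => by
    simp only [hD]; rw [cE_sub, cE_cE (subset_refl _), sub_self]
  set Y := EE (fun T => D T ^ 2) with hY
  have hY0 : 0 ≤ Y := EE_nonneg fun T => sq_nonneg _
  have h1 : EE (fun T => G T ^ 2) = EE (fun T => Fm X ℓ f J T ^ 2) + Y := by
    have o : EE (fun T => D T * cE X J G T) = 0 := by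
      rw [← EE_cE_mul (cE_ms G), EE_congr (g := fun _ => 0) fun T => by rw [hD0, zero_mul], EE_zero]
    have : EE (fun T => G T ^ 2) = EE (fun T => Fm X ℓ f J T ^ 2) + Y + 2 * EE (fun T => D T * cE X J G T) := by
      rw [hY, ← EE_mul, ← EE_add, ← EE_add]
      exact EE_congr fun T => by rw [← hGF]; simp only [hD]; ring
    rw [this, o]; ring
  have h2 : Y = av (Sp J ℓ) (fun I => EE (fun T => f I T * cE X I D T)) := by
    have o : EE (fun T => D T * cE X J G T) = 0 := by
      rw [← EE_cE_mul (cE_ms G), EE_congr (g := fun _ => 0) fun T => by rw [hD0, zero_mul], EE_zero]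
    have a : Y = EE (fun T => G T * D T) - EE (fun T => D T * cE X J G T) := by
      rw [hY, ← EE_sub]; exact EE_congr fun T => by simp only [hD]; ring
    rw [a, o, sub_zero]
    have : EE (fun T => G T * D T) = EE (fun T => av (Sp J ℓ) (fun I => f I T * D T)) :=
      EE_congr fun T => by rw [av_mul']
    rw [this, EE_av]
    refine av_congr fun I _ => ?_
    have e1 := EE_cE_mul (hf I) D
    rw [EE_congr (g := fun T => D T * f I T) fun T => mul_comm _ _, ← e1]
    exact EE_congr fun T => mul_comm _ _
  have h3 : ∀ k, J.card + k ≤ ℓ → av (Sp J (J.card + k)) (fun I => EE (fun T => cE X I D T ^ 2)) ≤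
      k * (3 * Y / (Fintype.card ι - ℓ : ℝ)) := by
    intro k
    induction k with
    | zero =>
      intro _
      rw [add_zero, Sp_self, av_singleton, EE_congr (g := fun _ => 0) fun T => by rw [hD0]; ring, EE_zero]; simp
    | succ k ih =>
      intro hk
      have ih := ih (by omega)
      rw [← add_assoc, ← av_Sp_chain (by omega)]
      have : ∀ I ∈ Sp J (J.card + k), av Iᶜ (fun i => EE (fun T => cE X (insert i I) D T ^ 2)) ≤
          EE (fun T => cE X I D T ^ 2) + 3 * Y / (Fintype.card ι - ℓ : ℝ) := by
        intro I hI
        rw [mem_Sp] at hI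
        have hne : (Iᶜ).Nonempty := by rw [← Finset.card_pos, card_compl]; omega
        have e : ∀ i, EE (fun T => cE X (insert i I) D T ^ 2) = EE (fun T => cE X I D T ^ 2) +
            EE (fun T => (cE X (insert i I) D T - cE X I D T)^2) := by
          intro i
          have o : EE (fun T => (cE X (insert i I) D T - cE X I D T) * cE X I D T) = 0 := by
            rw [← EE_cE_mul (cE_ms D), EE_congr (g := fun _ => 0) fun T => by rw [cE_sub_cE (subset_insert _ _), zero_mul], EE_zero]
          have : EE (fun T => cE X (insert i I) D T ^ 2) = EE (fun T => cE X I D T ^ 2) +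
            EE (fun T => (cE X (insert i I) D T - cE X I D T)^2) + 2 * EE (fun T => (cE X (insert i I) D T - cE X I D T) * cE X I D T) := by
            rw [← EE_mul, ← EE_add, ← EE_add]; exact EE_congr fun T => by ring
          rw [this, o]; ring
        rw [av_congr fun i _ => e i, av_add, av_const hne]
        have inf := influence H I D
        have hcI : (Fintype.card ι - ℓ : ℝ) ≤ (Iᶜ).card := by
          rw [card_compl, hI.2, Nat.cast_sub (by omega)]
          have : ((J.card + k : ℕ) : ℝ) ≤ ℓ := by exact_mod_cast (by omega : J.card + k ≤ ℓ)
          linarith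
        have : av Iᶜ (fun i => EE (fun T => (cE X (insert i I) D T - cE X I D T)^2)) ≤ 3 * Y / (Fintype.card ι - ℓ : ℝ) := by
          rw [av]
          exact div_le_div₀ (by positivity) inf hNl hcI
        linarith
      refine (av_mono this).trans ?_
      rw [av_add, av_const (Sp_ne (by omega) (by omega))]
      push_cast
      linarith
  have h4 := h3 (ℓ - J.card) (by omega)
  rw [show J.card + (ℓ - J.card) = ℓ by omega] at h4
  set A := av (Sp J ℓ) (fun I => EE (fun T => f I T ^ 2)) with hA
  have hA0 : 0 ≤ A := av_nonneg fun I _ => EE_nonneg fun T => sq_nonneg _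
  rw [h1]
  rcases Nat.eq_zero_or_pos ℓ with hl | hl
  · subst hl
    have hS : av (Sp J 0) (fun I => EE (fun T => cE X I D T ^ 2)) ≤ 0 := by simpa using h4
    have : Y = 0 := by
      rw [h2]
      have : J = ∅ := by rw [← card_eq_zero]; omega
      have e := Sp_self J
      rw [this] at hD0 e
      simp only [card_empty] at e
      rw [this, e, av_singleton, EE_congr (g := fun _ => 0) fun T => by rw [hD0, mul_zero], EE_zero]
    rw [this]; simp
  have hl' : (0:ℝ) < ℓ := by exact_mod_cast hl
  have hkl : ((ℓ - J.card : ℕ) : ℝ) ≤ ℓ := by exact_mod_cast Nat.sub_le _ _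
  set t := 3 * ℓ / (Fintype.card ι - ℓ : ℝ) with ht
  have ht0 : 0 < t := by positivity
  have h5 : av (Sp J ℓ) (fun I => EE (fun T => cE X I D T ^ 2)) ≤ t * Y := by
    refine h4.trans ((mul_le_mul_of_nonneg_right hkl (by positivity)).trans (le_of_eq ?_))
    rw [ht]; ring
  have h6 : Y ≤ t / 2 * A + 1 / (2 * t) * (t * Y) := by
    have : Y ≤ av (Sp J ℓ) (fun I => t / 2 * EE (fun T => f I T ^ 2) + 1 / (2 * t) * EE (fun T => cE X I D T ^ 2)) := by
      conv_lhs => rw [h2]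
      refine av_mono fun I _ => ?_
      rw [← EE_mul, ← EE_mul, ← EE_add]
      refine EE_mono fun T => ?_
      set a := f I T
      set b := cE X I D T
      have h : 0 ≤ 1 / (2 * t) * (b - t * a)^2 := by positivity
      have e : 1 / (2 * t) * (b - t * a)^2 = t / 2 * a^2 + 1 / (2 * t) * b^2 - a * b := by
        field_simp; ring
      linarith
    refine this.trans ?_
    rw [av_add, av_mul, av_mul]
    have := mul_le_mul_of_nonneg_left h5 (by positivity : (0:ℝ) ≤ 1 / (2 * t))
    linarith
  have e : 1 / (2 * t) * (t * Y) = Y / 2 := by field_simp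
  rw [e] at h6
  linarith
end lemV


section flags
variable {F : Type} [Field F] [Fintype F] {n a0 N : ℕ}

/-- flags with one subspace in each of the dimensions `a0, …, a0+N-1` -/
abbrev Fl (F : Type) [Field F] [Fintype F] (n a0 N : ℕ) :=
  {X : Fin N → Sb F n // Monotone X ∧ ∀ i, dm (X i) = a0 + i}

noncomputable instance : Fintype (Fl F n a0 N) := Subtype.fintype _

def cX (T : Fl F n a0 N) : Fin N → Sb F n := T.1

noncomputable def flo (J : Finset (Fin N)) (i : Fin N) (T : Fl F n a0 N) : Sb F n := (J.filter (· < i)).sup (cX T)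
noncomputable def fhi (J : Finset (Fin N)) (i : Fin N) (T : Fl F n a0 N) : Sb F n := (J.filter (i < ·)).inf (cX T)

theorem cX_mono (T : Fl F n a0 N) {i j : Fin N} (h : i ≤ j) : cX T i ≤ cX T j := T.2.1 h
theorem cX_dm (T : Fl F n a0 N) (i : Fin N) : dm (cX T i) = a0 + i := T.2.2 i

theorem flo_le (J : Finset (Fin N)) (i : Fin N) (T : Fl F n a0 N) : flo J i T ≤ cX T i :=
  Finset.sup_le fun j hj => cX_mono T (mem_filter.1 hj).2.le
theorem le_fhi (J : Finset (Fin N)) (i : Fin N) (T : Fl F n a0 N) : cX T i ≤ fhi J i T :=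
  Finset.le_inf fun j hj => cX_mono T (mem_filter.1 hj).2.le
theorem flo_cl {J : Finset (Fin N)} (i : Fin N) {T T' : Fl F n a0 N} (h : T' ∈ cl cX J T) : flo J i T' = flo J i T := by
  unfold flo; exact Finset.sup_congr rfl fun j hj => mem_cl.1 h j (mem_filter.1 hj).1
theorem fhi_cl {J : Finset (Fin N)} (i : Fin N) {T T' : Fl F n a0 N} (h : T' ∈ cl cX J T) : fhi J i T' = fhi J i T := by
  unfold fhi; exact Finset.inf_congr rfl fun j hj => mem_cl.1 h j (mem_filter.1 hj).1

theorem mem_Gr_fl {J : Finset (Fin N)} (i : Fin N) {T T' : Fl F n a0 N} (h : T' ∈ cl cX J T) :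
    cX T' i ∈ Gr (flo J i T) (fhi J i T) (a0 + i) := by
  rw [mem_Gr, ← flo_cl i h, ← fhi_cl i h]
  exact ⟨flo_le _ _ _, le_fhi _ _ _, cX_dm _ _⟩

def fmap (g : Sb F n ≃o Sb F n) (hg : ∀ y, dm (g y) = dm y) (T : Fl F n a0 N) : Fl F n a0 N :=
  ⟨fun j => g (T.1 j), fun i j h => g.monotone (T.2.1 h), fun i => by rw [hg, T.2.2]⟩

theorem law (J : Finset (Fin N)) (i : Fin N) (hiJ : i ∉ J) (T : Fl F n a0 N) (φ : Sb F n → ℝ) :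
    cE cX J (fun T' => φ (cX T' i)) T = av (Gr (flo J i T) (fhi J i T) (a0 + i)) φ := by
  set R' : Sb F n → Finset (Fl F n a0 N) := fun y => (cl cX J T).filter (fun T' => cX T' i = y) with hR'
  have key : ∀ y1 ∈ Gr (flo J i T) (fhi J i T) (a0 + i), ∀ y2 ∈ Gr (flo J i T) (fhi J i T) (a0 + i),
      (R' y1).card ≤ (R' y2).card := by
    intro y1 h1 y2 h2
    rw [mem_Gr] at h1 h2
    obtain ⟨g, hg, hgy, hlo, hhi⟩ := exists_iso h1.1 h1.2.1 h2.1 h2.2.1 (h1.2.2.trans h2.2.2.symm)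
    refine card_le_card_of_injOn (fmap g hg) ?_ ?_
    · intro T' hT'
      simp only [hR', coe_filter, Set.mem_setOf_eq, mem_cl] at hT' ⊢
      refine ⟨fun j hj => ?_, ?_⟩
      · change g (cX T' j) = _
        rw [hT'.1 j hj]
        rcases lt_trichotomy j i with h | h | h
        · exact hlo _ (Finset.le_sup (f := cX T) (mem_filter.2 ⟨hj, h⟩))
        · exact absurd (h ▸ hj) hiJ
        · exact hhi _ (Finset.inf_le (f := cX T) (mem_filter.2 ⟨hj, h⟩))
      · change g (cX T' i) = _
        rw [hT'.2, hgy]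
    · intro T1 _ T2 _ h
      refine Subtype.ext (funext fun j => ?_)
      exact g.injective (congrFun (congrArg Subtype.val h) j)
  have hT0 := mem_Gr_fl i (self_mem_cl (X := cX) (J := J) T)
  set c := (R' (cX T i)).card with hc
  have hcc : ∀ y ∈ Gr (flo J i T) (fhi J i T) (a0 + i), (R' y).card = c := fun y hy =>
    le_antisymm (key y hy _ hT0) (key _ hT0 y hy)
  have hc0 : 0 < c := card_pos.2 ⟨T, by simp [hR', self_mem_cl]⟩
  have := av_fubini (s := cl cX J T) (t := Gr (flo J i T) (fhi J i T) (a0 + i))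
    (fun T' => ({cX T' i} : Finset (Sb F n))) R' 1 c (by
      intro a b
      simp only [mem_singleton, hR', mem_filter]
      constructor
      · rintro ⟨ha, rfl⟩; exact ⟨mem_Gr_fl i ha, ha, rfl⟩
      · rintro ⟨_, ha, rfl⟩; exact ⟨ha, rfl⟩) (fun _ _ => card_singleton _) hcc (fun _ y => φ y)
  rw [cE, av_congr (g := fun T' => av {cX T' i} φ) fun T' _ => by rw [av_singleton], this]
  exact av_congr fun y hy => av_const (card_pos.1 (by rw [hcc y hy]; exact hc0)) _

/-- a function of `T_J` and `T_i`, as a function of `T_i` -/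
noncomputable def fib (J : Finset (Fin N)) (i : Fin N) (f : Fl F n a0 N → ℝ) (T : Fl F n a0 N) (y : Sb F n) : ℝ :=
  if h : ∃ T' ∈ cl cX J T, cX T' i = y then f h.choose else 0

theorem fib_eq {J : Finset (Fin N)} {i : Fin N} {f : Fl F n a0 N → ℝ} (hf : Ms cX (insert i J) f)
    {T T' : Fl F n a0 N} (h : T' ∈ cl cX J T) : fib J i f T (cX T' i) = f T' := by
  have h' : ∃ S ∈ cl cX J T, cX S i = cX T' i := ⟨T', h, rfl⟩
  rw [fib, dif_pos h']
  have := h'.choose_spec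
  refine hf _ _ fun j hj => ?_
  rcases mem_insert.1 hj with rfl | hj
  · exact this.2
  · rw [mem_cl.1 this.1 j hj, mem_cl.1 h j hj]

theorem fib_cl {J : Finset (Fin N)} {i : Fin N} {f : Fl F n a0 N → ℝ}
    {T T' : Fl F n a0 N} (h : T' ∈ cl cX J T) : fib J i f T' = fib J i f T := by
  unfold fib; rw [cl_eq (mem_cl.1 h)]

theorem cl_mono {Ω ι P : Type*} [Fintype Ω] [Fintype ι] [DecidableEq ι] {X : Ω → ι → P} {J K : Finset ι} (h : J ⊆ K) {T T' : Ω}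
    (h' : T' ∈ cl X K T) : T' ∈ cl X J T := mem_cl.2 fun j hj => mem_cl.1 h' j (h hj)

theorem cE_law {J K : Finset (Fin N)} (hJK : J ⊆ K) {i : Fin N} (hi : i ∉ K) {f : Fl F n a0 N → ℝ}
    (hf : Ms cX (insert i J) f) (T : Fl F n a0 N) :
    cE cX K f T = av (Gr (flo K i T) (fhi K i T) (a0 + i)) (fib J i f T) := by
  rw [← law K i hi]
  exact av_congr fun T' h => (fib_eq hf (cl_mono hJK h)).symm

theorem sum_geo (N : ℕ) (i : Fin N) : ∑ j : Fin N, (1/2:ℝ)^((i:ℤ) - j).natAbs ≤ 3 := by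
  rw [Fin.sum_univ_eq_sum_range (fun j => (1/2:ℝ)^((i:ℤ) - j).natAbs) N]
  obtain ⟨i, hi⟩ := i
  simp only
  have hN : (i:ℕ) + 1 + (N - (i+1)) = N := by omega
  rw [← hN, Finset.sum_range_add]
  have h1 : ∑ x ∈ range ((i:ℕ)+1), (1/2:ℝ)^((i:ℤ) - x).natAbs = ∑ x ∈ range ((i:ℕ)+1), (1/2:ℝ)^x := by
    rw [← sum_range_reflect]
    refine sum_congr rfl fun x hx => ?_
    have := mem_range.1 hx
    congr 1; omega
  have h2 : ∀ x, (1/2:ℝ)^((i:ℤ) - ((i + 1 + x : ℕ):ℤ)).natAbs = (1/2) * (1/2:ℝ)^x := by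
    intro x
    rw [← pow_succ']; congr 1; omega
  have h3 : ∀ m, ∑ x ∈ range m, (1/2:ℝ)^x ≤ 2 := fun m => by
    have := geom_sum_eq (x := (1/2:ℝ)) (by norm_num) m
    rw [this, div_le_iff_of_neg (by norm_num)]
    have : (0:ℝ) < (1/2)^m := by positivity
    linarith
  rw [h1, sum_congr rfl fun x _ => h2 x, ← mul_sum]
  have := h3 ((i:ℕ)+1)
  have := h3 (N - ((i:ℕ)+1))
  linarith

theorem flag_hyp (hq : (8:ℝ) ≤ Fintype.card F) :
    Hyp (cX : Fl F n a0 N → Fin N → Sb F n) (fun i j => (1/2:ℝ)^((i:ℤ) - j).natAbs) where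
  pos := fun i j => by positivity
  symm := fun i j => by congr 1; omega
  diag := fun i => by simp
  sum := fun i => sum_geo N i
  decay := by
    intro J i j f hi hj hij hf h0
    have hsub := subset_insert j J
    have hiK : i ∉ insert j J := by simp [hij, hi]
    have h0' : ∀ T, av (Gr (flo J i T) (fhi J i T) (a0 + i)) (fib J i f T) = 0 := fun T => by
      rw [← cE_law (Subset.refl J) hi hf, h0]
    have hf2 : ∀ T : Fl F n a0 N, cE cX J (fun T => f T ^ 2) T = av (Gr (flo J i T) (fhi J i T) (a0 + i)) (fun y => fib J i f T y ^ 2) := fun T => by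
      rw [← law J i hi]
      exact av_congr fun T' h => by rw [fib_eq hf h]
    have hlam : ∀ g : ℕ, (2 / (Fintype.card F:ℝ))^g ≤ ((1/2:ℝ)^g)^2 := fun g => by
      rw [← pow_mul, mul_comm, pow_mul]
      refine pow_le_pow_left₀ (by positivity) ?_ _
      rw [div_le_iff₀ (by linarith)]; linarith
    have hzero : (∀ T : Fl F n a0 N, flo (insert j J) i T = flo J i T) → (∀ T : Fl F n a0 N, fhi (insert j J) i T = fhi J i T) →
        EE (fun T => cE cX (insert j J) f T ^ 2) ≤ ((1/2:ℝ)^((i:ℤ) - j).natAbs) ^ 2 * EE (fun T => f T ^ 2) := by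
      intro e1 e2
      rw [EE_congr (g := fun _ => 0) fun T => by rw [cE_law hsub hiK hf, e1, e2, h0']; norm_num, EE_zero]
      exact mul_nonneg (by positivity) (EE_nonneg fun T => sq_nonneg _)
    have hfin : (∀ T : Fl F n a0 N, cE cX J (fun T' => cE cX (insert j J) f T' ^ 2) T ≤
        (2 / (Fintype.card F:ℝ))^((i:ℤ) - j).natAbs * cE cX J (fun T => f T ^ 2) T) →
        EE (fun T => cE cX (insert j J) f T ^ 2) ≤ ((1/2:ℝ)^((i:ℤ) - j).natAbs) ^ 2 * EE (fun T => f T ^ 2) := by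
      intro h
      rw [← EE_cE (X := cX) (J := J), ← EE_cE (X := cX) (J := J) (fun T => f T ^ 2), ← EE_mul]
      refine EE_mono fun T => (h T).trans ?_
      exact mul_le_mul_of_nonneg_right (hlam _) (cE_nonneg (fun _ => sq_nonneg _) T)
    rcases lt_or_gt_of_ne hij with hlt | hgt
    · -- i < j
      have elo : ∀ T : Fl F n a0 N, flo (insert j J) i T = flo J i T := fun T => by
        unfold flo; rw [filter_insert, if_neg (not_lt.2 hlt.le)]
      by_cases hb : ∃ k ∈ J, i < k ∧ k < j
      · obtain ⟨k, hk, hik, hkj⟩ := hb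
        refine hzero elo fun T => ?_
        unfold fhi; rw [filter_insert, if_pos hlt, inf_insert, inf_eq_right]
        exact (Finset.inf_le (f := cX T) (mem_filter.2 ⟨hk, hik⟩)).trans (cX_mono T hkj.le)
      · push Not at hb
        have ehi : ∀ T : Fl F n a0 N, fhi (insert j J) i T = cX T j := fun T => by
          unfold fhi; rw [filter_insert, if_pos hlt, inf_insert, inf_eq_left]
          refine Finset.le_inf fun k hk => cX_mono T ?_
          exact hb k (mem_filter.1 hk).1 (mem_filter.1 hk).2
        have e1 : ∀ T : Fl F n a0 N, flo J j T = flo J i T := fun T => by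
          unfold flo; congr 1; ext k; simp only [mem_filter]
          refine and_congr_right fun hk => ⟨fun h => ?_, fun h => h.trans hlt⟩
          by_contra h'
          rcases (not_lt.1 h').lt_or_eq with h' | h'
          · exact absurd h (not_lt.2 (hb k hk h'))
          · exact hi (h' ▸ hk)
        have e2 : ∀ T : Fl F n a0 N, fhi J j T = fhi J i T := fun T => by
          unfold fhi; congr 1; ext k; simp only [mem_filter]
          refine and_congr_right fun hk => ⟨fun h => hlt.trans h, fun h => ?_⟩
          exact lt_of_le_of_ne (hb k hk h) fun h' => hj (h' ▸ hk)
        refine hfin fun T => ?_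
        rw [hf2]
        have : cE cX J (fun T' => cE cX (insert j J) f T' ^ 2) T =
            av (Gr (flo J i T) (fhi J i T) (a0 + j)) (fun y => (av (Gr (flo J i T) y (a0+i)) (fib J i f T))^2) := by
          rw [← e1 T, ← e2 T, ← law J j hj]
          refine av_congr fun T' h => ?_
          rw [cE_law hsub hiK hf, ehi, elo, ← e1, flo_cl j h, fib_cl h]
        rw [this]
        have hg : ((i:ℤ) - j).natAbs = (j:ℕ) - i := by have : (i:ℕ) < j := hlt; omega
        have hs : a0 + (j:ℕ) = a0 + i + (j - i) := by have : (i:ℕ) < j := hlt; omega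
        rw [hg, hs]
        refine spectral_up ((flo_le J i T).trans (le_fhi J i T)) ?_ _ ?_ _ (h0' T)
        · rw [← cX_dm T i]; exact dm_mono (flo_le J i T)
        · rw [← hs, ← e2, ← cX_dm T j]; exact dm_mono (le_fhi J j T)
    · -- j < i
      have ehi : ∀ T : Fl F n a0 N, fhi (insert j J) i T = fhi J i T := fun T => by
        unfold fhi; rw [filter_insert, if_neg (not_lt.2 hgt.le)]
      by_cases hb : ∃ k ∈ J, j < k ∧ k < i
      · obtain ⟨k, hk, hjk, hki⟩ := hb
        refine hzero (fun T => ?_) ehi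
        unfold flo; rw [filter_insert, if_pos hgt, sup_insert, sup_eq_right]
        exact (cX_mono T hjk.le).trans (Finset.le_sup (f := cX T) (mem_filter.2 ⟨hk, hki⟩))
      · push Not at hb
        have elo : ∀ T : Fl F n a0 N, flo (insert j J) i T = cX T j := fun T => by
          unfold flo; rw [filter_insert, if_pos hgt, sup_insert, sup_eq_left]
          refine Finset.sup_le fun k hk => cX_mono T ?_
          by_contra h'
          exact absurd (mem_filter.1 hk).2 (not_lt.2 (hb k (mem_filter.1 hk).1 (not_le.1 h')))
        have e1 : ∀ T : Fl F n a0 N, flo J j T = flo J i T := fun T => by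
          unfold flo; congr 1; ext k; simp only [mem_filter]
          refine and_congr_right fun hk => ⟨fun h => h.trans hgt, fun h => ?_⟩
          by_contra h'
          rcases (not_lt.1 h').lt_or_eq with h' | h'
          · exact absurd h (not_lt.2 (hb k hk h'))
          · exact hj (h' ▸ hk)
        have e2 : ∀ T : Fl F n a0 N, fhi J j T = fhi J i T := fun T => by
          unfold fhi; congr 1; ext k; simp only [mem_filter]
          refine and_congr_right fun hk => ⟨fun h => ?_, fun h => hgt.trans h⟩
          exact lt_of_le_of_ne (hb k hk h) fun h' => hi (h' ▸ hk)
        refine hfin fun T => ?_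
        rw [hf2]
        have : cE cX J (fun T' => cE cX (insert j J) f T' ^ 2) T =
            av (Gr (flo J i T) (fhi J i T) (a0 + j)) (fun y => (av (Gr y (fhi J i T) (a0+i)) (fib J i f T))^2) := by
          rw [← e1 T, ← e2 T, ← law J j hj]
          refine av_congr fun T' h => ?_
          rw [cE_law hsub hiK hf, elo, ehi, ← e2, fhi_cl j h, fib_cl h]
        rw [this]
        have hg : ((i:ℤ) - j).natAbs = (i:ℕ) - j := by have : (j:ℕ) < i := hgt; omega
        have hs : a0 + (i:ℕ) = a0 + j + (i - j) := by have : (j:ℕ) < i := hgt; omega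
        have h00 := h0' T
        rw [hg]
        rw [hs] at h00 ⊢
        refine spectral_down ((flo_le J i T).trans (le_fhi J i T)) ?_ _ ?_ _ h00
        · rw [← e1, ← cX_dm T j]; exact dm_mono (flo_le J j T)
        · rw [← hs, ← cX_dm T i]; exact dm_mono (le_fhi J i T)
end flags


section splice
theorem av_prod {α β : Type*} (s : Finset α) (t : Finset β) (f : α → β → ℝ) :
    av (s ×ˢ t) (fun p => f p.1 p.2) = av s (fun a => av t (f a)) := by
  unfold av
  rw [card_product, sum_product, Nat.cast_mul, sum_div, sum_div]
  refine sum_congr rfl fun a _ => ?_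
  rw [div_div, mul_comm]

variable {Ω ι P : Type*} [Fintype Ω] [Fintype ι] [DecidableEq ι] {X : Ω → ι → P} {J K : Finset ι}

theorem splice_av (s : Ω → Ω → Ω) (h1 : ∀ T T', T' ∈ cl X J T → s T' T ∈ cl X J T)
    (h2 : ∀ T T', T' ∈ cl X J T → s (s T T') (s T' T) = T) (h : Ω → ℝ) :
    ∃ r : Ω → Ω, Ms X J r ∧ (∀ T, r T ∈ cl X J T) ∧ EE (fun T => h (s (r T) T)) ≤ EE h := by
  have hex : ∀ T, ∃ T' ∈ cl X J T, av (cl X J T) (fun S => h (s T' S)) ≤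
      av (cl X J T) (fun T' => av (cl X J T) (fun S => h (s T' S))) := fun T => exists_le_av (cl_ne T) _
  refine ⟨fun T => (hex T).choose, ?_, fun T => (hex T).choose_spec.1, ?_⟩
  · intro T T' hT
    have e := cl_eq hT
    have gen : ∀ (C C' : Finset Ω) (hC : ∃ T' ∈ C, av C (fun S => h (s T' S)) ≤ av C (fun T' => av C (fun S => h (s T' S))))
      (hC' : ∃ T' ∈ C', av C' (fun S => h (s T' S)) ≤ av C' (fun T' => av C' (fun S => h (s T' S)))),
      C = C' → hC.choose = hC'.choose := by
      intro C C' hC hC' e; subst e; rfl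
    exact gen _ _ _ _ e
  · have gen : ∀ (C C' : Finset Ω) (hC : ∃ T' ∈ C, av C (fun S => h (s T' S)) ≤ av C (fun T' => av C (fun S => h (s T' S))))
      (hC' : ∃ T' ∈ C', av C' (fun S => h (s T' S)) ≤ av C' (fun T' => av C' (fun S => h (s T' S)))),
      C = C' → hC.choose = hC'.choose := by
      intro C C' hC hC' e; subst e; rfl
    rw [← EE_cE (X := X) (J := J), ← EE_cE (X := X) (J := J) h]
    refine EE_mono fun T => ?_
    have e1 : cE X J (fun T => h (s (hex T).choose T)) T = av (cl X J T) (fun S => h (s (hex T).choose S)) :=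
      av_congr fun S hS => by rw [gen _ _ (hex S) (hex T) (cl_eq (mem_cl.1 hS))]
    rw [e1]
    refine (hex T).choose_spec.2.trans (le_of_eq ?_)
    rw [← av_prod (cl X J T) (cl X J T) (fun T' S => h (s T' S))]
    have hcc : ∀ {a b}, a ∈ cl X J T → b ∈ cl X J T → a ∈ cl X J b := fun ha hb => by
      rw [cl_eq (mem_cl.1 hb)]; exact ha
    have hm : ∀ {a b}, a ∈ cl X J T → b ∈ cl X J T → s a b ∈ cl X J T := fun {a b} ha hb => by
      have := h1 b a (hcc ha hb)
      rwa [cl_eq (mem_cl.1 hb)] at this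
    set e : Ω × Ω → Ω × Ω := fun p => (s p.2 p.1, s p.1 p.2) with he
    have hinv : ∀ p ∈ cl X J T ×ˢ cl X J T, e (e p) = p := by
      intro p hp
      rw [mem_product] at hp
      simp only [he]
      rw [h2 p.1 p.2 (hcc hp.2 hp.1), h2 p.2 p.1 (hcc hp.1 hp.2)]
    have hmap : ∀ p ∈ cl X J T ×ˢ cl X J T, e p ∈ cl X J T ×ˢ cl X J T := by
      intro p hp
      rw [mem_product] at hp ⊢
      exact ⟨hm hp.2 hp.1, hm hp.1 hp.2⟩
    rw [av_bij (e := e) (t := cl X J T ×ˢ cl X J T) hmap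
      (fun p hp p' hp' h => by rw [← hinv p hp, ← hinv p' hp', h])
      (fun p hp => ⟨e p, hmap p hp, hinv p hp⟩) (fun p => h p.2)]
    rw [av_prod (cl X J T) (cl X J T) (fun _ S => h S), av_const (cl_ne T)]
    rfl
end splice

section flags
variable {F : Type} [Field F] [Fintype F] {n a0 N : ℕ}

noncomputable def fsp (D : Finset (Fin N)) (T' T : Fl F n a0 N) : Fl F n a0 N :=
  if h : Monotone (fun j => if j ∈ D then cX T' j else cX T j) then
    ⟨fun j => if j ∈ D then cX T' j else cX T j, h, fun i => by beta_reduce; split_ifs <;> exact cX_dm _ _⟩ else T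

def Bdy (D J : Finset (Fin N)) : Prop := ∀ a ∈ D, ∀ b, b ∉ D →
  (a < b → ∃ j ∈ J, a ≤ j ∧ j ≤ b) ∧ (b < a → ∃ j ∈ J, b ≤ j ∧ j ≤ a)

theorem cX_fsp {D J : Finset (Fin N)} (hD : Bdy D J) {T' T : Fl F n a0 N} (h : T' ∈ cl cX J T) (j : Fin N) :
    cX (fsp D T' T) j = if j ∈ D then cX T' j else cX T j := by
  have hm : Monotone (fun j => if j ∈ D then cX T' j else cX T j) := by
    intro a b hab
    rcases hab.eq_or_lt with rfl | hab
    · exact le_rfl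
    simp only
    split_ifs with h1 h2 h2
    · exact cX_mono _ hab.le
    · obtain ⟨k, hk, h3, h4⟩ := (hD a h1 b h2).1 hab
      exact (cX_mono T' h3).trans ((mem_cl.1 h k hk).le.trans (cX_mono T h4))
    · obtain ⟨k, hk, h3, h4⟩ := (hD b h2 a h1).2 hab
      exact (cX_mono T h3).trans ((mem_cl.1 h k hk).ge.trans (cX_mono T' h4))
    · exact cX_mono _ hab.le
  rw [fsp, dif_pos hm]; rfl

theorem fsp_exists {D J : Finset (Fin N)} (hD : Bdy D J) (h : Fl F n a0 N → ℝ) :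
    ∃ r : Fl F n a0 N → Fl F n a0 N, Ms cX J r ∧ (∀ T, r T ∈ cl cX J T) ∧ EE (fun T => h (fsp D (r T) T)) ≤ EE h := by
  have h1 : ∀ T T' : Fl F n a0 N, T' ∈ cl cX J T → fsp D T' T ∈ cl cX J T := fun T T' hT => by
    refine mem_cl.2 fun j hj => ?_
    rw [cX_fsp hD hT]; split_ifs
    · exact mem_cl.1 hT j hj
    · rfl
  refine splice_av (fsp D) h1 ?_ h
  intro T T' hT
  have hT' := cl_symm.1 hT
  refine Subtype.ext (funext fun j => ?_)
  change cX (fsp D (fsp D T T') (fsp D T' T)) j = cX T j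
  have : fsp D T T' ∈ cl cX J (fsp D T' T) := by
    refine mem_cl.2 fun j hj => ?_
    rw [mem_cl.1 (h1 T T' hT) j hj, mem_cl.1 (h1 T' T hT') j hj, mem_cl.1 hT j hj]
  rw [cX_fsp hD this, cX_fsp hD hT', cX_fsp hD hT]
  split_ifs <;> rfl

theorem law_top {J : Finset (Fin N)} {m i : Fin N} (hm : m ∈ J) (hJ : ∀ j ∈ J, j ≤ m) (hmi : m ≤ i)
    (Ψ : Fl F n a0 N → Sb F n → ℝ) (hΨ : Ms cX J Ψ) :
    EE (fun T => Ψ T (cX T i)) = EE (fun T => av (Gr (cX T m) ⊤ (a0 + i)) (Ψ T)) := by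
  rcases hmi.eq_or_lt with rfl | hmi
  · refine EE_congr fun T => ?_
    rw [← cX_dm T m, Gr_self le_top, av_singleton]
  have hi : i ∉ J := fun h => absurd (hJ i h) (not_le.2 hmi)
  rw [← EE_cE (X := cX) (J := J)]
  refine EE_congr fun T => ?_
  have e1 : flo J i T = cX T m := le_antisymm
    (Finset.sup_le fun j hj => cX_mono T (hJ j (mem_filter.1 hj).1))
    (Finset.le_sup (f := cX T) (mem_filter.2 ⟨hm, hmi⟩))
  have e2 : fhi J i T = ⊤ := by
    unfold fhi
    rw [filter_eq_empty_iff.2 fun j hj => not_lt.2 ((hJ j hj).trans hmi.le), inf_empty]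
  rw [← e1, ← e2, ← law J i hi]
  exact av_congr fun T' h => by rw [hΨ T' T (mem_cl.1 h)]

theorem law_one [Nonempty (Fl F n a0 N)] (i : Fin N) (φ : Sb F n → ℝ) :
    EE (fun T : Fl F n a0 N => φ (cX T i)) = av (Gr ⊥ ⊤ (a0 + i)) φ := by
  obtain ⟨T⟩ := ‹Nonempty (Fl F n a0 N)›
  have := law ∅ i (by simp) T φ
  have e : cl cX ∅ T = univ := by ext; simp [mem_cl]
  rw [cE, e] at this
  rw [EE, this]; simp [flo, fhi]

variable {Γ : Type*} [Group Γ]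

theorem law_fe [Nonempty (Fl F n a0 N)] {i j : Fin N} (hij : i ≤ j) (Φ : Sb F n → Sb F n → Γ) (γ H : Sb F n → Γ) :
    fe Φ (a0 + i) (a0 + j) ⊥ γ H = EE (fun T : Fl F n a0 N => ind (γ (cX T i) * Φ (cX T i) (cX T j) ≠ H (cX T j))) := by
  rw [law_top (J := {i}) (m := i) (i := j) (by simp) (by simp) hij
    (fun T x => ind (γ (cX T i) * Φ (cX T i) x ≠ H x)) (fun T T' h => by beta_reduce; rw [h i (by simp)])]
  rw [law_one i (fun u => av (Gr u ⊤ (a0 + j)) fun x => ind (γ u * Φ u x ≠ H x))]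
  exact swap_Gr (a0 + i) (a0 + j) (fun u x => ind (γ u * Φ u x ≠ H x))

theorem law_pp [Nonempty (Fl F n a0 N)] {i1 i2 i2' i3 : Fin N} (h12 : i1 < i2) (h22 : i2 ≤ i2') (h23 : i2' < i3)
    (A B : Sb F n → Sb F n → Sb F n → Γ) (Φ : Sb F n → Sb F n → Γ) :
    pp A B Φ (a0 + i1) (a0 + i2) (a0 + i2') (a0 + i3) ⊥ = EE (fun T : Fl F n a0 N =>
      ind (A (cX T i1) (cX T i2) (cX T i2') * B (cX T i2) (cX T i2') (cX T i3) ≠ Φ (cX T i1) (cX T i3))) := by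
  have hh := h12.le.trans h22
  rw [law_top (J := {i1, i2, i2'}) (m := i2') (i := i3) (by simp) (by simp [h22, hh]) h23.le
    (fun T x => ind (A (cX T i1) (cX T i2) (cX T i2') * B (cX T i2) (cX T i2') x ≠ Φ (cX T i1) x))
    (fun T T' h => by beta_reduce; rw [h i1 (by simp), h i2 (by simp), h i2' (by simp)])]
  rw [law_top (J := {i1, i2}) (m := i2) (i := i2') (by simp) (by simp [h12.le]) h22
    (fun T v' => av (Gr v' ⊤ (a0 + i3)) fun x => ind (A (cX T i1) (cX T i2) v' * B (cX T i2) v' x ≠ Φ (cX T i1) x))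
    (fun T T' h => by beta_reduce; rw [h i1 (by simp), h i2 (by simp)])]
  rw [law_top (J := {i1}) (m := i1) (i := i2) (by simp) (by simp) h12.le
    (fun T v => av (Gr v ⊤ (a0 + i2')) fun v' => av (Gr v' ⊤ (a0 + i3)) fun x => ind (A (cX T i1) v v' * B v v' x ≠ Φ (cX T i1) x))
    (fun T T' h => by beta_reduce; rw [h i1 (by simp)])]
  rw [law_one i1 (fun u => av (Gr u ⊤ (a0 + i2)) fun v => av (Gr v ⊤ (a0 + i2')) fun v' => av (Gr v' ⊤ (a0 + i3)) fun x =>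
    ind (A u v v' * B v v' x ≠ Φ u x))]
  rfl
end flags


section perms
variable {M : ℕ}

theorem perm_ai {α : Type*} (π : Equiv.Perm α) (a : α) : π (π⁻¹ a) = a := π.apply_symm_apply a
theorem perm_ia {α : Type*} (π : Equiv.Perm α) (a : α) : π⁻¹ (π a) = a := π.symm_apply_apply a

def IsM (m : ℕ) (rel : Fin M → Fin M → Prop) (φ : Equiv.Perm (Fin M)) : Prop :=
  (∀ a : Fin M, m ≤ a.1 → φ a = a) ∧ (∀ a : Fin M, a.1 < m → (φ a).1 < m) ∧
    ∀ a b : Fin M, a.1 < m → b.1 < m → (rel a b ↔ a = φ b)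

theorem IsM.unique {m : ℕ} {rel : Fin M → Fin M → Prop} {φ ψ : Equiv.Perm (Fin M)} (h : IsM m rel φ) (h' : IsM m rel ψ) :
    φ = ψ := by
  ext b
  by_cases hb : b.1 < m
  · rw [(h'.2.2 (φ b) b (h.2.1 b hb) hb).1 ((h.2.2 (φ b) b (h.2.1 b hb) hb).2 rfl)]
  · rw [h.1 b (not_lt.1 hb), h'.1 b (not_lt.1 hb)]

noncomputable def cperm (m : ℕ) (rel : Fin M → Fin M → Prop) : Equiv.Perm (Fin M) :=
  if h : ∃ φ, IsM m rel φ then h.choose else 1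

theorem cperm_eq {m : ℕ} {rel : Fin M → Fin M → Prop} {φ : Equiv.Perm (Fin M)} (h : IsM m rel φ) : cperm m rel = φ := by
  have h' : ∃ φ, IsM m rel φ := ⟨φ, h⟩
  rw [cperm, dif_pos h']
  exact h'.choose_spec.unique h

/-- permutation fixing labels `≥ m` and preserving labels `< m` -/
def Pres (m : ℕ) (π : Equiv.Perm (Fin M)) : Prop :=
  (∀ a : Fin M, m ≤ a.1 → π a = a) ∧ (∀ a : Fin M, a.1 < m → (π a).1 < m)

theorem Pres.symm_lt {m : ℕ} {π : Equiv.Perm (Fin M)} (h : Pres m π) {a : Fin M} (ha : a.1 < m) : (π⁻¹ a).1 < m := by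
  by_contra h'
  have := h.1 _ (not_lt.1 h')
  rw [perm_ai] at this
  rw [← this] at h'; exact h' ha

theorem Pres.symm_ge {m : ℕ} {π : Equiv.Perm (Fin M)} (h : Pres m π) {a : Fin M} (ha : m ≤ a.1) : π⁻¹ a = a := by
  rw [Equiv.Perm.inv_eq_iff_eq, h.1 a ha]

theorem cperm_of {m : ℕ} {rel : Fin M → Fin M → Prop} {π ρ : Equiv.Perm (Fin M)} (h1 : Pres m π) (h2 : Pres m ρ)
    (h : ∀ a b : Fin M, a.1 < m → b.1 < m → (rel (π a) (ρ b) ↔ a = b)) : cperm m rel = π * ρ⁻¹ := by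
  refine cperm_eq ⟨fun a ha => ?_, fun a ha => ?_, fun a b ha hb => ?_⟩
  · rw [Equiv.Perm.mul_apply, h2.symm_ge ha, h1.1 a ha]
  · rw [Equiv.Perm.mul_apply]; exact h1.2 _ (h2.symm_lt ha)
  · have := h (π⁻¹ a) (ρ⁻¹ b) (h1.symm_lt ha) (h2.symm_lt hb)
    rw [perm_ai, perm_ai] at this
    rw [this, Equiv.Perm.mul_apply, Equiv.Perm.inv_eq_iff_eq]
end perms

section node
variable {Ω ι : Type*} {M : ℕ} {A : Type*} [Nonempty A] [DecidableEq ι]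
  (cnt : Finset ι → Ω → ℕ) (Mt : Finset ι → Finset ι → Ω → Fin M → Fin M → Prop)
  (Vl : Finset ι → ι → Ω → Fin M → A → Prop)

def GoodN (J1 J2 JB : Finset ι) (i : ι) (T : Ω) : Prop :=
  ∃ (m : ℕ) (π1 π2 πB : Equiv.Perm (Fin M)) (vl : Fin M → A),
    cnt J1 T = m ∧ cnt J2 T = m ∧ cnt JB T = m ∧ Pres m π1 ∧ Pres m π2 ∧ Pres m πB ∧
    (∀ a b : Fin M, a.1 < m → b.1 < m → (Mt J1 J2 T (π1 a) (π2 b) ↔ a = b)) ∧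
    (∀ a b : Fin M, a.1 < m → b.1 < m → (Mt J2 JB T (π2 a) (πB b) ↔ a = b)) ∧
    (∀ a b : Fin M, a.1 < m → b.1 < m → (Mt J1 JB T (π1 a) (πB b) ↔ a = b)) ∧
    (∀ (a : Fin M) c, a.1 < m → (Vl J1 i T (π1 a) c ↔ c = vl a)) ∧
    (∀ (a : Fin M) c, a.1 < m → (Vl J2 i T (π2 a) c ↔ c = vl a)) ∧
    (∀ (a : Fin M) c, a.1 < m → (Vl JB i T (πB a) c ↔ c = vl a))

noncomputable def PM (J J' : Finset ι) (T : Ω) : Equiv.Perm (Fin M) := cperm (cnt J T) (Mt J J' T)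

noncomputable def vv (J : Finset ι) (i : ι) (T : Ω) (p : Fin M) : A :=
  if h : p.1 < cnt J T ∧ ∃ c, Vl J i T p c then h.2.choose else Classical.arbitrary A

theorem vv_eq {J : Finset ι} {i : ι} {T : Ω} {m : ℕ} {π : Equiv.Perm (Fin M)} {vl : Fin M → A} (hm : cnt J T = m)
    (hπ : Pres m π) (h : ∀ (a : Fin M) c, a.1 < m → (Vl J i T (π a) c ↔ c = vl a)) (a : Fin M) :
    vv cnt Vl J i T (π a) = if a.1 < m then vl a else Classical.arbitrary A := by
  split_ifs with ha
  · have h' : (π a).1 < cnt J T ∧ ∃ c, Vl J i T (π a) c := ⟨hm ▸ hπ.2 a ha, vl a, (h a _ ha).2 rfl⟩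
    rw [vv, dif_pos h']
    exact (h a _ ha).1 h'.2.choose_spec
  · rw [hπ.1 a (not_lt.1 ha), vv, dif_neg]
    rw [hm]; tauto

/-- consequences of goodness -/
theorem GoodN.cons {J1 J2 JB : Finset ι} {i : ι} {T : Ω} (h : GoodN cnt Mt Vl J1 J2 JB i T) :
    PM cnt Mt J1 J2 T * PM cnt Mt J2 JB T = PM cnt Mt J1 JB T ∧
    (∀ p, vv cnt Vl J1 i T (PM cnt Mt J1 JB T p) = vv cnt Vl JB i T p) ∧
    (∀ (p : Fin M) c, p.1 < cnt J2 T → Vl J2 i T p c → vv cnt Vl JB i T ((PM cnt Mt J2 JB T)⁻¹ p) = c) := by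
  obtain ⟨m, π1, π2, πB, vl, c1, c2, cB, p1, p2, pB, m12, m2B, m1B, v1, v2, vB⟩ := h
  have e12 : PM cnt Mt J1 J2 T = π1 * π2⁻¹ := by rw [PM, c1]; exact cperm_of p1 p2 m12
  have e2B : PM cnt Mt J2 JB T = π2 * πB⁻¹ := by rw [PM, c2]; exact cperm_of p2 pB m2B
  have e1B : PM cnt Mt J1 JB T = π1 * πB⁻¹ := by rw [PM, c1]; exact cperm_of p1 pB m1B
  refine ⟨by rw [e12, e2B, e1B]; group, fun p => ?_, fun p c hp hc => ?_⟩
  · obtain ⟨a, rfl⟩ := πB.surjective p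
    rw [e1B, vv_eq cnt Vl cB pB vB, Equiv.Perm.mul_apply, perm_ia, vv_eq cnt Vl c1 p1 v1]
  · obtain ⟨a, rfl⟩ := π2.surjective p
    have ha : a.1 < m := by
      have := p2.symm_lt (c2 ▸ hp); rwa [perm_ia] at this
    rw [e2B, mul_inv_rev, inv_inv, Equiv.Perm.mul_apply, perm_ia, vv_eq cnt Vl cB pB vB, if_pos ha]
    exact ((v2 a c ha).1 hc).symm

theorem GoodN.congr {J1 J2 JB : Finset ι} {i : ι} {T T' : Ω} (h1 : ∀ J ∈ [J1, J2, JB], cnt J T = cnt J T')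
    (h2 : ∀ J ∈ [J1, J2, JB], ∀ J' ∈ [J1, J2, JB], Mt J J' T = Mt J J' T') (h3 : ∀ J ∈ [J1, J2, JB], Vl J i T = Vl J i T') :
    GoodN cnt Mt Vl J1 J2 JB i T ↔ GoodN cnt Mt Vl J1 J2 JB i T' := by
  unfold GoodN
  rw [h1 J1 (by simp), h1 J2 (by simp), h1 JB (by simp), h2 J1 (by simp) J2 (by simp), h2 J2 (by simp) JB (by simp),
    h2 J1 (by simp) JB (by simp), h3 J1 (by simp), h3 J2 (by simp), h3 JB (by simp)]
end node


section decode
variable {F : Type} [Field F] [Fintype F] {n a0 N : ℕ}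

theorem exists_S {i1 i3 : Fin N} (h13 : i1 ≤ i3) (h : Fl F n a0 N → ℝ) :
    ∃ S : Fl F n a0 N → Fl F n a0 N, (∀ T j, i1 ≤ j → j ≤ i3 → cX (S T) j = cX T j) ∧
      (∀ T T', cX T i1 = cX T' i1 → ∀ j ≤ i1, cX (S T) j = cX (S T') j) ∧
      (∀ T T', cX T i3 = cX T' i3 → ∀ j, i3 ≤ j → cX (S T) j = cX (S T') j) ∧ EE (fun T => h (S T)) ≤ EE h := by
  have hD1 : Bdy (univ.filter (· < i1)) {i1} := by
    intro a ha b hb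
    simp only [mem_filter, mem_univ, true_and, not_lt] at ha hb
    exact ⟨fun _ => ⟨i1, by simp, ha.le, hb⟩, fun h => absurd (h.trans ha) (not_lt.2 hb)⟩
  have hD3 : Bdy (univ.filter (i3 < ·)) {i3} := by
    intro a ha b hb
    simp only [mem_filter, mem_univ, true_and, not_lt] at ha hb
    exact ⟨fun h => absurd (ha.trans h) (not_lt.2 hb), fun _ => ⟨i3, by simp, hb, ha.le⟩⟩
  obtain ⟨r1, m1, c1, e1⟩ := fsp_exists hD1 h
  obtain ⟨r3, m3, c3, e3⟩ := fsp_exists hD3 (fun T => h (fsp (univ.filter (· < i1)) (r1 T) T))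
  set U : Fl F n a0 N → Fl F n a0 N := fun T => fsp (univ.filter (i3 < ·)) (r3 T) T with hU
  have k3 : ∀ T j, cX (U T) j = if i3 < j then cX (r3 T) j else cX T j := fun T j => by
    rw [hU]; beta_reduce; rw [cX_fsp hD3 (c3 T)]; simp
  have k1 : ∀ T j, cX (fsp (univ.filter (· < i1)) (r1 T) T) j = if j < i1 then cX (r1 T) j else cX T j := fun T j => by
    rw [cX_fsp hD1 (c1 T)]; simp
  refine ⟨fun T => fsp (univ.filter (· < i1)) (r1 (U T)) (U T), fun T j h1 h3 => ?_, fun T T' hT j hj => ?_, fun T T' hT j hj => ?_, e3.trans e1⟩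
  · rw [k1, if_neg (not_lt.2 h1), k3, if_neg (not_lt.2 h3)]
  · have hu : cX (U T) i1 = cX (U T') i1 := by rw [k3, k3, if_neg (not_lt.2 h13), if_neg (not_lt.2 h13), hT]
    beta_reduce
    rw [k1, k1]
    split_ifs with hj'
    · rw [m1 (U T) (U T') (by simpa using hu)]
    · rw [le_antisymm hj (not_lt.1 hj')]; exact hu
  · beta_reduce
    rw [k1, k1, if_neg (not_lt.2 (h13.trans hj)), if_neg (not_lt.2 (h13.trans hj)), k3, k3]
    split_ifs with hj'
    · rw [m3 T T' (by simpa using hT)]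
    · rw [le_antisymm (not_lt.1 hj') hj, hT]

theorem factor2 {β : Type*} [Nonempty β] {i j : Fin N} {φ : Fl F n a0 N → β} (h : Ms cX {i, j} φ) :
    ∃ Φ : Sb F n → Sb F n → β, ∀ T, φ T = Φ (cX T i) (cX T j) := by
  refine ⟨fun x y => if h : ∃ T : Fl F n a0 N, cX T i = x ∧ cX T j = y then φ h.choose else Classical.arbitrary β, fun T => ?_⟩
  have hh : ∃ T' : Fl F n a0 N, cX T' i = cX T i ∧ cX T' j = cX T j := ⟨T, rfl, rfl⟩
  beta_reduce
  rw [dif_pos hh]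
  refine h _ _ fun k hk => ?_
  simp only [mem_insert, mem_singleton] at hk
  rcases hk with rfl | rfl
  · exact hh.choose_spec.1.symm
  · exact hh.choose_spec.2.symm

theorem factor3 {β : Type*} [Nonempty β] {i j k : Fin N} {φ : Fl F n a0 N → β} (h : Ms cX {i, j, k} φ) :
    ∃ Φ : Sb F n → Sb F n → Sb F n → β, ∀ T, φ T = Φ (cX T i) (cX T j) (cX T k) := by
  refine ⟨fun x y z => if h : ∃ T : Fl F n a0 N, cX T i = x ∧ cX T j = y ∧ cX T k = z then φ h.choose else Classical.arbitrary β, fun T => ?_⟩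
  have hh : ∃ T' : Fl F n a0 N, cX T' i = cX T i ∧ cX T' j = cX T j ∧ cX T' k = cX T k := ⟨T, rfl, rfl, rfl⟩
  beta_reduce
  rw [dif_pos hh]
  refine h _ _ fun l hk => ?_
  simp only [mem_insert, mem_singleton] at hk
  rcases hk with rfl | rfl | rfl
  · exact hh.choose_spec.1.symm
  · exact hh.choose_spec.2.1.symm
  · exact hh.choose_spec.2.2.symm

variable {M : ℕ} {A : Type*} [Nonempty A]
  (cnt : Finset (Fin N) → Fl F n a0 N → ℕ) (Mt : Finset (Fin N) → Finset (Fin N) → Fl F n a0 N → Fin M → Fin M → Prop)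
  (Vl : Finset (Fin N) → Fin N → Fl F n a0 N → Fin M → A → Prop)

variable {cnt Mt Vl}

theorem PM_congr (hc : ∀ J, Ms cX J (cnt J)) (hM : ∀ J J', Ms cX (J ∪ J') (Mt J J')) {J J' : Finset (Fin N)} {T T' : Fl F n a0 N}
    (h : ∀ j ∈ J, cX T j = cX T' j) (h' : ∀ j ∈ J', cX T j = cX T' j) : PM cnt Mt J J' T = PM cnt Mt J J' T' := by
  unfold PM
  rw [hc J T T' h, hM J J' T T' (fun j hj => (mem_union.1 hj).elim (h j) (h' j))]

theorem vv_congr (hc : ∀ J, Ms cX J (cnt J)) (hV : ∀ J i, Ms cX (insert i J) (Vl J i)) {J : Finset (Fin N)} {i : Fin N} {T T' : Fl F n a0 N}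
    (h : ∀ j ∈ J, cX T j = cX T' j) (h' : cX T i = cX T' i) : vv cnt Vl J i T = vv cnt Vl J i T' := by
  have e1 := hc J T T' h
  have e2 := hV J i T T' (fun j hj => (mem_insert.1 hj).elim (fun e => e ▸ h') (h j))
  funext p
  unfold vv
  simp only [e1, e2]

theorem core_cocycle [Nonempty (Fl F n a0 N)] (hq : (10:ℝ)^21 ≤ Fintype.card F) (hc : ∀ J, Ms cX J (cnt J)) (hM : ∀ J J', Ms cX (J ∪ J') (Mt J J'))
    {J1 J2 JB : Finset (Fin N)} {i1 i3 i : Fin N} {ε : ℝ} (hJ1 : ∀ j ∈ J1, j ≤ i1) (hJB : ∀ j ∈ JB, i3 ≤ j) (hJ2 : J2.Nonempty)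
    (h12 : ∀ j ∈ J2, i1 < j) (h23 : ∀ j ∈ J2, j < i3) (S : Fl F n a0 N → Fl F n a0 N)
    (s1 : ∀ T j, i1 ≤ j → j ≤ i3 → cX (S T) j = cX T j)
    (s2 : ∀ T T', cX T i1 = cX T' i1 → ∀ j ≤ i1, cX (S T) j = cX (S T') j)
    (s3 : ∀ T T', cX T i3 = cX T' i3 → ∀ j, i3 ≤ j → cX (S T) j = cX (S T') j)
    (hε : EE (fun T => ind (¬ GoodN cnt Mt Vl J1 J2 JB i (S T))) ≤ ε) :
    ∃ h h' : Sb F n → Equiv.Perm (Fin M), EE (fun T => ind (h (cX T i1) * PM cnt Mt J1 JB (S T) ≠ h' (cX T i3))) ≤ (200 * Cf 3) * ε := by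
  set i2 := J2.min' hJ2
  set i2' := J2.max' hJ2
  have m2 : i2 ∈ J2 := min'_mem _ _
  have m2' : i2' ∈ J2 := max'_mem _ _
  have l22 : i2 ≤ i2' := min'_le _ _ m2'
  set D := univ.filter (fun j => i2 < j ∧ j < i2') with hDdef
  have hD : Bdy D {i2, i2'} := by
    intro a ha b hb
    simp only [hDdef, mem_filter, mem_univ, true_and, not_and, not_lt] at ha hb
    refine ⟨fun h => ⟨i2', by simp, ha.2.le, hb (ha.1.trans h)⟩, fun h => ⟨i2, by simp, ?_, ha.1.le⟩⟩
    by_contra! h'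
    exact absurd (hb h') (not_le.2 (h.trans ha.2))
  obtain ⟨r, mr, cr, er⟩ := fsp_exists hD (fun T => ind (¬ GoodN cnt Mt Vl J1 J2 JB i (S T)))
  set U : Fl F n a0 N → Fl F n a0 N := fun T => fsp D (r T) T with hU
  have kU : ∀ T j, cX (U T) j = if j ∈ D then cX (r T) j else cX T j := fun T j => cX_fsp hD (cr T) j
  have o1 : i1 ∉ D := by simp [hDdef]; intro h; exact absurd (h12 _ m2) (not_lt.2 h.le)
  have o3 : i3 ∉ D := by simp [hDdef]; intro h; exact (h23 _ m2').le
  have kU1 : ∀ T, cX (U T) i1 = cX T i1 := fun T => by rw [kU, if_neg o1]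
  have kU3 : ∀ T, cX (U T) i3 = cX T i3 := fun T => by rw [kU, if_neg o3]
  have kU2 : ∀ T T', cX T i2 = cX T' i2 → cX T i2' = cX T' i2' → ∀ j ∈ J2, cX (S (U T)) j = cX (S (U T')) j := by
    intro T T' e e' j hj
    rw [s1 _ _ (h12 j hj).le (h23 j hj).le, s1 _ _ (h12 j hj).le (h23 j hj).le, kU, kU]
    split_ifs with hjD
    · rw [mr T T' (by simp [e, e'])]
    · simp only [hDdef, mem_filter, mem_univ, true_and, not_and, not_lt] at hjD
      rcases (min'_le J2 j hj).eq_or_lt with h0 | h0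
      · rw [← h0]; exact e
      · rw [le_antisymm (le_max' J2 j hj) (hjD h0)]; exact e'
  have aMs : Ms cX {i1, i2, i2'} (fun T => PM cnt Mt J1 J2 (S (U T))) := fun T T' h => by
    refine PM_congr hc hM (fun j hj => s2 _ _ ?_ j (hJ1 j hj)) (kU2 T T' (h _ (by simp)) (h _ (by simp)))
    rw [kU1, kU1]; exact h _ (by simp)
  have bMs : Ms cX {i2, i2', i3} (fun T => PM cnt Mt J2 JB (S (U T))) := fun T T' h => by
    refine PM_congr hc hM (kU2 T T' (h _ (by simp)) (h _ (by simp))) (fun j hj => s3 _ _ ?_ j (hJB j hj))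
    rw [kU3, kU3]; exact h _ (by simp)
  have pMs : Ms cX {i1, i3} (fun T => PM cnt Mt J1 JB (S T)) := fun T T' h => by
    exact PM_congr hc hM (fun j hj => s2 _ _ (h _ (by simp)) j (hJ1 j hj)) (fun j hj => s3 _ _ (h _ (by simp)) j (hJB j hj))
  have pU : ∀ T, PM cnt Mt J1 JB (S (U T)) = PM cnt Mt J1 JB (S T) := fun T =>
    PM_congr hc hM (fun j hj => s2 _ _ (kU1 T) j (hJ1 j hj)) (fun j hj => s3 _ _ (kU3 T) j (hJB j hj))
  obtain ⟨Aa, hA⟩ := factor3 aMs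
  obtain ⟨Bb, hB⟩ := factor3 bMs
  obtain ⟨Φ, hΦ⟩ := factor2 pMs
  have hn : a0 + i3.1 ≤ n := by
    obtain ⟨T⟩ := ‹Nonempty (Fl F n a0 N)›
    rw [← cX_dm T i3]; exact dm_le _
  have c12 : i1 < i2 := h12 _ m2
  have c23 : i2' < i3 := h23 _ m2'
  obtain ⟨h, h', hh⟩ := main_cocycle hq (a0 + i1) (a0 + i2) (a0 + i2') (a0 + i3) (by have : i1.1 < i2.1 := c12; omega)
    (by have : i2.1 ≤ i2'.1 := l22; omega) (by have : i2'.1 < i3.1 := c23; omega) hn Aa Bb Φ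
  refine ⟨h, h', ?_⟩
  rw [law_fe ((c12.trans_le l22).trans c23).le, law_pp c12 l22 c23] at hh
  have e1 : EE (fun T => ind (h (cX T i1) * PM cnt Mt J1 JB (S T) ≠ h' (cX T i3))) =
      EE (fun T : Fl F n a0 N => ind (h (cX T i1) * Φ (cX T i1) (cX T i3) ≠ h' (cX T i3))) := EE_congr fun T => by
    have := hΦ T; beta_reduce at this; rw [this]
  rw [e1]
  refine hh.trans (mul_le_mul_of_nonneg_left ((EE_mono fun T => ind_mono ?_).trans (er.trans hε)) (by rw [Cf_three]; norm_num))
  intro hne hg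
  apply hne
  have q1 := hA T; have q2 := hB T; have q3 := hΦ T
  beta_reduce at q1 q2 q3
  rw [← q1, ← q2, ← q3, ← pU]
  exact (GoodN.cons cnt Mt Vl hg).1

theorem core_decode [Nonempty (Fl F n a0 N)] (hq : (10:ℝ)^21 ≤ Fintype.card F) (hc : ∀ J, Ms cX J (cnt J)) (hM : ∀ J J', Ms cX (J ∪ J') (Mt J J'))
    (hV : ∀ J i, Ms cX (insert i J) (Vl J i))
    {β : Type*} {s : Finset β} (hs : s.Nonempty) {J1 JB : Finset (Fin N)} {J2 : β → Finset (Fin N)} {pt : β → Fin N}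
    {i1 i3 : Fin N} {ε : ℝ} (hJ1 : ∀ j ∈ J1, j ≤ i1) (hJB : ∀ j ∈ JB, i3 ≤ j) (hJ2 : ∀ b ∈ s, (J2 b).Nonempty)
    (h12 : ∀ b ∈ s, ∀ j ∈ J2 b, i1 < j) (h2p : ∀ b ∈ s, ∀ j ∈ J2 b, j < pt b) (hp3 : ∀ b ∈ s, pt b < i3)
    (hε : av s (fun b => EE (fun T => ind (¬ GoodN cnt Mt Vl J1 (J2 b) JB (pt b) T))) ≤ ε) :
    ∃ (f : Sb F n → Fin M → A) (Idx : Fl F n a0 N → Finset (Fin N) → Fin M → Fin M),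
      av s (fun b => EE (fun T => ind (∃ p c, p.1 < cnt (J2 b) T ∧ Vl (J2 b) (pt b) T p c ∧ c ≠ f (cX T (pt b)) (Idx T (J2 b) p))))
        ≤ (2 + 200 * Cf 3) * ε := by
  have h1p : ∀ b ∈ s, i1 < pt b := fun b hb => by
    obtain ⟨j, hj⟩ := hJ2 b hb
    exact (h12 b hb j hj).trans (h2p b hb j hj)
  have h13 : i1 ≤ i3 := by
    obtain ⟨b, hb⟩ := hs
    exact ((h1p b hb).trans (hp3 b hb)).le
  have h23 : ∀ b ∈ s, ∀ j ∈ J2 b, j < i3 := fun b hb j hj => (h2p b hb j hj).trans (hp3 b hb)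
  obtain ⟨S, s1, s2, s3, se⟩ := exists_S h13 (fun T => av s (fun b => ind (¬ GoodN cnt Mt Vl J1 (J2 b) JB (pt b) T)))
  rw [EE_av, EE_av] at se
  replace se := se.trans hε
  obtain ⟨b2, hb2, hb2e⟩ := exists_le_av hs (fun b => EE (fun T => ind (¬ GoodN cnt Mt Vl J1 (J2 b) JB (pt b) (S T))))
  obtain ⟨h, h', hh⟩ := core_cocycle hq hc hM hJ1 hJB (hJ2 b2 hb2) (h12 b2 hb2) (h23 b2 hb2) S s1 s2 s3 (hb2e.trans se)
  set w1 : Fin N → Fl F n a0 N → Fin M → A := fun i T c => vv cnt Vl J1 i (S T) ((h (cX T i1))⁻¹ c) with hw1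
  set w3 : Fin N → Fl F n a0 N → Fin M → A := fun i T c => vv cnt Vl JB i (S T) ((h' (cX T i3))⁻¹ c) with hw3
  have hD : ∀ i : Fin N, Bdy (univ.filter (· < i)) {i} := by
    intro i a ha b hb
    simp only [mem_filter, mem_univ, true_and, not_lt] at ha hb
    exact ⟨fun _ => ⟨i, by simp, ha.le, hb⟩, fun h => absurd (h.trans ha) (not_lt.2 hb)⟩
  choose r mr cr er using fun i => fsp_exists (hD i) (fun T : Fl F n a0 N => ind (w1 i T ≠ w3 i T))
  have fx : ∀ i, ∃ g : Sb F n → Fin M → A, ∀ T, w1 i (r i T) = g (cX T i) := fun i => by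
    have : Ms cX {i, i} (fun T => w1 i (r i T)) := fun T T' e => by
      beta_reduce; rw [mr i T T' (fun j hj => e j (by simpa using hj))]
    obtain ⟨Φ, hΦ⟩ := factor2 this
    exact ⟨fun x => Φ x x, hΦ⟩
  choose g hg using fx
  have hdec : ∀ i, i1 < i → i < i3 → EE (fun T => ind (g i (cX T i) ≠ w3 i T)) ≤ EE (fun T => ind (w1 i T ≠ w3 i T)) := by
    intro i hi hi'
    refine le_trans (le_of_eq (EE_congr fun T => ?_)) (er i)
    have k : ∀ j, cX (fsp (univ.filter (· < i)) (r i T) T) j = if j < i then cX (r i T) j else cX T j := fun j => by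
      rw [cX_fsp (hD i) (cr i T)]; simp
    have ki : cX (r i T) i = cX T i := mem_cl.1 (cr i T) i (by simp)
    have a1 : w1 i (fsp (univ.filter (· < i)) (r i T) T) = w1 i (r i T) := by
      have c1 : cX (fsp (univ.filter (· < i)) (r i T) T) i1 = cX (r i T) i1 := by rw [k, if_pos hi]
      funext c
      simp only [hw1]
      rw [c1, vv_congr hc hV (fun j hj => s2 _ _ c1 j (hJ1 j hj)) ?_]
      rw [s1 _ _ hi.le hi'.le, s1 _ _ hi.le hi'.le, k, if_neg (lt_irrefl _), ki]
    have a3 : w3 i (fsp (univ.filter (· < i)) (r i T) T) = w3 i T := by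
      have c3 : cX (fsp (univ.filter (· < i)) (r i T) T) i3 = cX T i3 := by rw [k, if_neg (not_lt.2 hi'.le)]
      funext c
      simp only [hw3]
      rw [c3, vv_congr hc hV (fun j hj => s3 _ _ c3 j (hJB j hj)) ?_]
      rw [s1 _ _ hi.le hi'.le, s1 _ _ hi.le hi'.le, k, if_neg (lt_irrefl _)]
    rw [a1, a3, hg]
  refine ⟨fun y => if hy : ∃ i : Fin N, dm y = a0 + i then g hy.choose y else fun _ => Classical.arbitrary A,
    fun T J2 p => h' (cX T i3) ((PM cnt Mt J2 JB (S T))⁻¹ p), ?_⟩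
  have hf : ∀ (T : Fl F n a0 N) (i : Fin N), (if hy : ∃ i' : Fin N, dm (cX T i) = a0 + i' then g hy.choose (cX T i) else fun _ => Classical.arbitrary A) = g i (cX T i) := by
    intro T i
    have hy : ∃ i' : Fin N, dm (cX T i) = a0 + i' := ⟨i, cX_dm T i⟩
    rw [dif_pos hy]
    have : hy.choose = i := by
      have := hy.choose_spec
      have h0 := cX_dm T i
      exact Fin.ext (by omega)
    rw [this]
  simp only [hf]
  have key : ∀ b ∈ s, EE (fun T => ind (∃ p c, p.1 < cnt (J2 b) T ∧ Vl (J2 b) (pt b) T p c ∧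
      c ≠ g (pt b) (cX T (pt b)) (h' (cX T i3) ((PM cnt Mt (J2 b) JB (S T))⁻¹ p)))) ≤
      2 * EE (fun T => ind (¬ GoodN cnt Mt Vl J1 (J2 b) JB (pt b) (S T))) + (200 * Cf 3) * ε := by
    intro b hb
    have k1 : EE (fun T => ind (∃ p c, p.1 < cnt (J2 b) T ∧ Vl (J2 b) (pt b) T p c ∧
        c ≠ g (pt b) (cX T (pt b)) (h' (cX T i3) ((PM cnt Mt (J2 b) JB (S T))⁻¹ p)))) ≤
        EE (fun T => ind (g (pt b) (cX T (pt b)) ≠ w3 (pt b) T) + ind (¬ GoodN cnt Mt Vl J1 (J2 b) JB (pt b) (S T))) := by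
      refine EE_mono fun T => ind_or ?_
      rintro ⟨p, c, hp, hv, hne⟩
      by_contra! hcon
      obtain ⟨e, gd⟩ := hcon
      apply hne
      have in2 : ∀ j ∈ J2 b, cX (S T) j = cX T j := fun j hj => s1 T j (h12 b hb j hj).le (h23 b hb j hj).le
      have inp : cX (S T) (pt b) = cX T (pt b) := s1 T _ (h1p b hb).le (hp3 b hb).le
      rw [← hc (J2 b) _ _ in2] at hp
      rw [← hV (J2 b) (pt b) (S T) T (fun j hj => (mem_insert.1 hj).elim (fun e => e ▸ inp) (in2 j))] at hv
      have := (GoodN.cons cnt Mt Vl gd).2.2 p c hp hv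
      rw [e, hw3]
      simp only [perm_ia]
      exact this.symm
    have k2 : EE (fun T => ind (w1 (pt b) T ≠ w3 (pt b) T)) ≤ EE (fun T => ind (¬ GoodN cnt Mt Vl J1 (J2 b) JB (pt b) (S T)) +
        ind (h (cX T i1) * PM cnt Mt J1 JB (S T) ≠ h' (cX T i3))) := by
      refine EE_mono fun T => ind_or ?_
      intro hne
      by_contra! hcon
      obtain ⟨gd, e⟩ := hcon
      apply hne
      funext c
      simp only [hw1, hw3]
      rw [← e, mul_inv_rev, Equiv.Perm.mul_apply, ← (GoodN.cons cnt Mt Vl gd).2.1, perm_ai]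
    rw [EE_add] at k1 k2
    have k3 := hdec (pt b) (h1p b hb) (hp3 b hb)
    linarith
  refine (av_mono key).trans ?_
  rw [av_add, av_mul, av_const hs]
  linarith

end decode


section dist
variable {Y : Type*} [Fintype Y]

noncomputable def push (k : Y → Y) (μ : Y → ℝ) (σ : Y) : ℝ := ∑ ρ, μ ρ * ind (k ρ = σ)
noncomputable def coll (μ : Y → ℝ) : ℝ := ∑ σ, μ σ ^ 2

theorem push_nonneg {k : Y → Y} {μ : Y → ℝ} (h : ∀ y, 0 ≤ μ y) (σ : Y) : 0 ≤ push k μ σ :=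
  sum_nonneg fun ρ _ => mul_nonneg (h ρ) (ind_nonneg _)

theorem push_eq (k : Y → Y) (μ : Y → ℝ) (σ : Y) : push k μ σ = ∑ ρ ∈ univ.filter (fun ρ => k ρ = σ), μ ρ := by
  unfold push ind
  rw [sum_filter]
  exact sum_congr rfl fun ρ _ => by split_ifs <;> simp

theorem push_push (k k' : Y → Y) (μ : Y → ℝ) (σ : Y) : push k (push k' μ) σ = push (fun y => k (k' y)) μ σ := by
  unfold push
  simp only [sum_mul]
  rw [sum_comm]
  refine sum_congr rfl fun ρ _ => ?_
  rw [sum_eq_single (k' ρ)]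
  · rw [ind_true (p := k' ρ = k' ρ) rfl, mul_one]
  · intro b _ hb; rw [ind_false (p := k' ρ = b) (fun h => hb h.symm)]; simp
  · simp

theorem sum_fib (k : Y → Y) (f : Y → ℝ) : ∑ σ, ∑ ρ ∈ univ.filter (fun ρ => k ρ = σ), f ρ = ∑ ρ, f ρ :=
  sum_fiberwise univ k f

theorem push_sum (k : Y → Y) (μ : Y → ℝ) : ∑ σ, push k μ σ = ∑ ρ, μ ρ := by
  simp only [push_eq]; exact sum_fib k μ

theorem fib_nonneg {k : Y → Y} {μ : Y → ℝ} (h : ∀ y, 0 ≤ μ y) (σ : Y) :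
    0 ≤ push k μ σ ^ 2 - ∑ ρ ∈ univ.filter (fun ρ => k ρ = σ), μ ρ ^ 2 := by
  rw [push_eq, sub_nonneg]
  exact sum_sq_le_sq_sum_of_nonneg fun i _ => h i

theorem coll_sub (k : Y → Y) (μ : Y → ℝ) : coll (push k μ) - coll μ =
    ∑ σ, (push k μ σ ^ 2 - ∑ ρ ∈ univ.filter (fun ρ => k ρ = σ), μ ρ ^ 2) := by
  rw [sum_sub_distrib, sum_fib k (fun ρ => μ ρ ^ 2)]; rfl

theorem coll_le {k : Y → Y} {μ : Y → ℝ} (h : ∀ y, 0 ≤ μ y) : coll μ ≤ coll (push k μ) := by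
  rw [← sub_nonneg, coll_sub]; exact sum_nonneg fun σ _ => fib_nonneg h σ

theorem heavy {k : Y → Y} {μ : Y → ℝ} (h : ∀ y, 0 ≤ μ y) {ε τ : ℝ} (hc : coll (push k μ) - coll μ ≤ ε) (hτ : 0 < τ) {σ : Y}
    (hσ : τ ≤ push k μ σ) : ∃ ρ, k ρ = σ ∧ push k μ σ - μ ρ ≤ ε / τ := by
  have hpos : 0 < push k μ σ := hτ.trans_le hσ
  have hne : (univ.filter (fun ρ => k ρ = σ)).Nonempty := by
    by_contra hcon
    rw [not_nonempty_iff_eq_empty] at hcon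
    rw [push_eq, hcon, sum_empty] at hpos
    exact lt_irrefl _ hpos
  obtain ⟨ρ, hρ, hmax⟩ := exists_max_image _ μ hne
  refine ⟨ρ, (mem_filter.1 hρ).2, ?_⟩
  have h1 : push k μ σ ^ 2 - ∑ ρ ∈ univ.filter (fun ρ => k ρ = σ), μ ρ ^ 2 ≤ ε := by
    rw [coll_sub] at hc
    exact (single_le_sum (f := fun σ => push k μ σ ^ 2 - ∑ ρ ∈ univ.filter (fun ρ => k ρ = σ), μ ρ ^ 2) (fun σ _ => fib_nonneg h σ) (mem_univ σ)).trans hc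
  have h2 : ∑ ρ ∈ univ.filter (fun ρ => k ρ = σ), μ ρ ^ 2 ≤ μ ρ * push k μ σ := by
    rw [push_eq, mul_sum]
    refine sum_le_sum fun x hx => ?_
    rw [sq]; exact mul_le_mul_of_nonneg_right (hmax x hx) (h x)
  have hle : 0 ≤ push k μ σ - μ ρ := by
    rw [push_eq, sub_nonneg]; exact single_le_sum (f := μ) (fun i _ => h i) hρ
  rw [le_div_iff₀ hτ]
  calc (push k μ σ - μ ρ) * τ ≤ (push k μ σ - μ ρ) * push k μ σ := mul_le_mul_of_nonneg_left hσ hle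
    _ ≤ ε := by nlinarith

theorem card_heavy {μ : Y → ℝ} (h : ∀ y, 0 ≤ μ y) (h1 : ∑ y, μ y ≤ 1) (τ : ℝ) : ((univ.filter (fun y => τ ≤ μ y)).card : ℝ) * τ ≤ 1 := by
  calc ((univ.filter (fun y => τ ≤ μ y)).card : ℝ) * τ = ∑ y ∈ univ.filter (fun y => τ ≤ μ y), τ := by rw [sum_const, nsmul_eq_mul]
    _ ≤ ∑ y ∈ univ.filter (fun y => τ ≤ μ y), μ y := sum_le_sum fun y hy => (mem_filter.1 hy).2
    _ ≤ ∑ y, μ y := sum_le_sum_of_subset_of_nonneg (filter_subset _ _) fun y _ _ => h y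
    _ ≤ 1 := h1

/-- enumeration -/
noncomputable def en [Nonempty Y] {M : ℕ} (L : Finset Y) (p : Fin M) : Y :=
  if h : p.1 < L.card then (L.equivFin.symm ⟨p.1, h⟩).1 else Classical.arbitrary Y

variable [Nonempty Y] {M : ℕ}

theorem en_mem {L : Finset Y} {p : Fin M} (h : p.1 < L.card) : en L p ∈ L := by
  rw [en, dif_pos h]; exact (L.equivFin.symm ⟨p.1, h⟩).2

theorem en_inj {L : Finset Y} {p p' : Fin M} (h : p.1 < L.card) (h' : p'.1 < L.card) (e : en L p = en L p') : p = p' := by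
  rw [en, dif_pos h, en, dif_pos h'] at e
  have := L.equivFin.symm.injective (Subtype.ext e)
  exact Fin.ext (by simpa using this)

theorem en_surj {L : Finset Y} (hL : L.card ≤ M) {σ : Y} (hσ : σ ∈ L) : ∃ p : Fin M, p.1 < L.card ∧ en L p = σ := by
  have hb := (L.equivFin ⟨σ, hσ⟩).2
  refine ⟨⟨L.equivFin ⟨σ, hσ⟩, hb.trans_le hL⟩, hb, ?_⟩
  rw [en, dif_pos hb]; simp

theorem en_perm {L : Finset Y} (hL : L.card ≤ M) (y : Fin M → Y) (hy : ∀ p : Fin M, p.1 < L.card → y p ∈ L)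
    (hinj : ∀ p p' : Fin M, p.1 < L.card → p'.1 < L.card → y p = y p' → p = p') :
    ∃ π : Equiv.Perm (Fin M), Pres L.card π ∧ ∀ p : Fin M, p.1 < L.card → en L (π p) = y p := by
  choose! u hu1 hu2 using fun (p : Fin M) (hp : p.1 < L.card) => en_surj hL (hy p hp)
  set φ : Fin M → Fin M := fun p => if p.1 < L.card then u p else p with hφ
  have hinjφ : Function.Injective φ := by
    intro p p' e
    simp only [hφ] at e
    split_ifs at e with h1 h2 h2
    · exact hinj p p' h1 h2 (by rw [← hu2 p h1, ← hu2 p' h2, e])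
    · exact absurd (e ▸ hu1 p h1) h2
    · exact absurd (e.symm ▸ hu1 p' h2) h1
    · exact e
  refine ⟨Equiv.ofBijective φ (Finite.injective_iff_bijective.1 hinjφ), ⟨fun a ha => ?_, fun a ha => ?_⟩, fun p hp => ?_⟩
  · simp [hφ, not_lt.2 ha]
  · simp [hφ, ha, hu1 a ha]
  · simp [hφ, hp, hu2 p hp]
end dist

section good
variable {ι A : Type*} [Fintype ι] [DecidableEq ι] [Fintype A] [Nonempty A]

noncomputable def restr (c : Finset ι) (σ : ι → A) : ι → A := fun x => if x ∈ c then σ x else Classical.arbitrary A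

theorem restr_restr {c d : Finset ι} (h : c ⊆ d) (σ : ι → A) : restr c (restr d σ) = restr c σ := by
  funext x; unfold restr; split_ifs with h1 h2
  · rfl
  · exact absurd (h h1) h2
  · rfl

theorem restr_eq {c : Finset ι} {σ ρ : ι → A} : restr c σ = restr c ρ ↔ ∀ x ∈ c, σ x = ρ x := by
  constructor
  · intro h x hx
    have := congrFun h x
    simpa [restr, hx] using this
  · intro h; funext x; unfold restr; split_ifs with hx
    · exact h x hx
    · rfl

theorem restr_in {c : Finset ι} {σ : ι → A} {x : ι} (h : x ∈ c) : restr c σ x = σ x := by simp [restr, h]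

noncomputable def glue (J J' : Finset ι) (σ σ' : ι → A) : ι → A :=
  fun x => if x ∈ J then σ x else if x ∈ J' then σ' x else Classical.arbitrary A

variable {Ω : Type*} {M : ℕ} (τ : ℝ) (P : Ω → Finset ι → (ι → A) → ℝ)

noncomputable def LL (T : Ω) (J : Finset ι) : Finset (ι → A) := univ.filter (fun σ => τ ≤ P T J σ)
noncomputable def cntD (J : Finset ι) (T : Ω) : ℕ := (LL τ P T J).card
def MtD (J J' : Finset ι) (T : Ω) (a b : Fin M) : Prop := τ / 2 ≤ P T (J ∪ J') (glue J J' (en (LL τ P T J) a) (en (LL τ P T J') b))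
def VlD (J : Finset ι) (i : ι) (T : Ω) (p : Fin M) (c : A) : Prop := τ / 2 ≤ P T (insert i J) (Function.update (en (LL τ P T J) p) i c)

variable {τ P}

/-- data for one conditioning set `J` -/
structure OneOK (τ η ε : ℝ) (μ : (ι → A) → ℝ) (PJ : (ι → A) → ℝ) (J : Finset ι) : Prop where
  near : ∀ σ, |PJ σ - push (restr J) μ σ| ≤ ε
  coll : coll (push (restr J) μ) - coll μ ≤ ε
  gap : ∀ σ, τ - η ≤ PJ σ → τ + η ≤ PJ σ

structure Cst (τ η ε : ℝ) : Prop where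
  τ0 : 0 < τ
  τ1 : τ ≤ 1
  ε0 : 0 ≤ ε
  h1 : ε + ε / τ ≤ η
  h2 : ε + ε / τ < τ / 2

variable {η ε : ℝ} {μ PJ : (ι → A) → ℝ} {J K : Finset ι}

theorem OneOK.a (h : OneOK τ η ε μ PJ J) (hc : Cst τ η ε) (h0 : ∀ y, 0 ≤ μ y) {ρ : ι → A} (hρ : τ ≤ μ ρ) : τ ≤ PJ (restr J ρ) := by
  have h1 : μ ρ ≤ push (restr J) μ (restr J ρ) := by
    rw [push_eq]; exact single_le_sum (f := μ) (fun i _ => h0 i) (by simp)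
  have h2 := h.near (restr J ρ)
  rw [abs_le] at h2
  have h3 : 0 ≤ ε / τ := div_nonneg hc.ε0 hc.τ0.le
  have := h.gap (restr J ρ) (by linarith [hc.h1])
  linarith [hc.h1, hc.ε0]

theorem OneOK.b (h : OneOK τ η ε μ PJ J) (hc : Cst τ η ε) (h0 : ∀ y, 0 ≤ μ y) {σ : ι → A} (hσ : τ ≤ PJ σ) :
    ∃ ρ, τ ≤ μ ρ ∧ restr J ρ = σ ∧ push (restr J) μ σ - μ ρ ≤ ε / τ := by
  have h1 := h.gap σ (by have := div_nonneg hc.ε0 hc.τ0.le; linarith [hc.h1, hc.ε0])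
  have h2 := h.near σ
  rw [abs_le] at h2
  have h3 : 0 ≤ ε / τ := div_nonneg hc.ε0 hc.τ0.le
  have h4 : τ ≤ push (restr J) μ σ := by linarith [hc.h1]
  obtain ⟨ρ, e, hρ⟩ := heavy h0 h.coll hc.τ0 h4
  exact ⟨ρ, by linarith [hc.h1], e, hρ⟩

theorem OneOK.b' (h : OneOK τ η ε μ PJ J) (hc : Cst τ η ε) (h0 : ∀ y, 0 ≤ μ y) {ρ : ι → A} (hρ : τ ≤ μ ρ) :
    ∀ ρ', ρ' ≠ ρ → restr J ρ' = restr J ρ → push (restr J) μ (restr J ρ) - μ ρ ≤ ε / τ ∧ μ ρ' ≤ ε / τ := by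
  intro ρ' hne e
  obtain ⟨ρ2, h2, e2, hm⟩ := h.b hc h0 (h.a hc h0 hρ)
  have two : ∀ x y, x ≠ y → restr J x = restr J ρ → restr J y = restr J ρ → μ x + μ y ≤ push (restr J) μ (restr J ρ) := by
    intro x y hxy hx hy
    rw [push_eq, ← sum_pair hxy]
    refine sum_le_sum_of_subset_of_nonneg ?_ fun i _ _ => h0 i
    intro z hz
    simp only [mem_insert, mem_singleton] at hz
    rcases hz with rfl | rfl <;> simp [hx, hy]
  have : ρ2 = ρ := by
    by_contra hcon
    have := two ρ2 ρ hcon e2 rfl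
    have := hc.h2; have := hc.ε0; have := hc.τ0
    linarith
  subst this
  exact ⟨hm, by linarith [two ρ' ρ2 hne e rfl]⟩

theorem OneOK.off (h : OneOK τ η ε μ PJ J) (hc : Cst τ η ε) (h0 : ∀ y, 0 ≤ μ y) {ρ : ι → A} (hρ : τ ≤ μ ρ) :
    push (restr J) μ (restr J ρ) - μ ρ ≤ ε / τ := by
  obtain ⟨ρ2, h2, e2, hm⟩ := h.b hc h0 (h.a hc h0 hρ)
  by_cases e : ρ2 = ρ
  · subst e; exact hm
  · exact (h.b' hc h0 hρ ρ2 e e2).1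

theorem OneOK.inj (h : OneOK τ η ε μ PJ J) (hc : Cst τ η ε) (h0 : ∀ y, 0 ≤ μ y) {ρ ρ' : ι → A} (hρ : τ ≤ μ ρ) (hρ' : τ ≤ μ ρ')
    (e : restr J ρ' = restr J ρ) : ρ' = ρ := by
  by_contra hcon
  have := (h.b' hc h0 hρ ρ' hcon e).2
  have := hc.h2; have := hc.ε0; have := hc.τ0
  linarith

theorem OneOK.c (h : OneOK τ η ε μ PJ J) (hc : Cst τ η ε) (h0 : ∀ y, 0 ≤ μ y) (hJK : J ⊆ K) {PK : (ι → A) → ℝ}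
    (hK : ∀ σ, |PK σ - push (restr K) μ σ| ≤ ε) {ρ ρ' : ι → A} (hρ : τ ≤ μ ρ) (e : restr J ρ' = restr J ρ) :
    τ / 2 ≤ PK ρ' ↔ ρ' = restr K ρ := by
  have hk := hK ρ'
  rw [abs_le] at hk
  have hoff := h.off hc h0 hρ
  have q1 := hc.h2; have q2 := hc.ε0; have q3 := hc.τ0
  have q4 : 0 ≤ ε / τ := div_nonneg hc.ε0 hc.τ0.le
  constructor
  · intro hh
    by_contra hne
    have : push (restr K) μ ρ' + μ ρ ≤ push (restr J) μ (restr J ρ) := by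
      rw [push_eq, push_eq, add_comm, ← sum_insert (by simp; exact fun h => hne h.symm)]
      refine sum_le_sum_of_subset_of_nonneg ?_ fun i _ _ => h0 i
      intro z hz
      simp only [mem_insert, mem_filter, mem_univ, true_and] at hz ⊢
      rcases hz with rfl | hz
      · rfl
      · rw [← e, ← hz, restr_restr hJK]
    linarith
  · rintro rfl
    have : μ ρ ≤ push (restr K) μ (restr K ρ) := by
      rw [push_eq]; exact single_le_sum (f := μ) (fun i _ => h0 i) (by simp)
    linarith

theorem good_det (hc : Cst τ η ε) (h0 : ∀ y, 0 ≤ μ y) (h1 : ∑ y, μ y ≤ 1) (hM : 1 / τ ≤ M) {T : Ω} {J1 J2 JB : Finset ι} {i : ι}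
    (d12 : Disjoint J1 J2) (d2B : Disjoint J2 JB) (d1B : Disjoint J1 JB) (i1 : i ∉ J1) (i2 : i ∉ J2) (iB : i ∉ JB)
    (o1 : OneOK τ η ε μ (P T J1) J1) (o2 : OneOK τ η ε μ (P T J2) J2) (oB : OneOK τ η ε μ (P T JB) JB)
    (n12 : ∀ σ, |P T (J1 ∪ J2) σ - push (restr (J1 ∪ J2)) μ σ| ≤ ε)
    (n2B : ∀ σ, |P T (J2 ∪ JB) σ - push (restr (J2 ∪ JB)) μ σ| ≤ ε)
    (n1B : ∀ σ, |P T (J1 ∪ JB) σ - push (restr (J1 ∪ JB)) μ σ| ≤ ε)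
    (m1 : ∀ σ, |P T (insert i J1) σ - push (restr (insert i J1)) μ σ| ≤ ε)
    (m2 : ∀ σ, |P T (insert i J2) σ - push (restr (insert i J2)) μ σ| ≤ ε)
    (mB : ∀ σ, |P T (insert i JB) σ - push (restr (insert i JB)) μ σ| ≤ ε) :
    GoodN (M := M) (cntD τ P) (MtD τ P) (VlD τ P) J1 J2 JB i T := by
  set H : Finset (ι → A) := univ.filter (fun ρ => τ ≤ μ ρ) with hH
  have hHM : H.card ≤ M := by
    have := card_heavy h0 h1 τ
    rw [← le_div_iff₀ hc.τ0] at this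
    exact_mod_cast this.trans hM
  have inH : ∀ a : Fin M, a.1 < H.card → τ ≤ μ (en H a) := fun a ha => (mem_filter.1 (en_mem ha)).2
  have one : ∀ J, OneOK τ η ε μ (P T J) J → (LL τ P T J).card = H.card ∧ ∃ π : Equiv.Perm (Fin M), Pres H.card π ∧
      ∀ p : Fin M, p.1 < H.card → en (LL τ P T J) (π p) = restr J (en H p) := by
    intro J o
    have hcard : (LL τ P T J).card = H.card := by
      symm
      refine card_bij (fun ρ _ => restr J ρ) (fun ρ hρ => ?_) (fun ρ hρ ρ' hρ' e => ?_) (fun σ hσ => ?_)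
      · exact mem_filter.2 ⟨mem_univ _, o.a hc h0 (mem_filter.1 hρ).2⟩
      · exact o.inj hc h0 (mem_filter.1 hρ').2 (mem_filter.1 hρ).2 e
      · obtain ⟨ρ, q1, q2, -⟩ := o.b hc h0 (mem_filter.1 hσ).2
        exact ⟨ρ, mem_filter.2 ⟨mem_univ _, q1⟩, q2⟩
    refine ⟨hcard, ?_⟩
    rw [← hcard]
    refine en_perm (by rw [hcard]; exact hHM) (fun p => restr J (en H p)) (fun p hp => ?_) (fun p p' hp hp' e => ?_)
    · exact mem_filter.2 ⟨mem_univ _, o.a hc h0 (inH p (hcard ▸ hp))⟩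
    · exact en_inj (hcard ▸ hp) (hcard ▸ hp') (o.inj hc h0 (inH p' (hcard ▸ hp')) (inH p (hcard ▸ hp)) e)
  obtain ⟨c1, π1, p1, e1⟩ := one J1 o1
  obtain ⟨c2, π2, p2, e2⟩ := one J2 o2
  obtain ⟨cB, πB, pB, eB⟩ := one JB oB
  have mt : ∀ J J', Disjoint J J' → OneOK τ η ε μ (P T J) J → OneOK τ η ε μ (P T J') J' →
      (∀ σ, |P T (J ∪ J') σ - push (restr (J ∪ J')) μ σ| ≤ ε) → ∀ (π π' : Equiv.Perm (Fin M)),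
      (∀ p : Fin M, p.1 < H.card → en (LL τ P T J) (π p) = restr J (en H p)) →
      (∀ p : Fin M, p.1 < H.card → en (LL τ P T J') (π' p) = restr J' (en H p)) →
      ∀ a b : Fin M, a.1 < H.card → b.1 < H.card → (MtD τ P J J' T (π a) (π' b) ↔ a = b) := by
    intro J J' hd o o' hn π π' e e' a b ha hb
    unfold MtD
    rw [e a ha, e' b hb]
    set ρ' := glue J J' (restr J (en H a)) (restr J' (en H b)) with hρ'
    have r1 : restr J ρ' = restr J (en H a) := restr_eq.2 fun x hx => by simp [hρ', glue, hx, restr]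
    have r2 : restr J' ρ' = restr J' (en H b) := restr_eq.2 fun x hx => by
      have : x ∉ J := fun h => (disjoint_left.1 hd h) hx
      simp [hρ', glue, hx, restr, this]
    rw [o.c hc h0 subset_union_left hn (inH a ha) r1]
    constructor
    · intro h
      rw [h, restr_restr subset_union_right] at r2
      exact en_inj ha hb (o'.inj hc h0 (inH b hb) (inH a ha) r2)
    · rintro rfl
      funext x
      simp only [hρ', glue, restr, mem_union]
      by_cases hx : x ∈ J <;> by_cases hx' : x ∈ J' <;> simp [hx, hx']
  have vl : ∀ J, i ∉ J → OneOK τ η ε μ (P T J) J → (∀ σ, |P T (insert i J) σ - push (restr (insert i J)) μ σ| ≤ ε) →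
      ∀ (π : Equiv.Perm (Fin M)), (∀ p : Fin M, p.1 < H.card → en (LL τ P T J) (π p) = restr J (en H p)) →
      ∀ (a : Fin M) c, a.1 < H.card → (VlD τ P J i T (π a) c ↔ c = en H a i) := by
    intro J hi o hn π e a c ha
    unfold VlD
    rw [e a ha]
    have r1 : restr J (Function.update (restr J (en H a)) i c) = restr J (en H a) := restr_eq.2 fun x hx => by
      have : x ≠ i := fun h => hi (h ▸ hx)
      rw [Function.update_of_ne this, restr_in hx]
    rw [o.c hc h0 (subset_insert _ _) hn (inH a ha) r1]
    constructor
    · intro h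
      have := congrFun h i
      simpa [restr] using this
    · rintro rfl
      funext x
      by_cases hx : x = i
      · subst hx; simp [restr]
      · rw [Function.update_of_ne hx]; simp [restr, hx]
  exact ⟨H.card, π1, π2, πB, fun a => en H a i, c1, c2, cB, p1, p2, pB, mt J1 J2 d12 o1 o2 n12 π1 π2 e1 e2,
    mt J2 JB d2B o2 oB n2B π2 πB e2 eB, mt J1 JB d1B o1 oB n1B π1 πB e1 eB, vl J1 i1 o1 m1 π1 e1, vl J2 i2 o2 m2 π2 e2, vl JB iB oB mB πB eB⟩

/-- off-list mass -/
theorem bad_mass (hc : Cst τ η ε) (h0 : ∀ y, 0 ≤ μ y) (h1 : ∑ y, μ y ≤ 1) {T : Ω} {J2 : Finset ι} {i : ι}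
    (o2 : OneOK τ η ε μ (P T J2) J2)
    (m2 : ∀ σ, |P T (insert i J2) σ - push (restr (insert i J2)) μ σ| ≤ ε) :
    ∑ ρ, μ ρ * ind (restr J2 ρ ∈ LL τ P T J2 ∧ ¬ (τ / 2 ≤ P T (insert i J2) (restr (insert i J2) ρ))) ≤ ε / τ ^ 2 := by
  set H : Finset (ι → A) := univ.filter (fun ρ => τ ≤ μ ρ) with hH
  have hH1 := card_heavy h0 h1 τ
  have step : ∀ ρ, μ ρ * ind (restr J2 ρ ∈ LL τ P T J2 ∧ ¬ (τ / 2 ≤ P T (insert i J2) (restr (insert i J2) ρ))) ≤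
      ∑ ρ2 ∈ H, μ ρ * (ind (restr J2 ρ = restr J2 ρ2) - ind (ρ = ρ2)) := by
    intro ρ
    rw [← mul_sum]
    refine mul_le_mul_of_nonneg_left ?_ (h0 ρ)
    have nn : ∀ ρ2 ∈ H, 0 ≤ ind (restr J2 ρ = restr J2 ρ2) - ind (ρ = ρ2) := fun ρ2 _ => by
      rw [sub_nonneg]; exact ind_mono fun h => by rw [h]
    by_cases hE : restr J2 ρ ∈ LL τ P T J2 ∧ ¬ (τ / 2 ≤ P T (insert i J2) (restr (insert i J2) ρ))
    · rw [ind_true hE]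
      obtain ⟨ρ2, q1, q2, -⟩ := o2.b hc h0 (mem_filter.1 hE.1).2
      have hne : ρ ≠ ρ2 := by
        rintro rfl
        refine hE.2 ((o2.c hc h0 (subset_insert _ _) m2 q1 ?_).2 rfl)
        rw [restr_restr (subset_insert _ _)]
      refine le_trans ?_ (single_le_sum (f := fun ρ2 => ind (restr J2 ρ = restr J2 ρ2) - ind (ρ = ρ2)) nn (mem_filter.2 ⟨mem_univ _, q1⟩))
      beta_reduce
      rw [ind_true q2.symm, ind_false hne]; norm_num
    · rw [ind_false hE]; exact sum_nonneg nn
  refine (sum_le_sum fun ρ _ => step ρ).trans ?_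
  rw [sum_comm]
  have each : ∀ ρ2 ∈ H, ∑ ρ, μ ρ * (ind (restr J2 ρ = restr J2 ρ2) - ind (ρ = ρ2)) ≤ ε / τ := by
    intro ρ2 h2
    have := o2.off hc h0 (mem_filter.1 h2).2
    refine le_trans (le_of_eq ?_) this
    simp only [mul_sub, sum_sub_distrib]
    congr 1
    rw [sum_eq_single ρ2]
    · rw [ind_true rfl, mul_one]
    · intro b _ hb; rw [ind_false hb, mul_zero]
    · simp
  refine (sum_le_sum each).trans ?_
  rw [sum_const, nsmul_eq_mul]
  have q : 0 ≤ ε / τ ^ 2 := div_nonneg hc.ε0 (by positivity)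
  have e : ε / τ = τ * (ε / τ ^ 2) := by have := hc.τ0; field_simp
  rw [e, ← mul_assoc]
  calc _ ≤ 1 * (ε / τ ^ 2) := mul_le_mul_of_nonneg_right hH1 q
    _ = _ := one_mul _
end good


section PPs
variable {Ω ι P : Type*} [Fintype Ω] [Fintype ι] [DecidableEq ι] {X : Ω → ι → P} {A : Type*} [Fintype A] [Nonempty A]

noncomputable def PP (X : Ω → ι → P) (ℓ : ℕ) (g : Finset ι → Ω → ι → A) (J c : Finset ι) (T : Ω) (σ : ι → A) : ℝ :=
  Fm X ℓ (fun I T => ind (restr c (g I T) = σ)) J T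

variable {ℓ : ℕ} {g : Finset ι → Ω → ι → A} {J K c d : Finset ι}

theorem PP_nonneg (T : Ω) (σ : ι → A) : 0 ≤ PP X ℓ g J c T σ :=
  av_nonneg fun I _ => cE_nonneg (fun T => ind_nonneg _) T

theorem sum_ind_eq {Y : Type*} [Fintype Y] (y : Y) (f : Y → ℝ) : ∑ σ, ind (y = σ) * f σ = f y := by
  rw [sum_eq_single y]
  · rw [ind_true rfl, one_mul]
  · intro b _ hb; rw [ind_false (fun h => hb h.symm), zero_mul]
  · simp

theorem sum_ind_eq' {Y : Type*} [Fintype Y] (y : Y) : ∑ σ : Y, ind (y = σ) = 1 := by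
  have := sum_ind_eq y (fun _ => (1:ℝ)); simpa using this

theorem PP_lin (f : (ι → A) → ℝ) (T : Ω) :
    ∑ σ, PP X ℓ g J c T σ * f σ = Fm X ℓ (fun I T => f (restr c (g I T))) J T := by
  unfold PP Fm cE
  have : ∀ I T, f (restr c (g I T)) = ∑ σ, ind (restr c (g I T) = σ) * f σ := fun I T => (sum_ind_eq _ f).symm
  simp only [this, av_sum, av_mul']

theorem PP_sum (hJ : J.card ≤ ℓ) (hℓ : ℓ ≤ Fintype.card ι) (T : Ω) : ∑ σ, PP X ℓ g J c T σ = 1 := by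
  have := PP_lin (X := X) (ℓ := ℓ) (g := g) (J := J) (c := c) (fun _ => 1) T
  simp only [mul_one] at this
  rw [this]
  unfold Fm
  simp only [cE_const]
  exact av_const (Sp_ne hJ hℓ) 1

theorem PP_push (h : c ⊆ d) (T : Ω) : PP X ℓ g J c T = push (restr c) (PP X ℓ g J d T) := by
  funext σ
  unfold push
  rw [PP_lin (fun ρ => ind (restr c ρ = σ))]
  simp only [restr_restr h]
  rfl

theorem PP_ms (σ : ι → A) : Ms X J (fun T => PP X ℓ g J c T σ) := Fm_ms ℓ _ J

theorem PP_ms' : Ms X J (PP X ℓ g J c) := fun T T' h => funext fun σ => PP_ms σ T T' h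

theorem PP_le_one (hJ : J.card ≤ ℓ) (hℓ : ℓ ≤ Fintype.card ι) (T : Ω) (σ : ι → A) : PP X ℓ g J c T σ ≤ 1 := by
  rw [← PP_sum (X := X) (g := g) (c := c) hJ hℓ T]
  exact single_le_sum (f := PP X ℓ g J c T) (fun i _ => PP_nonneg T i) (mem_univ σ)

theorem coll_PP_le_one (hJ : J.card ≤ ℓ) (hℓ : ℓ ≤ Fintype.card ι) (T : Ω) : coll (PP X ℓ g J c T) ≤ 1 := by
  rw [← PP_sum (X := X) (g := g) (c := c) hJ hℓ T]
  refine sum_le_sum fun σ _ => ?_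
  have := PP_nonneg (X := X) (ℓ := ℓ) (g := g) (J := J) (c := c) T σ
  have := PP_le_one (X := X) (ℓ := ℓ) (g := g) (J := J) (c := c) hJ hℓ T σ
  nlinarith

theorem PP_conv (Ψ : Ω → (ι → A) → ℝ) (h : ∀ ρ, Ms X J (fun T => Ψ T ρ)) :
    EE (fun T => ∑ ρ, PP X ℓ g J c T ρ * Ψ T ρ) = av (Sp J ℓ) (fun I => EE (fun T => Ψ T (restr c (g I T)))) := by
  rw [EE_sum]
  unfold PP
  rw [sum_congr rfl fun ρ _ => EE_Fm_mul _ (h ρ), ← av_sum]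
  refine av_congr fun I _ => ?_
  rw [← EE_sum]
  exact EE_congr fun T => sum_ind_eq _ (Ψ T)

/-- squared distance -/
noncomputable def d2 (X : Ω → ι → P) (ℓ : ℕ) (g : Finset ι → Ω → ι → A) (J K c : Finset ι) : ℝ :=
  EE (fun T => ∑ σ, (PP X ℓ g J c T σ - PP X ℓ g K c T σ)^2)

theorem d2_nonneg : 0 ≤ d2 X ℓ g J K c := EE_nonneg fun T => sum_nonneg fun σ _ => sq_nonneg _

variable {lam : ι → ι → ℝ}

theorem sum_sq_one [Nonempty Ω] (hJ : J.card ≤ ℓ) (hℓ : ℓ ≤ Fintype.card ι) :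
    ∑ σ, av (Sp J ℓ) (fun I => EE (fun T => ind (restr c (g I T) = σ) ^ 2)) = 1 := by
  rw [← av_sum]
  simp only [ind_sq]
  have : ∀ I, ∑ σ, EE (fun T => ind (restr c (g I T) = σ)) = 1 := fun I => by
    rw [← EE_sum]
    simp only [sum_ind_eq']
    exact av_const univ_nonempty 1
  simp only [this]
  exact av_const (Sp_ne hJ hℓ) 1

theorem d2_step [Nonempty Ω] (H : Hyp X lam) (hK : K.card < ℓ) (hℓ : ℓ ≤ Fintype.card ι) :
    av Kᶜ (fun i => d2 X ℓ g (insert i K) K c) ≤ 3 / ((ℓ - K.card : ℕ) : ℝ) := by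
  unfold d2
  simp only [EE_sum, av_sum]
  refine (sum_le_sum fun σ _ => lemmaV H (fun I T => ind (restr c (g I T) = σ)) hK hℓ).trans ?_
  rw [← mul_sum, sum_sq_one hK.le hℓ, mul_one]

theorem coll_step [Nonempty Ω] (H : Hyp X lam) (hK : K.card < ℓ) (hℓ : ℓ ≤ Fintype.card ι) :
    av Kᶜ (fun i => EE (fun T => coll (PP X ℓ g (insert i K) c T))) ≤ EE (fun T => coll (PP X ℓ g K c T)) + 3 / ((ℓ - K.card : ℕ) : ℝ) := by
  have h1 := d2_step (g := g) (c := c) H hK hℓ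
  unfold d2 at h1
  unfold coll
  simp only [EE_sum, av_sum] at h1 ⊢
  have : ∀ σ, _ := fun σ : ι → A => Fm_pythag (X := X) (fun I T => ind (restr c (g I T) = σ)) hK hℓ
  unfold PP at h1 ⊢
  rw [sum_congr rfl fun σ _ => this σ, sum_sub_distrib] at h1
  linarith

theorem coll_chain [Nonempty Ω] (H : Hyp X lam) {W : Finset ι} {ℓ₀ : ℕ} (h0 : ℓ₀ < ℓ) (hℓ : ℓ ≤ Fintype.card ι) (k : ℕ) (hk : W.card + k ≤ ℓ₀) :
    av (Sp W (W.card + k)) (fun J => EE (fun T => coll (PP X ℓ g J c T))) ≤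
      EE (fun T => coll (PP X ℓ g W c T)) + k * (3 / ((ℓ - ℓ₀ : ℕ) : ℝ)) := by
  induction k with
  | zero => rw [add_zero, Sp_self, av_singleton]; simp
  | succ k ih =>
    have ih := ih (by omega)
    rw [← add_assoc, ← av_Sp_chain (by omega)]
    have : av (Sp W (W.card + k)) (fun I => av Iᶜ (fun i => EE (fun T => coll (PP X ℓ g (insert i I) c T)))) ≤
        av (Sp W (W.card + k)) (fun I => EE (fun T => coll (PP X ℓ g I c T)) + 3 / ((ℓ - ℓ₀ : ℕ) : ℝ)) := by
      refine av_mono fun I hI => ?_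
      rw [mem_Sp] at hI
      refine (coll_step H (by omega) hℓ).trans ?_
      gcongr
      · exact_mod_cast (by omega : 0 < ℓ - ℓ₀)
      · omega
    refine this.trans ?_
    rw [av_add, av_const (Sp_ne (by omega) (by omega))]
    push_cast
    linarith

theorem test_coll [Nonempty Ω] (H : Hyp X lam) (hg : ∀ I, Ms X I (g I)) (hJ : J.card ≤ ℓ) (hℓ : ℓ < Fintype.card ι) :
    EE (fun T => ∑ σ, (av (Sp J ℓ) (fun I => ind (restr c (g I T) = σ)))^2) ≤
      EE (fun T => coll (PP X ℓ g J c T)) + 3 * ℓ / (Fintype.card ι - ℓ : ℝ) := by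
  unfold coll
  simp only [EE_sum]
  have h : ∀ σ, _ := fun σ : ι → A => test_lemma H (fun I T => ind (restr c (g I T) = σ))
    (fun I T T' h => by beta_reduce; rw [hg I T T' h]) hJ hℓ
  refine (sum_le_sum fun σ _ => h σ).trans ?_
  rw [sum_add_distrib, ← mul_sum, sum_sq_one hJ hℓ.le, mul_one]
  rfl

theorem sq_add_le (a b : ℝ) : (a + b)^2 ≤ 2 * a^2 + 2 * b^2 := by nlinarith [sq_nonneg (a - b)]
end PPs


section strat
variable {ι Lf Lc : Type*} [Fintype ι] [DecidableEq ι] [Fintype Lf] [DecidableEq Lf] [Fintype Lc] [DecidableEq Lc]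

theorem pi_av (B : Lf → Finset Lc) (l : Lf) (φ : (Lf → Lc) → ℝ) :
    av (Fintype.piFinset B) φ = av (Fintype.piFinset B) (fun z => av (B l) (fun y => φ (Function.update z l y))) := by
  have hupd : ∀ z ∈ Fintype.piFinset B, ∀ y ∈ B l, Function.update z l y ∈ Fintype.piFinset B := by
    intro z hz y hy
    rw [Fintype.mem_piFinset] at hz ⊢
    intro a
    by_cases h : a = l
    · subst h; simpa using hy
    · rw [Function.update_of_ne h]; exact hz a
  have hinj : ∀ z : Lf → Lc, Function.Injective (Function.update z l) := fun z => Function.update_injective z l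
  have key := av_fubini (s := Fintype.piFinset B) (t := Fintype.piFinset B) (fun z => (B l).image (Function.update z l))
    (fun z => (B l).image (Function.update z l)) (B l).card (B l).card ?_ ?_ ?_ (fun _ z' => φ z')
  · have e1 : ∀ z ∈ Fintype.piFinset B, av ((B l).image (Function.update z l)) φ = av (B l) (fun y => φ (Function.update z l y)) := by
      intro z hz
      symm
      refine av_bij (fun y hy => mem_image_of_mem _ hy) ((hinj z).injOn) (fun b hb => ?_) φ
      obtain ⟨y, hy, e⟩ := mem_image.1 hb
      exact ⟨y, hy, e⟩
    rw [← av_congr e1, key]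
    refine av_congr fun z hz => ?_
    rw [av_const]
    rw [Fintype.mem_piFinset] at hz
    exact ⟨_, mem_image_of_mem _ (hz l)⟩
  · intro z z'
    have gen : ∀ z z', z ∈ Fintype.piFinset B → z' ∈ (B l).image (Function.update z l) → z' ∈ Fintype.piFinset B ∧ z ∈ (B l).image (Function.update z' l) := by
      intro z z' hz hz'
      obtain ⟨y, hy, rfl⟩ := mem_image.1 hz'
      refine ⟨hupd z hz y hy, mem_image.2 ⟨z l, (Fintype.mem_piFinset.1 hz) l, by simp⟩⟩
    exact ⟨fun h => gen z z' h.1 h.2, fun h => gen z' z h.1 h.2⟩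
  · intro z _; exact card_image_of_injective _ (hinj z)
  · intro z _; exact card_image_of_injective _ (hinj z)

theorem EZ_upd (l : Lf) (φ : (Lf → Lc) → ℝ) :
    av univ φ = av univ (fun z => av univ (fun y => φ (Function.update z l y))) := by
  have := pi_av (fun _ : Lf => (univ : Finset Lc)) l φ
  rwa [Fintype.piFinset_univ] at this

variable (po : Lf → Lc → ι)

noncomputable def zs (z : Lf → Lc) (S : Finset Lf) : Finset ι := S.image (fun l => po l (z l))
noncomputable def Zs (I : Finset ι) : Finset (Lf → Lc) := Fintype.piFinset (fun l => univ.filter (fun y => po l y ∈ I))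

variable {po}

theorem mem_Zs {I : Finset ι} {z : Lf → Lc} : z ∈ Zs po I ↔ zs po z univ ⊆ I := by
  simp [Zs, zs, Fintype.mem_piFinset, image_subset_iff]

theorem card_zs (hpo : Function.Injective2 po) (z : Lf → Lc) (S : Finset Lf) : (zs po z S).card = S.card :=
  card_image_of_injective _ fun l l' h => (hpo h).1

theorem mem_zs {z : Lf → Lc} {S : Finset Lf} {i : ι} : i ∈ zs po z S ↔ ∃ l ∈ S, po l (z l) = i := by simp [zs]

theorem zs_mono {z : Lf → Lc} {S S' : Finset Lf} (h : S ⊆ S') : zs po z S ⊆ zs po z S' := image_subset_image h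

theorem zs_insert {z : Lf → Lc} {S : Finset Lf} {l : Lf} : zs po z (insert l S) = insert (po l (z l)) (zs po z S) := image_insert _ _ _

theorem zs_union {z : Lf → Lc} {S S' : Finset Lf} : zs po z (S ∪ S') = zs po z S ∪ zs po z S' := image_union _ _

theorem zs_congr {z z' : Lf → Lc} {S : Finset Lf} (h : ∀ l ∈ S, z l = z' l) : zs po z S = zs po z' S :=
  image_congr fun l hl => by beta_reduce; rw [h l hl]

theorem zs_upd {z : Lf → Lc} {S : Finset Lf} {l : Lf} (h : l ∉ S) (y : Lc) : zs po (Function.update z l y) S = zs po z S :=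
  zs_congr fun l' hl' => by
    have : l' ≠ l := by rintro rfl; exact h hl'
    exact Function.update_of_ne this _ _

theorem po_mem_zs (hpo : Function.Injective2 po) {z : Lf → Lc} {S : Finset Lf} {l : Lf} {y : Lc} : po l y ∈ zs po z S ↔ l ∈ S ∧ z l = y := by
  rw [mem_zs]
  constructor
  · rintro ⟨l', h, e⟩
    obtain ⟨rfl, rfl⟩ := hpo e
    exact ⟨h, rfl⟩
  · rintro ⟨h, rfl⟩; exact ⟨l, h, rfl⟩

theorem zs_disj (hpo : Function.Injective2 po) {z : Lf → Lc} {S S' : Finset Lf} (h : Disjoint S S') : Disjoint (zs po z S) (zs po z S') := by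
  rw [disjoint_left]
  intro i hi hi'
  obtain ⟨l, hl, rfl⟩ := mem_zs.1 hi
  exact disjoint_left.1 h hl ((po_mem_zs hpo).1 hi').1

theorem strat_swap (hpo : Function.Injective2 po) {s : ℕ} (hs : Fintype.card Lf ≤ s) (Ψ : Finset ι → (Lf → Lc) → ℝ) :
    av univ (fun z => av (Sp (zs po z univ) s) (fun I => Ψ I z)) =
      (∑ I ∈ Sp ∅ s, ∑ z ∈ Zs po I, Ψ I z) / ((Fintype.card Lc : ℝ) ^ Fintype.card Lf *
        ((Fintype.card ι - Fintype.card Lf).choose (s - Fintype.card Lf) : ℕ)) := by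
  have hc : ∀ z : Lf → Lc, (Sp (zs po z univ) s).card = (Fintype.card ι - Fintype.card Lf).choose (s - Fintype.card Lf) := fun z => by
    rw [card_Sp (by rw [card_zs hpo, card_univ]; exact hs), card_zs hpo, card_univ]
  unfold av
  simp only [hc, ← sum_div]
  rw [div_div, card_univ, Fintype.card_fun, mul_comm]
  push_cast
  congr 1
  refine sum_comm' fun z I => ?_
  rw [mem_Zs, mem_Sp, mem_Sp]; simp

theorem resample (hpo : Function.Injective2 po) {s : ℕ} (hs : Fintype.card Lf ≤ s) (l : Lf) (Ψ : Finset ι → (Lf → Lc) → ℝ) :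
    av univ (fun z => av (Sp (zs po z univ) s) (fun I => Ψ I z)) =
    av univ (fun z => av (Sp (zs po z univ) s) (fun I => av (univ.filter (fun y => po l y ∈ I)) (fun y => Ψ I (Function.update z l y)))) := by
  rw [strat_swap hpo hs Ψ, strat_swap hpo hs (fun I z => av (univ.filter (fun y => po l y ∈ I)) (fun y => Ψ I (Function.update z l y)))]
  congr 1
  refine sum_congr rfl fun I _ => ?_
  have := pi_av (fun l => univ.filter (fun y => po l y ∈ I)) l (Ψ I)
  change av (Zs po I) _ = av (Zs po I) _ at this
  unfold av at this ⊢
  by_cases h : (Zs po I).card = 0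
  · rw [card_eq_zero.1 h]; simp
  · have h' : ((Zs po I).card : ℝ) ≠ 0 := by exact_mod_cast h
    field_simp at this
    exact this

theorem card_Zs_le (hpo : Function.Injective2 po) [Nonempty Lf] (I : Finset ι) :
    ((Zs po I).card : ℝ) ≤ ((I.card : ℝ) / Fintype.card Lf) ^ Fintype.card Lf := by
  have hn : (0:ℝ) < Fintype.card Lf := by exact_mod_cast Fintype.card_pos
  set n : Lf → ℕ := fun l => (univ.filter (fun y => po l y ∈ I)).card with hnl
  have hsum : ∑ l, n l ≤ I.card := by
    have : ∑ l, n l = ((univ : Finset Lf).sigma (fun l => univ.filter (fun y => po l y ∈ I))).card := by rw [card_sigma]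
    rw [this]
    refine card_le_card_of_injOn (fun p => po p.1 p.2) (fun p hp => ?_) ?_
    · simp at hp; exact hp
    · rintro ⟨l, y⟩ _ ⟨l', y'⟩ _ e
      obtain ⟨rfl, rfl⟩ := hpo e
      rfl
  have hcard : ((Zs po I).card : ℝ) = ∏ l, (n l : ℝ) := by
    rw [Zs, Fintype.card_piFinset]; push_cast; rfl
  rw [hcard]
  have am := Real.geom_mean_le_arith_mean (univ : Finset Lf) (fun _ => (1:ℝ)) (fun l => (n l : ℝ)) (fun _ _ => zero_le_one)
    (by simpa using hn) (fun l _ => Nat.cast_nonneg _)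
  simp only [Real.rpow_one, sum_const, card_univ, nsmul_eq_mul, mul_one, one_mul] at am
  have hp : 0 ≤ ∏ l, (n l : ℝ) := prod_nonneg fun l _ => Nat.cast_nonneg _
  have e1 : ∏ l, (n l : ℝ) = ((∏ l, (n l : ℝ)) ^ ((Fintype.card Lf : ℝ))⁻¹) ^ (Fintype.card Lf) := by
    rw [← Real.rpow_natCast, ← Real.rpow_mul hp, inv_mul_cancel₀ hn.ne', Real.rpow_one]
  have e2 : (∑ l, (n l : ℝ)) ≤ I.card := by exact_mod_cast hsum
  rw [e1]
  refine pow_le_pow_left₀ (Real.rpow_nonneg hp _) (am.trans ?_) _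
  exact div_le_div_of_nonneg_right e2 hn.le

theorem dens (hpo : Function.Injective2 po) [Nonempty Lf] [Nonempty Lc] {s : ℕ} (hs : Fintype.card Lf < s) (hsN : s ≤ Fintype.card ι) (h : Finset ι → ℝ)
    (h0 : ∀ I, 0 ≤ h I) :
    av univ (fun z => av (Sp (zs po z univ) s) h) ≤
      ((s : ℝ) / (s - Fintype.card Lf) * (Fintype.card ι / (Fintype.card Lf * Fintype.card Lc))) ^ Fintype.card Lf * av (Sp ∅ s) h := by
  rw [strat_swap hpo hs.le (fun I _ => h I)]
  set Λ := Fintype.card Lf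
  set L := Fintype.card Lc
  set N := Fintype.card ι
  have hΛ : (0:ℝ) < Λ := by exact_mod_cast (Fintype.card_pos : 0 < Fintype.card Lf)
  have hL : (0:ℝ) < L := by exact_mod_cast (Fintype.card_pos : 0 < Fintype.card Lc)
  have hsΛ : (0:ℝ) < (s:ℝ) - Λ := by rw [sub_pos]; exact_mod_cast hs
  have hC1 : (0:ℝ) < ((N - Λ).choose (s - Λ) : ℕ) := by exact_mod_cast Nat.choose_pos (by omega)
  have hC2 : (0:ℝ) < (N.choose s : ℕ) := by exact_mod_cast Nat.choose_pos hsN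
  have hH : 0 ≤ ∑ I ∈ Sp ∅ s, h I := sum_nonneg fun I _ => h0 I
  have e1 : ∑ I ∈ Sp (∅ : Finset ι) s, ∑ z ∈ Zs po I, h I ≤ ((s:ℝ) / Λ) ^ Λ * ∑ I ∈ Sp ∅ s, h I := by
    rw [mul_sum]
    refine sum_le_sum fun I hI => ?_
    rw [sum_const, nsmul_eq_mul]
    refine mul_le_mul_of_nonneg_right ?_ (h0 I)
    have := card_Zs_le hpo I
    rwa [(mem_Sp.1 hI).2] at this
  have hcs : (Sp (∅ : Finset ι) s).card = N.choose s := by rw [card_Sp (by simp)]; simp [N]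
  have e2 : (N.choose s : ℝ) * ((s:ℝ) - Λ)^Λ ≤ (N:ℝ)^Λ * ((N - Λ).choose (s - Λ) : ℕ) := by
    have q1 := Nat.choose_mul (n := N) hs.le
    have q2 : N.choose Λ * Λ.factorial ≤ N ^ Λ := by
      rw [mul_comm, ← Nat.descFactorial_eq_factorial_mul_choose]; exact Nat.descFactorial_le_pow N Λ
    have q3 : (s - Λ) ^ Λ ≤ s.choose Λ * Λ.factorial := by
      rw [mul_comm, ← Nat.descFactorial_eq_factorial_mul_choose]
      exact (Nat.pow_le_pow_left (by omega) _).trans (Nat.pow_sub_le_descFactorial s Λ)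
    have q4 : N.choose s * (s - Λ)^Λ ≤ N^Λ * (N - Λ).choose (s - Λ) := by
      calc N.choose s * (s - Λ)^Λ ≤ N.choose s * (s.choose Λ * Λ.factorial) := Nat.mul_le_mul_left _ q3
        _ = (N.choose Λ * Λ.factorial) * (N - Λ).choose (s - Λ) := by rw [← mul_assoc, q1]; ring
        _ ≤ _ := Nat.mul_le_mul_right _ q2
    have q5 : ((s - Λ : ℕ) : ℝ) = (s:ℝ) - Λ := by rw [Nat.cast_sub hs.le]
    rw [← q5]; exact_mod_cast q4
  refine (div_le_div_of_nonneg_right e1 (by positivity)).trans ?_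
  unfold av
  rw [hcs]
  rw [mul_div_assoc', div_le_div_iff₀ (by positivity) hC2]
  calc ((s:ℝ) / Λ) ^ Λ * (∑ I ∈ Sp ∅ s, h I) * (N.choose s : ℝ) = ((s:ℝ) / Λ) ^ Λ * (∑ I ∈ Sp ∅ s, h I) / ((s:ℝ) - Λ)^Λ * ((N.choose s : ℝ) * ((s:ℝ) - Λ)^Λ) := by
        field_simp
    _ ≤ ((s:ℝ) / Λ) ^ Λ * (∑ I ∈ Sp ∅ s, h I) / ((s:ℝ) - Λ)^Λ * ((N:ℝ)^Λ * ((N - Λ).choose (s - Λ) : ℕ)) := by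
        refine mul_le_mul_of_nonneg_left e2 ?_
        positivity
    _ = _ := by
        rw [mul_pow, div_pow, div_pow, div_pow, mul_pow]
        field_simp
end strat


section stratdist
variable {Ω ι P : Type*} [Fintype Ω] [Fintype ι] [DecidableEq ι] {X : Ω → ι → P} {A : Type*} [Fintype A] [Nonempty A]
variable {Lf Lc : Type*} [Fintype Lf] [DecidableEq Lf] [Fintype Lc] [DecidableEq Lc] {po : Lf → Lc → ι}
variable {ℓ : ℕ} {g : Finset ι → Ω → ι → A} {lam : ι → ι → ℝ}

theorem av_cells (hpo : Function.Injective2 po) (l : Lf) (K : Finset ι) (hK : ∀ y, po l y ∉ K) (ψ : ι → ℝ) (h0 : ∀ i, 0 ≤ ψ i) :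
    av univ (fun y => ψ (po l y)) ≤ ((Fintype.card ι : ℝ) / Fintype.card Lc) * av Kᶜ ψ := by
  unfold av
  have h1 : ∑ y, ψ (po l y) ≤ ∑ i ∈ Kᶜ, ψ i := by
    have hi : Function.Injective (po l) := fun y y' h => (hpo h).2
    rw [← sum_image (s := univ) (g := po l) (f := ψ) (fun y _ y' _ h => hi h)]
    refine sum_le_sum_of_subset_of_nonneg (fun i hi => ?_) (fun i _ _ => h0 i)
    obtain ⟨y, _, rfl⟩ := mem_image.1 hi
    simpa using hK y
  have hS : 0 ≤ ∑ i ∈ Kᶜ, ψ i := sum_nonneg fun i _ => h0 i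
  rw [card_univ]
  rcases Nat.eq_zero_or_pos (Fintype.card Lc) with h | h
  · simp [h]
  · obtain ⟨y⟩ := Fintype.card_pos_iff.1 h
    have hne : (0:ℝ) < (Kᶜ).card := by
      have : 0 < (Kᶜ).card := card_pos.2 ⟨po l y, by simpa using hK y⟩
      exact_mod_cast this
    have hle : ((Kᶜ).card : ℝ) ≤ Fintype.card ι := by exact_mod_cast card_le_univ _
    have hL : (0:ℝ) < Fintype.card Lc := by exact_mod_cast h
    rw [div_mul_div_comm, div_le_div_iff₀ hL (by positivity)]
    have := mul_le_mul hle h1 (sum_nonneg fun i _ => h0 _) (by positivity)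
    nlinarith

theorem strat_step [Nonempty Ω] (hpo : Function.Injective2 po) (H : Hyp X lam) (hΛ : Fintype.card Lf < ℓ) (hℓ : ℓ ≤ Fintype.card ι)
    {l : Lf} {K S : Finset Lf} (hl : l ∉ K) (hS : S ⊆ K) :
    av univ (fun z => d2 X ℓ g (zs po z (insert l K)) (zs po z K) (zs po z S)) ≤
      ((Fintype.card ι : ℝ) / Fintype.card Lc) * (3 / ((ℓ - Fintype.card Lf : ℕ) : ℝ)) := by
  rw [EZ_upd l]
  have hk : ∀ S : Finset Lf, S.card ≤ Fintype.card Lf := fun S => card_le_univ _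
  have : (0:ℝ) < ((ℓ - Fintype.card Lf : ℕ) : ℝ) := by exact_mod_cast (by omega : 0 < ℓ - Fintype.card Lf)
  refine av_le_const' (by positivity) fun z _ => ?_
  have e : ∀ y, d2 X ℓ g (zs po (Function.update z l y) (insert l K)) (zs po (Function.update z l y) K) (zs po (Function.update z l y) S) =
      d2 X ℓ g (insert (po l y) (zs po z K)) (zs po z K) (zs po z S) := fun y => by
    rw [zs_insert, zs_upd hl, zs_upd (fun h => hl (hS h)), Function.update_self]
  simp only [e]
  refine (av_cells hpo l (zs po z K) (fun y hy => hl ((po_mem_zs hpo).1 hy).1) (fun i => d2 X ℓ g (insert i (zs po z K)) (zs po z K) (zs po z S))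
    (fun i => d2_nonneg)).trans ?_
  refine mul_le_mul_of_nonneg_left ?_ (by positivity)
  refine (d2_step H (by rw [card_zs hpo]; exact (hk K).trans_lt hΛ) hℓ).trans ?_
  rw [card_zs hpo]
  gcongr
  exact hk K

theorem d2_tri (J K U c : Finset ι) : d2 X ℓ g J U c ≤ 2 * d2 X ℓ g J K c + 2 * d2 X ℓ g K U c := by
  unfold d2
  rw [← EE_mul, ← EE_mul, ← EE_add]
  refine EE_mono fun T => ?_
  rw [mul_sum, mul_sum, ← sum_add_distrib]
  refine sum_le_sum fun σ _ => ?_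
  refine le_trans (le_of_eq ?_) (sq_add_le _ _)
  ring

noncomputable def G2 (N L Λ ℓ : ℕ) : ℝ := 2 ^ (Λ + 1) * (((N:ℝ) / L) * (3 / ((ℓ - Λ : ℕ) : ℝ)))

theorem strat_dist_aux [Nonempty Ω] (hpo : Function.Injective2 po) (H : Hyp X lam) (hΛ : Fintype.card Lf < ℓ) (hℓ : ℓ ≤ Fintype.card ι)
    {K S : Finset Lf} (hS : S ⊆ K) (U : Finset Lf) (hU : Disjoint U K) :
    av univ (fun z => d2 X ℓ g (zs po z (U ∪ K)) (zs po z K) (zs po z S)) ≤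
      (2 ^ (U.card + 1) - 2) * (((Fintype.card ι : ℝ) / Fintype.card Lc) * (3 / ((ℓ - Fintype.card Lf : ℕ) : ℝ))) := by
  induction U using Finset.induction_on with
  | empty =>
    simp [d2, EE_zero, av_zero]
  | insert l U hl ih =>
    rw [disjoint_insert_left] at hU
    have ih := ih hU.2
    have st := strat_step (X := X) (g := g) hpo H hΛ hℓ (l := l) (K := U ∪ K) (S := S)
      (by rw [mem_union]; tauto) (hS.trans subset_union_right)
    have := av_mono (s := (univ : Finset (Lf → Lc))) fun z _ => d2_tri (X := X) (ℓ := ℓ) (g := g) (zs po z (insert l (U ∪ K))) (zs po z (U ∪ K)) (zs po z K) (zs po z S)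
    rw [av_add, av_mul, av_mul] at this
    rw [insert_union, card_insert_of_notMem hl]
    refine this.trans ?_
    rw [pow_succ]
    linarith

theorem strat_dist [Nonempty Ω] (hpo : Function.Injective2 po) (H : Hyp X lam) (hΛ : Fintype.card Lf < ℓ) (hℓ : ℓ ≤ Fintype.card ι)
    (K : Finset Lf) :
    av univ (fun z => d2 X ℓ g (zs po z univ) (zs po z K) (zs po z K)) ≤ G2 (Fintype.card ι) (Fintype.card Lc) (Fintype.card Lf) ℓ := by
  have := strat_dist_aux (X := X) (g := g) hpo H hΛ hℓ (Subset.refl K) Kᶜ disjoint_compl_left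
  rw [show Kᶜ ∪ K = univ from by rw [union_comm]; exact union_compl K] at this
  refine this.trans ?_
  unfold G2
  refine mul_le_mul_of_nonneg_right ?_ (by positivity)
  have : (2:ℝ) ^ ((Kᶜ).card + 1) ≤ 2 ^ (Fintype.card Lf + 1) := by
    gcongr
    · norm_num
    · exact card_le_univ _
  linarith

noncomputable def dn (N L Λ s : ℕ) : ℝ := ((s : ℝ) / (s - Λ) * (N / (Λ * L))) ^ Λ

theorem global_coll [Nonempty Ω] [Nonempty Lf] [Nonempty Lc] (hpo : Function.Injective2 po) (H : Hyp X lam) {ℓ₀ : ℕ} {Dt : ℝ}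
    (hΛ : Fintype.card Lf < ℓ₀) (h0 : ℓ₀ < ℓ) (hℓ : ℓ ≤ Fintype.card ι)
    (hD : Dt ≤ av (Sp ∅ ℓ₀) (fun J => EE (fun T => coll (PP X ℓ g J J T)))) :
    1 - dn (Fintype.card ι) (Fintype.card Lc) (Fintype.card Lf) ℓ₀ * (1 - Dt) - ℓ₀ * (3 / ((ℓ - ℓ₀ : ℕ) : ℝ)) ≤
      av univ (fun z => EE (fun T => coll (PP X ℓ g (zs po z univ) (zs po z univ) T))) := by
  have hd := dens hpo hΛ (h0.le.trans hℓ) (fun J => if J.card = ℓ₀ then 1 - EE (fun T => coll (PP X ℓ g J J T)) else 0) (fun J => by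
    split_ifs with h
    · rw [sub_nonneg]
      exact av_le_const' zero_le_one fun T _ => coll_PP_le_one (by omega) hℓ T
    · exact le_rfl)
  have e1 : ∀ W : Finset ι, W.card ≤ ℓ₀ → av (Sp W ℓ₀) (fun J => if J.card = ℓ₀ then 1 - EE (fun T => coll (PP X ℓ g J J T)) else 0) =
      1 - av (Sp W ℓ₀) (fun J => EE (fun T => coll (PP X ℓ g J J T))) := by
    intro W hW
    rw [← av_const (Sp_ne hW (h0.le.trans hℓ)) (1:ℝ), ← av_sub]
    refine av_congr fun J hJ => ?_
    rw [if_pos (mem_Sp.1 hJ).2]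
    beta_reduce
    rw [av_const (Sp_ne hW (h0.le.trans hℓ))]
  rw [e1 ∅ (by simp), av_congr fun z _ => e1 (zs po z univ) (by rw [card_zs hpo, card_univ]; exact hΛ.le), av_sub,
    av_const univ_nonempty] at hd
  have hdn : 0 ≤ dn (Fintype.card ι) (Fintype.card Lc) (Fintype.card Lf) ℓ₀ := by
    have : (0:ℝ) ≤ (ℓ₀:ℝ) - Fintype.card Lf := by rw [sub_nonneg]; exact_mod_cast hΛ.le
    unfold dn; positivity
  have hz : ∀ z : Lf → Lc, av (Sp (zs po z univ) ℓ₀) (fun J => EE (fun T => coll (PP X ℓ g J J T))) ≤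
      EE (fun T => coll (PP X ℓ g (zs po z univ) (zs po z univ) T)) + ℓ₀ * (3 / ((ℓ - ℓ₀ : ℕ) : ℝ)) := by
    intro z
    have hc : (zs po z univ).card = Fintype.card Lf := by rw [card_zs hpo, card_univ]
    have h1 : (zs po z univ).card + (ℓ₀ - Fintype.card Lf) = ℓ₀ := by omega
    have := coll_chain (g := g) (c := zs po z univ) H (W := zs po z univ) h0 hℓ (ℓ₀ - Fintype.card Lf) h1.le
    rw [h1] at this
    refine le_trans (av_mono fun J hJ => EE_mono fun T => ?_) (this.trans ?_)
    · rw [PP_push (mem_Sp.1 hJ).1 T]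
      exact coll_le (fun _ => PP_nonneg _ _)
    · gcongr
      omega
  have h2 := av_mono (s := (univ : Finset (Lf → Lc))) fun z _ => hz z
  rw [av_add, av_const univ_nonempty] at h2
  change _ ≤ dn _ _ _ _ * _ at hd
  have h3 := mul_le_mul_of_nonneg_left hD hdn
  linarith
end stratdist


section nodeprob
variable {Ω ι P : Type*} [Fintype Ω] [Fintype ι] [DecidableEq ι] {X : Ω → ι → P} {A : Type*} [Fintype A] [Nonempty A]
variable {Lf Lc : Type*} [Fintype Lf] [DecidableEq Lf] [Fintype Lc] [DecidableEq Lc] {po : Lf → Lc → ι}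
variable {ℓ : ℕ} {g : Finset ι → Ω → ι → A} {lam : ι → ι → ℝ}

def nb (X : Ω → ι → P) (ℓ : ℕ) (g : Finset ι → Ω → ι → A) (po : Lf → Lc → ι) (ε : ℝ) (K : Finset Lf) (z : Lf → Lc) (T : Ω) : Prop :=
  ∃ σ, ε < |PP X ℓ g (zs po z univ) (zs po z K) T σ - PP X ℓ g (zs po z K) (zs po z K) T σ|
def cb (X : Ω → ι → P) (ℓ : ℕ) (g : Finset ι → Ω → ι → A) (po : Lf → Lc → ι) (ε : ℝ) (S C : Finset Lf) (z : Lf → Lc) (T : Ω) : Prop :=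
  ε < coll (PP X ℓ g (zs po z univ) (zs po z C) T) - coll (PP X ℓ g (zs po z univ) (zs po z S) T)
def gb (X : Ω → ι → P) (ℓ : ℕ) (g : Finset ι → Ω → ι → A) (po : Lf → Lc → ι) (τ η : ℝ) (C : Finset Lf) (z : Lf → Lc) (T : Ω) : Prop :=
  ∃ σ, τ - η ≤ PP X ℓ g (zs po z C) (zs po z C) T σ ∧ PP X ℓ g (zs po z C) (zs po z C) T σ < τ + η
noncomputable def qq (X : Ω → ι → P) (ℓ : ℕ) (g : Finset ι → Ω → ι → A) (po : Lf → Lc → ι) (C : Finset Lf) : ℝ :=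
  av univ (fun z => EE (fun T => coll (PP X ℓ g (zs po z univ) (zs po z C) T)))

theorem qq_anti {S C : Finset Lf} (h : C ⊆ S) : qq X ℓ g po S ≤ qq X ℓ g po C := by
  refine av_mono fun z _ => EE_mono fun T => ?_
  rw [PP_push (zs_mono h) T]
  exact coll_le (fun _ => PP_nonneg _ _)

theorem qq_nonneg {S : Finset Lf} : 0 ≤ qq X ℓ g po S :=
  av_nonneg fun z _ => EE_nonneg fun T => sum_nonneg fun σ _ => sq_nonneg _

theorem qq_le_one (hpo : Function.Injective2 po) (hΛ : Fintype.card Lf ≤ ℓ) (hℓ : ℓ ≤ Fintype.card ι) {S : Finset Lf} : qq X ℓ g po S ≤ 1 :=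
  av_le_const' zero_le_one fun z _ => av_le_const' zero_le_one fun T _ => coll_PP_le_one (by rw [card_zs hpo, card_univ]; exact hΛ) hℓ T

theorem nb_le [Nonempty Ω] (hpo : Function.Injective2 po) (H : Hyp X lam) (hΛ : Fintype.card Lf < ℓ) (hℓ : ℓ ≤ Fintype.card ι)
    (K : Finset Lf) {ε : ℝ} (hε : 0 < ε) :
    av univ (fun z => EE (fun T => ind (nb X ℓ g po ε K z T))) ≤ G2 (Fintype.card ι) (Fintype.card Lc) (Fintype.card Lf) ℓ / ε ^ 2 := by
  refine le_trans ?_ (div_le_div_of_nonneg_right (strat_dist (X := X) (g := g) hpo H hΛ hℓ K) (by positivity))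
  rw [← av_div]
  refine av_mono fun z _ => ?_
  unfold d2 EE
  rw [← av_div]
  refine av_mono fun T _ => ?_
  by_cases h : nb X ℓ g po ε K z T
  · rw [ind_true h]
    obtain ⟨σ, hσ⟩ := h
    rw [le_div_iff₀ (by positivity), one_mul]
    refine le_trans ?_ (single_le_sum (f := fun σ => (PP X ℓ g (zs po z univ) (zs po z K) T σ - PP X ℓ g (zs po z K) (zs po z K) T σ)^2)
      (fun σ _ => sq_nonneg _) (mem_univ σ))
    beta_reduce
    rw [← sq_abs (PP X ℓ g (zs po z univ) (zs po z K) T σ - PP X ℓ g (zs po z K) (zs po z K) T σ)]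
    exact pow_le_pow_left₀ hε.le hσ.le 2
  · rw [ind_false h]
    exact div_nonneg (sum_nonneg fun σ _ => sq_nonneg _) (by positivity)

theorem cb_le {S C : Finset Lf} (h : C ⊆ S) {ε : ℝ} (hε : 0 < ε) :
    av univ (fun z => EE (fun T => ind (cb X ℓ g po ε S C z T))) ≤ (qq X ℓ g po C - qq X ℓ g po S) / ε := by
  unfold qq
  rw [← av_sub, ← av_div]
  refine av_mono fun z _ => ?_
  rw [← EE_sub]
  unfold EE
  rw [← av_div]
  refine av_mono fun T _ => ?_
  have h0 : coll (PP X ℓ g (zs po z univ) (zs po z S) T) ≤ coll (PP X ℓ g (zs po z univ) (zs po z C) T) := by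
    rw [PP_push (zs_mono h) T]
    exact coll_le (fun _ => PP_nonneg _ _)
  by_cases h : cb X ℓ g po ε S C z T
  · rw [ind_true h, le_div_iff₀ hε, one_mul]; exact h.le
  · rw [ind_false h]; exact div_nonneg (by linarith) hε.le

theorem gb_sum {Y : Type*} [Fintype Y] {p : Y → ℝ} (h0 : ∀ y, 0 ≤ p y) (h1 : ∑ y, p y ≤ 1) {τ0 η : ℝ} (hτ : 0 < τ0) (hη : 0 < η) (Q : ℕ) :
    ∑ j ∈ range Q, ind (∃ σ, (τ0 / 2 + (2 * j + 1) * η) - η ≤ p σ ∧ p σ < (τ0 / 2 + (2 * j + 1) * η) + η) ≤ 2 / τ0 := by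
  have e1 : ∀ j ∈ range Q, ind (∃ σ, (τ0 / 2 + (2 * j + 1) * η) - η ≤ p σ ∧ p σ < (τ0 / 2 + (2 * j + 1) * η) + η) ≤
      ∑ σ, ind ((τ0 / 2 + (2 * j + 1) * η) - η ≤ p σ ∧ p σ < (τ0 / 2 + (2 * j + 1) * η) + η) := by
    intro j _
    by_cases h : ∃ σ, (τ0 / 2 + (2 * j + 1) * η) - η ≤ p σ ∧ p σ < (τ0 / 2 + (2 * j + 1) * η) + η
    · rw [ind_true h]
      obtain ⟨σ, hσ⟩ := h
      refine le_trans (le_of_eq (ind_true hσ).symm) ?_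
      exact single_le_sum (f := fun σ => ind ((τ0 / 2 + (2 * j + 1) * η) - η ≤ p σ ∧ p σ < (τ0 / 2 + (2 * j + 1) * η) + η))
        (fun σ _ => ind_nonneg _) (mem_univ σ)
    · rw [ind_false h]; exact sum_nonneg fun σ _ => ind_nonneg _
  refine (sum_le_sum e1).trans ?_
  rw [sum_comm]
  have e2 : ∀ σ, ∑ j ∈ range Q, ind ((τ0 / 2 + (2 * j + 1) * η) - η ≤ p σ ∧ p σ < (τ0 / 2 + (2 * j + 1) * η) + η) ≤ ind (τ0 / 2 ≤ p σ) := by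
    intro σ
    by_cases h : ∃ j ∈ range Q, (τ0 / 2 + (2 * j + 1) * η) - η ≤ p σ ∧ p σ < (τ0 / 2 + (2 * j + 1) * η) + η
    · obtain ⟨j, hj, h2, h3⟩ := h
      have hp : τ0 / 2 ≤ p σ := by
        have : (0:ℝ) ≤ 2 * j * η := by positivity
        linarith
      rw [ind_true hp, sum_eq_single j, ind_true ⟨h2, h3⟩]
      · intro j' _ hne
        refine ind_false fun ⟨h4, h5⟩ => hne ?_
        have a1 : (j:ℝ) < j' + 1 := by
          by_contra hc; push Not at hc
          have := mul_le_mul_of_nonneg_right hc hη.le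
          linarith
        have a2 : (j':ℝ) < j + 1 := by
          by_contra hc; push Not at hc
          have := mul_le_mul_of_nonneg_right hc hη.le
          linarith
        have a1' : j < j' + 1 := by exact_mod_cast a1
        have a2' : j' < j + 1 := by exact_mod_cast a2
        omega
      · intro h; exact absurd hj h
    · push Not at h
      rw [sum_eq_zero]
      · exact ind_nonneg _
      · intro j hj
        exact ind_false fun ⟨h2, h3⟩ => absurd h3 (not_lt.2 (h j hj h2))
  refine (sum_le_sum fun σ _ => e2 σ).trans ?_
  have := card_heavy h0 h1 (τ0 / 2)
  rw [le_div_iff₀ hτ]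
  have e3 : ∑ σ, ind (τ0 / 2 ≤ p σ) = ((univ.filter (fun y => τ0 / 2 ≤ p y)).card : ℝ) := by
    unfold ind; rw [sum_boole]
  rw [e3]; linarith

theorem gap_choice [Nonempty Ω] (hpo : Function.Injective2 po) (hΛ : Fintype.card Lf ≤ ℓ) (hℓ : ℓ ≤ Fintype.card ι)
    (C1 C2 CB : Finset Lf) {τ0 : ℝ} (hτ : 0 < τ0) {Q : ℕ} (hQ : 0 < Q) :
    ∃ τ, τ0 / 2 ≤ τ ∧ τ ≤ τ0 ∧
      av univ (fun z => EE (fun T => ind (gb X ℓ g po τ (τ0 / (4 * Q)) C1 z T) + ind (gb X ℓ g po τ (τ0 / (4 * Q)) C2 z T)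
        + ind (gb X ℓ g po τ (τ0 / (4 * Q)) CB z T))) ≤ 6 / (τ0 * Q) := by
  have hQ' : (0:ℝ) < Q := by exact_mod_cast hQ
  set η := τ0 / (4 * Q) with hη
  have hη0 : 0 < η := by positivity
  set φ : ℕ → ℝ := fun j => av univ (fun z => EE (fun T => ind (gb X ℓ g po (τ0 / 2 + (2 * j + 1) * η) η C1 z T) + ind (gb X ℓ g po (τ0 / 2 + (2 * j + 1) * η) η C2 z T)
        + ind (gb X ℓ g po (τ0 / 2 + (2 * j + 1) * η) η CB z T))) with hφ
  obtain ⟨j, hj, hje⟩ := exists_le_av (s := range Q) ⟨0, by simpa using hQ⟩ φ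
  refine ⟨τ0 / 2 + (2 * j + 1) * η, by
      have : (0:ℝ) ≤ (2 * j + 1) * η := by positivity
      linarith, ?_, hje.trans ?_⟩
  · rw [mem_range] at hj
    have h1 : (2 * (j:ℝ) + 1) ≤ 2 * Q := by
      have : (j:ℝ) + 1 ≤ Q := by exact_mod_cast hj
      linarith
    have h2 := mul_le_mul_of_nonneg_right h1 hη0.le
    have h3 : 2 * (Q:ℝ) * η = τ0 / 2 := by rw [hη]; field_simp; ring
    linarith
  · have : av (range Q) φ = (∑ j ∈ range Q, φ j) / Q := by unfold av; rw [card_range]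
    rw [this, div_le_div_iff₀ hQ' (by positivity)]
    have hs : ∑ j ∈ range Q, φ j ≤ 6 / τ0 := by
      rw [hφ]
      beta_reduce
      rw [← av_sum]
      refine av_le_const' (by positivity) fun z _ => ?_
      rw [← EE_sum]
      refine av_le_const' (by positivity) fun T _ => ?_
      rw [sum_add_distrib, sum_add_distrib]
      have : ∀ C : Finset Lf, ∑ j ∈ range Q, ind (gb X ℓ g po (τ0 / 2 + (2 * j + 1) * η) η C z T) ≤ 2 / τ0 := fun C =>
        gb_sum (p := PP X ℓ g (zs po z C) (zs po z C) T) (fun _ => PP_nonneg _ _)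
          (PP_sum (by rw [card_zs hpo]; exact (card_le_univ _).trans hΛ) hℓ T).le hτ hη0 Q
      have h1 := this C1
      have h2 := this C2
      have h3 := this CB
      have : 6 / τ0 = 2 / τ0 + 2 / τ0 + 2 / τ0 := by ring
      linarith
    rw [le_div_iff₀ hτ] at hs
    nlinarith

theorem mix_av [Nonempty Lc] (C : Finset Lf) (h : (Lf → Lc) → ℝ) : ∃ z0 : Lf → Lc,
    av univ (fun z : Lf → Lc => h (fun l => if l ∈ C then z0 l else z l)) ≤ av univ h := by
  obtain ⟨r, h1, _, h3⟩ := splice_av (X := fun (_ : Lf → Lc) (_ : Unit) => ()) (J := ∅)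
    (fun (z0 z : Lf → Lc) l => if l ∈ C then z0 l else z l) (fun _ _ _ => by rw [mem_cl]; simp) (fun T T' _ => by
      funext l; by_cases hl : l ∈ C <;> simp [hl]) h
  refine ⟨r (Classical.arbitrary _), le_trans (le_of_eq ?_) h3⟩
  refine av_congr fun z _ => ?_
  rw [h1 (Classical.arbitrary _) z (by simp)]
end nodeprob


section nodegen
variable {Ω ι P : Type*} [Fintype Ω] [Fintype ι] [DecidableEq ι] {X : Ω → ι → P} {A : Type*} [Fintype A] [Nonempty A]
variable {Lf Lc : Type*} [Fintype Lf] [DecidableEq Lf] [Fintype Lc] [DecidableEq Lc] {po : Lf → Lc → ι}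
variable {ℓ : ℕ} {g : Finset ι → Ω → ι → A} {lam : ι → ι → ℝ}

/-- the nine index sets -/
def Ks (C1 C2 CB : Finset Lf) (l : Lf) : List (Finset Lf) :=
  [C1, C2, CB, C1 ∪ C2, C2 ∪ CB, C1 ∪ CB, insert l C1, insert l C2, insert l CB]

def bdN (X : Ω → ι → P) (ℓ : ℕ) (g : Finset ι → Ω → ι → A) (po : Lf → Lc → ι) (τ η ε : ℝ) (S C1 C2 CB : Finset Lf) (l : Lf) (z : Lf → Lc) (T : Ω) : Prop :=
  (∃ C ∈ [C1, C2, CB], cb X ℓ g po ε S C z T ∨ gb X ℓ g po τ η C z T) ∨ ∃ K ∈ Ks C1 C2 CB l, nb X ℓ g po ε K z T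

theorem ind_bd_le (τ η ε : ℝ) (S C1 C2 CB : Finset Lf) (l : Lf) (z : Lf → Lc) (T : Ω) :
    ind (bdN X ℓ g po τ η ε S C1 C2 CB l z T) ≤
      (ind (cb X ℓ g po ε S C1 z T) + ind (cb X ℓ g po ε S C2 z T) + ind (cb X ℓ g po ε S CB z T)) +
      (ind (gb X ℓ g po τ η C1 z T) + ind (gb X ℓ g po τ η C2 z T) + ind (gb X ℓ g po τ η CB z T)) +
      ((Ks C1 C2 CB l).map (fun K => ind (nb X ℓ g po ε K z T))).sum := by
  have hs : ∀ Ls : List (Finset Lf), 0 ≤ (Ls.map (fun K => ind (nb X ℓ g po ε K z T))).sum := fun Ls =>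
    List.sum_nonneg (by intro x hx; rw [List.mem_map] at hx; obtain ⟨K, _, rfl⟩ := hx; exact ind_nonneg _)
  have h1 := hs (Ks C1 C2 CB l)
  have n1 := ind_nonneg (cb X ℓ g po ε S C1 z T)
  have n2 := ind_nonneg (cb X ℓ g po ε S C2 z T)
  have n3 := ind_nonneg (cb X ℓ g po ε S CB z T)
  have n4 := ind_nonneg (gb X ℓ g po τ η C1 z T)
  have n5 := ind_nonneg (gb X ℓ g po τ η C2 z T)
  have n6 := ind_nonneg (gb X ℓ g po τ η CB z T)
  by_cases h : bdN X ℓ g po τ η ε S C1 C2 CB l z T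
  · rw [ind_true h]
    rcases h with ⟨C, hC, h | h⟩ | ⟨K, hK, h⟩
    · simp only [List.mem_cons, List.not_mem_nil, or_false] at hC
      rcases hC with rfl | rfl | rfl <;> · have := ind_true h; linarith
    · simp only [List.mem_cons, List.not_mem_nil, or_false] at hC
      rcases hC with rfl | rfl | rfl <;> · have := ind_true h; linarith
    · have : ind (nb X ℓ g po ε K z T) ≤ ((Ks C1 C2 CB l).map (fun K => ind (nb X ℓ g po ε K z T))).sum :=
        List.single_le_sum (by intro x hx; rw [List.mem_map] at hx; obtain ⟨K, _, rfl⟩ := hx; exact ind_nonneg _) _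
          (List.mem_map.2 ⟨K, hK, rfl⟩)
      rw [ind_true h] at this
      linarith
  · rw [ind_false h]; linarith

theorem bd_prob [Nonempty Ω] (hpo : Function.Injective2 po) (H : Hyp X lam) (hΛ : Fintype.card Lf < ℓ) (hℓ : ℓ ≤ Fintype.card ι)
    {τ η ε εg B : ℝ} (hε : 0 < ε) {S C1 C2 CB : Finset Lf} (h1 : C1 ⊆ S) (h2 : C2 ⊆ S) (hB : CB ⊆ S)
    (q1 : qq X ℓ g po C1 - qq X ℓ g po S ≤ εg) (q2 : qq X ℓ g po C2 - qq X ℓ g po S ≤ εg) (q3 : qq X ℓ g po CB - qq X ℓ g po S ≤ εg)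
    (hg : av univ (fun z => EE (fun T => ind (gb X ℓ g po τ η C1 z T) + ind (gb X ℓ g po τ η C2 z T)
        + ind (gb X ℓ g po τ η CB z T))) ≤ B) (l : Lf) :
    av univ (fun z => EE (fun T => ind (bdN X ℓ g po τ η ε S C1 C2 CB l z T))) ≤
      3 * (εg / ε) + B + 9 * (G2 (Fintype.card ι) (Fintype.card Lc) (Fintype.card Lf) ℓ / ε ^ 2) := by
  refine le_trans (av_mono fun z _ => EE_mono fun T => ind_bd_le τ η ε S C1 C2 CB l z T) ?_
  simp only [Ks, List.map_cons, List.map_nil, List.sum_cons, List.sum_nil, EE_add, av_add] at hg ⊢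
  have c : ∀ C, C ⊆ S → qq X ℓ g po C - qq X ℓ g po S ≤ εg → av univ (fun z => EE (fun T => ind (cb X ℓ g po ε S C z T))) ≤ εg / ε :=
    fun C hC hq => (cb_le hC hε).trans (div_le_div_of_nonneg_right hq hε.le)
  have m := fun K => nb_le (g := g) hpo H hΛ hℓ K hε
  have := c _ h1 q1
  have := c _ h2 q2
  have := c _ hB q3
  have := m C1
  have := m C2
  have := m CB
  have := m (C1 ∪ C2)
  have := m (C2 ∪ CB)
  have := m (C1 ∪ CB)
  have := m (insert l C1)
  have := m (insert l C2)
  have := m (insert l CB)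
  have z0 : EE (fun _ : Ω => (0:ℝ)) = 0 := EE_zero
  have z1 : av (univ : Finset (Lf → Lc)) (fun _ => (0:ℝ)) = 0 := av_zero _
  rw [z0, z1]
  linarith

/-- the local distribution functional -/
noncomputable def PQ (X : Ω → ι → P) (ℓ : ℕ) (g : Finset ι → Ω → ι → A) (T : Ω) (J : Finset ι) (σ : ι → A) : ℝ := PP X ℓ g J J T σ

section det
variable {τ η ε : ℝ} {S C1 C2 CB : Finset Lf} {l : Lf} {z : Lf → Lc} {T : Ω}

theorem near_of {K : Finset Lf} (hK : K ⊆ S) (h : ¬ nb X ℓ g po ε K z T) (σ : ι → A) :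
    |PQ X ℓ g T (zs po z K) σ - push (restr (zs po z K)) (PP X ℓ g (zs po z univ) (zs po z S) T) σ| ≤ ε := by
  rw [← PP_push (zs_mono hK) T, abs_sub_comm]
  unfold nb at h
  push Not at h
  exact h σ

theorem one_of {C : Finset Lf} (hC : C ⊆ S) (h : ¬ nb X ℓ g po ε C z T) (h' : ¬ cb X ℓ g po ε S C z T) (h'' : ¬ gb X ℓ g po τ η C z T) :
    OneOK τ η ε (PP X ℓ g (zs po z univ) (zs po z S) T) (PQ X ℓ g T (zs po z C)) (zs po z C) where
  near := near_of hC h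
  coll := by
    rw [← PP_push (zs_mono hC) T]
    unfold cb at h'
    push Not at h'
    exact h'
  gap := fun σ hσ => by
    unfold gb at h''
    push Not at h''
    exact h'' σ hσ

theorem bd_two (h : ¬ bdN X ℓ g po τ η ε S C1 C2 CB l z T) (h2 : C2 ⊆ S) (hl : l ∈ S) :
    OneOK τ η ε (PP X ℓ g (zs po z univ) (zs po z S) T) (PQ X ℓ g T (zs po z C2)) (zs po z C2) ∧
    ∀ σ, |PQ X ℓ g T (insert (po l (z l)) (zs po z C2)) σ - push (restr (insert (po l (z l)) (zs po z C2))) (PP X ℓ g (zs po z univ) (zs po z S) T) σ| ≤ ε := by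
  unfold bdN at h
  push Not at h
  obtain ⟨ha, hb⟩ := h
  refine ⟨one_of h2 (hb C2 (by simp [Ks])) (ha C2 (by simp)).1 (ha C2 (by simp)).2, ?_⟩
  rw [← zs_insert]
  exact near_of (insert_subset hl h2) (hb _ (by simp [Ks]))

theorem bd_good {M : ℕ} (hpo : Function.Injective2 po) (hΛ : Fintype.card Lf ≤ ℓ) (hℓ : ℓ ≤ Fintype.card ι) (hc : Cst τ η ε) (hM : 1 / τ ≤ M)
    (h1 : C1 ⊆ S) (h2 : C2 ⊆ S) (hB : CB ⊆ S) (hl : l ∈ S) (d12 : Disjoint C1 C2) (d2B : Disjoint C2 CB) (d1B : Disjoint C1 CB)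
    (l1 : l ∉ C1) (l2 : l ∉ C2) (lB : l ∉ CB) (h : ¬ bdN X ℓ g po τ η ε S C1 C2 CB l z T) :
    GoodN (M := M) (cntD τ (PQ X ℓ g)) (MtD τ (PQ X ℓ g)) (VlD τ (PQ X ℓ g)) (zs po z C1) (zs po z C2) (zs po z CB) (po l (z l)) T := by
  unfold bdN at h
  push Not at h
  obtain ⟨ha, hb⟩ := h
  have nt : ∀ C : Finset Lf, l ∉ C → po l (z l) ∉ zs po z C := fun C hC hh => hC ((po_mem_zs hpo).1 hh).1
  refine good_det (μ := PP X ℓ g (zs po z univ) (zs po z S) T) hc (fun _ => PP_nonneg _ _)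
    (PP_sum (by rw [card_zs hpo, card_univ]; exact hΛ) hℓ T).le hM (zs_disj hpo d12) (zs_disj hpo d2B) (zs_disj hpo d1B)
    (nt _ l1) (nt _ l2) (nt _ lB)
    (one_of h1 (hb _ (by simp [Ks])) (ha _ (by simp)).1 (ha _ (by simp)).2)
    (one_of h2 (hb _ (by simp [Ks])) (ha _ (by simp)).1 (ha _ (by simp)).2)
    (one_of hB (hb _ (by simp [Ks])) (ha _ (by simp)).1 (ha _ (by simp)).2) ?_ ?_ ?_ ?_ ?_ ?_
  · rw [← zs_union]; exact near_of (union_subset h1 h2) (hb _ (by simp [Ks]))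
  · rw [← zs_union]; exact near_of (union_subset h2 hB) (hb _ (by simp [Ks]))
  · rw [← zs_union]; exact near_of (union_subset h1 hB) (hb _ (by simp [Ks]))
  · rw [← zs_insert]; exact near_of (insert_subset hl h1) (hb _ (by simp [Ks]))
  · rw [← zs_insert]; exact near_of (insert_subset hl h2) (hb _ (by simp [Ks]))
  · rw [← zs_insert]; exact near_of (insert_subset hl hB) (hb _ (by simp [Ks]))
end det

/-- expected bad mass -/
theorem mass_bd [Nonempty Ω] (hpo : Function.Injective2 po) (hΛ : Fintype.card Lf ≤ ℓ) (hℓ : ℓ ≤ Fintype.card ι)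
    {τ η ε : ℝ} (hc : Cst τ η ε) {S C1 C2 CB : Finset Lf} (h2 : C2 ⊆ S) {l : Lf} (hl : l ∈ S) (z : Lf → Lc) :
    av (Sp (zs po z univ) ℓ) (fun I => EE (fun T => ind (restr (zs po z C2) (g I T) ∈ LL τ (PQ X ℓ g) T (zs po z C2) ∧
      ¬ (τ / 2 ≤ PQ X ℓ g T (insert (po l (z l)) (zs po z C2)) (restr (insert (po l (z l)) (zs po z C2)) (g I T)))))) ≤
    EE (fun T => ind (bdN X ℓ g po τ η ε S C1 C2 CB l z T)) + ε / τ ^ 2 := by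
  set Ψ : Ω → (ι → A) → ℝ := fun T ρ => ind (restr (zs po z C2) ρ ∈ LL τ (PQ X ℓ g) T (zs po z C2) ∧
      ¬ (τ / 2 ≤ PQ X ℓ g T (insert (po l (z l)) (zs po z C2)) (restr (insert (po l (z l)) (zs po z C2)) ρ))) with hΨ
  have hsub1 : zs po z C2 ⊆ zs po z S := zs_mono h2
  have hsub2 : insert (po l (z l)) (zs po z C2) ⊆ zs po z S := by rw [← zs_insert]; exact zs_mono (insert_subset hl h2)
  have hm : ∀ ρ, Ms X (zs po z univ) (fun T => Ψ T ρ) := by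
    intro ρ T T' hT
    have sub : ∀ K : Finset Lf, PQ X ℓ g T (zs po z K) = PQ X ℓ g T' (zs po z K) := fun K =>
      PP_ms' T T' (fun j hj => hT j (zs_mono (subset_univ K) hj))
    have s1 := sub C2
    have s2 := sub (insert l C2)
    rw [zs_insert] at s2
    have s3 : LL τ (PQ X ℓ g) T (zs po z C2) = LL τ (PQ X ℓ g) T' (zs po z C2) := by
      unfold LL; rw [s1]
    simp only [hΨ]
    rw [s2, s3]
  have hr : ∀ T ρ, Ψ T (restr (zs po z S) ρ) = Ψ T ρ := by
    intro T ρ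
    simp only [hΨ]
    rw [restr_restr hsub1, restr_restr hsub2]
  have key := PP_conv (X := X) (ℓ := ℓ) (g := g) (c := zs po z S) Ψ hm
  simp only [hr] at key
  have : (av (Sp (zs po z univ) ℓ) fun I => EE fun T => Ψ T (g I T)) ≤ EE (fun T => ind (bdN X ℓ g po τ η ε S C1 C2 CB l z T)) + ε / τ ^ 2 := by
    rw [← key]
    have hcst : EE (fun _ : Ω => ε / τ ^ 2) = ε / τ ^ 2 := av_const univ_nonempty _
    rw [← hcst, ← EE_add]
    refine EE_mono fun T => ?_
    have hs := PP_sum (X := X) (ℓ := ℓ) (g := g) (J := zs po z univ) (c := zs po z S) (by rw [card_zs hpo, card_univ]; exact hΛ) hℓ T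
    have hε := hc.ε0
    by_cases h : bdN X ℓ g po τ η ε S C1 C2 CB l z T
    · rw [ind_true h]
      have : ∑ ρ, PP X ℓ g (zs po z univ) (zs po z S) T ρ * Ψ T ρ ≤ 1 := by
        rw [← hs]
        refine sum_le_sum fun ρ _ => ?_
        have := PP_nonneg (X := X) (ℓ := ℓ) (g := g) (J := zs po z univ) (c := zs po z S) T ρ
        have h2 : Ψ T ρ ≤ 1 := ind_le_one _
        nlinarith
      have : 0 ≤ EE (fun _ : Ω => ε / τ ^ 2) := by rw [hcst]; positivity
      have : 0 ≤ ε / τ ^ 2 := by positivity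
      linarith
    · rw [ind_false h, zero_add]
      obtain ⟨o2, m2⟩ := bd_two h h2 hl
      exact bad_mass hc (fun _ => PP_nonneg _ _) hs.le o2 m2
  exact this
end nodegen


section msD
variable {Ω ι P : Type*} [Fintype Ω] [Fintype ι] [DecidableEq ι] {X : Ω → ι → P} {A : Type*} [Fintype A] [Nonempty A]
variable {ℓ : ℕ} {g : Finset ι → Ω → ι → A}

theorem PQ_eq {J K : Finset ι} {T T' : Ω} (hJ : J ⊆ K) (h : ∀ j ∈ K, X T j = X T' j) : PQ X ℓ g T J = PQ X ℓ g T' J :=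
  PP_ms' T T' (fun j hj => h j (hJ hj))

theorem LL_eq {τ : ℝ} {J K : Finset ι} {T T' : Ω} (hJ : J ⊆ K) (h : ∀ j ∈ K, X T j = X T' j) :
    LL τ (PQ X ℓ g) T J = LL τ (PQ X ℓ g) T' J := by
  unfold LL; rw [PQ_eq hJ h]

theorem cntD_ms (τ : ℝ) (J : Finset ι) : Ms X J (cntD τ (PQ X ℓ g) J) := fun T T' h => by
  unfold cntD; rw [LL_eq (Subset.refl J) h]

theorem MtD_ms {M : ℕ} (τ : ℝ) (J J' : Finset ι) : Ms X (J ∪ J') (MtD (M := M) τ (PQ X ℓ g) J J') := fun T T' h => by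
  funext a b
  unfold MtD; rw [LL_eq subset_union_left h, LL_eq subset_union_right h, PQ_eq (Subset.refl _) h]

theorem VlD_ms {M : ℕ} (τ : ℝ) (J : Finset ι) (i : ι) : Ms X (insert i J) (VlD (M := M) τ (PQ X ℓ g) J i) := fun T T' h => by
  funext a b
  unfold VlD; rw [LL_eq (subset_insert i J) h, PQ_eq (Subset.refl _) h]
end msD

theorem Cst_mk {τ0 τ : ℝ} {Q : ℕ} (h0 : 0 < τ0) (h1 : τ0 ≤ 1) (hQ : 0 < Q) (ha : τ0 / 2 ≤ τ) (hb : τ ≤ τ0) :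
    Cst τ (τ0 / (4 * Q)) (τ0 ^ 2 / (24 * Q)) := by
  have hQ' : (1:ℝ) ≤ Q := by exact_mod_cast hQ
  have hQ0 : (0:ℝ) < Q := by linarith
  have ht : 0 < τ := by linarith
  have e : τ0 ^ 2 / (24 * Q) / τ ≤ τ0 / (12 * Q) := by
    rw [div_div, div_le_div_iff₀ (by positivity) (by positivity)]
    nlinarith [mul_pos h0 hQ0]
  have e2 : τ0 ^ 2 / (24 * Q) ≤ τ0 / (24 * Q) := by
    apply div_le_div_of_nonneg_right _ (by positivity)
    nlinarith
  have e3 : τ0 / (12 * Q) + τ0 / (24 * Q) = τ0 / (8 * Q) := by field_simp; norm_num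
  have e4 : τ0 / (8 * Q) ≤ τ0 / 8 := by
    apply div_le_div_of_nonneg_left h0.le (by norm_num); linarith
  have e5 : τ0 / (8 * Q) ≤ τ0 / (4 * Q) := by
    apply div_le_div_of_nonneg_left h0.le (by positivity); linarith
  exact ⟨ht, hb.trans h1, by positivity, by linarith, by linarith⟩

section node
variable {F : Type} [Field F] [Fintype F] {n a0 N : ℕ} {A : Type*} [Fintype A] [Nonempty A]
variable {Lf Lc : Type*} [Fintype Lf] [DecidableEq Lf] [Fintype Lc] [DecidableEq Lc] {po : Lf → Lc → Fin N}
variable {ℓ : ℕ} {g : Finset (Fin N) → Fl F n a0 N → Fin N → A}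

theorem node [Nonempty (Fl F n a0 N)] [Nonempty Lc] (hq : (10:ℝ)^21 ≤ Fintype.card F) (hpo : Function.Injective2 po)
    (hΛ : Fintype.card Lf < ℓ) (hℓ : ℓ ≤ N) {τ0 εg : ℝ} (h0 : 0 < τ0) (h1 : τ0 ≤ 1) {Q : ℕ} (hQ : 0 < Q) {M : ℕ} (hM : 2 / τ0 ≤ M)
    {S C1 C2 CB R : Finset Lf} (s1 : C1 ⊆ S) (s2 : C2 ⊆ S) (sB : CB ⊆ S) (sR : R ⊆ S)
    (d12 : Disjoint C1 C2) (d2B : Disjoint C2 CB) (d1B : Disjoint C1 CB) (dR1 : Disjoint R C1) (dR2 : Disjoint R C2) (dRB : Disjoint R CB)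
    (nR : R.Nonempty) (n2 : C2.Nonempty) {i1 i3 : Fin N}
    (o1 : ∀ l ∈ C1, ∀ y, po l y ≤ i1) (o3 : ∀ l ∈ CB, ∀ y, i3 ≤ po l y) (o2 : ∀ l ∈ C2, ∀ y, i1 < po l y)
    (o2R : ∀ l ∈ C2, ∀ y, ∀ l' ∈ R, ∀ y', po l y < po l' y') (oR : ∀ l ∈ R, ∀ y, po l y < i3)
    (q1 : qq cX ℓ g po C1 - qq cX ℓ g po S ≤ εg) (q2 : qq cX ℓ g po C2 - qq cX ℓ g po S ≤ εg) (q3 : qq cX ℓ g po CB - qq cX ℓ g po S ≤ εg) :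
    ∃ (f : Sb F n → Fin M → A) (Idx : Fl F n a0 N → Finset (Fin N) → (Fin N → A) → Fin M),
      av R (fun l => av univ (fun z => av (Sp (zs po z univ) ℓ) (fun I => EE (fun T => ind (
        τ0 ≤ PQ cX ℓ g T (zs po z C2) (restr (zs po z C2) (g I T)) ∧
        g I T (po l (z l)) ≠ f (cX T (po l (z l))) (Idx T (zs po z C2) (restr (zs po z C2) (g I T)))))))) ≤
      (3 + 200 * Cf 3) * (3 * (εg / (τ0 ^ 2 / (24 * Q))) + 6 / (τ0 * Q) + 9 * (G2 N (Fintype.card Lc) (Fintype.card Lf) ℓ / (τ0 ^ 2 / (24 * Q)) ^ 2))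
        + (τ0 ^ 2 / (24 * Q)) / (τ0 / 2) ^ 2 := by
  have H := flag_hyp (F := F) (n := n) (a0 := a0) (N := N) (by linarith : (8:ℝ) ≤ Fintype.card F)
  have hQ0 : (0:ℝ) < Q := by exact_mod_cast hQ
  have hN : Fintype.card (Fin N) = N := Fintype.card_fin N
  have hℓ' : ℓ ≤ Fintype.card (Fin N) := by rw [hN]; exact hℓ
  obtain ⟨τ, ha, hb, hgap⟩ := gap_choice (X := cX) (g := g) hpo hΛ.le hℓ' C1 C2 CB h0 hQ
  have hc := Cst_mk h0 h1 hQ ha hb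
  set η := τ0 / (4 * Q)
  set ε := τ0 ^ 2 / (24 * Q) with hεd
  have hε : 0 < ε := by positivity
  set E := 3 * (εg / ε) + 6 / (τ0 * Q) + 9 * (G2 N (Fintype.card Lc) (Fintype.card Lf) ℓ / ε ^ 2) with hE
  have hbd : ∀ l, av univ (fun z => EE (fun T => ind (bdN cX ℓ g po τ η ε S C1 C2 CB l z T))) ≤ E := fun l => by
    have := bd_prob (g := g) hpo H hΛ hℓ' hε s1 s2 sB q1 q2 q3 hgap l
    rwa [hN] at this
  have hτ : 0 < τ := hc.τ0
  have hM' : 1 / τ ≤ M := by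
    refine le_trans ?_ hM
    rw [div_le_div_iff₀ hτ h0]; linarith
  set gd : Lf → (Lf → Lc) → Fl F n a0 N → Prop := fun l z T =>
    GoodN (M := M) (cntD τ (PQ cX ℓ g)) (MtD τ (PQ cX ℓ g)) (VlD τ (PQ cX ℓ g)) (zs po z C1) (zs po z C2) (zs po z CB) (po l (z l)) T with hgd
  have hgood : av univ (fun z => av R (fun l => EE (fun T => ind (¬ gd l z T)))) ≤ E := by
    rw [av_comm]
    refine av_le_const nR fun l hl => le_trans (av_mono fun z _ => EE_mono fun T => ind_mono ?_) (hbd l)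
    intro h
    by_contra hn
    exact h (bd_good hpo hΛ.le hℓ' hc hM' s1 s2 sB (sR hl) d12 d2B d1B (disjoint_left.1 dR1 hl) (disjoint_left.1 dR2 hl) (disjoint_left.1 dRB hl) hn)
  obtain ⟨z0, hz0⟩ := mix_av (C1 ∪ CB) (fun z => av R (fun l => EE (fun T => ind (¬ gd l z T))))
  replace hz0 := hz0.trans hgood
  have nP : (R ×ˢ (univ : Finset (Lf → Lc))).Nonempty := nR.product univ_nonempty
  have hmix : av (R ×ˢ (univ : Finset (Lf → Lc))) (fun b => EE (fun T => ind (¬ GoodN (M := M) (cntD τ (PQ cX ℓ g)) (MtD τ (PQ cX ℓ g)) (VlD τ (PQ cX ℓ g))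
      (zs po z0 C1) (zs po b.2 C2) (zs po z0 CB) (po b.1 (b.2 b.1)) T))) ≤ E := by
    rw [av_prod R univ (fun l z => EE (fun T => ind (¬ GoodN (M := M) (cntD τ (PQ cX ℓ g)) (MtD τ (PQ cX ℓ g)) (VlD τ (PQ cX ℓ g))
      (zs po z0 C1) (zs po z C2) (zs po z0 CB) (po l (z l)) T))), av_comm]
    refine le_trans (le_of_eq ?_) hz0
    refine av_congr fun z _ => av_congr fun l hl => EE_congr fun T => ?_
    have k1 : zs po (fun l => if l ∈ C1 ∪ CB then z0 l else z l) C1 = zs po z0 C1 := zs_congr fun l hl => by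
      rw [if_pos (mem_union_left _ hl)]
    have k2 : zs po (fun l => if l ∈ C1 ∪ CB then z0 l else z l) CB = zs po z0 CB := zs_congr fun l hl => by
      rw [if_pos (mem_union_right _ hl)]
    have k3 : zs po (fun l => if l ∈ C1 ∪ CB then z0 l else z l) C2 = zs po z C2 := zs_congr fun l hl => by
      rw [if_neg]; rw [mem_union]; rintro (h | h)
      · exact disjoint_left.1 d12 h hl
      · exact disjoint_left.1 d2B hl h
    have k4 : (if l ∈ C1 ∪ CB then z0 l else z l) = z l := by
      rw [if_neg]; rw [mem_union]; rintro (h | h)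
      · exact disjoint_left.1 dR1 hl h
      · exact disjoint_left.1 dRB hl h
    simp only [hgd]
    rw [k1, k2, k3, k4]
  obtain ⟨f, Idx, hf⟩ := core_decode (M := M) (β := Lf × (Lf → Lc)) hq (cntD_ms τ) (MtD_ms τ) (VlD_ms τ) nP (J1 := zs po z0 C1) (JB := zs po z0 CB)
    (J2 := fun b => zs po b.2 C2) (pt := fun b => po b.1 (b.2 b.1)) (i1 := i1) (i3 := i3)
    (fun j hj => by obtain ⟨l, hl, rfl⟩ := mem_zs.1 hj; exact o1 l hl _)
    (fun j hj => by obtain ⟨l, hl, rfl⟩ := mem_zs.1 hj; exact o3 l hl _)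
    (fun b _ => n2.image _)
    (fun b _ j hj => by obtain ⟨l, hl, rfl⟩ := mem_zs.1 hj; exact o2 l hl _)
    (fun b hb j hj => by obtain ⟨l, hl, rfl⟩ := mem_zs.1 hj; exact o2R l hl _ _ (mem_product.1 hb).1 _)
    (fun b hb => oR _ (mem_product.1 hb).1 _) hmix
  have Mpos : 0 < M := by
    have : (0:ℝ) < M := lt_of_lt_of_le (by positivity) hM
    exact_mod_cast this
  have hcard : ∀ T J, J.card ≤ ℓ → (LL τ (PQ cX ℓ g) T J).card ≤ M := by
    intro T J hJ
    have := card_heavy (μ := PQ cX ℓ g T J) (fun _ => PP_nonneg _ _) (PP_sum hJ hℓ' T).le τ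
    rw [← le_div_iff₀ hτ] at this
    exact_mod_cast this.trans hM'
  refine ⟨f, fun T J σ => Idx T J (if h : ∃ p : Fin M, p.1 < (LL τ (PQ cX ℓ g) T J).card ∧ en (LL τ (PQ cX ℓ g) T J) p = σ then h.choose else ⟨0, Mpos⟩), ?_⟩
  rw [av_prod R univ (fun l z => EE (fun T => ind (∃ p c, p.1 < cntD τ (PQ cX ℓ g) (zs po z C2) T ∧ VlD τ (PQ cX ℓ g) (zs po z C2) (po l (z l)) T p c ∧
    c ≠ f (cX T (po l (z l))) (Idx T (zs po z C2) p))))] at hf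
  have fin : ∀ l ∈ R, ∀ z, _ := fun l hl z => mass_bd (X := cX) (g := g) (τ := τ) (η := η) (ε := ε) (CB := CB) (C1 := C1) hpo hΛ.le hℓ' hc s2 (sR hl) z
  have hfin : av R (fun l => av univ (fun z => EE (fun T => ind (bdN cX ℓ g po τ η ε S C1 C2 CB l z T)) + ε / τ ^ 2)) ≤ E + ε / τ ^ 2 := by
    refine av_le_const nR fun l _ => ?_
    rw [av_add, av_const univ_nonempty]
    have := hbd l
    linarith
  have tot : av R (fun l => av univ (fun z => av (Sp (zs po z univ) ℓ) (fun I => EE (fun T => ind (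
        τ0 ≤ PQ cX ℓ g T (zs po z C2) (restr (zs po z C2) (g I T)) ∧
        g I T (po l (z l)) ≠ f (cX T (po l (z l))) (Idx T (zs po z C2) (if h : ∃ p : Fin M, p.1 < (LL τ (PQ cX ℓ g) T (zs po z C2)).card ∧ en (LL τ (PQ cX ℓ g) T (zs po z C2)) p = (restr (zs po z C2) (g I T)) then h.choose else ⟨0, Mpos⟩))))))) ≤
      av R (fun l => av univ (fun z => (EE (fun T => ind (bdN cX ℓ g po τ η ε S C1 C2 CB l z T)) + ε / τ ^ 2) +
        EE (fun T => ind (∃ p c, p.1 < cntD τ (PQ cX ℓ g) (zs po z C2) T ∧ VlD τ (PQ cX ℓ g) (zs po z C2) (po l (z l)) T p c ∧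
    c ≠ f (cX T (po l (z l))) (Idx T (zs po z C2) p))))) := by
    refine av_mono fun l hl => av_mono fun z _ => ?_
    refine le_trans ?_ (add_le_add_left (fin l hl z) _)
    have hSp : (Sp (zs po z univ) ℓ).Nonempty := Sp_ne (by rw [card_zs hpo, card_univ]; exact hΛ.le) hℓ'
    rw [← av_const hSp (EE (fun T => ind (∃ p c, p.1 < cntD τ (PQ cX ℓ g) (zs po z C2) T ∧ VlD τ (PQ cX ℓ g) (zs po z C2) (po l (z l)) T p c ∧
    c ≠ f (cX T (po l (z l))) (Idx T (zs po z C2) p)))), ← av_add]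
    refine av_mono fun I _ => ?_
    rw [← EE_add]
    refine EE_mono fun T => ind_or ?_
    rintro ⟨hr, hne⟩
    have hmem : restr (zs po z C2) (g I T) ∈ LL τ (PQ cX ℓ g) T (zs po z C2) := by
      unfold LL; rw [mem_filter]; exact ⟨mem_univ _, hb.trans hr⟩
    by_cases hv : τ / 2 ≤ PQ cX ℓ g T (insert (po l (z l)) (zs po z C2)) (restr (insert (po l (z l)) (zs po z C2)) (g I T))
    · right
      have hex : ∃ p : Fin M, p.1 < (LL τ (PQ cX ℓ g) T (zs po z C2)).card ∧ en (LL τ (PQ cX ℓ g) T (zs po z C2)) p = (restr (zs po z C2) (g I T)) :=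
        en_surj (hcard T _ (by rw [card_zs hpo]; exact (card_le_univ _).trans hΛ.le)) hmem
      rw [dif_pos hex] at hne
      refine ⟨hex.choose, g I T (po l (z l)), hex.choose_spec.1, ?_, hne⟩
      unfold VlD
      rw [hex.choose_spec.2]
      convert hv using 2
      funext x
      by_cases hx : x = po l (z l)
      · subst hx; rw [Function.update_self, restr_in (mem_insert_self _ _)]
      · rw [Function.update_of_ne hx]
        unfold restr
        simp [hx]
    · left; exact ⟨hmem, hv⟩
  refine tot.trans ?_
  have sp2 : ∀ a b : Lf → (Lf → Lc) → ℝ, av R (fun l => av univ (fun z => a l z + b l z)) = av R (fun l => av univ (a l)) + av R (fun l => av univ (b l)) := by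
    intro a b
    rw [← av_add]
    exact av_congr fun l _ => av_add _ _ _
  rw [sp2 (fun l z => EE (fun T => ind (bdN cX ℓ g po τ η ε S C1 C2 CB l z T)) + ε / τ ^ 2)]
  have e6 : ε / τ ^ 2 ≤ ε / (τ0 / 2) ^ 2 := by
    apply div_le_div_of_nonneg_left hε.le (by positivity)
    gcongr
  linarith
end node


section asm
variable {Ω ι P : Type*} [Fintype Ω] [Fintype ι] [DecidableEq ι] {X : Ω → ι → P} {A : Type*} [Fintype A] [Nonempty A]
variable {Lf Lc : Type*} [Fintype Lf] [DecidableEq Lf] [Fintype Lc] [DecidableEq Lc] {po : Lf → Lc → ι}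
variable {ℓ : ℕ} {g : Finset ι → Ω → ι → A} {lam : ι → ι → ℝ}

noncomputable def nl (po : Lf → Lc → ι) (I : Finset ι) (l : Lf) : ℕ := (univ.filter (fun y => po l y ∈ I)).card
def bal (po : Lf → Lc → ι) (ℓ : ℕ) (I : Finset ι) : Prop := ∀ l, (nl po I l : ℝ) ≤ 2 * ℓ / Fintype.card Lf

theorem nl_eq (hpo : Function.Injective2 po) (I : Finset ι) (l : Lf) :
    (nl po I l : ℝ) = ∑ i ∈ I, ind (∃ y, po l y = i) := by
  have e : ∑ i ∈ I, ind (∃ y, po l y = i) = ((I.filter (fun i => ∃ y, po l y = i)).card : ℝ) := by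
    rw [Finset.card_filter]; push_cast
    refine sum_congr rfl fun i _ => ?_
    unfold ind; split_ifs <;> rfl
  rw [e]
  unfold nl
  congr 1
  refine card_bij (fun y _ => po l y) ?_ ?_ ?_
  · intro y hy; simp at hy ⊢; exact hy
  · intro y _ y' _ h; exact (hpo h).2
  · intro i hi; simp at hi; obtain ⟨h, y, rfl⟩ := hi; exact ⟨y, by simpa using h, rfl⟩

theorem bal_prob (hpo : Function.Injective2 po) [Nonempty Lf] [Nonempty Lc] (h0 : 0 < ℓ) (hℓ : ℓ ≤ Fintype.card ι)
    (hN : Fintype.card Lf * Fintype.card Lc ≤ Fintype.card ι) :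
    av (Sp (∅ : Finset ι) ℓ) (fun I => ind (¬ bal po ℓ I)) ≤ (Fintype.card Lf : ℝ) ^ 2 / ℓ := by
  set Λ : ℝ := ((Fintype.card Lf : ℕ) : ℝ)
  set L : ℝ := ((Fintype.card Lc : ℕ) : ℝ)
  set N : ℝ := ((Fintype.card ι : ℕ) : ℝ)
  have hΛ0 : 0 < Λ := Nat.cast_pos.2 Fintype.card_pos
  have hL0 : 0 < L := Nat.cast_pos.2 Fintype.card_pos
  have hℓ0 : (0:ℝ) < ℓ := by exact_mod_cast h0
  have hN' : Λ * L ≤ N := by simp only [Λ, L, N]; exact_mod_cast hN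
  have hN0 : 0 < N := lt_of_lt_of_le (by positivity) hN'
  have hLN : L / N ≤ 1 / Λ := by rw [div_le_div_iff₀ hN0 hΛ0]; linarith
  have one : ∀ l, av (Sp (∅ : Finset ι) ℓ) (fun I => ind (2 * ℓ / Λ < (nl po I l : ℝ))) ≤ Λ / ℓ := by
    intro l
    have hav : av (univ : Finset ι) (fun i => ind (∃ y, po l y = i)) = L / N := by
      unfold av
      rw [← nl_eq hpo univ l, card_univ]
      congr 1
      simp [nl, L]
    have hne : (univ : Finset ι).Nonempty := by
      rw [← card_pos, card_univ]; exact Nat.cast_pos.1 hN0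
    have sw := sample_wo (J := (∅ : Finset ι)) (fun i => ind (∃ y, po l y = i) - L / N) (by
      rw [compl_empty, av_sub, hav, av_const hne]; ring) ℓ (by simpa using hℓ)
    rw [card_empty, zero_add, compl_empty] at sw
    have hvar : av (univ : Finset ι) (fun i => (ind (∃ y, po l y = i) - L / N) ^ 2) ≤ 1 / Λ := by
      have : ∀ i ∈ (univ : Finset ι), (ind (∃ y, po l y = i) - L / N) ^ 2 = (1 - 2 * (L / N)) * ind (∃ y, po l y = i) + (L / N)^2 := by
        intro i _
        have := ind_sq (∃ y, po l y = i)
        have e : (ind (∃ y, po l y = i) - L / N) ^ 2 = ind (∃ y, po l y = i) ^ 2 - 2 * (L / N) * ind (∃ y, po l y = i) + (L/N)^2 := by ring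
        rw [e, this]; ring
      rw [av_congr this, av_add, av_mul, av_const hne, hav]
      nlinarith [sq_nonneg (L / N)]
    have hb : av (Sp (∅ : Finset ι) ℓ) (fun I => ind (2 * ℓ / Λ < (nl po I l : ℝ))) ≤
        av (Sp (∅ : Finset ι) ℓ) (fun I => (∑ i ∈ I \ ∅, (ind (∃ y, po l y = i) - L / N)) ^ 2 * (Λ ^ 2 / ℓ ^ 2)) := by
      refine av_mono fun I hI => ?_
      rw [sdiff_empty, sum_sub_distrib, ← nl_eq hpo, sum_const, (mem_Sp.1 hI).2, nsmul_eq_mul]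
      by_cases h : 2 * ℓ / Λ < (nl po I l : ℝ)
      · rw [ind_true h]
        have h1 : ℓ * (L / N) ≤ ℓ / Λ := by
          have := mul_le_mul_of_nonneg_left hLN hℓ0.le
          rwa [mul_one_div] at this
        have h2 : ℓ / Λ ≤ nl po I l - ℓ * (L / N) := by
          have : 2 * ℓ / Λ = ℓ / Λ + ℓ / Λ := by ring
          linarith
        have h3 := pow_le_pow_left₀ (by positivity) h2 2
        have h4 := mul_le_mul_of_nonneg_right h3 (by positivity : 0 ≤ Λ ^ 2 / (ℓ:ℝ) ^ 2)
        refine le_trans (le_of_eq ?_) h4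
        field_simp
      · rw [ind_false h]; positivity
    refine hb.trans ?_
    rw [av_mul']
    have h5 := mul_le_mul_of_nonneg_right (sw.trans (mul_le_mul_of_nonneg_left hvar hℓ0.le)) (by positivity : 0 ≤ Λ ^ 2 / (ℓ:ℝ) ^ 2)
    refine h5.trans (le_of_eq ?_)
    field_simp
  have : av (Sp (∅ : Finset ι) ℓ) (fun I => ind (¬ bal po ℓ I)) ≤ av (Sp (∅ : Finset ι) ℓ) (fun I => ∑ l : Lf, ind (2 * ℓ / Λ < (nl po I l : ℝ))) := by
    refine av_mono fun I _ => ?_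
    by_cases h : bal po ℓ I
    · rw [ind_false (not_not.2 h)]; exact sum_nonneg fun l _ => ind_nonneg _
    · rw [ind_true h]
      unfold bal at h
      push Not at h
      obtain ⟨l, hl⟩ := h
      rw [← ind_true hl]
      exact single_le_sum (f := fun l => ind (2 * ℓ / Λ < (nl po I l : ℝ))) (fun l _ => ind_nonneg _) (mem_univ l)
  refine this.trans ?_
  rw [av_sum]
  refine (sum_le_sum fun l _ => one l).trans (le_of_eq ?_)
  rw [sum_const, card_univ, nsmul_eq_mul]
  ring

theorem ref_mass [Nonempty Ω] [Nonempty Lc] (hpo : Function.Injective2 po) (H : Hyp X lam) (hΛ : Fintype.card Lf < ℓ) (hℓ : ℓ ≤ Fintype.card ι)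
    {V : Type*} (Gd : Finset V) (C2 : V → Finset Lf) {D : ℝ} (hD : 0 < D)
    (hco : D ≤ av univ (fun z => EE (fun T => coll (PP X ℓ g (zs po z univ) (zs po z univ) T)))) :
    D / 2 - Gd.card * (G2 (Fintype.card ι) (Fintype.card Lc) (Fintype.card Lf) ℓ / (D / 4) ^ 2) ≤
      av univ (fun z => av (Sp (zs po z univ) ℓ) (fun I => EE (fun T => ind (∀ v ∈ Gd,
        D / 4 ≤ PQ X ℓ g T (zs po z (C2 v)) (restr (zs po z (C2 v)) (g I T)))))) := by
  have hW : ∀ z : Lf → Lc, (zs po z univ).card ≤ ℓ := fun z => by rw [card_zs hpo, card_univ]; exact hΛ.le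
  have hSp : ∀ z : Lf → Lc, (Sp (zs po z univ) ℓ).Nonempty := fun z => Sp_ne (hW z) hℓ
  -- heavy mass
  have hv : ∀ z : Lf → Lc, EE (fun T => coll (PP X ℓ g (zs po z univ) (zs po z univ) T)) - D / 2 ≤
      av (Sp (zs po z univ) ℓ) (fun I => EE (fun T => ind (D / 2 ≤ PP X ℓ g (zs po z univ) (zs po z univ) T (restr (zs po z univ) (g I T))))) := by
    intro z
    rw [← PP_conv (fun T ρ => ind (D / 2 ≤ PP X ℓ g (zs po z univ) (zs po z univ) T ρ)) (fun ρ T T' h => by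
      beta_reduce; rw [PP_ms' T T' h])]
    have hcst : EE (fun _ : Ω => D / 2) = D / 2 := av_const univ_nonempty _
    rw [← hcst, ← EE_sub]
    refine EE_mono fun T => ?_
    rw [hcst]
    have hs := PP_sum (X := X) (ℓ := ℓ) (g := g) (J := zs po z univ) (c := zs po z univ) (hW z) hℓ T
    have : D / 2 = ∑ ρ, PP X ℓ g (zs po z univ) (zs po z univ) T ρ * (D / 2) := by rw [← sum_mul, hs, one_mul]
    rw [this]
    unfold coll
    rw [← sum_sub_distrib]
    refine sum_le_sum fun ρ _ => ?_
    have p0 := PP_nonneg (X := X) (ℓ := ℓ) (g := g) (J := zs po z univ) (c := zs po z univ) T ρ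
    have p1 := PP_le_one (X := X) (ℓ := ℓ) (g := g) (J := zs po z univ) (c := zs po z univ) (hW z) hℓ T ρ
    rw [← this]
    by_cases h : D / 2 ≤ PP X ℓ g (zs po z univ) (zs po z univ) T ρ
    · rw [ind_true h]; nlinarith
    · rw [ind_false h]; push Not at h; nlinarith
  have hv2 := av_mono (s := (univ : Finset (Lf → Lc))) fun z _ => hv z
  rw [av_sub, av_const univ_nonempty] at hv2
  -- union bound
  have pt : ∀ z : Lf → Lc, ∀ I, ∀ T, ind (D / 2 ≤ PP X ℓ g (zs po z univ) (zs po z univ) T (restr (zs po z univ) (g I T))) ≤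
      ind (∀ v ∈ Gd, D / 4 ≤ PQ X ℓ g T (zs po z (C2 v)) (restr (zs po z (C2 v)) (g I T))) + ∑ v ∈ Gd, ind (nb X ℓ g po (D / 4) (C2 v) z T) := by
    intro z I T
    have s0 : 0 ≤ ∑ v ∈ Gd, ind (nb X ℓ g po (D / 4) (C2 v) z T) := sum_nonneg fun v _ => ind_nonneg _
    by_cases hn : ∃ v ∈ Gd, nb X ℓ g po (D / 4) (C2 v) z T
    · obtain ⟨v, hv, hh⟩ := hn
      have := single_le_sum (f := fun v => ind (nb X ℓ g po (D / 4) (C2 v) z T)) (fun v _ => ind_nonneg _) hv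
      beta_reduce at this
      rw [ind_true hh] at this
      have a1 := ind_le_one (D / 2 ≤ PP X ℓ g (zs po z univ) (zs po z univ) T (restr (zs po z univ) (g I T)))
      have a2 := ind_nonneg (∀ v ∈ Gd, D / 4 ≤ PQ X ℓ g T (zs po z (C2 v)) (restr (zs po z (C2 v)) (g I T)))
      linarith
    · push Not at hn
      have := ind_mono (p := D / 2 ≤ PP X ℓ g (zs po z univ) (zs po z univ) T (restr (zs po z univ) (g I T)))
        (q := ∀ v ∈ Gd, D / 4 ≤ PQ X ℓ g T (zs po z (C2 v)) (restr (zs po z (C2 v)) (g I T))) (fun h v hv => by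
          have h1 := hn v hv
          unfold nb at h1
          push Not at h1
          have h2 := h1 (restr (zs po z (C2 v)) (g I T))
          have hsub : zs po z (C2 v) ⊆ zs po z univ := zs_mono (subset_univ _)
          have h3 : PP X ℓ g (zs po z univ) (zs po z univ) T (restr (zs po z univ) (g I T)) ≤ PP X ℓ g (zs po z univ) (zs po z (C2 v)) T (restr (zs po z (C2 v)) (g I T)) := by
            rw [PP_push hsub T]
            unfold push
            refine le_trans (le_of_eq ?_) (single_le_sum (f := fun ρ => PP X ℓ g (zs po z univ) (zs po z univ) T ρ * ind (restr (zs po z (C2 v)) ρ = restr (zs po z (C2 v)) (g I T)))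
              (fun ρ _ => mul_nonneg (PP_nonneg _ _) (ind_nonneg _)) (mem_univ (restr (zs po z univ) (g I T))))
            beta_reduce
            rw [ind_true (restr_restr hsub _), mul_one]
          have h4 := (abs_le.1 h2).2
          unfold PQ
          linarith)
      linarith
  have hu : av univ (fun z => av (Sp (zs po z univ) ℓ) (fun I => EE (fun T => ind (D / 2 ≤ PP X ℓ g (zs po z univ) (zs po z univ) T (restr (zs po z univ) (g I T)))))) ≤
      av univ (fun z => av (Sp (zs po z univ) ℓ) (fun I => EE (fun T => ind (∀ v ∈ Gd,
        D / 4 ≤ PQ X ℓ g T (zs po z (C2 v)) (restr (zs po z (C2 v)) (g I T))))) + ∑ v ∈ Gd, EE (fun T => ind (nb X ℓ g po (D / 4) (C2 v) z T))) := by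
    refine av_mono fun z _ => ?_
    rw [← av_const (hSp z) (∑ v ∈ Gd, EE (fun T => ind (nb X ℓ g po (D / 4) (C2 v) z T))), ← av_add]
    refine av_mono fun I _ => ?_
    rw [← EE_sum, ← EE_add]
    exact EE_mono fun T => pt z I T
  rw [av_add, av_sum] at hu
  have hnb : ∑ v ∈ Gd, av univ (fun z => EE (fun T => ind (nb X ℓ g po (D / 4) (C2 v) z T))) ≤
      Gd.card * (G2 (Fintype.card ι) (Fintype.card Lc) (Fintype.card Lf) ℓ / (D / 4) ^ 2) := by
    rw [← nsmul_eq_mul, ← sum_const]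
    exact sum_le_sum fun v _ => nb_le (g := g) hpo H hΛ hℓ (C2 v) (by positivity)
  linarith
end asm


theorem card_mul_av {α : Type*} (s : Finset α) (f : α → ℝ) : s.card * av s f = ∑ x ∈ s, f x := by
  rcases s.eq_empty_or_nonempty with rfl | hs
  · simp
  · unfold av; rw [mul_div_cancel₀]; exact_mod_cast hs.card_pos.ne'

section asm2
variable {Ω ι P : Type*} [Fintype Ω] [Fintype ι] [DecidableEq ι] {X : Ω → ι → P} {A : Type*} [Fintype A] [Nonempty A]
variable {Lf Lc : Type*} [Fintype Lf] [DecidableEq Lf] [Fintype Lc] [DecidableEq Lc] {po : Lf → Lc → ι}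
variable {ℓ : ℕ} {g : Finset ι → Ω → ι → A} {lam : ι → ι → ℝ}

/-- average over stratified reference points, samples and flags -/
noncomputable def E3 (po : Lf → Lc → ι) (ℓ : ℕ) (φ : (Lf → Lc) → Finset ι → Ω → ℝ) : ℝ :=
  av univ (fun z => av (Sp (zs po z univ) ℓ) (fun I => EE (fun T => φ z I T)))

variable {φ ψ : (Lf → Lc) → Finset ι → Ω → ℝ}

theorem E3_mono (h : ∀ z, ∀ I, I.card = ℓ → ∀ T, φ z I T ≤ ψ z I T) : E3 po ℓ φ ≤ E3 po ℓ ψ :=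
  av_mono fun z _ => av_mono fun I hI => EE_mono fun T => h z I (mem_Sp.1 hI).2 T
theorem E3_add : E3 po ℓ (fun z I T => φ z I T + ψ z I T) = E3 po ℓ φ + E3 po ℓ ψ := by
  unfold E3
  rw [← av_add]
  refine av_congr fun z _ => ?_
  rw [← av_add]
  exact av_congr fun I _ => EE_add _ _
theorem E3_mul (c : ℝ) : E3 po ℓ (fun z I T => c * φ z I T) = c * E3 po ℓ φ := by
  unfold E3
  rw [← av_mul]
  refine av_congr fun z _ => ?_
  rw [← av_mul]
  exact av_congr fun I _ => EE_mul _ _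
theorem E3_sum {γ : Type*} (s : Finset γ) (f : γ → (Lf → Lc) → Finset ι → Ω → ℝ) :
    E3 po ℓ (fun z I T => ∑ c ∈ s, f c z I T) = ∑ c ∈ s, E3 po ℓ (f c) := by
  unfold E3
  rw [← av_sum]
  refine av_congr fun z _ => ?_
  rw [← av_sum]
  exact av_congr fun I _ => EE_sum s (fun T c => f c z I T)

theorem E3_res (hpo : Function.Injective2 po) (hΛ : Fintype.card Lf ≤ ℓ) (l : Lf) (φ : (Lf → Lc) → Finset ι → Ω → ℝ) :
    E3 po ℓ φ = E3 po ℓ (fun z I T => av (univ.filter (fun y => po l y ∈ I)) (fun y => φ (Function.update z l y) I T)) := by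
  unfold E3
  rw [resample hpo hΛ l (fun I z => EE (fun T => φ z I T))]
  refine av_congr fun z _ => av_congr fun I _ => ?_
  rw [← EE_av]

theorem count_cover (hpo : Function.Injective2 po) {u : ℝ} (hu : (Fintype.card ι : ℝ) - Fintype.card Lf * Fintype.card Lc ≤ u)
    (I : Finset ι) (Φ : ι → Prop) [DecidablePred Φ] :
    ((I.filter Φ).card : ℝ) ≤ u + ∑ l, ((univ.filter (fun y => po l y ∈ I ∧ Φ (po l y))).card : ℝ) := by
  set W : Finset ι := univ.image (fun p : Lf × Lc => po p.1 p.2) with hW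
  have hWc : W.card = Fintype.card Lf * Fintype.card Lc := by
    rw [hW, card_image_of_injective _ (fun p p' h => Prod.ext (hpo h).1 (hpo h).2), card_univ, Fintype.card_prod]
  have hsub : I.filter Φ ⊆ Wᶜ ∪ univ.biUnion (fun l => (univ.filter (fun y => po l y ∈ I ∧ Φ (po l y))).image (po l)) := by
    intro i hi
    rw [mem_filter] at hi
    by_cases h : i ∈ W
    · rw [hW, mem_image] at h
      obtain ⟨p, _, rfl⟩ := h
      exact mem_union_right _ (mem_biUnion.2 ⟨p.1, mem_univ _, mem_image.2 ⟨p.2, by simpa using hi, rfl⟩⟩)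
    · exact mem_union_left _ (mem_compl.2 h)
  have h1 := (card_le_card hsub).trans (card_union_le _ _)
  have h2 : (univ.biUnion (fun l => (univ.filter (fun y => po l y ∈ I ∧ Φ (po l y))).image (po l))).card ≤
      ∑ l, (univ.filter (fun y => po l y ∈ I ∧ Φ (po l y))).card :=
    card_biUnion_le.trans (sum_le_sum fun l _ => card_image_le)
  have h3 : (Wᶜ.card : ℝ) = Fintype.card ι - Fintype.card Lf * Fintype.card Lc := by
    rw [card_compl, Nat.cast_sub (card_le_univ _), hWc]; push_cast; ring
  have h4 : ((I.filter Φ).card : ℝ) ≤ Wᶜ.card + ∑ l, ((univ.filter (fun y => po l y ∈ I ∧ Φ (po l y))).card : ℝ) := by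
    exact_mod_cast h1.trans (Nat.add_le_add_left h2 _)
  linarith

theorem assemble [Nonempty Ω] [Nonempty Lf] [Nonempty Lc] (hpo : Function.Injective2 po) (hΛ : Fintype.card Lf < ℓ) (hℓ : ℓ ≤ Fintype.card ι)
    (hN : Fintype.card Lf * Fintype.card Lc ≤ Fintype.card ι) {u : ℝ} (hu : (Fintype.card ι : ℝ) - Fintype.card Lf * Fintype.card Lc ≤ u)
    (rk : P → ι) (hrk : ∀ T i, rk (X T i) = i)
    {V : Type*} [Fintype V] [DecidableEq V] {M : ℕ} (hM : 0 < M) (Gd : Finset V) (R : V → Finset Lf) (nd : Lf → V) (hnd : ∀ v ∈ Gd, ∀ l ∈ R v, nd l = v)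
    (rf : V → (Lf → Lc) → Finset ι → Ω → Prop) (ix : V → (Lf → Lc) → Finset ι → Ω → Fin M)
    (hrf : ∀ v ∈ Gd, ∀ l ∈ R v, ∀ z y I T, rf v (Function.update z l y) I T ↔ rf v z I T)
    (hix : ∀ v ∈ Gd, ∀ l ∈ R v, ∀ z y I T, ix v (Function.update z l y) I T = ix v z I T)
    (f : V → P → Fin M → A) {ε θ γ μ : ℝ} (hε : 0 ≤ ε) (hθ : 0 < θ)
    (hb : ∀ v ∈ Gd, av (R v) (fun l => E3 po ℓ (fun z I T => ind (rf v z I T ∧ g I T (po l (z l)) ≠ f v (X T (po l (z l))) (ix v z I T)))) ≤ ε)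
    (hγ : (1 - γ) * (Fintype.card Lf : ℝ) ≤ ∑ v ∈ Gd, ((R v).card : ℝ))
    (hμ : μ ≤ E3 po ℓ (fun z I T => ind (∀ v ∈ Gd, rf v z I T))) :
    ∃ fg : P → A, (μ - ε / θ - dn (Fintype.card ι) (Fintype.card Lc) (Fintype.card Lf) ℓ * ((Fintype.card Lf : ℝ) ^ 2 / ℓ)) / (M:ℝ) ^ Fintype.card V ≤
      dn (Fintype.card ι) (Fintype.card Lc) (Fintype.card Lf) ℓ * av (Sp ∅ ℓ) (fun I => EE (fun T =>
        ind (((I.filter (fun i => g I T i ≠ fg (X T i))).card : ℝ) ≤ u + 2 * ℓ * (θ + γ)))) := by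
  set Λ : ℝ := ((Fintype.card Lf : ℕ) : ℝ) with hΛd
  have hΛ0 : 0 < Λ := Nat.cast_pos.2 Fintype.card_pos
  have hℓ0 : 0 < ℓ := by omega
  have hℓr : (0:ℝ) < ℓ := by exact_mod_cast hℓ0
  have hdisj : (Gd : Set V).PairwiseDisjoint R := by
    intro v hv w hw hne
    refine disjoint_left.2 fun l h1 h2 => hne ?_
    rw [← hnd v hv l h1, hnd w hw l h2]
  have hRs : ∑ v ∈ Gd, ((R v).card : ℝ) ≤ Λ := by
    have : ∑ v ∈ Gd, (R v).card ≤ Fintype.card Lf := by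
      rw [← card_biUnion hdisj]; exact card_le_univ _
    rw [hΛd]; exact_mod_cast this
  -- mismatch indicator
  set mm : V → Lf → Lc → (Lf → Lc) → Finset ι → Ω → Prop := fun v l y z I T => rf v z I T ∧ g I T (po l y) ≠ f v (X T (po l y)) (ix v z I T) with hmm
  set Y : (Lf → Lc) → Finset ι → Ω → ℝ := fun z I T => ∑ v ∈ Gd, ∑ l ∈ R v, av (univ.filter (fun y => po l y ∈ I)) (fun y => ind (mm v l y z I T)) with hY
  have hY0 : ∀ z I T, 0 ≤ Y z I T := fun z I T => sum_nonneg fun v _ => sum_nonneg fun l _ => av_nonneg fun y _ => ind_nonneg _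
  have hEY : E3 po ℓ Y ≤ Λ * ε := by
    have e : E3 po ℓ Y = ∑ v ∈ Gd, ((R v).card : ℝ) * av (R v) (fun l => E3 po ℓ (fun z I T => ind (rf v z I T ∧ g I T (po l (z l)) ≠ f v (X T (po l (z l))) (ix v z I T)))) := by
      rw [hY, E3_sum]
      refine sum_congr rfl fun v hv => ?_
      rw [E3_sum, card_mul_av]
      refine sum_congr rfl fun l hl => ?_
      rw [E3_res hpo hΛ.le l (fun z I T => ind (rf v z I T ∧ g I T (po l (z l)) ≠ f v (X T (po l (z l))) (ix v z I T)))]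
      congr 1
      funext z I T
      refine av_congr fun y _ => ?_
      rw [hmm]
      refine ind_congr ?_
      rw [hrf v hv l hl, hix v hv l hl, Function.update_self]
    rw [e]
    calc _ ≤ ∑ v ∈ Gd, ((R v).card : ℝ) * ε := sum_le_sum fun v hv => mul_le_mul_of_nonneg_left (hb v hv) (by positivity)
      _ = (∑ v ∈ Gd, ((R v).card : ℝ)) * ε := by rw [sum_mul]
      _ ≤ Λ * ε := mul_le_mul_of_nonneg_right hRs hε
  have hYm : E3 po ℓ (fun z I T => ind (θ * Λ ≤ Y z I T)) ≤ ε / θ := by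
    have : E3 po ℓ (fun z I T => ind (θ * Λ ≤ Y z I T)) ≤ E3 po ℓ (fun z I T => (1 / (θ * Λ)) * Y z I T) := by
      refine E3_mono fun z I _ T => (ind_le_div (by positivity) (hY0 z I T)).trans_eq (by ring)
    rw [E3_mul] at this
    refine this.trans ?_
    calc 1 / (θ * Λ) * E3 po ℓ Y ≤ 1 / (θ * Λ) * (Λ * ε) := mul_le_mul_of_nonneg_left hEY (by positivity)
      _ = ε / θ := by field_simp
  have hdn0 : 0 ≤ dn (Fintype.card ι) (Fintype.card Lc) (Fintype.card Lf) ℓ := by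
    unfold dn
    have : (0:ℝ) < (ℓ:ℝ) - (Fintype.card Lf : ℕ) := by rw [sub_pos]; exact_mod_cast hΛ
    positivity
  have hdens : ∀ h : Finset ι → Ω → ℝ, (∀ I T, 0 ≤ h I T) → E3 po ℓ (fun _ I T => h I T) ≤
      dn (Fintype.card ι) (Fintype.card Lc) (Fintype.card Lf) ℓ * av (Sp ∅ ℓ) (fun I => EE (h I)) := by
    intro h h0
    exact dens hpo hΛ hℓ (fun I => EE (h I)) (fun I => EE_nonneg (h0 I))
  have hbal : E3 po ℓ (fun _ I (T : Ω) => ind (¬ bal po ℓ I)) ≤ dn (Fintype.card ι) (Fintype.card Lc) (Fintype.card Lf) ℓ * (Λ ^ 2 / ℓ) := by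
    refine (hdens (fun I _ => ind (¬ bal po ℓ I)) (fun _ _ => ind_nonneg _)).trans (mul_le_mul_of_nonneg_left ?_ hdn0)
    refine le_trans (le_of_eq ?_) (bal_prob hpo hℓ0 hℓ hN)
    refine av_congr fun I _ => ?_
    exact av_const univ_nonempty _
  -- global functions
  let fgk : (V → Fin M) → P → A := fun k x =>
    if h : ∃ p : Lf × Lc, po p.1 p.2 = rk x then f (nd h.choose.1) x (k (nd h.choose.1)) else Classical.arbitrary A
  have hfgk : ∀ k T l y, fgk k (X T (po l y)) = f (nd l) (X T (po l y)) (k (nd l)) := by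
    intro k T l y
    have h : ∃ p : Lf × Lc, po p.1 p.2 = rk (X T (po l y)) := ⟨(l, y), by rw [hrk]⟩
    have h2 := h.choose_spec
    have h3 := (hpo (h2.trans (hrk _ _))).1
    simp only [fgk]
    rw [dif_pos h, h3]
  have hdet : ∀ z I, I.card = ℓ → ∀ T, (∀ v ∈ Gd, rf v z I T) → Y z I T < θ * Λ → bal po ℓ I →
      ((I.filter (fun i => g I T i ≠ fgk (fun v => ix v z I T) (X T i))).card : ℝ) ≤ u + 2 * ℓ * (θ + γ) := by
    intro z I hI T hr hy hba
    refine (count_cover hpo hu I _).trans ?_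
    set c : Lf → ℝ := fun l => ((univ.filter (fun y => po l y ∈ I ∧ g I T (po l y) ≠ fgk (fun v => ix v z I T) (X T (po l y)))).card : ℝ) with hc
    have hcb : ∀ l, c l ≤ 2 * ℓ / Λ := by
      intro l
      refine le_trans ?_ (hba l)
      simp only [hc, nl]
      exact_mod_cast card_le_card (fun y hy => by simp only [mem_filter, mem_univ, true_and] at hy ⊢; exact hy.1)
    have hcR : ∀ v ∈ Gd, ∀ l ∈ R v, c l ≤ 2 * ℓ / Λ * av (univ.filter (fun y => po l y ∈ I)) (fun y => ind (mm v l y z I T)) := by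
      intro v hv l hl
      refine le_trans (le_of_eq ?_) (mul_le_mul_of_nonneg_right (hba l) (av_nonneg fun y _ => ind_nonneg _))
      unfold nl
      rw [card_mul_av, hc]
      beta_reduce
      rw [← filter_filter, card_filter]
      push_cast
      refine sum_congr rfl fun y _ => ?_
      have e0 : fgk (fun v => ix v z I T) (X T (po l y)) = f v (X T (po l y)) (ix v z I T) := by
        rw [← hnd v hv l hl]; exact hfgk (fun v => ix v z I T) T l y
      have e1 : (g I T (po l y) ≠ fgk (fun v => ix v z I T) (X T (po l y))) ↔ mm v l y z I T := by
        constructor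
        · intro h; exact ⟨hr v hv, fun h' => h (h'.trans e0.symm)⟩
        · intro h h'; exact h.2 (h'.trans e0)
      by_cases hq : mm v l y z I T
      · rw [ind_true hq, if_pos (e1.2 hq)]
      · rw [ind_false hq, if_neg (fun h => hq (e1.1 h))]
    have hsum : ∑ l, c l ≤ 2 * ℓ * (θ + γ) := by
      rw [← sum_add_sum_compl (Gd.biUnion R)]
      have a1 : ∑ l ∈ Gd.biUnion R, c l ≤ 2 * ℓ / Λ * Y z I T := by
        rw [sum_biUnion hdisj, hY, mul_sum]
        refine sum_le_sum fun v hv => ?_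
        rw [mul_sum]
        exact sum_le_sum fun l hl => hcR v hv l hl
      have a2 : ∑ l ∈ (Gd.biUnion R)ᶜ, c l ≤ (γ * Λ) * (2 * ℓ / Λ) := by
        refine (sum_le_card_nsmul _ _ _ fun l _ => hcb l).trans ?_
        rw [nsmul_eq_mul]
        refine mul_le_mul_of_nonneg_right ?_ (by positivity)
        rw [card_compl, Nat.cast_sub (card_le_univ _), card_biUnion hdisj]
        push_cast
        linarith
      have a3 : 2 * ℓ / Λ * Y z I T ≤ 2 * ℓ / Λ * (θ * Λ) := mul_le_mul_of_nonneg_left hy.le (by positivity)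
      have a4 : 2 * ℓ / Λ * (θ * Λ) + (γ * Λ) * (2 * ℓ / Λ) = 2 * ℓ * (θ + γ) := by field_simp
      linarith
    linarith
  set Gk : (V → Fin M) → Finset ι → Ω → ℝ := fun k I T => ind (((I.filter (fun i => g I T i ≠ fgk k (X T i))).card : ℝ) ≤ u + 2 * ℓ * (θ + γ)) with hGk
  have hmain : E3 po ℓ (fun z I T => ind (∀ v ∈ Gd, rf v z I T)) ≤
      E3 po ℓ (fun z I T => (∑ k, Gk k I T + ind (θ * Λ ≤ Y z I T)) + ind (¬ bal po ℓ I)) := by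
    refine E3_mono fun z I hI T => ?_
    have p1 : 0 ≤ ∑ k, Gk k I T := sum_nonneg fun k _ => ind_nonneg _
    have p2 := ind_nonneg (θ * Λ ≤ Y z I T)
    have p3 := ind_nonneg (¬ bal po ℓ I)
    by_cases h1 : ∀ v ∈ Gd, rf v z I T
    · by_cases h2 : θ * Λ ≤ Y z I T
      · rw [ind_true h2]; linarith [ind_le_one (∀ v ∈ Gd, rf v z I T)]
      · by_cases h3 : bal po ℓ I
        · have := hdet z I hI T h1 (not_le.1 h2) h3
          have q : Gk (fun v => ix v z I T) I T = 1 := ind_true this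
          have := single_le_sum (f := fun k => Gk k I T) (fun k _ => ind_nonneg _) (mem_univ (fun v => ix v z I T))
          beta_reduce at this
          rw [q] at this
          linarith [ind_le_one (∀ v ∈ Gd, rf v z I T)]
        · rw [ind_true h3]; linarith [ind_le_one (∀ v ∈ Gd, rf v z I T)]
    · rw [ind_false h1]; linarith
  rw [E3_add, E3_add, E3_sum univ (fun k _ I T => Gk k I T)] at hmain
  have hk : ∑ k, E3 po ℓ (fun _ I T => Gk k I T) ≤ ∑ k, dn (Fintype.card ι) (Fintype.card Lc) (Fintype.card Lf) ℓ * av (Sp ∅ ℓ) (fun I => EE (Gk k I)) :=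
    sum_le_sum fun k _ => hdens _ fun I T => ind_nonneg _
  haveI : Nonempty (Fin M) := ⟨⟨0, hM⟩⟩
  obtain ⟨k, _, hk2⟩ := exists_ge_av (s := (univ : Finset (V → Fin M))) univ_nonempty (fun k => dn (Fintype.card ι) (Fintype.card Lc) (Fintype.card Lf) ℓ * av (Sp ∅ ℓ) (fun I => EE (Gk k I)))
  refine ⟨fgk k, le_trans ?_ hk2⟩
  unfold av
  rw [card_univ, Fintype.card_fun, Fintype.card_fin]
  push_cast
  have hMp : (0:ℝ) < M := by exact_mod_cast hM
  refine div_le_div_of_nonneg_right ?_ (by positivity)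
  unfold av at hk
  linarith
end asm2


theorem sum_range_blocks (f : ℕ → ℝ) (m B : ℕ) : ∑ j ∈ range (m * B), f j = ∑ v ∈ range m, ∑ c ∈ range B, f (v * B + c) := by
  induction m with
  | zero => simp
  | succ m ih => rw [Nat.succ_mul, sum_range_add, ih, sum_range_succ]

theorem level_choice {B D : ℕ} (hB : 0 < B) (hD : 0 < D) (h : ℕ → ℕ → ℝ) (h0 : ∀ n v, 0 ≤ h n v) (h1 : ∀ n v, h n v ≤ 1)
    (hm : ∀ n < D, ∀ v < B ^ n, ∀ c < B, h n v ≤ h (n + 1) (v * B + c)) {ε : ℝ} (hε : 0 < ε) :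
    ∃ n < D, ∃ Gd : Finset ℕ, Gd ⊆ range (B ^ n) ∧ (1 - B / (D * ε)) * (B:ℝ) ^ n ≤ Gd.card ∧
      ∀ v ∈ Gd, ∀ c < B, h (n + 1) (v * B + c) - h n v ≤ ε := by
  have hB0 : (0:ℝ) < B := by exact_mod_cast hB
  have hD0 : (0:ℝ) < D := by exact_mod_cast hD
  set a : ℕ → ℝ := fun n => (∑ v ∈ range (B ^ n), h n v) / (B:ℝ) ^ n with ha
  have a0 : 0 ≤ a 0 := div_nonneg (sum_nonneg fun _ _ => h0 _ _) (by positivity)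
  have a1 : a D ≤ 1 := by
    rw [ha]; beta_reduce
    rw [div_le_one (by positivity)]
    refine (sum_le_card_nsmul _ _ 1 fun v _ => h1 _ _).trans ?_
    simp
  have tel : ∑ n ∈ range D, (a (n + 1) - a n) ≤ 1 := by rw [sum_range_sub]; linarith
  obtain ⟨n, hn, hna⟩ : ∃ n < D, a (n + 1) - a n ≤ 1 / D := by
    by_contra! hc
    have := sum_lt_sum_of_nonempty (s := range D) (f := fun _ => (1:ℝ) / D) (g := fun n => a (n + 1) - a n) ⟨0, mem_range.2 hD⟩ (fun n hn => hc n (mem_range.1 hn))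
    rw [sum_const, card_range, nsmul_eq_mul, mul_one_div_cancel hD0.ne'] at this
    linarith
  refine ⟨n, hn, (range (B ^ n)).filter (fun v => ∀ c < B, h (n + 1) (v * B + c) - h n v ≤ ε), filter_subset _ _, ?_, fun v hv => (mem_filter.1 hv).2⟩
  set Bd := (range (B ^ n)).filter (fun v => ¬ ∀ c < B, h (n + 1) (v * B + c) - h n v ≤ ε) with hBd
  have hcard : (((range (B ^ n)).filter (fun v => ∀ c < B, h (n + 1) (v * B + c) - h n v ≤ ε)).card : ℝ) + Bd.card = (B:ℝ) ^ n := by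
    have := card_filter_add_card_filter_not (s := range (B ^ n)) (fun v => ∀ c < B, h (n + 1) (v * B + c) - h n v ≤ ε)
    rw [card_range] at this
    exact_mod_cast this
  have hdrop : (a (n + 1) - a n) * (B:ℝ) ^ (n + 1) = ∑ v ∈ range (B ^ n), ∑ c ∈ range B, (h (n + 1) (v * B + c) - h n v) := by
    simp only [ha]
    rw [sub_mul, div_mul_cancel₀ _ (by positivity), pow_succ B n, sum_range_blocks, pow_succ (B:ℝ) n, ← mul_assoc, div_mul_cancel₀ _ (by positivity),
      sum_mul, ← sum_sub_distrib]
    refine sum_congr rfl fun v _ => ?_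
    rw [sum_sub_distrib, sum_const, card_range, nsmul_eq_mul]; ring
  have hbad : (Bd.card : ℝ) * ε ≤ ∑ v ∈ range (B ^ n), ∑ c ∈ range B, (h (n + 1) (v * B + c) - h n v) := by
    have nn : ∀ v ∈ range (B ^ n), ∀ c ∈ range B, 0 ≤ h (n + 1) (v * B + c) - h n v := fun v hv c hc =>
      sub_nonneg.2 (hm n hn v (mem_range.1 hv) c (mem_range.1 hc))
    calc (Bd.card : ℝ) * ε = ∑ v ∈ Bd, ε := by rw [sum_const, nsmul_eq_mul]
      _ ≤ ∑ v ∈ Bd, ∑ c ∈ range B, (h (n + 1) (v * B + c) - h n v) := by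
        refine sum_le_sum fun v hv => ?_
        obtain ⟨hv1, hv2⟩ := mem_filter.1 hv
        push Not at hv2
        obtain ⟨c, hc, hlt⟩ := hv2
        exact hlt.le.trans (single_le_sum (f := fun c => h (n + 1) (v * B + c) - h n v) (nn v hv1) (mem_range.2 hc))
      _ ≤ _ := sum_le_sum_of_subset_of_nonneg (filter_subset _ _) (fun v hv _ => sum_nonneg (nn v hv))
  have : (Bd.card : ℝ) * ε ≤ 1 / D * (B:ℝ) ^ (n + 1) := by
    rw [← hdrop] at hbad
    exact hbad.trans (mul_le_mul_of_nonneg_right hna (by positivity))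
  have hb2 : (Bd.card : ℝ) ≤ B / (D * ε) * (B:ℝ) ^ n := by
    rw [← le_div_iff₀ hε] at this
    refine this.trans_eq ?_
    rw [pow_succ]; field_simp
  linarith

/-- leaves in the block number `j` among blocks of size `K` -/
noncomputable def blk (Λ K j : ℕ) : Finset (Fin Λ) := univ.filter (fun l => l.1 / K = j)

theorem mem_blk {Λ K j : ℕ} {l : Fin Λ} : l ∈ blk Λ K j ↔ l.1 / K = j := by simp [blk]

theorem card_blks {Λ K a b : ℕ} (hK : 0 < K) (hb : b * K ≤ Λ) :
    (univ.filter (fun l : Fin Λ => a ≤ l.1 / K ∧ l.1 / K < b)).card = (b - a) * K := by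
  have : (univ.filter (fun l : Fin Λ => a ≤ l.1 / K ∧ l.1 / K < b)).card = (Ico (a * K) (b * K)).card := by
    refine card_bij (fun l _ => l.1) ?_ (fun l _ l' _ h => Fin.ext h) ?_
    · intro l hl
      simp only [mem_filter, mem_univ, true_and] at hl
      rw [mem_Ico]
      exact ⟨(Nat.le_div_iff_mul_le hK).1 hl.1, (Nat.div_lt_iff_lt_mul hK).1 hl.2⟩
    · intro i hi
      rw [mem_Ico] at hi
      refine ⟨⟨i, by omega⟩, ?_, rfl⟩
      simp only [mem_filter, mem_univ, true_and]
      exact ⟨(Nat.le_div_iff_mul_le hK).2 hi.1, (Nat.div_lt_iff_lt_mul hK).2 hi.2⟩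
  rw [this, Nat.card_Ico, Nat.sub_mul]

/-- position map -/
def pos (N Λ : ℕ) (l : Fin Λ) (y : Fin (N / Λ)) : Fin N := ⟨l.1 * (N / Λ) + y.1, by
  have h1 := l.2
  have h2 := y.2
  calc l.1 * (N / Λ) + y.1 < l.1 * (N / Λ) + N / Λ := by omega
    _ = (l.1 + 1) * (N / Λ) := by ring
    _ ≤ Λ * (N / Λ) := Nat.mul_le_mul_right _ h1
    _ ≤ N := Nat.mul_div_le N Λ⟩

theorem pos_lt {N Λ : ℕ} {l l' : Fin Λ} (h : l.1 < l'.1) (y y' : Fin (N / Λ)) : pos N Λ l y < pos N Λ l' y' := by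
  rw [Fin.lt_def]
  have h2 := y.2
  calc l.1 * (N / Λ) + y.1 < l.1 * (N / Λ) + N / Λ := by omega
    _ = (l.1 + 1) * (N / Λ) := by ring
    _ ≤ l'.1 * (N / Λ) := Nat.mul_le_mul_right _ h
    _ ≤ _ := Nat.le_add_right _ _

theorem pos_inj (N Λ : ℕ) : Function.Injective2 (pos N Λ) := by
  intro l l' y y' h
  have hl : l = l' := by
    rcases lt_trichotomy l.1 l'.1 with h1 | h1 | h1
    · exact absurd h (pos_lt h1 y y').ne
    · exact Fin.ext h1
    · exact absurd h (pos_lt h1 y' y).ne'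
  subst hl
  refine ⟨rfl, Fin.ext ?_⟩
  have := congrArg Fin.val h
  simp only [pos] at this
  omega


section core
variable {F : Type} [Field F] [Fintype F] {n a0 N : ℕ} {A : Type*} [Fintype A] [Nonempty A]
variable {ℓ : ℕ} {g : Finset (Fin N) → Fl F n a0 N → Fin N → A}

theorem core [Nonempty (Fl F n a0 N)] (hq : (10:ℝ)^21 ≤ Fintype.card F) {B D : ℕ} (hB : 4 ≤ B) (hD : 0 < D)
    (hΛ : B ^ D < ℓ) (hℓ : ℓ ≤ N) {Dc θ εg εn m : ℝ} (hDc : 0 < Dc) (hDc1 : Dc ≤ 1) (hθ : 0 < θ) (hεg : 0 < εg)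
    {Q : ℕ} (hQ : 0 < Q) {M : ℕ} (hM : 2 / (Dc / 4) ≤ M)
    (hco : Dc ≤ av univ (fun z : Fin (B ^ D) → Fin (N / B ^ D) => EE (fun T => coll (PP cX ℓ g (zs (pos N (B ^ D)) z univ) (zs (pos N (B ^ D)) z univ) T))))
    (hεn : (3 + 200 * Cf 3) * (3 * (εg / ((Dc / 4) ^ 2 / (24 * Q))) + 6 / ((Dc / 4) * Q) + 9 * (G2 N (N / B ^ D) (B ^ D) ℓ / ((Dc / 4) ^ 2 / (24 * Q)) ^ 2))
        + ((Dc / 4) ^ 2 / (24 * Q)) / ((Dc / 4) / 2) ^ 2 ≤ εn) (hεn0 : 0 ≤ εn) (hm0 : 0 ≤ m)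
    (hm : m ≤ Dc / 2 - ((B ^ D : ℕ) : ℝ) * (G2 N (N / B ^ D) (B ^ D) ℓ / (Dc / 4) ^ 2) - εn / θ - dn N (N / B ^ D) (B ^ D) ℓ * (((B ^ D : ℕ) : ℝ) ^ 2 / ℓ)) :
    ∃ fg : Sb F n → A, m / (M:ℝ) ^ (B ^ D) ≤ dn N (N / B ^ D) (B ^ D) ℓ * av (Sp ∅ ℓ) (fun I => EE (fun T : Fl F n a0 N =>
        ind (((I.filter (fun i => g I T i ≠ fg (cX T i))).card : ℝ) ≤ ((B ^ D : ℕ) : ℝ) + 2 * ℓ * (θ + (3 / B + B / (D * εg)))))) := by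
  set Λ := B ^ D with hΛd
  set L := N / Λ with hLd
  have hB0 : 0 < B := by omega
  have hΛ0 : 0 < Λ := pow_pos hB0 D
  have hL0 : 0 < L := Nat.div_pos (by omega) hΛ0
  have hN0 : 0 < N := by omega
  haveI : Nonempty (Fin Λ) := ⟨⟨0, hΛ0⟩⟩
  haveI : Nonempty (Fin L) := ⟨⟨0, hL0⟩⟩
  have hpo : Function.Injective2 (pos N Λ) := pos_inj N Λ
  have H := flag_hyp (F := F) (n := n) (a0 := a0) (N := N) (by linarith : (8:ℝ) ≤ Fintype.card F)
  have cLf : Fintype.card (Fin Λ) = Λ := Fintype.card_fin _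
  have cLc : Fintype.card (Fin L) = L := Fintype.card_fin _
  have cN : Fintype.card (Fin N) = N := Fintype.card_fin _
  have hΛ' : Fintype.card (Fin Λ) < ℓ := by rw [cLf]; exact hΛ
  have hℓ' : ℓ ≤ Fintype.card (Fin N) := by rw [cN]; exact hℓ
  have hM0 : 0 < M := by
    have : (0:ℝ) < M := lt_of_lt_of_le (by positivity) hM
    exact_mod_cast this
  haveI : Nonempty (Fin M) := ⟨⟨0, hM0⟩⟩
  obtain ⟨v0, hv0, Gd, hGs, hGc, hGd⟩ := level_choice hB0 hD (fun k v => qq (cX : Fl F n a0 N → _) ℓ g (pos N Λ) (blk Λ (B ^ (D - k)) v))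
    (fun _ _ => qq_nonneg) (fun _ _ => qq_le_one hpo hΛ'.le hℓ') (fun k hk v hv c hc => qq_anti (by
      intro l hl
      rw [mem_blk] at hl ⊢
      have : D - k = (D - (k + 1)) + 1 := by omega
      rw [this, pow_succ, ← Nat.div_div_eq_div_mul, hl, mul_comm v B, Nat.mul_add_div hB0, Nat.div_eq_of_lt hc, add_zero])) hεg
  set K := B ^ (D - (v0 + 1)) with hK
  have hKB : B ^ (D - v0) = K * B := by rw [hK, ← pow_succ]; congr 1; omega
  have hK0 : 0 < K := pow_pos hB0 _
  have hΛK : Λ = K * B * B ^ v0 := by rw [← hKB, ← pow_add, hΛd]; congr 1; omega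
  rw [hKB] at hGd
  set V := Fin (B ^ v0)
  set G' : Finset V := univ.filter (fun v => v.1 ∈ Gd) with hG'
  have hG'c : G'.card = Gd.card := by
    refine card_bij (fun v _ => v.1) (fun v hv => (mem_filter.1 hv).2) (fun v _ w _ h => Fin.ext h) (fun v hv => ?_)
    exact ⟨⟨v, mem_range.1 (hGs hv)⟩, mem_filter.2 ⟨mem_univ _, hv⟩, rfl⟩
  have hVΛ : B ^ v0 ≤ Λ := Nat.pow_le_pow_right hB0 hv0.le
  have hvb : ∀ v : V, (v.1 * B + B) * K ≤ Λ := by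
    intro v
    rw [hΛK]
    calc (v.1 * B + B) * K = (v.1 + 1) * (B * K) := by ring
      _ ≤ B ^ v0 * (B * K) := Nat.mul_le_mul_right _ v.2
      _ = _ := by ring
  set R : V → Finset (Fin Λ) := fun v => univ.filter (fun l => v.1 * B + 2 ≤ l.1 / K ∧ l.1 / K < v.1 * B + (B - 1)) with hR
  have mR : ∀ v l, l ∈ R v ↔ v.1 * B + 2 ≤ l.1 / K ∧ l.1 / K < v.1 * B + (B - 1) := fun v l => by simp [hR]
  have hRc : ∀ v, (R v).card = (B - 3) * K := by
    intro v
    rw [hR]; beta_reduce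
    rw [card_blks hK0 (le_trans (Nat.mul_le_mul_right _ (by omega)) (hvb v))]
    congr 1; omega
  set C2 : V → Finset (Fin Λ) := fun v => blk Λ K (v.1 * B + 1) with hC2
  have hdivlt : ∀ l : Fin Λ, l.1 / (K * B) < B ^ v0 := fun l => by
    rw [Nat.div_lt_iff_lt_mul (by positivity), mul_comm, ← hΛK]; exact l.2
  have hdv : ∀ (l : Fin Λ) (v c : ℕ), l.1 / K = v * B + c → c < B → l.1 / (K * B) = v := by
    intro l v c h hc
    rw [← Nat.div_div_eq_div_mul, h, mul_comm v B, Nat.mul_add_div hB0, Nat.div_eq_of_lt hc, add_zero]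
  have hRv : ∀ v l, l ∈ R v → l.1 / (K * B) = v.1 := by
    intro v l hl
    rw [mR] at hl
    exact hdv l v.1 (l.1 / K - v.1 * B) (by omega) (by omega)
  have dj : ∀ {a b : ℕ}, a ≠ b → Disjoint (blk Λ K a) (blk Λ K b) := fun {a b} h =>
    disjoint_left.2 fun l h1 h2 => h ((mem_blk.1 h1).symm.trans (mem_blk.1 h2))
  have hnode : ∀ v : V, ∃ (f : Sb F n → Fin M → A) (Idx : Fl F n a0 N → Finset (Fin N) → (Fin N → A) → Fin M), v ∈ G' →
      av (R v) (fun l => E3 (pos N Λ) ℓ (fun z I T => ind (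
        Dc / 4 ≤ PQ cX ℓ g T (zs (pos N Λ) z (C2 v)) (restr (zs (pos N Λ) z (C2 v)) (g I T)) ∧
        g I T (pos N Λ l (z l)) ≠ f (cX T (pos N Λ l (z l))) (Idx T (zs (pos N Λ) z (C2 v)) (restr (zs (pos N Λ) z (C2 v)) (g I T)))))) ≤ εn := by
    intro v
    by_cases hv : v ∈ G'
    swap
    · exact ⟨fun _ _ => Classical.arbitrary A, fun _ _ _ => Classical.arbitrary _, fun h => absurd h hv⟩
    have hvG := (mem_filter.1 hv).2
    have hg0 := hGd v.1 hvG
    have hKL : 0 < K * L := by positivity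
    have hpb : ∀ c, c < B → (v.1 * B + c) * K * L < N := by
      intro c hc
      have : (v.1 * B + c) * K < Λ := lt_of_lt_of_le (Nat.mul_lt_mul_of_pos_right (by omega) hK0) (hvb v)
      exact lt_of_lt_of_le (Nat.mul_lt_mul_of_pos_right this hL0) (Nat.mul_div_le N Λ)
    have sub : ∀ c, c < B → blk Λ K (v.1 * B + c) ⊆ blk Λ (K * B) v.1 := fun c hc l hl =>
      mem_blk.2 (hdv l v.1 c (mem_blk.1 hl) hc)
    have hi1 : (v.1 * B + 1) * K * L - 1 < N := by have := hpb 1 (by omega); omega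
    have pge : ∀ (l : Fin Λ) (y : Fin L) (j : ℕ), j ≤ l.1 / K → j * K * L ≤ (pos N Λ l y).1 := by
      intro l y j h
      have : j * K ≤ l.1 := (Nat.le_div_iff_mul_le hK0).1 h
      exact (Nat.mul_le_mul_right L this).trans (Nat.le_add_right _ _)
    have plt : ∀ (l : Fin Λ) (y : Fin L) (j : ℕ), l.1 / K < j → (pos N Λ l y).1 < j * K * L := by
      intro l y j h
      have : l.1 < j * K := (Nat.div_lt_iff_lt_mul hK0).1 h
      have hy := y.2
      calc l.1 * L + y.1 < l.1 * L + L := by omega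
        _ = (l.1 + 1) * L := by ring
        _ ≤ j * K * L := Nat.mul_le_mul_right L this
    obtain ⟨f, Idx, hb⟩ := node (g := g) hq hpo hΛ' hℓ (τ0 := Dc / 4) (εg := εg) (by positivity) (by linarith) hQ hM
      (S := blk Λ (K * B) v.1) (C1 := blk Λ K (v.1 * B + 0)) (C2 := C2 v) (CB := blk Λ K (v.1 * B + (B - 1))) (R := R v)
      (sub 0 hB0) (sub 1 (by omega)) (sub (B - 1) (by omega)) (fun l hl => mem_blk.2 (hRv v l hl))
      (dj (by omega)) (dj (by omega)) (dj (by omega))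
      (disjoint_left.2 fun l h1 h2 => by rw [mR] at h1; rw [mem_blk] at h2; omega)
      (disjoint_left.2 fun l h1 h2 => by rw [mR] at h1; rw [hC2] at h2; beta_reduce at h2; rw [mem_blk] at h2; omega)
      (disjoint_left.2 fun l h1 h2 => by rw [mR] at h1; rw [mem_blk] at h2; omega)
      (by rw [← card_pos, hRc]; exact Nat.mul_pos (by omega) hK0)
      (by
        have hlt : (v.1 * B + 1) * K < Λ := lt_of_lt_of_le (Nat.mul_lt_mul_of_pos_right (by omega) hK0) (hvb v)
        exact ⟨⟨(v.1 * B + 1) * K, hlt⟩, mem_blk.2 (Nat.mul_div_cancel _ hK0)⟩)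
      (i1 := ⟨(v.1 * B + 1) * K * L - 1, hi1⟩) (i3 := ⟨(v.1 * B + (B - 1)) * K * L, hpb (B - 1) (by omega)⟩)
      (fun l hl y => by
        rw [mem_blk] at hl; rw [Fin.le_def]
        have := plt l y (v.1 * B + 1) (by omega)
        show (pos N Λ l y).1 ≤ (v.1 * B + 1) * K * L - 1
        omega)
      (fun l hl y => by
        rw [mem_blk] at hl; rw [Fin.le_def]
        exact pge l y _ hl.ge)
      (fun l hl y => by
        replace hl := mem_blk.1 hl
        rw [Fin.lt_def]
        have := pge l y _ hl.ge
        have h2 : 0 < (v.1 * B + 1) * K * L := by positivity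
        show (v.1 * B + 1) * K * L - 1 < (pos N Λ l y).1
        omega)
      (fun l hl y l' hl' y' => by
        replace hl := mem_blk.1 hl
        rw [mR] at hl'
        refine pos_lt ?_ y y'
        by_contra hc
        have := Nat.div_le_div_right (c := K) (not_lt.1 hc)
        omega)
      (fun l hl y => by
        rw [mR] at hl; rw [Fin.lt_def]
        exact plt l y _ hl.2)
      (hg0 0 hB0) (hg0 1 (by omega)) (hg0 (B - 1) (by omega))
    refine ⟨f, Idx, fun _ => le_trans hb ?_⟩
    rw [cLf, cLc]
    exact hεn
  choose f Idx hb using hnode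
  have hnC : ∀ v, ∀ l ∈ R v, l ∉ C2 v := fun v l hl h2 => by
    rw [mR] at hl; replace h2 := mem_blk.1 h2; omega
  have hG20 : 0 ≤ G2 N L Λ ℓ := by unfold G2; positivity
  have hmass := ref_mass (g := g) hpo H hΛ' hℓ' G' C2 hDc hco
  have hBr : (4:ℝ) ≤ B := by exact_mod_cast hB
  obtain ⟨fg, hfg⟩ := assemble (X := (cX : Fl F n a0 N → _)) (g := g) (M := M) hpo hΛ' hℓ' (by rw [cLf, cLc, cN]; exact Nat.mul_div_le N Λ) (u := (Λ:ℝ))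
    (by
      rw [cLf, cLc, cN, hLd]
      have := Nat.div_add_mod N Λ
      have h2 := Nat.mod_lt N hΛ0
      have h3 : (N:ℝ) = Λ * (N / Λ : ℕ) + (N % Λ : ℕ) := by exact_mod_cast this.symm
      have h4 : ((N % Λ : ℕ):ℝ) ≤ Λ := by exact_mod_cast h2.le
      linarith)
    (fun x => ⟨(dm x - a0) % N, Nat.mod_lt _ hN0⟩)
    (fun T i => Fin.ext (by
      show (dm (cX T i) - a0) % N = i.1
      rw [cX_dm, Nat.add_sub_cancel_left, Nat.mod_eq_of_lt i.2]))
    hM0 G' R (fun l => (⟨l.1 / (K * B), hdivlt l⟩ : V)) (fun v _ l hl => Fin.ext (hRv v l hl))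
    (fun v z I T => Dc / 4 ≤ PQ cX ℓ g T (zs (pos N Λ) z (C2 v)) (restr (zs (pos N Λ) z (C2 v)) (g I T)))
    (fun v z I T => Idx v T (zs (pos N Λ) z (C2 v)) (restr (zs (pos N Λ) z (C2 v)) (g I T)))
    (fun v _ l hl z y I T => by rw [zs_upd (hnC v l hl)])
    (fun v _ l hl z y I T => by rw [zs_upd (hnC v l hl)])
    f (θ := θ) (γ := 3 / B + B / (D * εg)) hεn0 hθ (fun v hv => hb v hv)
    (by
      rw [cLf]
      simp only [hRc]
      rw [sum_const, nsmul_eq_mul, hG'c]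
      have e1 : (((B - 3) * K : ℕ) : ℝ) = (B - 3) * K := by
        push_cast [Nat.cast_sub (show 3 ≤ B by omega)]; ring
      have e2 : (Λ:ℝ) = K * B * (B:ℝ) ^ v0 := by exact_mod_cast hΛK
      rw [e1, e2]
      have hKr : (0:ℝ) < K := by exact_mod_cast hK0
      have hDr : (0:ℝ) < D := by exact_mod_cast hD
      set w := (B:ℝ) / (D * εg) with hw
      have hw0 : 0 ≤ w := by positivity
      calc (1 - (3 / B + w)) * (K * B * (B:ℝ) ^ v0) ≤ (1 - w) * (1 - 3 / B) * (K * B * (B:ℝ) ^ v0) := by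
            refine mul_le_mul_of_nonneg_right ?_ (by positivity)
            have : 0 ≤ w * (3 / B) := by positivity
            nlinarith
        _ = ((1 - w) * (B:ℝ) ^ v0) * ((B - 3) * K) := by field_simp
        _ ≤ _ := mul_le_mul_of_nonneg_right hGc (mul_nonneg (by linarith) hKr.le))
    hmass
  rw [cLf, cLc, cN] at hfg
  refine ⟨fg, le_trans ?_ hfg⟩
  have hMr : (1:ℝ) ≤ M := by exact_mod_cast hM0
  have cV : Fintype.card V = B ^ v0 := Fintype.card_fin _
  rw [cV]
  have hGcl : (G'.card : ℝ) ≤ Λ := by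
    have : G'.card ≤ Λ := (card_le_univ _).trans (by rw [cV]; exact hVΛ)
    exact_mod_cast this
  have hmm : m ≤ Dc / 2 - G'.card * (G2 N L Λ ℓ / (Dc / 4) ^ 2) - εn / θ - dn N L Λ ℓ * ((Λ:ℝ) ^ 2 / ℓ) := by
    have := mul_le_mul_of_nonneg_right hGcl (by positivity : 0 ≤ G2 N L Λ ℓ / (Dc / 4) ^ 2)
    linarith
  calc m / (M:ℝ) ^ Λ ≤ m / (M:ℝ) ^ (B ^ v0) := div_le_div_of_nonneg_left hm0 (by positivity) (pow_le_pow_right₀ hMr hVΛ)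
    _ ≤ _ := div_le_div_of_nonneg_right hmm (by positivity)
end core


section conv
variable {F : Type} [Field F] [Fintype F] {n a0 N : ℕ} {S : Finset ℕ} {A : Type} [Fintype A] [Nonempty A]
variable {ℓ₀ ℓ : ℕ}

theorem cX_inj (T : Fl F n a0 N) : Function.Injective (cX T) := by
  intro i j h
  have := congrArg dm h
  rw [cX_dm, cX_dm] at this
  exact Fin.ext (by omega)

noncomputable def im (T : Fl F n a0 N) : Finset (Sb F n) := univ.image (cX T)

theorem mem_im {T : Fl F n a0 N} {x : Sb F n} : x ∈ im T ↔ ∃ i, cX T i = x := by simp [im]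

theorem im_mem (hS : ∀ i, i ∈ S ↔ a0 ≤ i ∧ i < a0 + N) (T : Fl F n a0 N) : im T ∈ maxFlagFaces F n S := by
  unfold maxFlagFaces
  rw [mem_filter]
  refine ⟨mem_univ _, ⟨?_, ?_⟩, ?_⟩
  · intro x hx y hy _
    obtain ⟨i, rfl⟩ := mem_im.1 (mem_coe.1 hx)
    obtain ⟨j, rfl⟩ := mem_im.1 (mem_coe.1 hy)
    rcases le_total i j with h | h
    · exact Or.inl (cX_mono T h)
    · exact Or.inr (cX_mono T h)
  · intro W hW
    obtain ⟨i, rfl⟩ := mem_im.1 hW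
    rw [hS]
    have := cX_dm T i
    have h2 := i.2
    change a0 ≤ dm (cX T i) ∧ dm (cX T i) < a0 + N
    omega
  · intro i hi
    rw [hS] at hi
    refine ⟨cX T ⟨i - a0, by omega⟩, mem_im.2 ⟨_, rfl⟩, ?_⟩
    have := cX_dm T ⟨i - a0, by omega⟩
    change dm _ = i
    rw [this]
    show a0 + (i - a0) = i
    omega

theorem im_inj : Function.Injective (im : Fl F n a0 N → _) := by
  intro T T' h
  refine Subtype.ext (funext fun i => ?_)
  have : cX T i ∈ im T' := h ▸ mem_im.2 ⟨i, rfl⟩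
  obtain ⟨j, hj⟩ := mem_im.1 this
  have e := congrArg dm hj
  rw [cX_dm, cX_dm] at e
  have : j = i := Fin.ext (by omega)
  subst this
  exact hj.symm

theorem im_surj (hS : ∀ i, i ∈ S ↔ a0 ≤ i ∧ i < a0 + N) {M : Finset (Sb F n)} (hM : M ∈ maxFlagFaces F n S) : ∃ T : Fl F n a0 N, im T = M := by
  unfold maxFlagFaces at hM
  rw [mem_filter] at hM
  obtain ⟨_, ⟨hc, hd⟩, he⟩ := hM
  have ex : ∀ i : Fin N, ∃ W ∈ M, dm W = a0 + i := fun i => he _ ((hS _).2 ⟨by omega, by omega⟩)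
  choose X hXM hXd using ex
  have mono : Monotone X := by
    intro i j hij
    rcases hc.total (mem_coe.2 (hXM i)) (mem_coe.2 (hXM j)) with h | h
    · exact h
    · refine (eq_of_le_dm h ?_).ge
      rw [hXd, hXd]; have : i.1 ≤ j.1 := hij; omega
  refine ⟨⟨X, mono, hXd⟩, ?_⟩
  ext W
  rw [mem_im]
  constructor
  · rintro ⟨i, rfl⟩; exact hXM i
  · intro hW
    have hWd := (hS _).1 (hd W hW)
    have e := hXd ⟨Module.finrank F W - a0, by omega⟩
    refine ⟨⟨Module.finrank F W - a0, by omega⟩, ?_⟩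
    show X _ = W
    have e2 : dm (X ⟨Module.finrank F W - a0, by omega⟩) = dm W := by
      rw [e]; show a0 + (Module.finrank F W - a0) = Module.finrank F W; omega
    rcases hc.total (mem_coe.2 (hXM ⟨Module.finrank F W - a0, by omega⟩)) (mem_coe.2 hW) with h | h
    · exact eq_of_le_dm h e2.ge
    · exact (eq_of_le_dm h e2.le).symm

theorem av_flags (hS : ∀ i, i ∈ S ↔ a0 ≤ i ∧ i < a0 + N) (φ : Finset (Sb F n) → ℝ) :
    av (maxFlagFaces F n S) φ = EE (fun T : Fl F n a0 N => φ (im T)) := by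
  have e : maxFlagFaces F n S = (univ : Finset (Fl F n a0 N)).image im := by
    ext M
    rw [mem_image]
    constructor
    · intro h; obtain ⟨T, rfl⟩ := im_surj hS h; exact ⟨T, mem_univ _, rfl⟩
    · rintro ⟨T, _, rfl⟩; exact im_mem hS T
  unfold EE av
  rw [e, sum_image (fun _ _ _ _ h => im_inj h), card_image_of_injective _ im_inj]

theorem Sp_im (T : Fl F n a0 N) (J : Finset (Fin N)) (s : ℕ) :
    ((im T).powersetCard s).filter (fun I => J.image (cX T) ⊆ I) = (Sp J s).image (fun I => I.image (cX T)) := by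
  ext B
  rw [mem_filter, mem_powersetCard, mem_image]
  constructor
  · rintro ⟨⟨h1, h2⟩, h3⟩
    have hB : (univ.filter (fun i => cX T i ∈ B)).image (cX T) = B := by
      ext x
      rw [mem_image]
      constructor
      · rintro ⟨i, hi, rfl⟩; exact (mem_filter.1 hi).2
      · intro hx
        obtain ⟨i, rfl⟩ := mem_im.1 (h1 hx)
        exact ⟨i, mem_filter.2 ⟨mem_univ _, hx⟩, rfl⟩
    refine ⟨univ.filter (fun i => cX T i ∈ B), mem_Sp.2 ⟨?_, ?_⟩, hB⟩
    · intro j hj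
      exact mem_filter.2 ⟨mem_univ _, h3 (mem_image_of_mem _ hj)⟩
    · rw [← h2, ← card_image_of_injective _ (cX_inj T), hB]
  · rintro ⟨I, hI, rfl⟩
    rw [mem_Sp] at hI
    refine ⟨⟨image_subset_image (subset_univ _), ?_⟩, image_subset_image hI.1⟩
    rw [card_image_of_injective _ (cX_inj T)]; exact hI.2

theorem av_Sp_im (T : Fl F n a0 N) (J : Finset (Fin N)) (s : ℕ) (φ : Finset (Sb F n) → ℝ) :
    av (((im T).powersetCard s).filter (fun I => J.image (cX T) ⊆ I)) φ = av (Sp J s) (fun I => φ (I.image (cX T))) := by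
  have hi : Function.Injective (fun I : Finset (Fin N) => I.image (cX T)) := image_injective (cX_inj T)
  unfold av
  rw [Sp_im, sum_image (fun _ _ _ _ h => hi h), card_image_of_injective _ hi]

theorem av_psc (T : Fl F n a0 N) (s : ℕ) (φ : Finset (Sb F n) → ℝ) :
    av ((im T).powersetCard s) φ = av (Sp ∅ s) (fun I => φ (I.image (cX T))) := by
  rw [← av_Sp_im]
  congr 1
  rw [image_empty]
  exact (filter_true_of_mem fun I _ => empty_subset I).symm

variable (G : Finset (Sb F n) → Sb F n → A)

noncomputable def gG (I : Finset (Fin N)) (T : Fl F n a0 N) (i : Fin N) : A :=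
  if i ∈ I then G (I.image (cX T)) (cX T i) else Classical.arbitrary A

theorem gG_ms (I : Finset (Fin N)) : Ms (cX : Fl F n a0 N → _) I (gG G I) := by
  intro T T' h
  funext i
  unfold gG
  have e : I.image (cX T) = I.image (cX T') := image_congr fun j hj => h j hj
  split_ifs with hi
  · rw [e, h i hi]
  · rfl

theorem close_eq (hS : ∀ i, i ∈ S ↔ a0 ≤ i ∧ i < a0 + N) (δ : ℝ) (f : Sb F n → A) :
    closeProb F n S ℓ δ A G f = av (Sp ∅ ℓ) (fun I => EE (fun T : Fl F n a0 N =>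
      ind (((I.filter (fun i => gG G I T i ≠ f (cX T i))).card : ℝ) ≤ δ * ℓ))) := by
  have e : closeProb F n S ℓ δ A G f = av (maxFlagFaces F n S) (fun T => av (T.powersetCard ℓ) (fun B => ind (((B.filter (fun x => G B x ≠ f x)).card : ℝ) ≤ δ * ℓ))) := by
    unfold closeProb av ind
    rfl
  rw [e, av_flags (a0 := a0) (N := N) hS, ← EE_av]
  refine EE_congr fun T => ?_
  rw [av_psc]
  refine av_congr fun I _ => ?_
  have : ((I.image (cX T)).filter (fun x => G (I.image (cX T)) x ≠ f x)).card = (I.filter (fun i => gG G I T i ≠ f (cX T i))).card := by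
    rw [filter_image, card_image_of_injective _ (cX_inj T)]
    congr 1
    refine filter_congr fun i hi => ?_
    unfold gG
    rw [if_pos hi]
  rw [this]

theorem agree_le [Nonempty (Fl F n a0 N)] (hq : (8:ℝ) ≤ Fintype.card F) (hS : ∀ i, i ∈ S ↔ a0 ≤ i ∧ i < a0 + N) (h0 : ℓ₀ ≤ ℓ) (hℓ : ℓ < N) :
    agreeProb F n S ℓ₀ ℓ A G ≤ av (Sp ∅ ℓ₀) (fun J => EE (fun T : Fl F n a0 N => coll (PP cX ℓ (gG G) J J T))) + 3 * ℓ / (N - ℓ : ℝ) := by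
  have e : agreeProb F n S ℓ₀ ℓ A G = av (maxFlagFaces F n S) (fun T => av (T.powersetCard ℓ₀) (fun s =>
      av ((T.powersetCard ℓ).filter (fun I => s ⊆ I)) (fun s₁ => av ((T.powersetCard ℓ).filter (fun I => s ⊆ I)) (fun s₂ => ind (∀ x ∈ s₁ ∩ s₂, G s₁ x = G s₂ x))))) := by
    unfold agreeProb
    unfold av
    congr 1
    refine sum_congr rfl fun T _ => ?_
    congr 1
    refine sum_congr rfl fun s _ => ?_
    beta_reduce
    rw [← sum_div, div_div, ← sq]
    congr 1
    refine sum_congr rfl fun s₁ _ => sum_congr rfl fun s₂ _ => ?_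
    unfold ind
    split_ifs <;> rfl
  rw [e, av_flags (a0 := a0) (N := N) hS]
  have hne : (Sp (∅ : Finset (Fin N)) ℓ₀).Nonempty := Sp_ne (by simp) (by simp; omega)
  have key : ∀ T : Fl F n a0 N, ∀ J ∈ Sp (∅ : Finset (Fin N)) ℓ₀,
      av (((im T).powersetCard ℓ).filter (fun I => J.image (cX T) ⊆ I)) (fun s₁ => av (((im T).powersetCard ℓ).filter (fun I => J.image (cX T) ⊆ I)) (fun s₂ => ind (∀ x ∈ s₁ ∩ s₂, G s₁ x = G s₂ x)))
      ≤ ∑ σ, (av (Sp J ℓ) (fun I => ind (restr J (gG G I T) = σ)))^2 := by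
    intro T J _
    rw [av_Sp_im]
    have h1 : ∀ I₁ ∈ Sp J ℓ, av (((im T).powersetCard ℓ).filter (fun I => J.image (cX T) ⊆ I)) (fun s₂ => ind (∀ x ∈ (I₁.image (cX T)) ∩ s₂, G (I₁.image (cX T)) x = G s₂ x)) ≤
        ∑ σ, ind (restr J (gG G I₁ T) = σ) * av (Sp J ℓ) (fun I => ind (restr J (gG G I T) = σ)) := by
      intro I₁ hI₁
      rw [av_Sp_im]
      have h2 : ∀ σ, ind (restr J (gG G I₁ T) = σ) * av (Sp J ℓ) (fun I => ind (restr J (gG G I T) = σ)) =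
          av (Sp J ℓ) (fun I => ind (restr J (gG G I₁ T) = σ) * ind (restr J (gG G I T) = σ)) := fun σ => (av_mul _ _ _).symm
      simp only [h2]
      rw [← av_sum]
      refine av_mono fun I₂ hI₂ => ?_
      by_cases hx : ∀ x ∈ (I₁.image (cX T)) ∩ (I₂.image (cX T)), G (I₁.image (cX T)) x = G (I₂.image (cX T)) x
      · have hr : restr J (gG G I₂ T) = restr J (gG G I₁ T) := by
          funext i
          unfold restr
          split_ifs with hi
          · have i1 := (mem_Sp.1 hI₁).1 hi
            have i2 := (mem_Sp.1 hI₂).1 hi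
            unfold gG
            rw [if_pos i1, if_pos i2]
            exact (hx _ (mem_inter.2 ⟨mem_image_of_mem _ i1, mem_image_of_mem _ i2⟩)).symm
          · rfl
        refine (ind_le_one _).trans ?_
        refine le_trans (le_of_eq ?_) (single_le_sum (f := fun σ => ind (restr J (gG G I₁ T) = σ) * ind (restr J (gG G I₂ T) = σ))
          (fun σ _ => mul_nonneg (ind_nonneg _) (ind_nonneg _)) (mem_univ (restr J (gG G I₁ T))))
        rw [ind_true rfl, ind_true hr, mul_one]
      · rw [ind_false hx]
        exact sum_nonneg fun σ _ => mul_nonneg (ind_nonneg _) (ind_nonneg _)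
    refine (av_mono h1).trans (le_of_eq ?_)
    rw [av_sum]
    refine sum_congr rfl fun σ _ => ?_
    rw [av_mul' , sq]
  have H := flag_hyp (F := F) (n := n) (a0 := a0) (N := N) hq
  calc _ ≤ EE (fun T : Fl F n a0 N => av (Sp ∅ ℓ₀) (fun J => ∑ σ, (av (Sp J ℓ) (fun I => ind (restr J (gG G I T) = σ)))^2)) := by
        refine EE_mono fun T => ?_
        rw [av_psc]
        exact av_mono fun J hJ => key T J hJ
    _ = av (Sp ∅ ℓ₀) (fun J => EE (fun T : Fl F n a0 N => ∑ σ, (av (Sp J ℓ) (fun I => ind (restr J (gG G I T) = σ)))^2)) := EE_av _ _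
    _ ≤ av (Sp ∅ ℓ₀) (fun J => EE (fun T : Fl F n a0 N => coll (PP cX ℓ (gG G) J J T)) + 3 * ℓ / (N - ℓ : ℝ)) := by
        refine av_mono fun J hJ => ?_
        have := test_coll (g := gG G) (J := J) (c := J) (ℓ := ℓ) H (fun I => gG_ms G I) (by rw [(mem_Sp.1 hJ).2]; exact h0) (by rw [Fintype.card_fin]; exact hℓ)
        rw [Fintype.card_fin] at this
        exact this
    _ = _ := by rw [av_add, av_const hne]
end conv


theorem pick_nat {a : ℝ} : ∃ k : ℕ, 0 < k ∧ a ≤ k := by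
  obtain ⟨k, hk⟩ := exists_nat_ge a
  exact ⟨k + 1, by omega, by push_cast; linarith⟩

theorem dn_le {N Λ s : ℕ} (hΛ : 0 < Λ) (hs : 2 * Λ ≤ s) (hN : s ≤ N) :
    dn N (N / Λ) Λ s ≤ (1 + 2 * Λ / (s:ℝ)) ^ (2 * Λ) := by
  have hΛr : (0:ℝ) < Λ := by exact_mod_cast hΛ
  have hs0 : (0:ℝ) < s := by have : 0 < s := by omega
                             exact_mod_cast this
  have hsr : 2 * (Λ:ℝ) ≤ s := by exact_mod_cast hs
  have hNr : (s:ℝ) ≤ N := by exact_mod_cast hN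
  have hL : (N:ℝ) - Λ ≤ Λ * (N / Λ : ℕ) := by
    have := Nat.div_add_mod N Λ
    have h2 := Nat.mod_lt N hΛ
    have h3 : (N:ℝ) = Λ * (N / Λ : ℕ) + (N % Λ : ℕ) := by exact_mod_cast this.symm
    have h4 : ((N % Λ : ℕ):ℝ) ≤ Λ := by exact_mod_cast h2.le
    linarith
  have b1 : (s:ℝ) / (s - Λ) ≤ 1 + 2 * Λ / s := by
    rw [div_le_iff₀ (by linarith)]
    have : (1 + 2 * (Λ:ℝ) / s) * (s - Λ) = s + Λ * (1 - 2 * Λ / s) := by field_simp; ring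
    rw [this]
    have : 2 * (Λ:ℝ) / s ≤ 1 := by rw [div_le_one hs0]; exact hsr
    nlinarith
  have b2 : (N:ℝ) / (Λ * (N / Λ : ℕ)) ≤ 1 + 2 * Λ / s := by
    have hN0 : (0:ℝ) < N := by linarith
    have h1 : (N:ℝ) / (Λ * (N / Λ : ℕ)) ≤ N / (N - Λ) := div_le_div_of_nonneg_left hN0.le (by linarith) hL
    have h2 : (N:ℝ) / (N - Λ) ≤ 1 + 2 * Λ / N := by
      rw [div_le_iff₀ (by linarith)]
      have : (1 + 2 * (Λ:ℝ) / N) * (N - Λ) = N + Λ * (1 - 2 * Λ / N) := by field_simp; ring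
      rw [this]
      have : 2 * (Λ:ℝ) / N ≤ 1 := by rw [div_le_one hN0]; linarith
      nlinarith
    have h3 : 2 * (Λ:ℝ) / N ≤ 2 * Λ / s := div_le_div_of_nonneg_left (by positivity) hs0 hNr
    linarith
  unfold dn
  have p : (0:ℝ) ≤ s / (s - Λ) := div_nonneg hs0.le (by linarith)
  calc ((s : ℝ) / (s - Λ) * (N / (Λ * (N / Λ : ℕ)))) ^ Λ ≤ ((1 + 2 * Λ / (s:ℝ)) * (1 + 2 * Λ / (s:ℝ))) ^ Λ := by
        refine pow_le_pow_left₀ (mul_nonneg p (by positivity)) ?_ _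
        exact mul_le_mul b1 b2 (by positivity) (by positivity)
    _ = _ := by rw [← sq, ← pow_mul]

theorem G2_le {N Λ ℓ : ℕ} (hΛ : 0 < Λ) (hs : 2 * Λ ≤ ℓ) (hN : ℓ ≤ N) :
    G2 N (N / Λ) Λ ℓ ≤ (2 ^ (Λ + 1) * (12 * Λ)) / ℓ := by
  have hΛr : (0:ℝ) < Λ := by exact_mod_cast hΛ
  have hℓ0 : (0:ℝ) < ℓ := by have : 0 < ℓ := by omega
                             exact_mod_cast this
  have hL0 : 0 < N / Λ := Nat.div_pos (by omega) hΛ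
  have hLr : (0:ℝ) < (N / Λ : ℕ) := by exact_mod_cast hL0
  have c1 : (N:ℝ) / (N / Λ : ℕ) ≤ 2 * Λ := by
    rw [div_le_iff₀ hLr]
    have h1 := Nat.div_add_mod N Λ
    have h2 := Nat.mod_lt N hΛ
    have h3 : N ≤ 2 * Λ * (N / Λ) := by nlinarith
    exact_mod_cast h3
  have c2 : 3 / ((ℓ - Λ : ℕ) : ℝ) ≤ 6 / ℓ := by
    rw [Nat.cast_sub (by omega)]
    have : 2 * (Λ:ℝ) ≤ ℓ := by exact_mod_cast hs
    rw [div_le_div_iff₀ (by linarith) hℓ0]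
    linarith
  unfold G2
  calc (2:ℝ) ^ (Λ + 1) * ((N:ℝ) / (N / Λ : ℕ) * (3 / ((ℓ - Λ : ℕ) : ℝ))) ≤ 2 ^ (Λ + 1) * (2 * Λ * (6 / ℓ)) := by
        refine mul_le_mul_of_nonneg_left (mul_le_mul c1 c2 (by positivity) (by positivity)) (by positivity)
    _ = _ := by ring

theorem consts (δ : ℝ) (h0 : 0 < δ) (h1 : δ < 1) {C : ℝ} (hC : 0 < C) :
    ∃ (B D Q M : ℕ) (εg ε1 : ℝ), 4 ≤ B ∧ 0 < D ∧ 0 < Q ∧ 0 < εg ∧ 0 < ε1 ∧ 2 / (δ / 2 / 4) ≤ M ∧ ε1 = (δ / 2 / 4) ^ 2 / (24 * Q) ∧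
      (3:ℝ) / B ≤ δ / 8 ∧ B / (D * εg) ≤ δ / 8 ∧
      C * (3 * (εg / ε1) + 6 / ((δ / 2 / 4) * Q)) + ε1 / ((δ / 2 / 4) / 2) ^ 2 ≤ (δ * (δ / 16) / 16) * (3 / 4) := by
  obtain ⟨B, hB0, hB⟩ := pick_nat (a := 4 + 24 / δ)
  obtain ⟨M, hM0, hM⟩ := pick_nat (a := 2 / (δ / 2 / 4))
  set εn := δ * (δ / 16) / 16 with hεn
  have hεn0 : 0 < εn := by positivity
  obtain ⟨Q, hQ0, hQ⟩ := pick_nat (a := C * 6 * 4 / ((δ / 2 / 4) * εn) + 4 / εn)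
  have hQr : (0:ℝ) < Q := by exact_mod_cast hQ0
  set ε1 := (δ / 2 / 4) ^ 2 / (24 * Q) with hε1
  have hε10 : 0 < ε1 := by positivity
  set εg := εn * ε1 / (12 * C) with hεg
  have hεg0 : 0 < εg := by positivity
  have p24 : 0 < 24 / δ := by positivity
  have hBr : (0:ℝ) < B := by exact_mod_cast hB0
  obtain ⟨D, hD0, hD⟩ := pick_nat (a := 8 * B / (δ * εg))
  have hDr : (0:ℝ) < D := by exact_mod_cast hD0
  refine ⟨B, D, Q, M, εg, ε1, ?_, hD0, hQ0, hεg0, hε10, hM, rfl, ?_, ?_, ?_⟩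
  · have : (4:ℝ) ≤ B := by linarith
    exact_mod_cast this
  · have : 24 / δ ≤ B := by linarith
    rw [div_le_iff₀ h0] at this
    rw [div_le_iff₀ hBr]; linarith
  · rw [div_le_iff₀ (by positivity)] at hD ⊢
    linarith
  · have e1 : C * (3 * (εg / ε1)) = εn / 4 := by rw [hεg]; field_simp; norm_num
    have q1 : 0 ≤ C * 6 * 4 / ((δ / 2 / 4) * εn) := by positivity
    have q2 : 0 ≤ 4 / εn := by positivity
    have e2 : C * (6 / ((δ / 2 / 4) * Q)) ≤ εn / 4 := by
      have : C * 6 * 4 / ((δ / 2 / 4) * εn) ≤ Q := by linarith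
      rw [div_le_iff₀ (by positivity)] at this
      rw [← mul_div_assoc, div_le_iff₀ (by positivity)]
      linarith
    have e3 : ε1 / ((δ / 2 / 4) / 2) ^ 2 ≤ εn / 4 := by
      have : 4 / εn ≤ Q := by linarith
      rw [div_le_iff₀ hεn0] at this
      have e : ε1 / ((δ / 2 / 4) / 2) ^ 2 = 1 / (6 * Q) := by rw [hε1]; field_simp; norm_num
      rw [e, div_le_iff₀ (by positivity)]
      linarith
    rw [mul_add]; linarith

set_option maxHeartbeats 4000000 in
theorem main_const (δ : ℝ) (hδ0 : 0 < δ) (hδ1 : δ < 1) : ∃ (s0 : ℕ) (κ : ℝ), 0 < κ ∧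
    ∀ (F : Type) [Field F] [Fintype F], (10:ℝ)^21 ≤ Fintype.card F → ∀ d k ℓ₀ : ℕ, s0 ≤ ℓ₀ → (ℓ₀ ^ 2) ^ 2 ≤ k → k < d →
      ∀ (A : Type) [Fintype A] [Nonempty A],
      ∀ G : Finset (Submodule F (Fin (2 * d) → F)) → Submodule F (Fin (2 * d) → F) → A,
        δ ≤ agreeProb F (2 * d) (Finset.Icc (d - k) (d + k)) ℓ₀ (ℓ₀ ^ 2) A G →
        ∃ f : Submodule F (Fin (2 * d) → F) → A,
          κ ≤ closeProb F (2 * d) (Finset.Icc (d - k) (d + k)) (ℓ₀ ^ 2) δ A G f := by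
  have hC : (0:ℝ) < 3 + 200 * Cf 3 := by rw [Cf_three]; norm_num
  set C := 3 + 200 * Cf 3 with hCd
  obtain ⟨B, D, Q, M, εg, ε1, hB, hD, hQ, hεg, hε1, hM, hε1d, hB3, hBD, hsmall⟩ := consts δ hδ0 hδ1 hC
  set εn := δ * (δ / 16) / 16 with hεn
  have hεn0 : 0 < εn := by positivity
  set Λ := B ^ D with hΛd
  have hΛ0 : 0 < Λ := pow_pos (by omega) D
  have hΛr : (0:ℝ) < Λ := by exact_mod_cast hΛ0
  have hMr : (0:ℝ) < M := lt_of_lt_of_le (by positivity) hM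
  set K : ℝ := 2 ^ (Λ + 1) * (12 * Λ) with hK
  have hK0 : 0 < K := by positivity
  have ev : ∀ᶠ s : ℕ in Filter.atTop, (1 + 2 * Λ / (s:ℝ)) ^ (2 * Λ) ≤ 1 + δ / 8 := by
    have t : Filter.Tendsto (fun s : ℕ => (1 + 2 * Λ / (s:ℝ)) ^ (2 * Λ)) Filter.atTop (nhds ((1 + 0) ^ (2 * Λ))) :=
      (tendsto_const_nhds.add (tendsto_const_div_atTop_nhds_zero_nat (2 * (Λ:ℝ)))).pow _
    rw [add_zero, one_pow] at t
    exact (t.eventually_lt_const (by linarith)).mono fun s h => h.le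
  have evc : ∀ c : ℝ, ∀ᶠ s : ℕ in Filter.atTop, c ≤ (s:ℝ) := fun c => tendsto_natCast_atTop_atTop.eventually_ge_atTop c
  have all := ev.and ((evc (24 / δ + 1)).and ((evc (8 * Λ / (3 * δ))).and ((evc (Λ * K * 32 / (δ * (δ / 8) ^ 2))).and
    ((evc (64 * Λ ^ 2 / δ)).and ((evc (36 * C * K / (ε1 ^ 2 * εn))).and (Filter.eventually_ge_atTop (2 * Λ + 2)))))))
  rw [Filter.eventually_atTop] at all
  obtain ⟨s0, hs0⟩ := all
  refine ⟨s0, δ / 8 / (M:ℝ) ^ Λ / 2, by positivity, ?_⟩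
  intro F _ _ hq d k ℓ₀ hℓ₀ hk hkd A _ _ G hagree
  set ℓ := ℓ₀ ^ 2 with hℓd
  set N := 2 * k + 1 with hN
  set a0 := d - k with ha0
  have h0b := (hs0 ℓ₀ hℓ₀).2.2.2.2.2.2
  have hℓ₀ℓ : ℓ₀ < ℓ := by rw [hℓd]; nlinarith
  obtain ⟨_, b1, b2, b3, b4, b5, b6⟩ := hs0 ℓ (by omega)
  obtain ⟨a1, a2, _⟩ := hs0 ℓ₀ hℓ₀
  have aℓ := (hs0 ℓ (by omega)).1
  have hℓN : ℓ < N := by nlinarith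
  have hS : ∀ i, i ∈ Finset.Icc (d - k) (d + k) ↔ a0 ≤ i ∧ i < a0 + N := by
    intro i; rw [mem_Icc]; omega
  have hq8 : (8:ℝ) ≤ Fintype.card F := le_trans (by norm_num) hq
  have hne : Nonempty (Fl F (2 * d) a0 N) := by
    by_contra hc
    have hem : maxFlagFaces F (2 * d) (Finset.Icc (d - k) (d + k)) = ∅ := by
      rw [eq_empty_iff_forall_notMem]
      intro T hT
      obtain ⟨T', _⟩ := im_surj hS hT
      exact hc ⟨T'⟩
    unfold agreeProb at hagree
    rw [hem] at hagree
    simp at hagree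
    linarith
  have hag := agree_le (a0 := a0) (N := N) G hq8 hS hℓ₀ℓ.le hℓN (ℓ := ℓ)
  have hℓr : (0:ℝ) < ℓ := by have : 0 < ℓ := by omega
                             exact_mod_cast this
  have hNℓ : (ℓ:ℝ) ^ 2 ≤ (N:ℝ) - ℓ := by
    have : ℓ ^ 2 + ℓ ≤ N := by nlinarith
    have : (ℓ:ℝ) ^ 2 + ℓ ≤ N := by exact_mod_cast this
    linarith
  have hε3 : 3 * (ℓ:ℝ) / (N - ℓ : ℝ) ≤ δ / 8 := by
    have : 24 / δ ≤ ℓ := by linarith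
    rw [div_le_iff₀ hδ0] at this
    rw [div_le_iff₀ (lt_of_lt_of_le (by positivity) hNℓ)]
    have h2 := mul_le_mul_of_nonneg_left hNℓ (by positivity : 0 ≤ δ / 8)
    nlinarith
  haveI : Nonempty (Fin Λ) := ⟨⟨0, hΛ0⟩⟩
  haveI : Nonempty (Fin (N / Λ)) := ⟨⟨0, Nat.div_pos (by omega) hΛ0⟩⟩
  have H := flag_hyp (F := F) (n := 2 * d) (a0 := a0) (N := N) hq8
  have hgc := global_coll (g := gG G) (ℓ := ℓ) (ℓ₀ := ℓ₀) (Dt := δ - δ / 8) (pos_inj N Λ) H (by rw [Fintype.card_fin]; omega) hℓ₀ℓ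
    (by rw [Fintype.card_fin]; omega) (by linarith)
  rw [Fintype.card_fin, Fintype.card_fin, Fintype.card_fin] at hgc
  have hdn0 : dn N (N / Λ) Λ ℓ₀ ≤ 1 + δ / 8 := (dn_le hΛ0 (by omega) (by omega)).trans a1
  have hdnℓ : dn N (N / Λ) Λ ℓ ≤ 1 + δ / 8 := (dn_le hΛ0 (by omega) (by omega)).trans aℓ
  have hG2 : G2 N (N / Λ) Λ ℓ ≤ K / ℓ := G2_le hΛ0 (by omega) (by omega)
  have hG20 : 0 ≤ G2 N (N / Λ) Λ ℓ := by unfold G2; positivity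
  have hℓ₀r : (0:ℝ) < ℓ₀ := by have : 0 < ℓ₀ := by omega
                               exact_mod_cast this
  have h30 : (ℓ₀:ℝ) * (3 / ((ℓ - ℓ₀ : ℕ) : ℝ)) ≤ δ / 8 := by
    rw [Nat.cast_sub hℓ₀ℓ.le, hℓd]
    push_cast
    have h24 : 24 / δ ≤ ℓ₀ - 1 := by linarith
    rw [div_le_iff₀ hδ0] at h24
    have hp : (0:ℝ) < 24 / δ := by positivity
    have e : (ℓ₀:ℝ) * (3 / ((ℓ₀:ℝ) ^ 2 - ℓ₀)) = 3 / (ℓ₀ - 1) := by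
      have : (ℓ₀:ℝ) - 1 ≠ 0 := by linarith
      have : (ℓ₀:ℝ) ^ 2 - ℓ₀ = ℓ₀ * (ℓ₀ - 1) := by ring
      rw [this]; field_simp
    rw [e, div_le_iff₀ (by linarith)]
    linarith
  have hco : δ / 2 ≤ av univ (fun z : Fin Λ → Fin (N / Λ) => EE (fun T : Fl F (2 * d) a0 N => coll (PP cX ℓ (gG G) (zs (pos N Λ) z univ) (zs (pos N Λ) z univ) T))) := by
    refine le_trans ?_ hgc
    have := mul_le_mul_of_nonneg_right hdn0 (by linarith : 0 ≤ 1 - (δ - δ / 8))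
    nlinarith
  have hdd : 0 < δ / 2 := by positivity
  obtain ⟨fg, hfg⟩ := core (g := gG G) (ℓ := ℓ) hq hB hD (by omega) (by omega) hdd (by linarith) (θ := δ / 16) (by positivity) hεg hQ hM hco (εn := εn) (m := δ / 8)
    (by
      rw [← hε1d]
      have e : C * (9 * (G2 N (N / Λ) Λ ℓ / ε1 ^ 2)) ≤ εn / 4 := by
        calc C * (9 * (G2 N (N / Λ) Λ ℓ / ε1 ^ 2)) ≤ C * (9 * ((K / ℓ) / ε1 ^ 2)) := by gcongr
          _ = 9 * C * K / (ε1 ^ 2 * ℓ) := by field_simp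
          _ ≤ εn / 4 := by
            rw [div_le_iff₀ (by positivity)] at b5 ⊢
            linarith
      rw [mul_add] at hsmall ⊢
      linarith)
    hεn0.le (by positivity)
    (by
      have e1 : (Λ:ℝ) * (G2 N (N / Λ) Λ ℓ / (δ / 2 / 4) ^ 2) ≤ δ / 32 := by
        calc (Λ:ℝ) * (G2 N (N / Λ) Λ ℓ / (δ / 2 / 4) ^ 2) ≤ Λ * ((K / ℓ) / (δ / 2 / 4) ^ 2) := by gcongr
          _ = Λ * K / ((δ / 8) ^ 2 * ℓ) := by rw [show δ / 2 / 4 = δ / 8 by ring]; field_simp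
          _ ≤ δ / 32 := by
            rw [div_le_iff₀ (by positivity)] at b3 ⊢
            linarith
      have e2 : dn N (N / Λ) Λ ℓ * ((Λ:ℝ) ^ 2 / ℓ) ≤ δ / 32 := by
        calc dn N (N / Λ) Λ ℓ * ((Λ:ℝ) ^ 2 / ℓ) ≤ 2 * ((Λ:ℝ) ^ 2 / ℓ) := mul_le_mul_of_nonneg_right (by linarith) (by positivity)
          _ = 2 * (Λ:ℝ) ^ 2 / ℓ := by ring
          _ ≤ δ / 32 := by
            rw [div_le_iff₀ (by positivity)] at b4 ⊢
            linarith
      have e3 : εn / (δ / 16) = δ / 16 := by rw [hεn]; field_simp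
      rw [e3]
      linarith)
  refine ⟨fg, ?_⟩
  rw [close_eq (a0 := a0) (N := N) G hS]
  set Z := av (Sp ∅ ℓ) (fun I => EE (fun T : Fl F (2 * d) a0 N =>
      ind (((I.filter (fun i => gG G I T i ≠ fg (cX T i))).card : ℝ) ≤ δ * ℓ))) with hZ
  have hZ0 : 0 ≤ Z := av_nonneg fun I _ => EE_nonneg fun T => ind_nonneg _
  have hle : (Λ:ℝ) + 2 * ℓ * (δ / 16 + (3 / B + B / (D * εg))) ≤ δ * ℓ := by
    rw [div_le_iff₀ (by positivity)] at b2
    have : 2 * (ℓ:ℝ) * (δ / 16 + (3 / B + B / (D * εg))) ≤ 2 * ℓ * (δ / 16 + (δ / 8 + δ / 8)) :=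
      mul_le_mul_of_nonneg_left (by linarith) (by positivity)
    nlinarith
  have hY : δ / 8 / (M:ℝ) ^ Λ ≤ dn N (N / Λ) Λ ℓ * Z := by
    refine hfg.trans (mul_le_mul_of_nonneg_left ?_ ?_)
    · exact av_mono fun I _ => EE_mono fun T => ind_mono fun h => h.trans hle
    · unfold dn
      have : (0:ℝ) ≤ (ℓ:ℝ) - Λ := by rw [sub_nonneg]; exact_mod_cast (by omega : Λ ≤ ℓ)
      positivity
  have : dn N (N / Λ) Λ ℓ * Z ≤ 2 * Z := mul_le_mul_of_nonneg_right (by linarith) hZ0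
  linarith
/-- Low-soundness agreement testing on the projected flags complex: for
every `δ ∈ (0,1)` there are a threshold `q₀` and constants `c₁, c₂, c₃ ≥ 1` such that for
every prime power `q ≥ q₀`, all `d > k ≥ ℓ^{c₁}` with `ℓ = ℓ₀² ≥ exp((1/δ)^{c₂})`, and every
nonempty finite alphabet, any ensemble of local functions passing the `(ℓ, √ℓ)`-agreement
test on `B(2d, S_k, q)` with probability at least `δ` is `δ`-close to a global function on
a `δ^{c₃}`-fraction of `ℓ`-element faces. -/
theorem stmt_14 (δ : ℝ) (hδ0 : 0 < δ) (hδ1 : δ < 1) :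
    ∃ (q₀ : ℕ) (c₁ c₂ c₃ : ℝ), 1 ≤ c₁ ∧ 1 ≤ c₂ ∧ 1 ≤ c₃ ∧
      ∀ q : ℕ, q₀ ≤ q → IsPrimePow q →
      ∀ (F : Type) [Field F] [Fintype F], Fintype.card F = q →
      ∀ d k ℓ₀ ℓ : ℕ, ℓ = ℓ₀ ^ 2 →
        Real.exp ((1 / δ) ^ c₂) ≤ (ℓ : ℝ) →
        ((ℓ : ℝ) ^ c₁ ≤ (k : ℝ)) → k < d →
      ∀ (A : Type) [Fintype A] [Nonempty A],
      ∀ G : Finset (Submodule F (Fin (2 * d) → F)) → Submodule F (Fin (2 * d) → F) → A,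
        δ ≤ agreeProb F (2 * d) (Finset.Icc (d - k) (d + k)) ℓ₀ ℓ A G →
        ∃ f : Submodule F (Fin (2 * d) → F) → A,
          δ ^ c₃ ≤ closeProb F (2 * d) (Finset.Icc (d - k) (d + k)) ℓ δ A G f := by

  obtain ⟨s0, κ, hκ, hmain⟩ := main_const δ hδ0 hδ1
  have h1δ : 1 < 1 / δ := by rw [lt_div_iff₀ hδ0]; linarith
  obtain ⟨c₂, hc₂, hc₂'⟩ : ∃ c : ℝ, 1 ≤ c ∧ (s0:ℝ) ^ 2 ≤ (1 / δ) ^ c := by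
    have t := tendsto_rpow_atTop_of_base_gt_one (1 / δ) h1δ
    obtain ⟨c, h1, h2⟩ := ((Filter.eventually_ge_atTop (1:ℝ)).and (t.eventually_ge_atTop ((s0:ℝ) ^ 2))).exists
    exact ⟨c, h1, h2⟩
  obtain ⟨c₃, hc₃, hc₃'⟩ : ∃ c : ℝ, 1 ≤ c ∧ δ ^ c ≤ κ := by
    have t := tendsto_rpow_atTop_of_base_lt_one δ (by linarith) hδ1
    obtain ⟨c, h1, h2⟩ := ((Filter.eventually_ge_atTop (1:ℝ)).and (t.eventually_lt_const hκ)).exists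
    exact ⟨c, h1, h2.le⟩
  refine ⟨10 ^ 21, 2, c₂, c₃, by norm_num, hc₂, hc₃, ?_⟩
  intro q hq _ F _ _ hF d k ℓ₀ ℓ hℓ hexp hk hkd A _ _ G hag
  subst hℓ
  have hq' : (10:ℝ) ^ 21 ≤ Fintype.card F := by rw [hF]; exact_mod_cast hq
  have hs : s0 ≤ ℓ₀ := by
    have h1 : (s0:ℝ) ^ 2 ≤ ((ℓ₀ ^ 2 : ℕ) : ℝ) := by
      have := Real.add_one_le_exp ((1 / δ) ^ c₂)
      linarith
    have h2 : s0 ^ 2 ≤ ℓ₀ ^ 2 := by exact_mod_cast h1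
    exact (Nat.pow_le_pow_iff_left (by norm_num)).1 h2
  have hk' : (ℓ₀ ^ 2) ^ 2 ≤ k := by
    rw [Real.rpow_two] at hk
    exact_mod_cast hk
  obtain ⟨f, hf⟩ := hmain F hq' d k ℓ₀ hs hk' hkd A G hag
  exact ⟨f, hc₃'.trans hf⟩
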